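/- Let (R, I) be a standard graded pair over an algebraically closed field k of characteristic 0, with R a two-dimensional domain and graded maximal ideal 𝔪, with a suitable spread (A, R_A, I_A) and reductions (R_s, I_s, 𝔪_s) mod p_s, and set c^I_∞(𝔪) := lim_{p_s→∞} c^{I_s}(𝔪_s). Then there is an integer N such that for every closed point s of Spec A with p_s > N: if c^{I_s}(𝔪_s) ≠ c^I_∞(𝔪), then c^{I_s}(𝔪_s) = a₁/(p_s·b₁) for some positive integers a₁, b₁ with gcd(a₁, p_s) = 1; in particular p_s divides the denominator of the rational number c^{I_s}(𝔪_s) written in lowest terms. -/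

import Mathlib

/-! STATEMENT 6: if `c^{I_s}(𝔪_s) ≠ c^I_∞(𝔪)` then `c^{I_s}(𝔪_s) = a₁/(p_s·b₁)` with
`gcd(a₁, p_s) = 1`; in particular `p_s` divides the denominator of `c^{I_s}(𝔪_s)`. -/

open Filter Topology TensorProduct

/-- The Frobenius power `I^{[q]}` of an ideal `I`. -/
def Ideal.frobPow {R : Type*} [CommRing R] (I : Ideal R) (q : ℕ) : Ideal R :=
  Ideal.span ((fun f => f ^ q) '' (I : Set R))

/-- `ν_I(J, q) = min { r ∈ ℕ | J^{r+1} ⊆ I^{[q]} }`. -/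
noncomputable def nuF {R : Type*} [CommRing R] (J I : Ideal R) (q : ℕ) : ℕ :=
  sInf {r : ℕ | J ^ (r + 1) ≤ I.frobPow q}

/-- The graded maximal (irrelevant) ideal `𝔪 = ⊕_{m>0} R_m` of an `ℕ`-graded algebra. -/
def irrelevantIdeal {k R : Type*} [CommSemiring k] [CommRing R] [Algebra k R]
    (𝒜 : ℕ → Submodule k R) : Ideal R :=
  Ideal.span (⋃ n ∈ Set.Ioi (0 : ℕ), (𝒜 n : Set R))

/-- The extension `I_A·(Ω ⊗_A R_A)` of an ideal `I_A ⊆ R_A` under base change. -/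
noncomputable def redIdeal (A RA Ω : Type*) [CommRing A] [CommRing RA] [Algebra A RA]
    [CommRing Ω] [Algebra A Ω] (IA : Ideal RA) : Ideal (Ω ⊗[A] RA) :=
  Ideal.map (Algebra.TensorProduct.includeRight : RA →ₐ[A] Ω ⊗[A] RA).toRingHom IA

/-- The grading on `Ω ⊗_A R_A` obtained by base change from a grading on `R_A`. -/
noncomputable def redGrading (A RA Ω : Type*) [CommRing A] [CommRing RA] [Algebra A RA]
    [CommRing Ω] [Algebra A Ω] (𝒜A : ℕ → Submodule A RA) (n : ℕ) :
    Submodule Ω (Ω ⊗[A] RA) :=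
  Submodule.span Ω
    (⇑(Algebra.TensorProduct.includeRight : RA →ₐ[A] Ω ⊗[A] RA) '' (𝒜A n : Set RA))

namespace FT
open Polynomial IntermediateField
open scoped IntermediateField.algebraAdjoinAdjoin

set_option linter.unusedSectionVars false

section fmod
variable {K E V : Type*} [Field K] [Field E] [Algebra K E] [AddCommGroup V] [Module K V]
  [Module E V] [IsScalarTower K E V]

/-- A filtered module. -/
structure FMod (t : E) (N : ℤ → Submodule K V) : Prop where
  mono1 : ∀ n, N n ≤ N (n + 1)
  tmul : ∀ n, ∀ x ∈ N n, t • x ∈ N (n + 1)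
  refl : ∀ n, ∀ x ∈ N (n + 1), t • x ∈ N (n + 1) → x ∈ N n
  bdd : ∃ n₀ : ℤ, ∀ n < n₀, N n = ⊥

variable {t : E} {N : ℤ → Submodule K V}

lemma FMod.mono (h : FMod t N) : Monotone N := monotone_int_of_le_succ h.mono1

lemma FMod.tpow (h : FMod t N) (d : ℕ) : ∀ n, ∀ x ∈ N n, t ^ d • x ∈ N (n + d) := by
  induction d with
  | zero => intro n x hx; simpa using hx
  | succ d ih =>
    intro n x hx
    have := h.tmul _ _ (ih n x hx)
    rw [smul_smul, ← pow_succ'] at this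
    convert this using 2
    push_cast; ring

lemma FMod.tpow_refl (h : FMod t N) (d : ℕ) : ∀ n, ∀ x ∈ N (n + 1), t ^ d • x ∈ N (n + d) →
    x ∈ N n := by
  induction d with
  | zero => intro n x hx hx2; simpa using hx2
  | succ d ih =>
    intro n x hx hx2
    apply ih n x hx
    apply h.refl
    · have := h.tpow d _ _ hx
      convert this using 2; ring
    · rw [smul_smul, ← pow_succ']
      convert hx2 using 2
      push_cast; ring

/-- main independence lemma, polynomial form -/
lemma FMod.indep_poly (h : FMod t N) {ι : Type*} [Fintype ι] (n : ℤ) (v : ι → V)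
    (hv : ∀ i, v i ∈ N (n + 1)) (hind : ∀ c : ι → K, ∑ i, c i • v i ∈ N n → c = 0)
    (d : ℕ) : ∀ P : ι → K[X], (∀ i, ∀ j ≥ d, (P i).coeff j = 0) →
      ∑ i, (aeval t (P i)) • v i = 0 → P = 0 := by
  induction d with
  | zero =>
    intro P hP _
    funext i
    ext j
    simpa using hP i j (by omega)
  | succ d ih =>
    intro P hP h0
    have key : (fun i => (P i).coeff d) = 0 := by
      apply hind
      apply h.tpow_refl d
      · exact Submodule.sum_mem _ fun i _ => Submodule.smul_mem _ _ (hv i)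
      · have e1 : ∀ i, aeval t (P i) = ∑ j ∈ Finset.range d, (P i).coeff j • t ^ j
            + (P i).coeff d • t ^ d := by
          intro i
          rw [aeval_eq_sum_range' (n := d + 1), Finset.sum_range_succ]
          rw [Nat.lt_succ_iff, natDegree_le_iff_coeff_eq_zero]
          intro j hj
          exact hP i j hj
        have e2 : t ^ d • ∑ i, (P i).coeff d • v i
            = - ∑ i, ∑ j ∈ Finset.range d, (P i).coeff j • (t ^ j • v i) := by
          rw [eq_neg_iff_add_eq_zero, ← h0, Finset.smul_sum, ← Finset.sum_add_distrib]
          refine Finset.sum_congr rfl fun i _ => ?_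
          rw [e1, add_smul, Finset.sum_smul, add_comm, smul_comm]
          congr 1
          · exact Finset.sum_congr rfl fun j _ => by rw [smul_assoc]
          · rw [smul_assoc]
        rw [e2]
        refine Submodule.neg_mem _ (Submodule.sum_mem _ fun i _ => Submodule.sum_mem _ fun j hj =>
          Submodule.smul_mem _ _ ?_)
        have := h.tpow j _ _ (hv i)
        refine h.mono ?_ this
        have := Finset.mem_range.1 hj
        omega
    apply ih P _ h0
    intro i j hj
    rcases Nat.lt_or_ge d j with h2 | h2
    · exact hP i j h2
    · have h3 : (P i).coeff d = 0 := congrFun key i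
      rwa [le_antisymm h2 hj]

/-- independence over `K[t]` gives independence over `K(t)`. -/
lemma linInd_of_poly (t : E) {ι : Type*} [Fintype ι] (v : ι → V)
    (hv : ∀ P : ι → K[X], ∑ i, (aeval t (P i)) • v i = 0 → ∀ i, aeval t (P i) = 0) :
    LinearIndependent K⟮t⟯ v := by
  have h1 : LinearIndependent (Algebra.adjoin K {t}) v := by
    rw [Fintype.linearIndependent_iff]
    intro g hg i
    have hex : ∀ i, ∃ P : K[X], aeval t P = (g i : E) := by
      intro i
      have h2 : ∀ x ∈ Algebra.adjoin K {t}, ∃ P : K[X], aeval t P = x := by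
        intro x hx
        rw [Algebra.adjoin_singleton_eq_range_aeval] at hx
        exact hx
      exact h2 _ (g i).2
    choose P hP using hex
    have := hv P (by simp only [hP]; exact hg) i
    rw [hP] at this
    exact_mod_cast this
  exact (LinearIndependent.iff_fractionRing (Algebra.adjoin K {t}) K⟮t⟯).1 h1

lemma FMod.linInd (h : FMod t N) {ι : Type*} [Fintype ι] (n : ℤ) (v : ι → V)
    (hv : ∀ i, v i ∈ N (n + 1)) (hind : ∀ c : ι → K, ∑ i, c i • v i ∈ N n → c = 0) :
    LinearIndependent K⟮t⟯ v := by
  apply linInd_of_poly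
  intro P hP i
  have : P = 0 := by
    refine h.indep_poly n v hv hind (∑ i, ((P i).natDegree + 1)) P ?_ hP
    intro i j hj
    apply coeff_eq_zero_of_natDegree_lt
    have : (P i).natDegree + 1 ≤ _ :=
      Finset.single_le_sum (f := fun i => (P i).natDegree + 1) (fun _ _ => Nat.zero_le _) (Finset.mem_univ i)
    omega
  simp [this]

variable (t) in
/-- dimension bound. -/
lemma card_le_of_linInd [FiniteDimensional K⟮t⟯ E] {ι : Type*} [Fintype ι] (v : ι → V)
    (hli : LinearIndependent K⟮t⟯ v) (S : Submodule E V) [FiniteDimensional E S]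
    (hv : ∀ i, v i ∈ S) :
    Fintype.card ι ≤ Module.finrank K⟮t⟯ E * Module.finrank E S := by
  have hli' : LinearIndependent K⟮t⟯ (fun i => (⟨v i, hv i⟩ : S)) := by
    refine LinearIndependent.of_comp ((S.restrictScalars K⟮t⟯).subtype) ?_
    exact hli
  have : FiniteDimensional K⟮t⟯ S := FiniteDimensional.trans K⟮t⟯ E S
  rw [Module.finrank_mul_finrank K⟮t⟯ E S]
  exact hli'.fintype_card_le_finrank

/-- one step of the filtration -/
lemma FMod.step [FiniteDimensional K⟮t⟯ E] (h : FMod t N) (n : ℤ) (S : Submodule E V)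
    [FiniteDimensional E S] (hS : ∀ x ∈ N (n + 1), x ∈ S) [FiniteDimensional K (N n)] :
    ∃ Q : Submodule K V, FiniteDimensional K Q ∧ N n ⊔ Q = N (n + 1) ∧ Disjoint (N n) Q ∧
      Module.finrank K Q ≤ Module.finrank K⟮t⟯ E * Module.finrank E S := by
  obtain ⟨Q, hQ1, hQ2⟩ : ∃ Q : Submodule K V, N n ⊔ Q = N (n + 1) ∧ Disjoint (N n) Q := by
    obtain ⟨Q', hQ'⟩ := Submodule.exists_isCompl (N n)
    refine ⟨Q' ⊓ N (n + 1), ?_, hQ'.disjoint.mono_right inf_le_left⟩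
    rw [← sup_inf_assoc_of_le _ (h.mono1 n), hQ'.sup_eq_top, top_inf_eq]
  have hcard : ∀ (m : ℕ) (v : Fin m → Q), LinearIndependent K v →
      m ≤ Module.finrank K⟮t⟯ E * Module.finrank E S := by
    intro m v hv
    have h1 : ∀ i, (v i : V) ∈ N (n + 1) := fun i => hQ1 ▸ Submodule.mem_sup_right (v i).2
    have := card_le_of_linInd t (fun i => (v i : V)) (h.linInd n _ h1 ?_) S (fun i => hS _ (h1 i))
    · simpa using this
    · intro c hc
      have h2 : (∑ i, c i • (v i : V)) ∈ Q :=
        Submodule.sum_mem _ fun i _ => Submodule.smul_mem _ _ (v i).2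
      have h3 := Submodule.disjoint_def.1 hQ2 _ hc h2
      funext i
      refine Fintype.linearIndependent_iff.1 hv c ?_ i
      apply Subtype.ext
      push_cast
      exact h3
  have hr : Module.rank K Q ≤ (Module.finrank K⟮t⟯ E * Module.finrank E S : ℕ) := by
    apply rank_le
    intro s hs
    have e := hcard s.card (fun i => ((s.equivFin.symm i : s) : Q)) ?_
    · exact e
    · exact hs.comp _ (s.equivFin.symm.injective)
  have : FiniteDimensional K Q :=
    Module.rank_lt_aleph0_iff.1 (lt_of_le_of_lt hr (Cardinal.natCast_lt_aleph0))
  refine ⟨Q, this, hQ1, hQ2, ?_⟩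
  exact Module.finrank_le_of_rank_le hr

lemma finrank_sup_disj {A B : Submodule K V} [FiniteDimensional K A] [FiniteDimensional K B]
    (h : Disjoint A B) : Module.finrank K (A ⊔ B : Submodule K V)
      = Module.finrank K A + Module.finrank K B := by
  have := Submodule.finrank_sup_add_finrank_inf_eq A B
  rw [h.eq_bot] at this
  simpa using this

lemma FMod.finDim [FiniteDimensional K⟮t⟯ E] [FiniteDimensional E V] (h : FMod t N) (n : ℤ) :
    FiniteDimensional K (N n) := by
  obtain ⟨n₀, h0⟩ := h.bdd
  have : ∀ m : ℕ, FiniteDimensional K (N (n₀ - 1 + m)) := by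
    intro m
    induction m with
    | zero => rw [h0 _ (by push_cast; omega)]; infer_instance
    | succ m ih =>
      obtain ⟨Q, hQ, h1, -, -⟩ := h.step (n₀ - 1 + m) ⊤ (fun _ _ => trivial)
      have : N (n₀ - 1 + (m + 1 : ℕ)) = N (n₀ - 1 + m) ⊔ Q := by
        rw [h1]; congr 1; push_cast; ring
      rw [this]; infer_instance
  have h2 := this (n - n₀ + 1).toNat
  refine Submodule.finiteDimensional_of_le (S₂ := N (n₀ - 1 + (n - n₀ + 1).toNat)) (h.mono ?_)
  omega

variable (K) in
/-- dimension function -/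
noncomputable abbrev dm (N : ℤ → Submodule K V) (n : ℤ) : ℤ := (Module.finrank K (N n) : ℤ)

lemma FMod.dm_step [FiniteDimensional K⟮t⟯ E] [FiniteDimensional E V] (h : FMod t N) (n : ℤ)
    (S : Submodule E V) (hS : ∀ x ∈ N (n + 1), x ∈ S) :
    dm K N (n + 1) ≤ dm K N n + Module.finrank K⟮t⟯ E * Module.finrank E S := by
  have := h.finDim n
  obtain ⟨Q, hQ, h1, h2, h3⟩ := h.step n S hS
  have := finrank_sup_disj h2
  unfold dm
  rw [← h1, this]
  push_cast
  have h3' : (Module.finrank K Q : ℤ) ≤ (Module.finrank K⟮t⟯ E * Module.finrank E S : ℕ) := by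
    exact_mod_cast h3
  push_cast at h3'
  linarith

lemma FMod.dm_convex [FiniteDimensional K⟮t⟯ E] [FiniteDimensional E V] (h : FMod t N)
    (ht : t ≠ 0) (n : ℤ) :
    dm K N (n + 1) - dm K N n ≤ dm K N (n + 2) - dm K N (n + 1) ∧
    (dm K N (n + 1) - dm K N n = dm K N (n + 2) - dm K N (n + 1) →
      ∀ x ∈ N (n + 2), ∃ y ∈ N (n + 1), ∃ z ∈ N (n + 1), x = y + t • z) := by
  have := h.finDim n
  have := h.finDim (n + 1)
  have := h.finDim (n + 2)
  obtain ⟨Q, hQ, h1, h2, -⟩ := h.step n ⊤ (fun _ _ => trivial)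
  let f : V →ₗ[K] V := LinearMap.lsmul E V t |>.restrictScalars K
  have hf : ∀ x, f x = t • x := fun _ => rfl
  have hinj : Function.Injective f := by
    intro x y hxy
    simp only [hf] at hxy
    exact smul_right_injective V ht hxy
  have hQN : Q ≤ N (n + 1) := h1 ▸ le_sup_right
  have hle : Q.map f ≤ N (n + 2) := by
    rintro _ ⟨x, hx, rfl⟩
    have := h.tmul _ _ (hQN hx)
    rw [show n + 2 = n + 1 + 1 by ring]; exact this
  have hdisj : Disjoint (N (n + 1)) (Q.map f) := by
    rw [Submodule.disjoint_def]
    rintro _ hx ⟨y, hy, rfl⟩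
    have := h.refl n y (hQN hy) hx
    have := Submodule.disjoint_def.1 h2 _ this hy
    simp [this]
  have e1 := finrank_sup_disj h2
  have e2 := finrank_sup_disj hdisj
  have e3 : Module.finrank K (Q.map f) = Module.finrank K Q :=
    (Submodule.equivMapOfInjective f hinj Q).finrank_eq.symm
  have hle2 : N (n + 1) ⊔ Q.map f ≤ N (n + 2) :=
    sup_le (h.mono (by omega)) hle
  have e4 := Submodule.finrank_mono hle2
  rw [h1] at e1
  constructor
  · unfold dm; omega
  · intro heq x hx
    have : N (n + 1) ⊔ Q.map f = N (n + 2) := by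
      apply Submodule.eq_of_le_of_finrank_eq hle2
      unfold dm at heq; omega
    rw [← this] at hx
    obtain ⟨y, hy, _, ⟨z, hz, rfl⟩, hyz⟩ := Submodule.mem_sup.1 hx
    exact ⟨y, hy, z, hQN hz, hyz.symm⟩

end fmod
end FT

namespace FT
open Polynomial IntermediateField
open scoped IntermediateField.algebraAdjoinAdjoin
set_option linter.unusedSectionVars false

/-- A projective curve over `K` with function field `E`, given by two affine charts. -/
structure Crv (K E : Type*) [Field K] [Field E] [Algebra K E] where
  t : E
  O : Subalgebra K E
  Oi : Subalgebra K E
  tr : Transcendental K t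
  t_mem : t ∈ O
  ti_mem : t⁻¹ ∈ Oi
  loc : ∀ x ∈ O, ∃ n : ℕ, t⁻¹ ^ n * x ∈ Oi
  loci : ∀ x ∈ Oi, ∃ n : ℕ, t ^ n * x ∈ O
  int : ∀ x ∈ O, IsIntegral (Algebra.adjoin K {t}) x
  inti : ∀ x ∈ Oi, IsIntegral (Algebra.adjoin K {t⁻¹}) x
  frac : ∀ x : E, ∃ a ∈ O, ∃ b ∈ O, b ≠ 0 ∧ x * b = a
  fraci : ∀ x : E, ∃ a ∈ Oi, ∃ b ∈ Oi, b ≠ 0 ∧ x * b = a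
  fin : FiniteDimensional K⟮t⟯ E
  sep : Algebra.IsSeparable K⟮t⟯ E

variable {K E : Type*} [Field K] [Field E] [Algebra K E]

lemma adjoin_inv (t : E) : K⟮t⁻¹⟯ = K⟮t⟯ := by
  apply le_antisymm
  · rw [adjoin_simple_le_iff]; exact inv_mem (mem_adjoin_simple_self K t)
  · rw [adjoin_simple_le_iff]
    have := inv_mem (mem_adjoin_simple_self K t⁻¹)
    rwa [inv_inv] at this

/-- The same curve with the charts exchanged. -/
def Crv.swap (C : Crv K E) : Crv K E where
  t := C.t⁻¹
  O := C.Oi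
  Oi := C.O
  tr := by
    intro h
    apply C.tr
    have := h.inv
    rwa [inv_inv] at this
  t_mem := C.ti_mem
  ti_mem := by simpa using C.t_mem
  loc := by simpa using C.loci
  loci := C.loc
  int := C.inti
  inti := (inv_inv C.t).symm ▸ C.int
  frac := C.fraci
  fraci := C.frac
  fin := (adjoin_inv (K := K) C.t).symm ▸ C.fin
  sep := (adjoin_inv (K := K) C.t).symm ▸ C.sep

instance (C : Crv K E) : FiniteDimensional K⟮C.t⟯ E := C.fin
instance (C : Crv K E) : Algebra.IsSeparable K⟮C.t⟯ E := C.sep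

lemma Crv.swap_swap (C : Crv K E) : C.swap.swap = C := by
  cases C; simp [Crv.swap]

namespace Crv
variable (C : Crv K E)

lemma t0 : C.t ≠ 0 := by
  intro h
  apply C.tr
  rw [h]; exact isAlgebraic_zero

/-- the degree of the covering -/
noncomputable def dl : ℕ := Module.finrank K⟮C.t⟯ E

lemma finrank_congr {F F' : IntermediateField K E} (h : F = F') :
    Module.finrank F E = Module.finrank F' E := by subst h; rfl

lemma norm_congr {F F' : IntermediateField K E} (h : F = F') (y : E) :
    algebraMap F E (Algebra.norm F y) = algebraMap F' E (Algebra.norm F' y) := by subst h; rfl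

lemma dl_swap : C.swap.dl = C.dl := finrank_congr (adjoin_inv C.t)

lemma dl_pos : 0 < C.dl := Module.finrank_pos

/-- the norm, as an element of `E` -/
noncomputable def nrm (y : E) : E := algebraMap K⟮C.t⟯ E (Algebra.norm K⟮C.t⟯ y)

lemma nrm_swap (y : E) : C.swap.nrm y = C.nrm y := norm_congr (adjoin_inv C.t) y

lemma nrm_mul (x y : E) : C.nrm (x * y) = C.nrm x * C.nrm y := by simp [nrm]

lemma nrm_ne {x : E} (h : x ≠ 0) : C.nrm x ≠ 0 := by
  unfold nrm
  simpa using (Algebra.norm_ne_zero_iff (R := K⟮C.t⟯)).2 h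

lemma nrm_t : C.nrm C.t = C.t ^ C.dl := by
  have := Algebra.norm_algebraMap (R := K⟮C.t⟯) (S := E)
    (⟨C.t, mem_adjoin_simple_self K C.t⟩ : K⟮C.t⟯)
  have h2 := congrArg (algebraMap K⟮C.t⟯ E) this
  rw [map_pow] at h2
  exact h2

lemma nrm_zpow (x : E) (n : ℤ) : C.nrm (x ^ n) = C.nrm x ^ n := by
  let f : E →*₀ E :=
    { toFun := C.nrm
      map_zero' := by simp [nrm, Algebra.norm_zero]
      map_one' := by simp [nrm]
      map_mul' := C.nrm_mul }
  exact map_zpow₀ f x n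

/-- the twisting sheaf sections -/
def L (n : ℤ) : Submodule K E where
  carrier := {x | x ∈ C.O ∧ C.t ^ (-n) * x ∈ C.Oi}
  add_mem' := by
    rintro a b ⟨h1, h2⟩ ⟨h3, h4⟩
    refine ⟨add_mem h1 h3, ?_⟩
    rw [mul_add]; exact add_mem h2 h4
  zero_mem' := ⟨zero_mem _, by rw [mul_zero]; exact zero_mem _⟩
  smul_mem' := by
    rintro c x ⟨h1, h2⟩
    refine ⟨Subalgebra.smul_mem _ h1 c, ?_⟩
    rw [mul_smul_comm]; exact Subalgebra.smul_mem _ h2 c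

lemma mem_L {n : ℤ} {x : E} : x ∈ C.L n ↔ x ∈ C.O ∧ C.t ^ (-n) * x ∈ C.Oi := Iff.rfl

lemma mem_L_swap {n : ℤ} {x : E} : C.t ^ (-n) * x ∈ C.swap.L n ↔ x ∈ C.L n := by
  rw [mem_L, mem_L]
  have : C.swap.t ^ (-n) * (C.t ^ (-n) * x) = x := by
    have := zpow_ne_zero n C.t0
    simp only [swap, inv_zpow', zpow_neg, neg_neg]
    field_simp
  rw [this]
  exact and_comm

lemma mul_mem_L {a b : ℤ} {x y : E} (hx : x ∈ C.L a) (hy : y ∈ C.L b) : x * y ∈ C.L (a + b) := by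
  refine ⟨mul_mem hx.1 hy.1, ?_⟩
  have := mul_mem hx.2 hy.2
  convert this using 1
  rw [neg_add, zpow_add₀ C.t0]; ring

lemma one_mem_L : (1 : E) ∈ C.L 0 := ⟨one_mem _, by simp⟩

lemma t_mem_L : C.t ∈ C.L 1 := ⟨C.t_mem, by simp [C.t0]⟩

lemma one_mem_L1 : (1 : E) ∈ C.L 1 := ⟨one_mem _, by simpa using C.ti_mem⟩

lemma pow_mem_L {a : ℤ} {x : E} (hx : x ∈ C.L a) (n : ℕ) : x ^ n ∈ C.L (n * a) := by
  induction n with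
  | zero => simpa using C.one_mem_L
  | succ n ih =>
    rw [pow_succ]
    have := C.mul_mem_L ih hx
    convert this using 1; push_cast; ring_nf

lemma prod_mem_L {ι : Type*} (s : Finset ι) (d : ι → ℤ) (x : ι → E)
    (h : ∀ i ∈ s, x i ∈ C.L (d i)) : ∏ i ∈ s, x i ∈ C.L (∑ i ∈ s, d i) := by
  classical
  induction s using Finset.induction_on with
  | empty => simpa using C.one_mem_L
  | insert a s ha ih =>
    rw [Finset.prod_insert ha, Finset.sum_insert ha]
    exact C.mul_mem_L (h a (by simp)) (ih fun i hi => h i (by simp [hi]))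

lemma L_mono : Monotone C.L := by
  apply monotone_int_of_le_succ
  intro n x hx
  simpa using C.mul_mem_L hx C.one_mem_L1

lemma mem_O_iff {x : E} : x ∈ C.O ↔ ∃ N : ℤ, ∀ n ≥ N, x ∈ C.L n := by
  constructor
  · intro hx
    obtain ⟨n, hn⟩ := C.loc x hx
    refine ⟨n, fun m hm => C.L_mono hm ⟨hx, ?_⟩⟩
    simpa using hn
  · rintro ⟨N, hN⟩
    exact (hN N le_rfl).1

instance pid (t : E) : IsPrincipalIdealRing (Algebra.adjoin K {t}) := by
  have hm : ∀ P : K[X], aeval t P ∈ Algebra.adjoin K {t} := fun P => aeval_mem_adjoin_singleton K t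
  let f : K[X] →+* Algebra.adjoin K {t} := ((aeval t).codRestrict _ hm : K[X] →ₐ[K] _)
  apply IsPrincipalIdealRing.of_surjective f
  rintro ⟨x, hx⟩
  have hx' := hx
  rw [Algebra.adjoin_singleton_eq_range_aeval] at hx'
  obtain ⟨P, hP⟩ := hx'
  exact ⟨P, Subtype.ext hP⟩

lemma mem_adj {t x : E} : x ∈ Algebra.adjoin K {t} ↔ ∃ P : K[X], aeval t P = x := by
  rw [Algebra.adjoin_singleton_eq_range_aeval]; rfl

lemma nrm_poly {y : E} (hy : IsIntegral (Algebra.adjoin K {C.t}) y) :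
    ∃ P : K[X], C.nrm y = aeval C.t P := by
  have h1 : IsIntegral (Algebra.adjoin K {C.t}) (Algebra.norm K⟮C.t⟯ y) :=
    Algebra.isIntegral_norm K⟮C.t⟯ hy
  obtain ⟨z, hz⟩ := IsIntegrallyClosed.isIntegral_iff.1 h1
  obtain ⟨P, hP⟩ := mem_adj.1 z.2
  refine ⟨P, ?_⟩
  unfold nrm
  rw [hP, ← hz]
  rfl

lemma aeval_inj {P Q : K[X]} (h : aeval C.t P = aeval C.t Q) : P = Q :=
  transcendental_iff_injective.1 C.tr h

lemma deg_swap {P Q : K[X]} {D : ℤ} (hP : P ≠ 0)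
    (h : aeval C.t⁻¹ Q = C.t ^ (-D) * aeval C.t P) :
    (Q.natTrailingDegree : ℤ) = D - P.natDegree := by
  have ht := C.t0
  let _ : Invertible (C.t⁻¹) := invertibleOfNonzero (inv_ne_zero ht)
  have h1 := eval₂_reverse_mul_pow (algebraMap K E) C.t⁻¹ Q
  rw [invOf_eq_inv, inv_inv] at h1
  change aeval C.t Q.reverse * _ = aeval C.t⁻¹ Q at h1
  rw [h] at h1
  have hr : (Q.reverse.natDegree : ℤ) = Q.natDegree - Q.natTrailingDegree := by
    rw [reverse_natDegree]; have := natTrailingDegree_le_natDegree Q; omega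
  have h2 : aeval C.t Q.reverse = C.t ^ ((Q.natDegree : ℤ) - D) * aeval C.t P := by
    rw [inv_pow, mul_inv_eq_iff_eq_mul₀ (pow_ne_zero _ ht)] at h1
    rw [h1, sub_eq_add_neg, zpow_add₀ ht, zpow_natCast]; ring
  rcases le_total 0 ((Q.natDegree : ℤ) - D) with hc | hc
  · obtain ⟨k, hk⟩ := Int.eq_ofNat_of_zero_le hc
    rw [hk, zpow_natCast] at h2
    have h3 : Q.reverse = X ^ k * P := C.aeval_inj (by simp [h2])
    have : Q.reverse.natDegree = k + P.natDegree := by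
      rw [h3, natDegree_mul (pow_ne_zero _ X_ne_zero) hP, natDegree_X_pow]
    omega
  · obtain ⟨k, hk⟩ := Int.eq_ofNat_of_zero_le (a := D - Q.natDegree) (by omega)
    have h3 : X ^ k * Q.reverse = P := by
      apply C.aeval_inj
      rw [map_mul, h2, ← mul_assoc, map_pow, aeval_X, ← zpow_natCast, ← zpow_add₀ ht, ← hk]
      simp
    have hQ0 : Q.reverse ≠ 0 := by
      rintro h0; rw [h0, mul_zero] at h3; exact hP h3.symm
    have : P.natDegree = k + Q.reverse.natDegree := by
      rw [← h3, natDegree_mul (pow_ne_zero _ X_ne_zero) hQ0, natDegree_X_pow]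
    omega

lemma nrm_L {n : ℤ} {y : E} (hy : y ∈ C.L n) (h0 : y ≠ 0) :
    ∃ P : K[X], P ≠ 0 ∧ C.nrm y = aeval C.t P ∧ (P.natDegree : ℤ) ≤ C.dl * n := by
  obtain ⟨P, hP⟩ := C.nrm_poly (C.int _ hy.1)
  have hP0 : P ≠ 0 := by
    rintro rfl
    exact C.nrm_ne h0 (by simpa using hP)
  obtain ⟨Q, hQ⟩ := C.swap.nrm_poly (C.inti _ hy.2)
  refine ⟨P, hP0, hP, ?_⟩
  have : (Q.natTrailingDegree : ℤ) = C.dl * n - P.natDegree := by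
    apply C.deg_swap hP0
    change aeval C.swap.t Q = _
    rw [← hQ, nrm_swap, nrm_mul, hP, nrm_zpow, nrm_t, ← zpow_natCast, ← zpow_mul]
    congr 2; ring
  omega

lemma L_neg {n : ℤ} (hn : n < 0) : C.L n = ⊥ := by
  rw [eq_bot_iff]
  intro y hy
  by_contra h0
  obtain ⟨P, -, -, hP⟩ := C.nrm_L hy h0
  have := C.dl_pos
  have : (C.dl : ℤ) * n < 0 := by nlinarith
  omega

lemma fmodL : FMod (V := E) C.t C.L where
  mono1 n := C.L_mono (by omega)
  tmul n x hx := by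
    have := C.mul_mem_L hx C.t_mem_L
    rwa [mul_comm] at this
  refl n x hx htx := by
    refine ⟨hx.1, ?_⟩
    have := htx.2
    rw [smul_eq_mul, ← mul_assoc] at this
    convert this using 2
    rw [neg_add, zpow_add₀ C.t0, mul_assoc, zpow_neg_one, inv_mul_cancel₀ C.t0, mul_one]
  bdd := ⟨0, fun _ h => C.L_neg h⟩

instance (n : ℤ) : FiniteDimensional K (C.L n) := C.fmodL.finDim n

end Crv
end FT

namespace FT
open Polynomial IntermediateField
open scoped IntermediateField.algebraAdjoinAdjoin
set_option linter.unusedSectionVars false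

section lower
variable {K E V : Type*} [Field K] [Field E] [Algebra K E] [AddCommGroup V] [Module K V]
  [Module E V] [IsScalarTower K E V] {t : E} {N : ℤ → Submodule K V}

lemma FMod.lower (h : FMod t N) [FiniteDimensional K⟮t⟯ E] [FiniteDimensional E V]
    (tr : Transcendental K t) {ι : Type*} [Fintype ι] (v : ι → V)
    (hli : LinearIndependent K⟮t⟯ v) (n : ℤ) (hv : ∀ i, v i ∈ N n) (j : ℕ) :
    (Fintype.card ι : ℤ) * (j + 1) ≤ dm K N (n + j) := by
  have hp : LinearIndependent K (fun i : Fin (j + 1) =>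
      (⟨t, mem_adjoin_simple_self K t⟩ : K⟮t⟯) ^ (i : ℕ)) := by
    rw [Fintype.linearIndependent_iff]
    intro g hg i
    let P : K[X] := ∑ i : Fin (j + 1), C (g i) * X ^ (i : ℕ)
    have hP : aeval t P = 0 := by
      have := congrArg (algebraMap K⟮t⟯ E) hg
      simp only [map_sum, map_zero] at this
      simp only [P, map_sum, map_mul, aeval_C, map_pow, aeval_X]
      rw [← this]
      refine Finset.sum_congr rfl fun i _ => ?_
      rw [Algebra.smul_def, map_mul, map_pow]
      rfl
    have hP0 : P = 0 := by
      by_contra h0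
      exact tr ⟨P, h0, hP⟩
    have := congrArg (fun Q : K[X] => Q.coeff (i : ℕ)) hP0
    simp only [P, finsetSum_coeff, coeff_C_mul, coeff_X_pow, coeff_zero] at this
    rw [Finset.sum_eq_single i] at this
    · simpa using this
    · intro b _ hb
      have : (i : ℕ) ≠ b := fun h => hb (Fin.ext h.symm)
      simp [this]
    · simp
  have : IsScalarTower K K⟮t⟯ V := ⟨fun c x v => smul_assoc c (x : E) v⟩
  have hli2 := linearIndependent_smul hp hli
  have hfd := h.finDim (n + j)
  have hmem : ∀ p : Fin (j + 1) × ι,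
      (⟨t, mem_adjoin_simple_self K t⟩ : K⟮t⟯) ^ (p.1 : ℕ) • v p.2 ∈ N (n + j) := by
    intro p
    have := h.tpow (p.1 : ℕ) n _ (hv p.2)
    have h2 := h.mono (show n + ((p.1 : ℕ) : ℤ) ≤ n + j by have := p.1.2; omega) this
    exact h2
  have hli3 : LinearIndependent K (fun p : Fin (j + 1) × ι =>
      (⟨_, hmem p⟩ : N (n + j))) := by
    refine LinearIndependent.of_comp (N (n + j)).subtype ?_
    exact hli2
  have := hli3.fintype_card_le_finrank
  rw [Fintype.card_prod, Fintype.card_fin] at this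
  unfold dm
  have : (((j + 1) * Fintype.card ι : ℕ) : ℤ) ≤ (Module.finrank K (N (n + j)) : ℤ) := by
    exact_mod_cast this
  push_cast at this
  linarith
end lower

variable {K E : Type*} [Field K] [Field E] [Algebra K E]

lemma common_den {O : Subalgebra K E} (frac : ∀ x : E, ∃ a ∈ O, ∃ b ∈ O, b ≠ 0 ∧ x * b = a)
    {ι : Type*} [Finite ι] (x : ι → E) : ∃ b ∈ O, b ≠ 0 ∧ ∀ i, b * x i ∈ O := by
  classical
  have := Fintype.ofFinite ι
  choose a ha b hb hb0 hab using fun i => frac (x i)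
  refine ⟨∏ i, b i, prod_mem fun i _ => hb i, Finset.prod_ne_zero_iff.2 fun i _ => hb0 i, ?_⟩
  intro i
  rw [← Finset.mul_prod_erase _ _ (Finset.mem_univ i)]
  have : b i * (∏ j ∈ Finset.univ.erase i, b j) * x i
      = a i * ∏ j ∈ Finset.univ.erase i, b j := by rw [← hab]; ring
  rw [this]
  exact mul_mem (ha i) (prod_mem fun i _ => hb i)

namespace Crv
variable (C : Crv K E)

lemma L_upper (n : ℤ) (hn : -1 ≤ n) : dm K C.L n ≤ C.dl * (n + 1) := by
  obtain ⟨j, rfl⟩ : ∃ j : ℕ, n = -1 + j := ⟨(n + 1).toNat, by omega⟩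
  induction j with
  | zero =>
    have := C.L_neg (n := -1) (by norm_num)
    simp [dm, this]
  | succ j ih =>
    have h1 := ih (by omega)
    have h2 := C.fmodL.dm_step (-1 + j) ⊤ (fun _ _ => trivial)
    rw [finrank_top, Module.finrank_self] at h2
    have e : (-1 + ((j + 1 : ℕ) : ℤ)) = -1 + (j : ℤ) + 1 := by push_cast; ring
    rw [e]
    have e2 : (Module.finrank K⟮C.t⟯ E : ℤ) = C.dl := rfl
    rw [e2] at h2
    push_cast at h2
    nlinarith

lemma L_indep : ∃ (n : ℤ) (v : Fin C.dl → E), LinearIndependent K⟮C.t⟯ v ∧ ∀ i, v i ∈ C.L n := by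
  let b := Module.finBasis K⟮C.t⟯ E
  obtain ⟨d, hd, hd0, hdb⟩ := common_den C.frac b
  choose N hN using fun i => C.mem_O_iff.1 (hdb i)
  refine ⟨∑ i, |N i|, fun i => d * b i, ?_, fun i => hN i _ ?_⟩
  · have := b.linearIndependent.map' (LinearMap.mulLeft K⟮C.t⟯ d)
      (LinearMap.ker_eq_bot.2 (mul_right_injective₀ hd0))
    exact this
  · exact (le_abs_self _).trans
      (Finset.single_le_sum (f := fun i => |N i|) (fun _ _ => abs_nonneg _) (Finset.mem_univ i))

lemma L_lower : ∃ c : ℤ, 0 ≤ c ∧ ∀ n, C.dl * n - c ≤ dm K C.L n := by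
  obtain ⟨n₀, v, hv, hn⟩ := C.L_indep
  refine ⟨C.dl * |n₀|, by positivity, fun n => ?_⟩
  have hd : (0 : ℤ) ≤ C.dl := by positivity
  rcases lt_or_ge n |n₀| with h | h
  · have : (0 : ℤ) ≤ dm K C.L n := by unfold dm; positivity
    nlinarith
  · have := C.fmodL.lower C.tr v hv |n₀| (fun i => C.L_mono (le_abs_self _) (hn i)) (n - |n₀|).toNat
    rw [Fintype.card_fin] at this
    have e : (((n - |n₀|).toNat : ℕ) : ℤ) = n - |n₀| := by omega
    rw [e] at this
    rw [show |n₀| + (n - |n₀|) = n by ring] at this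
    nlinarith
end Crv

/-! ### Greedy minima -/
section greedy
variable {V : Type*} [AddCommGroup V] [Module K V] [Module E V] [IsScalarTower K E V]
  [FiniteDimensional E V]

lemma greedy {N : ℤ → Submodule K V} (hb : ∃ n₀ : ℤ, ∀ n < n₀, N n = ⊥)
    (S : Submodule E V) (hS : ∀ T : Submodule E V, (∀ n, ∀ x ∈ N n, x ∈ T) → S ≤ T) (k : ℕ)
    (hk : k ≤ Module.finrank E S) :
    ∃ (m : Fin k → ℤ) (s : Fin k → V), Monotone m ∧ LinearIndependent E s ∧
      (∀ i, s i ∈ N (m i)) ∧ ∀ i, ∀ n < m i, ∀ x ∈ N n, x ∈ Submodule.span E (s '' Set.Iio i) := by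
  induction k with
  | zero =>
    exact ⟨Fin.elim0, Fin.elim0, fun i => i.elim0, linearIndependent_empty_type,
      fun i => i.elim0, fun i => i.elim0⟩
  | succ k ih =>
    obtain ⟨m, s, hmm, hs, hsm, hsn⟩ := ih (by omega)
    let T := Submodule.span E (Set.range s)
    have hT : Module.finrank E T = k := by
      have := finrank_span_eq_card hs
      simpa using this
    have hex : ∃ n, ∃ x ∈ N n, x ∉ T := by
      by_contra hcon
      push Not at hcon
      have := Submodule.finrank_mono (hS T hcon)
      omega
    obtain ⟨n₀, hn₀⟩ := hb
    obtain ⟨n₁, ⟨x, hx, hxT⟩, hmin⟩ : ∃ n₁, (∃ x ∈ N n₁, x ∉ T) ∧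
        ∀ n, (∃ x ∈ N n, x ∉ T) → n₁ ≤ n := by
      apply Int.exists_least_of_bdd (P := fun n => ∃ x ∈ N n, x ∉ T) _ hex
      refine ⟨n₀, ?_⟩
      rintro z ⟨x, hx, hxT⟩
      by_contra hz
      rw [hn₀ z (by omega)] at hx
      rw [Submodule.mem_bot] at hx
      exact hxT (hx ▸ zero_mem _)
    have hle : ∀ i, m i ≤ n₁ := by
      intro i
      by_contra hi
      have := hsn i n₁ (by omega) x hx
      exact hxT (Submodule.span_mono (Set.image_subset_range _ _) this)
    refine ⟨Fin.snoc m n₁, Fin.snoc s x, ?_, ?_, ?_, ?_⟩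
    · intro i j hij
      induction j using Fin.lastCases with
      | last =>
        induction i using Fin.lastCases with
        | last => exact le_rfl
        | cast i => simpa using hle i
      | cast j =>
        induction i using Fin.lastCases with
        | last => exact absurd hij (not_le.2 (Fin.castSucc_lt_last j))
        | cast i => simpa using hmm (by simpa using hij)
    · rw [linearIndependent_finSnoc]; exact ⟨hs, hxT⟩
    · intro i
      induction i using Fin.lastCases with
      | last => simpa using hx
      | cast i => simpa using hsm i
    · intro i n hn y hy
      have him : ∀ i : Fin k, (Fin.snoc s x : Fin (k + 1) → V) '' Set.Iio i.castSucc
          = s '' Set.Iio i := by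
        intro i
        ext z
        constructor
        · rintro ⟨j, hj, rfl⟩
          induction j using Fin.lastCases with
          | last => exact absurd hj (not_lt.2 (Fin.castSucc_lt_last i).le)
          | cast j => exact ⟨j, by simpa using hj, by simp⟩
        · rintro ⟨j, hj, rfl⟩
          exact ⟨j.castSucc, by simpa using hj, by simp⟩
      induction i using Fin.lastCases with
      | last =>
        have : y ∈ T := by
          by_contra hyT
          have := hmin n ⟨y, hy, hyT⟩
          simp at hn
          omega
        refine Submodule.span_mono ?_ this
        rintro _ ⟨j, rfl⟩
        exact ⟨j.castSucc, Fin.castSucc_lt_last j, by simp⟩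
      | cast i =>
        rw [him]
        exact hsn i n (by simpa using hn) y hy

end greedy
end FT

namespace FT
open Polynomial IntermediateField
open scoped IntermediateField.algebraAdjoinAdjoin
set_option linter.unusedSectionVars false

variable {K E : Type*} [Field K] [Field E] [Algebra K E]

/-- An ideal sheaf generated by sections `φ_j` of degree `e_j` without common zeros. -/
structure Dat (C : Crv K E) (r : ℕ) where
  φ : Fin (r + 1) → E
  e : Fin (r + 1) → ℤ
  he : ∀ j, 0 ≤ e j
  hφ : ∀ j, φ j ∈ C.L (e j)
  a : Fin (r + 1) → E
  ha : ∀ j, a j ∈ C.O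
  ha1 : ∑ j, a j * φ j = 1
  b : Fin (r + 1) → E
  hb : ∀ j, b j ∈ C.Oi
  hb1 : ∑ j, b j * (C.t ^ (-e j) * φ j) = 1

lemma frob_sum {p : ℕ} [Fact p.Prime] [CharP E p] {q : ℕ} (hq : ∃ n, q = p ^ n) {ι : Type*}
    (s : Finset ι) (f : ι → E) : (∑ i ∈ s, f i) ^ q = ∑ i ∈ s, f i ^ q := by
  obtain ⟨n, rfl⟩ := hq
  have := sum_pow_char_pow (R := E) p n s f
  exact this

lemma det_mem_sub (O : Subalgebra K E) {n : ℕ} (M : Matrix (Fin n) (Fin n) E)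
    (h : ∀ i j, M i j ∈ O) : M.det ∈ O := by
  rw [Matrix.det_apply]
  refine sum_mem fun σ _ => ?_
  rw [Units.smul_def]
  exact zsmul_mem (prod_mem fun i _ => h _ _) _

variable {C : Crv K E} {r : ℕ}

namespace Dat
variable (D : Dat C r)

/-- the sections of the twisted direct sum -/
def G (q : ℕ) (n : ℤ) : Submodule K (Fin (r + 1) → E) where
  carrier := {s | ∀ j, s j ∈ C.L (n - q * D.e j)}
  add_mem' h1 h2 j := add_mem (h1 j) (h2 j)
  zero_mem' _ := zero_mem _
  smul_mem' c _ h j := Submodule.smul_mem _ c (h j)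

lemma mem_G {q : ℕ} {n : ℤ} {s : Fin (r + 1) → E} :
    s ∈ D.G q n ↔ ∀ j, s j ∈ C.L (n - q * D.e j) := Iff.rfl

lemma smul_mem_G {q : ℕ} {n d : ℤ} {x : E} {s : Fin (r + 1) → E} (hx : x ∈ C.L d)
    (hs : s ∈ D.G q n) : x • s ∈ D.G q (d + n) := by
  intro j
  have := C.mul_mem_L hx (hs j)
  rwa [← add_sub_assoc] at this

lemma fmodG (q : ℕ) : FMod C.t (D.G q) where
  mono1 n s hs j := C.L_mono (by omega) (hs j)
  tmul n s hs := by
    have := D.smul_mem_G C.t_mem_L hs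
    rwa [add_comm (1 : ℤ) n] at this
  refl n s hs hts j := by
    apply C.fmodL.refl
    · have := hs j; rwa [add_sub_right_comm] at this
    · have := hts j; rwa [add_sub_right_comm] at this
  bdd := by
    refine ⟨0, fun n hn => ?_⟩
    rw [eq_bot_iff]
    intro s hs
    rw [Submodule.mem_bot]
    funext j
    have := hs j
    rw [C.L_neg] at this
    · simpa using this
    · have := D.he j
      have : 0 ≤ (q : ℤ) * D.e j := by positivity
      omega

/-- the Frobenius twisted pairing -/
noncomputable def ph (q : ℕ) : (Fin (r + 1) → E) →ₗ[E] E :=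
  Fintype.linearCombination E (fun j => D.φ j ^ q)

lemma ph_apply (q : ℕ) (s : Fin (r + 1) → E) : D.ph q s = ∑ j, s j * D.φ j ^ q := by
  simp [ph, Fintype.linearCombination_apply]

/-- intersection of a subspace with the lattice -/
def NW (q : ℕ) (W : Submodule E (Fin (r + 1) → E)) (n : ℤ) : Submodule K (Fin (r + 1) → E) :=
  D.G q n ⊓ W.restrictScalars K

lemma mem_NW {q : ℕ} {W : Submodule E (Fin (r + 1) → E)} {n : ℤ} {s : Fin (r + 1) → E} :
    s ∈ D.NW q W n ↔ s ∈ D.G q n ∧ s ∈ W := Iff.rfl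

lemma fmodNW (q : ℕ) (W : Submodule E (Fin (r + 1) → E)) : FMod C.t (D.NW q W) where
  mono1 n s hs := ⟨(D.fmodG q).mono1 n hs.1, hs.2⟩
  tmul n s hs := ⟨(D.fmodG q).tmul n s hs.1, W.smul_mem _ hs.2⟩
  refl n s hs hts := ⟨(D.fmodG q).refl n s hs.1 hts.1, hs.2⟩
  bdd := by
    obtain ⟨n₀, h⟩ := (D.fmodG q).bdd
    refine ⟨n₀, fun n hn => ?_⟩
    rw [eq_bot_iff, ← h n hn]
    exact inf_le_left

lemma ph_mem {q : ℕ} {n : ℤ} {s : Fin (r + 1) → E} (hs : s ∈ D.G q n) : D.ph q s ∈ C.L n := by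
  rw [ph_apply]
  refine sum_mem fun j _ => ?_
  have := C.mul_mem_L (hs j) (C.pow_mem_L (D.hφ j) q)
  simpa using this

variable {p : ℕ} [Fact p.Prime] [CharP E p]

lemma ph_a {q : ℕ} (hq : ∃ n, q = p ^ n) : D.ph q (fun j => D.a j ^ q) = 1 := by
  rw [ph_apply]
  have := frob_sum hq Finset.univ (fun j => D.a j * D.φ j)
  rw [D.ha1, one_pow] at this
  rw [this]
  exact Finset.sum_congr rfl fun j _ => (mul_pow _ _ _).symm

lemma ph_b {q : ℕ} (hq : ∃ n, q = p ^ n) :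
    D.ph q (fun j => (C.t ^ (-D.e j) * D.b j) ^ q) = 1 := by
  rw [ph_apply]
  have := frob_sum hq Finset.univ (fun j => D.b j * (C.t ^ (-D.e j) * D.φ j))
  rw [D.hb1, one_pow] at this
  rw [this]
  exact Finset.sum_congr rfl fun j _ => by rw [← mul_pow]; ring

/-- the syzygies -/
noncomputable def kr (q : ℕ) : Submodule E (Fin (r + 1) → E) := LinearMap.ker (D.ph q)

lemma mem_kr {q : ℕ} {x : Fin (r + 1) → E} : x ∈ D.kr q ↔ D.ph q x = 0 := LinearMap.mem_ker

lemma finrank_kr {q : ℕ} (hq : ∃ n, q = p ^ n) : Module.finrank E (D.kr q) = r := by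
  have h1 := LinearMap.finrank_range_add_finrank_ker (D.ph q)
  have h2 : LinearMap.range (D.ph q) = ⊤ := by
    rw [LinearMap.range_eq_top]
    intro y
    refine ⟨y • fun j => D.a j ^ q, ?_⟩
    rw [map_smul, D.ph_a hq, smul_eq_mul, mul_one]
  rw [h2, finrank_top, Module.finrank_self, Module.finrank_fin_fun] at h1
  unfold kr
  omega

lemma kr_le (q : ℕ) (T : Submodule E (Fin (r + 1) → E))
    (hT : ∀ n, ∀ x ∈ D.NW q (D.kr q) n, x ∈ T) : D.kr q ≤ T := by
  intro x hx
  obtain ⟨b, hb, hb0, hbx⟩ := common_den C.frac x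
  choose N hN using fun i => C.mem_O_iff.1 (hbx i)
  have : b • x ∈ T := by
    apply hT (∑ i, (|N i| + |q * D.e i|))
    refine ⟨fun j => hN j _ ?_, (D.kr q).smul_mem b hx⟩
    have h1 := Finset.single_le_sum (f := fun i => |N i| + |q * D.e i|)
      (fun _ _ => by positivity) (Finset.mem_univ j)
    have h2 := le_abs_self (N j)
    have h3 := le_abs_self ((q : ℤ) * D.e j)
    have h1' : |N j| + |(q : ℤ) * D.e j| ≤ ∑ i, (|N i| + |(q : ℤ) * D.e i|) := h1
    linarith
  have h2 := T.smul_mem b⁻¹ this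
  rwa [smul_smul, inv_mul_cancel₀ hb0, one_smul] at h2

/-- successive minima -/
structure IsMin (q : ℕ) (m : Fin r → ℤ) (s : Fin r → (Fin (r + 1) → E)) : Prop where
  mono : Monotone m
  li : LinearIndependent E s
  mem : ∀ i, s i ∈ D.NW q (D.kr q) (m i)
  low : ∀ i, ∀ n < m i, ∀ x ∈ D.NW q (D.kr q) n, x ∈ Submodule.span E (s '' Set.Iio i)

lemma exists_min {q : ℕ} (hq : ∃ n, q = p ^ n) : ∃ m s, D.IsMin q m s := by
  obtain ⟨m, s, h1, h2, h3, h4⟩ := greedy (D.fmodNW q (D.kr q)).bdd (D.kr q) (D.kr_le q) r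
    (D.finrank_kr hq).ge
  exact ⟨m, s, h1, h2, h3, h4⟩

end Dat

/-- initial segments -/
def Fk (r k : ℕ) : Finset (Fin r) := Finset.univ.filter (fun i => (i : ℕ) < k)

lemma mem_Fk {r k : ℕ} {i : Fin r} : i ∈ Fk r k ↔ (i : ℕ) < k := by simp [Fk]

lemma card_Fk {r k : ℕ} (h : k ≤ r) : (Fk r k).card = k := by
  have : (Fk r k) = (Finset.univ : Finset (Fin k)).map (Fin.castLEEmb h) := by
    ext i
    simp only [mem_Fk, Finset.mem_map, Finset.mem_univ, true_and]
    constructor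
    · intro hi; exact ⟨⟨i, hi⟩, rfl⟩
    · rintro ⟨j, rfl⟩; exact j.2
  rw [this]; simp

/-- the span of the first `k` vectors -/
def Wk (s : Fin r → (Fin (r + 1) → E)) (k : ℕ) : Submodule E (Fin (r + 1) → E) :=
  Submodule.span E (s '' (Fk r k : Set (Fin r)))

namespace Dat
variable {D : Dat C r} {p : ℕ} [Fact p.Prime] [CharP E p] {q : ℕ} {m : Fin r → ℤ}
  {s : Fin r → (Fin (r + 1) → E)}

lemma IsMin.nonneg (h : D.IsMin q m s) (i : Fin r) : 0 ≤ m i := by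
  by_contra hm
  have h1 := (h.mem i).1
  have : s i = 0 := by
    funext j
    have := h1 j
    rw [C.L_neg] at this
    · simpa using this
    · have : 0 ≤ (q : ℤ) * D.e j := mul_nonneg (by positivity) (D.he j)
      omega
  exact h.li.ne_zero i this

lemma IsMin.finrank_Wk (h : D.IsMin q m s) {k : ℕ} (hk : k ≤ r) :
    Module.finrank E (Wk s k) = k := by
  have h1 : LinearIndependent E (fun i : (Fk r k : Set (Fin r)) => s i) :=
    h.li.comp _ Subtype.val_injective
  have h2 := finrank_span_eq_card h1
  have h3 : Set.range (fun i : (Fk r k : Set (Fin r)) => s i) = s '' (Fk r k : Set (Fin r)) := by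
    rw [Set.image_eq_range]
  rw [h3] at h2
  rw [Wk, h2]
  simpa using card_Fk hk

lemma IsMin.Wk_le (h : D.IsMin q m s) (k : ℕ) : Wk s k ≤ D.kr q := by
  rw [Wk, Submodule.span_le]
  rintro _ ⟨i, -, rfl⟩
  exact (h.mem i).2

lemma IsMin.Wk_top (h : D.IsMin q m s) (hq : ∃ n, q = p ^ n) : Wk s r = D.kr q := by
  apply Submodule.eq_of_le_of_finrank_eq (h.Wk_le r)
  rw [h.finrank_Wk le_rfl, D.finrank_kr hq]

lemma IsMin.mem_Wk (h : D.IsMin q m s) (hq : ∃ n, q = p ^ n) {k : ℕ} (hk : k ≤ r) {n : ℤ}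
    (hn : ∀ i : Fin r, (i : ℕ) = k → n < m i) {x : Fin (r + 1) → E} (hx : x ∈ D.G q n)
    (hx2 : x ∈ D.kr q) : x ∈ Wk s k := by
  rcases hk.eq_or_lt with rfl | hk
  · rwa [h.Wk_top hq]
  · have := h.low ⟨k, hk⟩ n (hn _ rfl) x ⟨hx, hx2⟩
    refine Submodule.span_mono (Set.image_mono ?_) this
    intro i hi
    simpa [Fk, Fin.lt_def] using hi

lemma IsMin.dm_NW_step (h : D.IsMin q m s) {k : ℕ} (n : ℤ) :
    dm K (D.NW q (Wk s k)) (n + 1) ≤ dm K (D.NW q (Wk s k)) n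
      + C.dl * ((Fk r k).filter (fun i => m i ≤ n + 1)).card := by
  let J := (Fk r k).filter (fun i => m i ≤ n + 1)
  let S := Submodule.span E (s '' (J : Set (Fin r)))
  have hS : ∀ x ∈ D.NW q (Wk s k) (n + 1), x ∈ S := by
    intro x hx
    by_cases hall : ∀ i ∈ Fk r k, m i ≤ n + 1
    · have : J = Fk r k := Finset.filter_true_of_mem hall
      have h2 := hx.2
      change x ∈ Wk s k at h2
      rwa [Wk, ← this] at h2
    · push Not at hall
      obtain ⟨i, hi, hmi⟩ := hall
      have hne : (((Fk r k).filter (fun i => n + 1 < m i))).Nonempty :=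
        ⟨i, Finset.mem_filter.2 ⟨hi, hmi⟩⟩
      obtain ⟨i₀, h1, h2⟩ := Finset.exists_minimal hne
      rw [Finset.mem_filter] at h1
      have := h.low i₀ _ h1.2 x ⟨hx.1, h.Wk_le k hx.2⟩
      refine Submodule.span_mono (Set.image_mono ?_) this
      intro l hl
      have hl' : l < i₀ := hl
      have hlk : l ∈ Fk r k := by
        rw [mem_Fk] at *
        have : (l : ℕ) < i₀ := hl'
        omega
      rw [Finset.mem_coe, Finset.mem_filter]
      refine ⟨hlk, ?_⟩
      by_contra hc
      have := h2 (Finset.mem_filter.2 ⟨hlk, by omega⟩) hl'.le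
      exact absurd hl' (not_lt.2 this)
  have h1 := (D.fmodNW q (Wk s k)).dm_step n S hS
  have h2 : Module.finrank E S ≤ J.card := by
    classical
    have := finrank_span_finset_le_card (R := E) (J.image s)
    rw [Finset.coe_image] at this
    exact this.trans Finset.card_image_le
  have h3 : (Module.finrank K⟮C.t⟯ E : ℤ) = C.dl := rfl
  rw [h3] at h1
  have h4 : (C.dl : ℤ) * Module.finrank E S ≤ C.dl * J.card := by
    have : (Module.finrank E S : ℤ) ≤ J.card := by exact_mod_cast h2
    exact mul_le_mul_of_nonneg_left this (by positivity)
  linarith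

lemma IsMin.dm_NW_le (h : D.IsMin q m s) (k : ℕ) (n : ℤ) :
    dm K (D.NW q (Wk s k)) n ≤ C.dl * ∑ i ∈ Fk r k, max (n - m i + 1) 0 := by
  have hneg : ∀ n < 0, dm K (D.NW q (Wk s k)) n = 0 := by
    intro n hn
    have : D.NW q (Wk s k) n = ⊥ := by
      rw [eq_bot_iff]
      intro x hx
      rw [Submodule.mem_bot]
      funext j
      have := hx.1 j
      rw [C.L_neg] at this
      · simpa using this
      · have : 0 ≤ (q : ℤ) * D.e j := mul_nonneg (by positivity) (D.he j)
        omega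
    unfold dm
    rw [this]
    simp
  have hnn : 0 ≤ (C.dl : ℤ) * ∑ i ∈ Fk r k, max (n - m i + 1) 0 :=
    mul_nonneg (by positivity) (Finset.sum_nonneg fun _ _ => le_max_right _ _)
  rcases lt_or_ge n 0 with hn | hn
  · rw [hneg n hn]; exact hnn
  · clear hnn
    obtain ⟨j, rfl⟩ : ∃ j : ℕ, n = -1 + j := ⟨(n + 1).toNat, by omega⟩
    clear hn
    induction j with
    | zero =>
      rw [hneg _ (by norm_num)]
      exact mul_nonneg (by positivity) (Finset.sum_nonneg fun _ _ => le_max_right _ _)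
    | succ j ih =>
      have h1 := h.dm_NW_step (k := k) (-1 + j)
      have e : (-1 + ((j + 1 : ℕ) : ℤ)) = -1 + (j : ℤ) + 1 := by push_cast; ring
      rw [e]
      refine h1.trans ?_
      have h2 : ∑ i ∈ Fk r k, max (-1 + (j : ℤ) + 1 - m i + 1) 0
          = ∑ i ∈ Fk r k, max (-1 + (j : ℤ) - m i + 1) 0
            + ((Fk r k).filter (fun i => m i ≤ -1 + j + 1)).card := by
        rw [Finset.card_filter]
        push_cast
        rw [← Finset.sum_add_distrib]
        refine Finset.sum_congr rfl fun i _ => ?_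
        split_ifs <;> omega
      rw [h2, mul_add]
      linarith

lemma IsMin.dm_NW_ge (h : D.IsMin q m s) (k : ℕ) (n : ℤ) :
    ∑ i ∈ Fk r k, dm K C.L (n - m i) ≤ dm K (D.NW q (Wk s k)) n := by
  let f : ((i : Fk r k) → C.L (n - m i)) →ₗ[K] (Fin (r + 1) → E) :=
    ∑ i : Fk r k, ((LinearMap.toSpanSingleton E (Fin (r + 1) → E) (s i)).restrictScalars K) ∘ₗ
      (C.L (n - m i)).subtype ∘ₗ (LinearMap.proj (R := K) (φ := fun i : Fk r k => C.L (n - m i)) i)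
  have hf : ∀ x, f x = ∑ i, (x i : E) • s i := by
    intro x
    simp [f, LinearMap.sum_apply]
  have hmem : ∀ x, f x ∈ D.NW q (Wk s k) n := by
    intro x
    rw [hf]
    refine sum_mem fun i _ => ?_
    refine ⟨?_, ?_⟩
    · have := D.smul_mem_G (x i).2 (h.mem i).1
      simpa using this
    · exact Submodule.smul_mem _ _ (Submodule.subset_span (Set.mem_image_of_mem s i.2))
  have hinj : Function.Injective f := by
    rw [← LinearMap.ker_eq_bot, LinearMap.ker_eq_bot']
    intro x hx
    rw [hf] at hx
    have h1 : LinearIndependent E (fun i : Fk r k => s i) := h.li.comp _ Subtype.val_injective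
    have := Fintype.linearIndependent_iff.1 h1 (fun i => (x i : E)) hx
    funext i
    exact Subtype.ext (this i)
  have := (D.fmodNW q (Wk s k)).finDim n
  have h2 := LinearMap.finrank_le_finrank_of_injective
    (f := f.codRestrict _ hmem) (by
      intro x y hxy
      exact hinj (congrArg Subtype.val hxy))
  rw [Module.finrank_pi_fintype] at h2
  have h3 : ∑ i ∈ Fk r k, dm K C.L (n - m i) = ∑ i : Fk r k, dm K C.L (n - m i) :=
    (Finset.sum_coe_sort (Fk r k) (fun i => dm K C.L (n - m i))).symm
  rw [h3]
  unfold dm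
  exact_mod_cast h2

end Dat
end FT

namespace FT
open Polynomial IntermediateField
open scoped IntermediateField.algebraAdjoinAdjoin
set_option linter.unusedSectionVars false

variable {K E : Type*} [Field K] [Field E] [Algebra K E]

/-- Frobenius on vectors -/
def fv {ι : Type*} (q : ℕ) (x : ι → E) : ι → E := fun j => x j ^ q

lemma fv_apply {ι : Type*} (q : ℕ) (x : ι → E) (j : ι) : fv q x j = x j ^ q := rfl

lemma linInd_fv {p : ℕ} [Fact p.Prime] [CharP E p] {q : ℕ} (hq : ∃ n, q = p ^ n) {ι κ : Type*}
    [Fintype ι] [Fintype κ] {s : ι → κ → E} (hs : LinearIndependent E s) :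
    LinearIndependent E (fun i => fv q (s i)) := by
  classical
  obtain ⟨g, hg⟩ := LinearMap.exists_leftInverse_of_injective (Fintype.linearCombination E s)
    (LinearMap.ker_eq_bot.2 (by
      exact linearIndependent_iff_injective_fintypeLinearCombination.1 hs))
  have hgs : ∀ i, g (s i) = Pi.single i 1 := by
    intro i
    have := LinearMap.congr_fun hg (Pi.single i 1)
    simpa [Fintype.linearCombination_apply_single] using this
  have h1 : ∀ i l, ∑ j, s i j * g (Pi.single j 1) l = (Pi.single i 1 : ι → E) l := by
    intro i l
    rw [← hgs]
    conv_rhs => rw [pi_eq_sum_univ' (s i)]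
    rw [map_sum, Finset.sum_apply]
    refine Finset.sum_congr rfl fun j _ => ?_
    rw [map_smul, Pi.smul_apply, smul_eq_mul]
  have hq0 : q ≠ 0 := by
    obtain ⟨n, rfl⟩ := hq
    exact pow_ne_zero _ (Fact.out : p.Prime).ne_zero
  have h2 : ∀ i l, ∑ j, s i j ^ q * g (Pi.single j 1) l ^ q = (Pi.single i 1 : ι → E) l := by
    intro i l
    have := congrArg (· ^ q) (h1 i l)
    simp only [frob_sum hq, mul_pow] at this
    rw [this, Pi.single_apply]
    split_ifs <;> simp [hq0]
  rw [Fintype.linearIndependent_iff]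
  intro c hc l
  have h3 : ∑ i, c i * (Pi.single i 1 : ι → E) l = 0 := by
    simp_rw [← h2, Finset.mul_sum]
    rw [Finset.sum_comm]
    refine Finset.sum_eq_zero fun j _ => ?_
    have h4 := congrFun hc j
    simp only [Finset.sum_apply, Pi.smul_apply, smul_eq_mul, fv_apply, Pi.zero_apply] at h4
    simp_rw [← mul_assoc]
    rw [← Finset.sum_mul, h4, zero_mul]
  simpa [Pi.single_apply] using h3

lemma det_scale {n : ℕ} (u v : Fin n → E) (M : Matrix (Fin n) (Fin n) E) :
    Matrix.det (Matrix.of fun i j => u i * v j * M i j) = (∏ i, u i) * (∏ j, v j) * M.det := by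
  have h1 := Matrix.det_mul_column u (Matrix.of fun i j => v j * M i j)
  have h2 := Matrix.det_mul_row v M
  rw [mul_assoc, ← h2, ← h1]
  congr 1
  ext i j
  simp [mul_assoc]

variable {C : Crv K E} {r : ℕ}

/-- bordered determinant -/
noncomputable def hd (s : Fin r → (Fin (r + 1) → E)) : (Fin (r + 1) → E) →ₗ[E] E :=
  Matrix.detRowAlternating.toMultilinearMap.toLinearMap (Fin.snoc s 0) (Fin.last r)

lemma hd_apply (s : Fin r → (Fin (r + 1) → E)) (x : Fin (r + 1) → E) :
    hd s x = Matrix.det (Matrix.of (Fin.snoc (α := fun _ => Fin (r + 1) → E) s x)) := by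
  simp only [hd, MultilinearMap.toLinearMap_apply, Fin.update_snoc_last]
  rfl

lemma hd_self (s : Fin r → (Fin (r + 1) → E)) (i : Fin r) : hd s (s i) = 0 := by
  rw [hd_apply]
  apply Matrix.det_zero_of_row_eq (i := i.castSucc) (j := Fin.last r) (Fin.castSucc_lt_last i).ne
  change Fin.snoc (α := fun _ => Fin (r + 1) → E) s (s i) i.castSucc =
    Fin.snoc (α := fun _ => Fin (r + 1) → E) s (s i) (Fin.last r)
  rw [Fin.snoc_castSucc, Fin.snoc_last]

namespace Dat
variable {D : Dat C r} {p : ℕ} [Fact p.Prime] [CharP E p] {q : ℕ} {m : Fin r → ℤ}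
  {s : Fin r → (Fin (r + 1) → E)}

lemma IsMin.hd_eq (h : D.IsMin q m s) (hq : ∃ n, q = p ^ n) (y : Fin (r + 1) → E)
    (hy : D.ph q y = 1) (x : Fin (r + 1) → E) : hd s x = D.ph q x * hd s y := by
  have h0 : ∀ z ∈ D.kr q, hd s z = 0 := by
    intro z hz
    rw [← h.Wk_top hq] at hz
    refine Submodule.span_induction (p := fun z _ => hd s z = 0) ?_ ?_ ?_ ?_ hz
    · rintro _ ⟨i, -, rfl⟩; exact hd_self s i
    · simp
    · intro x y _ _ hx hy; simp [hx, hy]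
    · intro c x _ hx; simp [hx]
  have h1 : x - D.ph q x • y ∈ D.kr q := by
    rw [mem_kr]; simp [hy]
  have := h0 _ h1
  rw [map_sub, map_smul, sub_eq_zero] at this
  exact this

lemma IsMin.hd_ne (h : D.IsMin q m s) (y : Fin (r + 1) → E)
    (hy : D.ph q y = 1) : hd s y ≠ 0 := by
  rw [hd_apply]
  have : LinearIndependent E (Matrix.of (Fin.snoc (α := fun _ => Fin (r + 1) → E) s y)).row := by
    change LinearIndependent E (Fin.snoc (α := fun _ => Fin (r + 1) → E) s y)
    rw [linearIndependent_finSnoc]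
    refine ⟨h.li, fun hys => ?_⟩
    have : y ∈ D.kr q := by
      refine Submodule.span_le.2 ?_ hys
      rintro _ ⟨i, rfl⟩
      exact (h.mem i).2
    rw [mem_kr, hy] at this
    exact one_ne_zero this
  have := Matrix.linearIndependent_rows_iff_isUnit.1 this
  rw [Matrix.isUnit_iff_isUnit_det] at this
  exact this.ne_zero

lemma IsMin.hd_mem (h : D.IsMin q m s) (hq : ∃ n, q = p ^ n) :
    hd s (fv q D.a) ∈ C.L (∑ i, m i - q * ∑ j, D.e j) := by
  refine ⟨?_, ?_⟩
  · rw [hd_apply]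
    apply det_mem_sub
    intro i j
    refine Fin.lastCases ?_ (fun i => ?_) i
    · simpa [fv] using pow_mem (D.ha j) q
    · simpa using ((h.mem i).1 j).1
  · rw [h.hd_eq hq _ (D.ph_b hq) (fv q D.a)]
    have : D.ph q (fv q D.a) = 1 := D.ph_a hq
    rw [this, one_mul, hd_apply]
    have hs := det_scale (fun i => C.t ^ (-(Fin.snoc (α := fun _ => ℤ) m 0 : Fin (r+1) → ℤ) i))
      (fun j => C.t ^ (q * D.e j))
      (Matrix.of (Fin.snoc (α := fun _ => Fin (r + 1) → E) s
        (fun j => (C.t ^ (-D.e j) * D.b j) ^ q)))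
    have h1 : (∏ i, C.t ^ (-(Fin.snoc (α := fun _ => ℤ) m 0 : Fin (r+1) → ℤ) i)) *
        (∏ j, C.t ^ (q * D.e j)) = C.t ^ (-(∑ i, m i - q * ∑ j, D.e j)) := by
      have hz : ∀ {n : ℕ} (f : Fin n → ℤ), ∏ i, C.t ^ f i = C.t ^ ∑ i, f i := by
        intro n f
        induction n with
        | zero => simp
        | succ n ih => rw [Fin.prod_univ_succ, Fin.sum_univ_succ, zpow_add₀ C.t0, ih]
      rw [hz, hz, ← zpow_add₀ C.t0, ← Finset.mul_sum, Fin.sum_univ_castSucc]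
      congr 1
      simp
      ring
    rw [h1] at hs
    rw [← hs]
    apply det_mem_sub
    intro i j
    refine Fin.lastCases ?_ (fun i => ?_) i
    · have h2 := pow_mem (D.hb j) q
      simp only [Matrix.of_apply, Fin.snoc_last, neg_zero, zpow_zero, one_mul]
      convert h2 using 1
      rw [mul_pow, ← mul_assoc, ← zpow_natCast, ← zpow_mul, ← zpow_add₀ C.t0]
      rw [show (q : ℤ) * D.e j + -D.e j * q = 0 by ring, zpow_zero, one_mul]
    · have h2 := ((h.mem i).1 j).2
      simp only [Matrix.of_apply, Fin.snoc_castSucc]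
      convert h2 using 2
      rw [← zpow_add₀ C.t0]; congr 1; ring

lemma IsMin.sum_ge (h : D.IsMin q m s) (hq : ∃ n, q = p ^ n) :
    q * ∑ j, D.e j ≤ ∑ i, m i := by
  by_contra hc
  have h1 := h.hd_mem hq
  rw [C.L_neg (by omega)] at h1
  exact h.hd_ne (fv q D.a) (D.ph_a hq) (by simpa using h1)

lemma dm_kr_ge (q : ℕ) (n : ℤ) :
    ∑ j, dm K C.L (n - q * D.e j) ≤ dm K (D.NW q (D.kr q)) n + dm K C.L n := by
  have f1 := (D.fmodG q).finDim n
  let f : D.G q n →ₗ[K] C.L n :=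
    (((D.ph q).restrictScalars K).comp (D.G q n).subtype).codRestrict _
      (fun x => D.ph_mem x.2)
  have h1 := LinearMap.finrank_range_add_finrank_ker f
  have h2 : Module.finrank K (LinearMap.range f) ≤ Module.finrank K (C.L n) :=
    Submodule.finrank_le _
  let g : LinearMap.ker f →ₗ[K] D.NW q (D.kr q) n :=
    ((D.G q n).subtype.comp (LinearMap.ker f).subtype).codRestrict _ (fun x => by
      refine ⟨x.1.2, ?_⟩
      have := x.2
      rw [LinearMap.mem_ker] at this
      exact D.mem_kr.2 (congrArg Subtype.val this))
  have f2 := (D.fmodNW q (D.kr q)).finDim n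
  have h3 : Module.finrank K (LinearMap.ker f) ≤ Module.finrank K (D.NW q (D.kr q) n) := by
    apply LinearMap.finrank_le_finrank_of_injective (f := g)
    intro x y hxy
    have := congrArg Subtype.val hxy
    exact Subtype.ext (Subtype.ext this)
  let φ : ((j : Fin (r + 1)) → C.L (n - q * D.e j)) →ₗ[K] D.G q n :=
    { toFun := fun x => ⟨fun j => x j, fun j => (x j).2⟩
      map_add' := fun _ _ => rfl
      map_smul' := fun _ _ => rfl }
  have h4 := LinearMap.finrank_le_finrank_of_injective (f := φ) (by
    intro x y hxy
    funext j
    exact Subtype.ext (congrFun (congrArg Subtype.val hxy) j))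
  rw [Module.finrank_pi_fintype] at h4
  have h5 : ∑ j, dm K C.L (n - q * D.e j) =
    ((∑ j, Module.finrank K (C.L (n - q * D.e j)) : ℕ) : ℤ) := by
    push_cast; rfl
  rw [h5]
  unfold dm
  omega

lemma IsMin.sum_le (h : D.IsMin q m s) (hq : ∃ n, q = p ^ n) {c : ℤ}
    (hc : ∀ n, C.dl * n - c ≤ dm K C.L n) (hc0 : 0 ≤ c) :
    ∑ i, m i ≤ q * ∑ j, D.e j + (r + 1) * (c + 1) := by
  have hm := h.nonneg
  have hF : Fk r r = Finset.univ := by ext i; simp [mem_Fk]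
  have h1 := D.dm_kr_ge q (∑ i, m i)
  have h2 := h.dm_NW_le r (∑ i, m i)
  rw [h.Wk_top hq, hF] at h2
  have h3 := C.L_upper (∑ i, m i) (by
    have := Finset.sum_nonneg (fun i (_ : i ∈ Finset.univ) => hm i); omega)
  have h4 : ∑ j, (C.dl * (∑ i, m i - q * D.e j) - c) ≤ ∑ j, dm K C.L (∑ i, m i - q * D.e j) :=
    Finset.sum_le_sum fun j _ => hc _
  have h5 : ∑ i, max (∑ i, m i - m i + 1) 0 = ∑ i, (∑ i, m i - m i + 1) := by
    refine Finset.sum_congr rfl fun i _ => max_eq_left ?_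
    have := Finset.single_le_sum (fun i _ => hm i) (Finset.mem_univ i)
    linarith
  rw [h5] at h2
  rw [Finset.sum_add_distrib, Finset.sum_sub_distrib, Finset.sum_const] at h2
  rw [Finset.sum_sub_distrib, ← Finset.mul_sum, Finset.sum_sub_distrib, Finset.sum_const,
    Finset.sum_const, ← Finset.mul_sum] at h4
  simp only [Finset.card_univ, Fintype.card_fin, nsmul_eq_mul, Finset.sum_const,
    mul_one, Nat.cast_add, Nat.cast_one] at h2 h4
  set S := ∑ i, m i
  have hd : (1 : ℤ) ≤ C.dl := by exact_mod_cast C.dl_pos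
  have h6 : (C.dl : ℤ) * S ≤ C.dl * (q * ∑ j, D.e j + (r + 1)) + (r + 1) * c := by
    nlinarith
  have h7 : ((r : ℤ) + 1) * c ≤ C.dl * ((r + 1) * c) :=
    le_mul_of_one_le_left (by positivity) hd
  have h8 : (C.dl : ℤ) * S ≤ C.dl * (q * ∑ j, D.e j + (r + 1) * (c + 1)) := by
    nlinarith
  exact le_of_mul_le_mul_left h8 (by omega)

lemma fv_mem {q q' : ℕ} (hq' : ∃ n, q' = p ^ n) {n : ℤ} {x : Fin (r + 1) → E}
    (hx : x ∈ D.NW q (D.kr q) n) : fv q' x ∈ D.NW (q * q') (D.kr (q * q')) (q' * n) := by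
  refine ⟨fun j => ?_, ?_⟩
  · have := C.pow_mem_L (hx.1 j) q'
    rw [fv_apply]
    convert this using 2
    push_cast; ring
  · refine D.mem_kr.2 ?_
    have := D.mem_kr.1 hx.2
    rw [ph_apply] at this ⊢
    simp only [fv_apply]
    have h2 := congrArg (· ^ q') this
    have hq0 : q' ≠ 0 := by
      obtain ⟨n, rfl⟩ := hq'
      exact pow_ne_zero _ (Fact.out : p.Prime).ne_zero
    simp only [frob_sum hq', zero_pow hq0] at h2
    rw [← h2]
    refine Finset.sum_congr rfl fun j _ => ?_
    rw [mul_pow, pow_mul]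

lemma IsMin.frob_le (h : D.IsMin q m s) {q' : ℕ} (hq' : ∃ n, q' = p ^ n)
    {m' : Fin r → ℤ} {s' : Fin r → (Fin (r + 1) → E)} (h' : D.IsMin (q * q') m' s')
    (l : Fin r) : m' l ≤ q' * m l := by
  by_contra hc
  push Not at hc
  let v : Set.Iic l → (Fin (r + 1) → E) := fun i => fv q' (s i)
  have hv : LinearIndependent E v := (linInd_fv hq' h.li).comp _ Subtype.val_injective
  have hmem : ∀ i, v i ∈ Submodule.span E (s' '' Set.Iio l) := by
    intro i
    refine h'.low l (q' * m l) hc _ ?_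
    refine (D.fmodNW _ _).mono ?_ (fv_mem hq' (h.mem i.1))
    exact mul_le_mul_of_nonneg_left (h.mono i.2) (by positivity)
  have h1 : Module.finrank E (Submodule.span E (Set.range v)) = Fintype.card (Set.Iic l) :=
    finrank_span_eq_card hv
  have h2 : Submodule.span E (Set.range v) ≤ Submodule.span E (s' '' Set.Iio l) := by
    rw [Submodule.span_le]; rintro _ ⟨i, rfl⟩; exact hmem i
  have h3 := Submodule.finrank_mono h2
  have h4 : Module.finrank E (Submodule.span E (s' '' Set.Iio l)) ≤ (Finset.Iio l).card := by
    classical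
    have := finrank_span_finset_le_card (R := E) ((Finset.Iio l).image s')
    rw [Finset.coe_image, Finset.coe_Iio] at this
    exact this.trans Finset.card_image_le
  rw [h1] at h3
  simp at h3 h4
  omega

end Dat
end FT

namespace FT
open Polynomial IntermediateField
open scoped IntermediateField.algebraAdjoinAdjoin
set_option linter.unusedSectionVars false

variable {K E : Type*} [Field K] [Field E] [Algebra K E]
variable {C : Crv K E} {r : ℕ}

lemma finrank_Wk_of_li {s : Fin r → (Fin (r + 1) → E)} (hs : LinearIndependent E s)
    {k : ℕ} (hk : k ≤ r) : Module.finrank E (Wk s k) = k := by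
  have h1 : LinearIndependent E (fun i : (Fk r k : Set (Fin r)) => s i) :=
    hs.comp _ Subtype.val_injective
  have h2 := finrank_span_eq_card h1
  have h3 : Set.range (fun i : (Fk r k : Set (Fin r)) => s i) = s '' (Fk r k : Set (Fin r)) := by
    rw [Set.image_eq_range]
  rw [h3] at h2
  rw [Wk, h2]
  simpa using card_Fk hk

/-- graded refl iterated -/
lemma refl_iter {V : Type*} [AddCommGroup V] [Module E V] {t : E} {Q : ℤ → Set V} {n₀ : ℤ}
    (mono : ∀ n, Q n ⊆ Q (n + 1)) (tm : ∀ n, ∀ x ∈ Q n, t • x ∈ Q (n + 1))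
    (refl : ∀ n ≥ n₀, ∀ x ∈ Q (n + 1), t • x ∈ Q (n + 1) → x ∈ Q n) (x : V) (i j : ℕ) (n : ℤ)
    (hn : n₀ ≤ n) (h1 : x ∈ Q (n + i)) (h2 : t ^ j • x ∈ Q (n + j)) : x ∈ Q n := by
  have mono' : ∀ n (i : ℕ), Q n ⊆ Q (n + i) := by
    intro n i
    induction i with
    | zero => simp
    | succ i ih => push_cast; rw [← add_assoc]; exact ih.trans (mono _)
  have tm' : ∀ (d : ℕ) n, ∀ x ∈ Q n, t ^ d • x ∈ Q (n + d) := by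
    intro d n x hx
    induction d with
    | zero => simpa using hx
    | succ d ih =>
      rw [pow_succ', mul_smul]; push_cast; rw [← add_assoc]; exact tm _ _ ih
  have key : ∀ (d : ℕ) n, n₀ ≤ n → ∀ x ∈ Q (n + 1), t ^ d • x ∈ Q (n + d) → x ∈ Q n := by
    intro d
    induction d with
    | zero => intro n _ x _ h; simpa using h
    | succ d ih =>
      intro n hn x hx h
      apply ih n hn x hx
      apply refl _ (by omega)
      · have := tm' d _ x hx
        rwa [add_right_comm] at this
      · rw [pow_succ', mul_smul] at h; push_cast at h; rwa [← add_assoc] at h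
  induction i with
  | zero => simpa using h1
  | succ i ih =>
    apply ih
    apply key j (n + i) (by omega)
    · push_cast at h1; rwa [← add_assoc] at h1
    · have := mono' _ i h2
      rwa [add_right_comm] at this

namespace Dat
variable {D : Dat C r} {p : ℕ} [Fact p.Prime] [CharP E p] {q : ℕ} {m : Fin r → ℤ}
  {s : Fin r → (Fin (r + 1) → E)}

lemma IsMin.incr (h : D.IsMin q m s) {c : ℤ} (hc : ∀ n, C.dl * n - c ≤ dm K C.L n)
    {k : ℕ} (hk : k ≤ r) {M : ℤ} (hM0 : 0 ≤ M) (hM : ∀ i ∈ Fk r k, m i ≤ M) (n : ℤ)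
    (hn : M + (C.dl * k + k * c) ≤ n) (hn2 : M ≤ n) :
    dm K (D.NW q (Wk s k)) (n + 1) - dm K (D.NW q (Wk s k)) n = C.dl * k := by
  set f := dm K (D.NW q (Wk s k)) with hf
  have up : ∀ n, f (n + 1) - f n ≤ C.dl * k := by
    intro n
    have h1 := h.dm_NW_step (k := k) n
    have h2 : ((Fk r k).filter (fun i => m i ≤ n + 1)).card ≤ k :=
      (Finset.card_filter_le _ _).trans (card_Fk hk).le
    have h3 : (C.dl : ℤ) * ((Fk r k).filter (fun i => m i ≤ n + 1)).card ≤ C.dl * k :=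
      mul_le_mul_of_nonneg_left (by exact_mod_cast h2) (by positivity)
    linarith
  have cv : ∀ n (j : ℕ), f (n + 1) - f n ≤ f (n + j + 1) - f (n + j) := by
    intro n j
    induction j with
    | zero => simp
    | succ j ih =>
      have := ((D.fmodNW q (Wk s k)).dm_convex C.t0 (n + j)).1
      push_cast
      rw [show n + (j + 1 : ℤ) + 1 = n + j + 2 by ring, show n + (j + 1 : ℤ) = n + j + 1 by ring]
      exact ih.trans this
  by_contra hne
  have hlt : f (n + 1) - f n ≤ C.dl * k - 1 := by
    have := lt_of_le_of_ne (up n) hne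
    omega
  have tot : ∀ j : ℕ, M + j ≤ n + 1 → f (M + j) ≤ f M + (C.dl * k - 1) * j := by
    intro j hj
    induction j with
    | zero => simp
    | succ j ih =>
      have h1 := ih (by push_cast at hj; omega)
      have h2 := cv (M + j) (n - (M + j)).toNat
      have e : M + j + ((n - (M + j)).toNat : ℤ) = n := by push_cast at hj; omega
      rw [e] at h2
      push_cast
      rw [← add_assoc]
      nlinarith
  have h1 := tot (n + 1 - M).toNat (by omega)
  have e : M + ((n + 1 - M).toNat : ℤ) = n + 1 := by omega
  have e2 : ((n + 1 - M).toNat : ℤ) = n + 1 - M := by omega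
  rw [e, e2] at h1
  have h2 := h.dm_NW_le k M
  have h3 : ∑ i ∈ Fk r k, max (M - m i + 1) 0 = ∑ i ∈ Fk r k, (M - m i + 1) :=
    Finset.sum_congr rfl fun i hi => max_eq_left (by have := hM i hi; omega)
  have h4 := h.dm_NW_ge k (n + 1)
  have h5 : ∑ i ∈ Fk r k, (C.dl * (n + 1 - m i) - c) ≤ ∑ i ∈ Fk r k, dm K C.L (n + 1 - m i) :=
    Finset.sum_le_sum fun i _ => hc _
  rw [h3, Finset.sum_add_distrib, Finset.sum_sub_distrib, Finset.sum_const, Finset.sum_const,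
    card_Fk hk] at h2
  rw [Finset.sum_sub_distrib, ← Finset.mul_sum, Finset.sum_sub_distrib, Finset.sum_const,
    Finset.sum_const, card_Fk hk] at h5
  simp only [nsmul_eq_mul, mul_one] at h2 h5
  nlinarith

/-- the sections modulo `W` -/
def Qn (D : Dat C r) (q : ℕ) (W : Submodule E (Fin (r + 1) → E)) (n : ℤ) :
    Set (Fin (r + 1) → E) := {Y | ∃ g ∈ D.G q n, Y - g ∈ W}

lemma IsMin.Qn_refl (h : D.IsMin q m s) {c : ℤ} (hc : ∀ n, C.dl * n - c ≤ dm K C.L n)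
    (hc0 : 0 ≤ c) {k : ℕ} (hk : k ≤ r) {M : ℤ} (hM0 : 0 ≤ M) (hM : ∀ i ∈ Fk r k, m i ≤ M) (n : ℤ)
    (hn : M + (C.dl * k + k * c) ≤ n) (Y : Fin (r + 1) → E)
    (h1 : Y ∈ D.Qn q (Wk s k) (n + 1)) (h2 : C.t • Y ∈ D.Qn q (Wk s k) (n + 1)) :
    Y ∈ D.Qn q (Wk s k) n := by
  have hp : 0 ≤ (C.dl : ℤ) * k + k * c := by positivity
  obtain ⟨g, hg, hw⟩ := h1
  obtain ⟨g', hg', hw'⟩ := h2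
  have i1 := h.incr hc hk hM0 hM n hn (by omega)
  have i2 := h.incr hc hk hM0 hM (n + 1) (by omega) (by omega)
  have hgen := ((D.fmodNW q (Wk s k)).dm_convex C.t0 n).2 (by
    rw [show n + 2 = n + 1 + 1 by ring, i1, i2])
  obtain ⟨y, hy, z, hz, hyz⟩ := hgen (C.t • g - g') (by
    refine ⟨sub_mem ?_ ?_, ?_⟩
    · have := (D.fmodG q).tmul _ _ hg
      rwa [show n + 2 = n + 1 + 1 by ring]
    · exact (D.fmodG q).mono (by omega) hg'
    · have := sub_mem hw' ((Wk s k).smul_mem C.t hw)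
      have e : C.t • g - g' = C.t • Y - g' - C.t • (Y - g) := by rw [smul_sub]; abel
      rw [e]; exact this)
  refine ⟨g - z, ?_, ?_⟩
  · apply (D.fmodG q).refl
    · exact sub_mem hg hz.1
    · have : C.t • (g - z) = g' + y := by
        rw [smul_sub, sub_eq_iff_eq_add, add_assoc, ← hyz]; abel
      rw [this]; exact add_mem hg' hy.1
  · have : Y - (g - z) = (Y - g) + z := by abel
    rw [this]; exact add_mem hw hz.2

/-- gluing -/
lemma IsMin.glue (h : D.IsMin q m s) {c : ℤ} (hc : ∀ n, C.dl * n - c ≤ dm K C.L n)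
    (hc0 : 0 ≤ c) {k : ℕ} (hk : k ≤ r) {M : ℤ} (hM0 : 0 ≤ M) (hM : ∀ i ∈ Fk r k, m i ≤ M) (n : ℤ)
    (hn : M + (C.dl * k + k * c) ≤ n) (Y u u' : Fin (r + 1) → E)
    (hu : ∀ j, u j ∈ C.O) (hYu : Y - u ∈ Wk s k)
    (hu' : ∀ j, C.t ^ (-(n - q * D.e j)) * u' j ∈ C.Oi) (hYu' : Y - u' ∈ Wk s k) :
    ∃ g ∈ D.G q n, Y - g ∈ Wk s k := by
  set W := Wk s k
  choose N hN using fun j => C.mem_O_iff.1 (hu j)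
  choose N' hN' using fun j => C.loci _ (hu' j)
  have a1 : Y ∈ D.Qn q W (n + ((∑ j, (|N j| + |n - q * D.e j|)).toNat : ℕ)) := by
    refine ⟨u, fun j => hN j _ ?_, hYu⟩
    have h1 := Finset.single_le_sum (f := fun j => |N j| + |n - q * D.e j|)
      (fun _ _ => by positivity) (Finset.mem_univ j)
    have h1' : |N j| + |n - q * D.e j| ≤ ∑ j, (|N j| + |n - q * D.e j|) := h1
    have h2 := le_abs_self (N j)
    have h3 := neg_abs_le (n - q * D.e j)
    have := Int.self_le_toNat (∑ j, (|N j| + |n - q * D.e j|))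
    linarith
  have hx : ∀ j, ∃ B : ℤ, ∀ b ≥ B, C.t ^ b * u' j ∈ C.O := by
    intro j
    refine ⟨N' j - (n - q * D.e j), fun b hb => ?_⟩
    obtain ⟨l, hl⟩ := Int.eq_ofNat_of_zero_le (a := b - (N' j - (n - q * D.e j))) (by omega)
    have := mul_mem (pow_mem C.t_mem l) (hN' j)
    rw [← mul_assoc, ← mul_assoc] at this
    convert this using 2
    rw [← zpow_natCast, ← zpow_natCast, ← zpow_add₀ C.t0, ← zpow_add₀ C.t0]
    congr 1; omega
  choose B hB using hx
  have a2 : C.t ^ ((∑ j, |B j|).toNat) • Y ∈ D.Qn q W (n + ((∑ j, |B j|).toNat : ℕ)) := by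
    set b := (∑ j, |B j|).toNat with hb
    refine ⟨C.t ^ b • u', fun j => ⟨?_, ?_⟩, ?_⟩
    · have := hB j b (by
        have h1 := Finset.single_le_sum (f := fun j => |B j|)
          (fun _ _ => by positivity) (Finset.mem_univ j)
        have h1' : |B j| ≤ ∑ j, |B j| := h1
        have h2 := le_abs_self (B j)
        have := Int.self_le_toNat (∑ j, |B j|)
        omega)
      rwa [zpow_natCast] at this
    · have := hu' j
      rw [Pi.smul_apply, smul_eq_mul, ← mul_assoc, ← zpow_natCast, ← zpow_add₀ C.t0]
      convert this using 3
      ring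
    · rw [← smul_sub]; exact W.smul_mem _ hYu'
  refine refl_iter (t := C.t) (Q := D.Qn q W) (n₀ := M + (C.dl * k + k * c)) ?_ ?_ ?_ Y _ _ n hn
    a1 a2
  · rintro n x ⟨g, hg, hw⟩
    exact ⟨g, (D.fmodG q).mono1 n hg, hw⟩
  · rintro n x ⟨g, hg, hw⟩
    refine ⟨C.t • g, (D.fmodG q).tmul n g hg, ?_⟩
    rw [← smul_sub]; exact W.smul_mem _ hw
  · intro n hn x h1 h2
    exact h.Qn_refl hc hc0 hk hM0 hM n hn x h1 h2

lemma IsMin.Wk_frob (h : D.IsMin q m s) {q' : ℕ} (hq' : ∃ n, q' = p ^ n)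
    (hqq : ∃ n, q * q' = p ^ n)
    {m' : Fin r → ℤ} {s' : Fin r → (Fin (r + 1) → E)} (h' : D.IsMin (q * q') m' s')
    {k : ℕ} (hk : k ≤ r) (hn : ∀ i j : Fin r, (i : ℕ) < k → (j : ℕ) = k → q' * m i < m' j) :
    Wk s' k = Wk (fun i => fv q' (s i)) k := by
  symm
  apply Submodule.eq_of_le_of_finrank_eq
  · rw [Wk, Submodule.span_le]
    rintro _ ⟨i, hi, rfl⟩
    have hi' : (i : ℕ) < k := mem_Fk.1 hi
    have h1 := fv_mem hq' (h.mem i)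
    exact h'.mem_Wk hqq hk (fun j hj => hn i j hi' hj) h1.1 h1.2
  · rw [h'.finrank_Wk hk, finrank_Wk_of_li (linInd_fv hq' h.li) hk]

end Dat

/-- a choice of minima for all Frobenius powers together with their limits -/
structure MinSys (p : ℕ) [Fact p.Prime] [CharP E p] (D : Dat C r) where
  m : ℕ → Fin r → ℤ
  s : ℕ → Fin r → (Fin (r + 1) → E)
  h : ∀ e, D.IsMin (p ^ e) (m e) (s e)
  β : Fin r → ℝ
  C0 : ℝ
  C0_nn : 0 ≤ C0
  lo : ∀ e i, β i * p ^ e ≤ m e i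
  hi : ∀ e i, (m e i : ℝ) ≤ β i * p ^ e + C0
  sum : ∑ i, β i = ∑ j, (D.e j : ℝ)

lemma exists_minSys (p : ℕ) [Fact p.Prime] [CharP E p] (D : Dat C r) : Nonempty (MinSys p D) := by
  choose m s h using fun e : ℕ => D.exists_min (p := p) (q := p ^ e) ⟨e, rfl⟩
  obtain ⟨c, hc0, hc⟩ := C.L_lower
  have hp : (0 : ℝ) < p := by exact_mod_cast (Fact.out : p.Prime).pos
  have anti : ∀ i, Antitone (fun e => (m e i : ℝ) / p ^ e) := by
    intro i
    apply antitone_nat_of_succ_le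
    intro e
    have := (h e).frob_le (p := p) (q' := p) ⟨1, (pow_one p).symm⟩ (by
      rw [← pow_succ]; exact h (e + 1)) i
    have h2 : (m (e + 1) i : ℝ) ≤ p * m e i := by exact_mod_cast this
    rw [div_le_div_iff₀ (by positivity) (by positivity), pow_succ]
    have : (0 : ℝ) < (p : ℝ) ^ e := by positivity
    nlinarith
  have bd : ∀ i, BddBelow (Set.range (fun e => (m e i : ℝ) / p ^ e)) := by
    intro i
    refine ⟨0, ?_⟩
    rintro _ ⟨e, rfl⟩
    have := (h e).nonneg i
    have : (0 : ℝ) ≤ m e i := by exact_mod_cast this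
    positivity
  let β : Fin r → ℝ := fun i => ⨅ e, (m e i : ℝ) / p ^ e
  have lim : ∀ i, Tendsto (fun e => (m e i : ℝ) / p ^ e) atTop (𝓝 (β i)) := fun i =>
    tendsto_atTop_ciInf (anti i) (bd i)
  have lo : ∀ e i, β i * p ^ e ≤ m e i := by
    intro e i
    have : β i ≤ (m e i : ℝ) / p ^ e := ciInf_le (bd i) e
    rwa [le_div_iff₀ (by positivity)] at this
  let C0 : ℝ := (r + 1) * (c + 1)
  have hC0 : 0 ≤ C0 := by
    have : (0 : ℝ) ≤ c := by exact_mod_cast hc0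
    positivity
  have s1 : ∀ e, (p : ℝ) ^ e * ∑ j, (D.e j : ℝ) ≤ ∑ i, (m e i : ℝ) := by
    intro e
    have := (h e).sum_ge (p := p) ⟨e, rfl⟩
    exact_mod_cast this
  have s2 : ∀ e, ∑ i, (m e i : ℝ) ≤ (p : ℝ) ^ e * ∑ j, (D.e j : ℝ) + C0 := by
    intro e
    have := (h e).sum_le (p := p) ⟨e, rfl⟩ hc hc0
    have h2 : ((∑ i, m e i : ℤ) : ℝ) ≤ (((p ^ e : ℕ) * ∑ j, D.e j + (r + 1) * (c + 1) : ℤ) : ℝ) := by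
      exact_mod_cast this
    push_cast at h2
    exact h2
  have sumlim : Tendsto (fun e => ∑ i, (m e i : ℝ) / p ^ e) atTop (𝓝 (∑ i, β i)) :=
    tendsto_finsetSum _ fun i _ => lim i
  have pl : Tendsto (fun e : ℕ => C0 / (p : ℝ) ^ e) atTop (𝓝 0) := by
    apply Tendsto.div_atTop tendsto_const_nhds
    apply tendsto_pow_atTop_atTop_of_one_lt
    exact_mod_cast (Fact.out : p.Prime).one_lt
  have hsum : ∑ i, β i = ∑ j, (D.e j : ℝ) := by
    refine tendsto_nhds_unique sumlim ?_
    refine tendsto_of_tendsto_of_tendsto_of_le_of_le (g := fun _ => ∑ j, (D.e j : ℝ))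
      (h := fun e => ∑ j, (D.e j : ℝ) + C0 / (p : ℝ) ^ e) tendsto_const_nhds ?_ ?_ ?_
    · simpa using tendsto_const_nhds.add pl
    · intro e
      simp only
      rw [← Finset.sum_div, le_div_iff₀ (by positivity), mul_comm]
      exact s1 e
    · intro e
      simp only
      rw [← Finset.sum_div, div_le_iff₀ (by positivity), add_mul, div_mul_cancel₀ _ (by positivity),
        mul_comm]
      exact s2 e
  refine ⟨⟨m, s, h, β, C0, hC0, lo, fun e i => ?_, hsum⟩⟩
  have h1 : (m e i : ℝ) - β i * p ^ e ≤ ∑ i, ((m e i : ℝ) - β i * p ^ e) :=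
    Finset.single_le_sum (f := fun i => (m e i : ℝ) - β i * p ^ e)
      (fun i _ => sub_nonneg.2 (lo e i)) (Finset.mem_univ i)
  rw [Finset.sum_sub_distrib, ← Finset.sum_mul, hsum] at h1
  have := s2 e
  linarith

end FT

namespace FT
open Polynomial IntermediateField
open scoped IntermediateField.algebraAdjoinAdjoin
set_option linter.unusedSectionVars false

lemma sup_pow_ded {B : Type*} [CommRing B] [IsDedekindDomain B] (I J : Ideal B) (q : ℕ) :
    (I ⊔ J) ^ q = I ^ q ⊔ J ^ q := by
  by_cases h0 : I ⊔ J = ⊥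
  · have h1 : I = ⊥ := le_bot_iff.1 (h0 ▸ le_sup_left)
    have h2 : J = ⊥ := le_bot_iff.1 (h0 ▸ le_sup_right)
    subst h1 h2
    simp
  obtain ⟨I', hI⟩ := Ideal.dvd_iff_le.2 (le_sup_left : I ≤ I ⊔ J)
  obtain ⟨J', hJ⟩ := Ideal.dvd_iff_le.2 (le_sup_right : J ≤ I ⊔ J)
  set g := I ⊔ J with hg
  have h1 : I' ⊔ J' = ⊤ := by
    have : g * (I' ⊔ J') = g * ⊤ := by
      rw [Ideal.mul_sup, ← hI, ← hJ, Ideal.mul_top]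
    exact mul_left_cancel₀ h0 this
  rw [hI, hJ, mul_pow, mul_pow, ← Ideal.mul_sup, Ideal.pow_sup_pow_eq_top h1, Ideal.mul_top]

lemma span_pow_ded {B : Type*} [CommRing B] [IsDedekindDomain B] {ι : Type*} [Finite ι]
    (a : ι → B) {q : ℕ} (hq : q ≠ 0) :
    Ideal.span (Set.range fun i => a i ^ q) = Ideal.span (Set.range a) ^ q := by
  classical
  cases nonempty_fintype ι
  have key : ∀ s : Finset ι, Ideal.span ((fun i => a i ^ q) '' s) = Ideal.span (a '' s) ^ q := by
    intro s
    induction s using Finset.induction_on with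
    | empty => simp [hq]
    | insert i s hi ih =>
      rw [Finset.coe_insert, Set.image_insert_eq, Set.image_insert_eq, Ideal.span_insert,
        Ideal.span_insert, sup_pow_ded, ih, Ideal.span_singleton_pow]
  have := key Finset.univ
  simpa using this

variable {K E : Type*} [Field K] [Field E] [Algebra K E]

namespace Crv
variable (C : Crv K E)

/-- the polynomial ring -/
abbrev A : Subalgebra K E := Algebra.adjoin K {C.t}

/-- the normalization -/
abbrev B : Subalgebra C.A E := integralClosure C.A E

instance : IsDedekindDomain C.B := integralClosure.isDedekindDomain C.A K⟮C.t⟯ E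

instance : IsFractionRing C.B E :=
  integralClosure.isFractionRing_of_finite_extension K⟮C.t⟯ E

instance : Module.Finite C.A C.B := IsIntegralClosure.finite C.A K⟮C.t⟯ E C.B

lemma mem_B {x : E} : x ∈ C.B ↔ IsIntegral C.A x := Iff.rfl

lemma O_le_B {x : E} (hx : x ∈ C.O) : x ∈ C.B := C.int x hx

lemma nrm_intNorm (x : C.B) : C.nrm x = (Algebra.intNorm C.A C.B x : C.A) := by
  have := Algebra.algebraMap_intNorm (A := C.A) (K := K⟮C.t⟯) (L := E) (B := C.B) x
  unfold nrm
  change _ = algebraMap C.A E _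
  rw [IsScalarTower.algebraMap_apply C.A K⟮C.t⟯ E, this]
  rfl

set_option maxHeartbeats 1000000 in
lemma chart {ι : Type*} [Finite ι] (P0 : ι → E) (h0 : ∀ i, P0 i ∈ C.B) (hne : ∃ i, P0 i ≠ 0) :
    ∃ D0 : K[X], D0 ≠ 0 ∧ ∀ (q : ℕ), q ≠ 0 → ∀ (P : ι → E) (f h : E), (∀ i, P i ∈ C.B) →
      (∀ i, P i = f * P0 i ^ q) → h ≠ 0 → h ∈ Submodule.span C.B (Set.range P) →
      ∃ Dq H : K[X], Dq ≠ 0 ∧ C.nrm f * aeval C.t D0 ^ q = aeval C.t Dq ∧ C.nrm h = aeval C.t H ∧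
        Dq ∣ H := by
  let a0 : ι → C.B := fun i => ⟨P0 i, h0 i⟩
  let c0 := Ideal.span (Set.range a0)
  have hc0 : c0 ≠ ⊥ := by
    obtain ⟨i, hi⟩ := hne
    intro hb
    have : a0 i ∈ c0 := Ideal.subset_span ⟨i, rfl⟩
    rw [hb, Ideal.mem_bot] at this
    exact hi (congrArg Subtype.val this)
  obtain ⟨d0, hd0⟩ := (inferInstance : (Ideal.relNorm C.A c0).IsPrincipal)
  obtain ⟨D0, hD0⟩ := mem_adj.1 d0.2
  have hd0' : d0 ≠ 0 := by
    rintro rfl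
    have : Ideal.relNorm C.A c0 = ⊥ := by rw [hd0]; simp
    exact hc0 (Ideal.relNorm_eq_bot_iff.1 this)
  refine ⟨D0, ?_, ?_⟩
  · rintro rfl
    apply hd0'
    ext
    simpa using hD0.symm
  intro q hq P f h hP hPf hh hmem
  let a : ι → C.B := fun i => ⟨P i, hP i⟩
  let c := Ideal.span (Set.range a)
  have hhc : ∃ hB : h ∈ C.B, (⟨h, hB⟩ : C.B) ∈ c := by
    refine Submodule.span_induction (p := fun h _ => ∃ hB : h ∈ C.B, (⟨h, hB⟩ : C.B) ∈ c)
      ?_ ?_ ?_ ?_ hmem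
    · rintro _ ⟨i, rfl⟩
      exact ⟨hP i, Ideal.subset_span ⟨i, rfl⟩⟩
    · exact ⟨zero_mem _, c.zero_mem⟩
    · rintro x y _ _ ⟨h1, h2⟩ ⟨h3, h4⟩
      exact ⟨add_mem h1 h3, c.add_mem h2 h4⟩
    · rintro b x _ ⟨h1, h2⟩
      exact ⟨mul_mem b.2 h1, c.mul_mem_left b h2⟩
  obtain ⟨hB, hhc⟩ := hhc
  obtain ⟨fn, fd, hfd, hf⟩ := IsFractionRing.div_surjective (A := C.B) f
  have hfd0 : fd ≠ 0 := nonZeroDivisors.ne_zero hfd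
  have hfdE : (fd : E) ≠ 0 := fun h => hfd0 (Subtype.ext h)
  have hf' : f = (fn : E) / (fd : E) := hf.symm
  have hid : Ideal.span {fd} * c = Ideal.span {fn} * c0 ^ q := by
    rw [← span_pow_ded a0 hq, Ideal.span_mul_span', Ideal.span_mul_span', Set.singleton_mul,
      Set.singleton_mul, ← Set.range_comp, ← Set.range_comp]
    congr 2
    funext i
    apply Subtype.ext
    change (fd : E) * P i = fn * P0 i ^ q
    rw [hPf, hf']; field_simp
  obtain ⟨d, hd⟩ := (inferInstance : (Ideal.relNorm C.A c).IsPrincipal)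
  have hc : c ≠ ⊥ := by
    intro hb
    rw [hb, Ideal.mem_bot] at hhc
    exact hh (congrArg Subtype.val hhc)
  have hd' : d ≠ 0 := by
    rintro rfl
    have : Ideal.relNorm C.A c = ⊥ := by rw [hd]; simp
    exact hc (Ideal.relNorm_eq_bot_iff.1 this)
  have h2 := congrArg (Ideal.relNorm C.A) hid
  rw [map_mul, map_mul, map_pow, hd, hd0, Ideal.relNorm_singleton, Ideal.relNorm_singleton] at h2
  change Ideal.span _ * Ideal.span _ = Ideal.span _ * Ideal.span _ ^ q at h2
  rw [Ideal.span_singleton_pow, Ideal.span_singleton_mul_span_singleton,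
    Ideal.span_singleton_mul_span_singleton, Ideal.span_singleton_eq_span_singleton] at h2
  obtain ⟨u, hu⟩ := h2
  obtain ⟨Dq, hDq⟩ := mem_adj.1 (d * u : C.A).2
  obtain ⟨H, hH⟩ := mem_adj.1 (Algebra.intNorm C.A C.B ⟨h, hB⟩).2
  refine ⟨Dq, H, ?_, ?_, ?_, ?_⟩
  · rintro rfl
    have : (d * u : C.A) = 0 := by
      ext; simpa using hDq.symm
    exact hd' (by simpa using this)
  · rw [hDq, hD0]
    have h3 := congrArg (Subtype.val : C.A → E) hu
    simp only [MulMemClass.coe_mul, SubmonoidClass.coe_pow] at h3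
    rw [← nrm_intNorm, ← nrm_intNorm] at h3
    have h4 : C.nrm f * C.nrm fd = C.nrm fn := by
      rw [← nrm_mul, hf', div_mul_cancel₀ _ hfdE]
    have h5 := C.nrm_ne hfdE
    apply mul_left_cancel₀ h5
    rw [← mul_assoc, mul_comm (C.nrm fd), h4, ← h3]
    push_cast
    ring
  · rw [hH, ← nrm_intNorm]
  · have h6 : Ideal.span {(⟨h, hB⟩ : C.B)} ≤ c := (Ideal.span_singleton_le_iff_mem _).2 hhc
    have h7 := Ideal.relNorm_mono C.A h6
    rw [Ideal.relNorm_singleton, hd] at h7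
    change Ideal.span _ ≤ Ideal.span _ at h7
    rw [Ideal.span_singleton_le_span_singleton] at h7
    obtain ⟨w', hw'⟩ := h7
    obtain ⟨w, hw⟩ : ∃ w : C.A, Algebra.intNorm C.A C.B ⟨h, hB⟩ = d * u * w := by
      refine ⟨(u⁻¹ : C.Aˣ) * w', ?_⟩
      rw [hw', ← mul_assoc, mul_assoc d, Units.mul_inv, mul_one]
    obtain ⟨Wp, hWp⟩ := mem_adj.1 w.2
    refine ⟨Wp, C.aeval_inj ?_⟩
    rw [map_mul, hH, hw, hDq, hWp]
    rfl

end Crv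

/-- `k`-minors of the first `k` rows -/
noncomputable def mnr {n N k : ℕ} (hk : k ≤ n) (M : Fin n → Fin N → E) (S : Fin k → Fin N) : E :=
  Matrix.det (Matrix.of fun i j => M (Fin.castLE hk i) (S j))

lemma laplace {A : Type*} [CommRing A] [Algebra A E] (B : Subalgebra A E) {n N : ℕ}
    (M : Fin n → Fin N → E)
    (hM : ∀ i j, M i j ∈ B) {l : ℕ} : ∀ {k : ℕ} (hk : k ≤ n) (hl : k + l ≤ n) (S : Fin (k + l) → Fin N),
    mnr hl M S ∈ Submodule.span B (Set.range (mnr hk M)) := by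
  induction l with
  | zero => intro k hk hl S; exact Submodule.subset_span ⟨S, rfl⟩
  | succ l ih =>
    intro k hk hl S
    have hl' : k + l ≤ n := by omega
    have e : mnr hl M S = Matrix.det (Matrix.of fun (i j : Fin (k + l + 1)) =>
      M (Fin.castLE hl i) (S j)) := rfl
    rw [e, Matrix.det_succ_row _ (Fin.last _)]
    refine sum_mem fun j _ => ?_
    have h2 : Matrix.det ((Matrix.of fun (i j : Fin (k + l + 1)) =>
      M (Fin.castLE hl i) (S j)).submatrix (Fin.last (k + l)).succAbove j.succAbove)
      = mnr hl' M (S ∘ j.succAbove) := by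
      unfold mnr
      congr 1
      ext i j'
      simp only [Matrix.submatrix_apply, Matrix.of_apply, Fin.succAbove_last, Function.comp]
      rfl
    rw [h2]
    have h3 : (-1 : E) ^ ((Fin.last (k + l) : ℕ) + (j : ℕ)) *
        (Matrix.of fun (i j : Fin (k + l + 1)) =>
        M (Fin.castLE hl i) (S j)) (Fin.last (k + l)) j ∈ B :=
      mul_mem (pow_mem (neg_mem (one_mem _)) _) (hM _ _)
    exact Submodule.smul_mem _ (⟨_, h3⟩ : B) (ih hk hl' _)

lemma det_mem_minors {A : Type*} [CommRing A] [Algebra A E] (B : Subalgebra A E) {n : ℕ}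
    (M : Matrix (Fin n) (Fin n) E)
    (hM : ∀ i j, M i j ∈ B) {k : ℕ} (hk : k ≤ n) :
    M.det ∈ Submodule.span B (Set.range (mnr hk (fun i j => M i j))) := by
  obtain ⟨l, rfl⟩ := Nat.exists_eq_add_of_le hk
  have := laplace B (fun i j => M i j) hM hk le_rfl id
  convert this using 1
  rfl

end FT

namespace FT
open Polynomial IntermediateField
open scoped IntermediateField.algebraAdjoinAdjoin
set_option linter.unusedSectionVars false

variable {K E : Type*} [Field K] [Field E] [Algebra K E]
variable {r : ℕ}

lemma Fk_eq_map {r k : ℕ} (h : k ≤ r) :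
    (Fk r k) = (Finset.univ : Finset (Fin k)).map (Fin.castLEEmb h) := by
  ext i
  simp only [mem_Fk, Finset.mem_map, Finset.mem_univ, true_and]
  constructor
  · intro hi; exact ⟨⟨i, hi⟩, rfl⟩
  · rintro ⟨j, rfl⟩; exact j.2

lemma sum_Fk {r k : ℕ} (h : k ≤ r) {M : Type*} [AddCommMonoid M] (f : Fin r → M) :
    ∑ i ∈ Fk r k, f i = ∑ i : Fin k, f (Fin.castLE h i) := by
  rw [Fk_eq_map h, Finset.sum_map]; rfl

lemma Wk_eq_range {r k : ℕ} (h : k ≤ r) (s : Fin r → (Fin (r + 1) → E)) :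
    Wk s k = Submodule.span E (Set.range fun i : Fin k => s (Fin.castLE h i)) := by
  rw [Wk, Fk_eq_map h]
  congr 1
  ext x
  constructor
  · rintro ⟨i, hi, rfl⟩
    obtain ⟨j, -, rfl⟩ := Finset.mem_map.1 (Finset.mem_coe.1 hi)
    exact ⟨j, rfl⟩
  · rintro ⟨j, rfl⟩
    exact ⟨_, Finset.mem_coe.2 (Finset.mem_map.2 ⟨j, Finset.mem_univ _, rfl⟩), rfl⟩

namespace Crv
variable (C : Crv K E)

lemma aeval_inv (Q : K[X]) :
    aeval C.t⁻¹ Q = C.t ^ (-(Q.natDegree : ℤ)) * aeval C.t Q.reverse := by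
  let _ : Invertible (C.t⁻¹) := invertibleOfNonzero (inv_ne_zero C.t0)
  have h1 := eval₂_reverse_mul_pow (algebraMap K E) C.t⁻¹ Q
  rw [invOf_eq_inv, inv_inv] at h1
  change aeval C.t Q.reverse * _ = aeval C.t⁻¹ Q at h1
  rw [← h1, mul_comm, zpow_neg, zpow_natCast, inv_pow]

lemma deg_zpow {P P' : K[X]} {a : ℤ} (hP : P ≠ 0)
    (h : C.t ^ a * aeval C.t P = aeval C.t P') : a + P.natDegree = P'.natDegree := by
  have ht := C.t0
  rcases le_total 0 a with hc | hc
  · obtain ⟨k, rfl⟩ := Int.eq_ofNat_of_zero_le hc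
    have h3 : P' = X ^ k * P := C.aeval_inj (by
      rw [← h, map_mul, map_pow, aeval_X, zpow_natCast])
    rw [h3, natDegree_mul (pow_ne_zero _ X_ne_zero) hP, natDegree_X_pow]
    push_cast; rfl
  · obtain ⟨k, hk⟩ := Int.eq_ofNat_of_zero_le (a := -a) (by omega)
    have h3 : P = X ^ k * P' := C.aeval_inj (by
      rw [map_mul, ← h, map_pow, aeval_X, ← zpow_natCast, ← mul_assoc, ← zpow_add₀ ht]
      rw [show (k : ℤ) + a = 0 by change -a = (k : ℤ) at hk; omega, zpow_zero, one_mul])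
    have hP' : P' ≠ 0 := by rintro rfl; simp at h3; exact hP h3
    have h4 := congrArg natDegree h3
    rw [natDegree_mul (pow_ne_zero _ X_ne_zero) hP', natDegree_X_pow] at h4
    change -a = (k : ℤ) at hk
    omega

lemma deg_mixed {P P' Q Q' : K[X]} {a : ℤ} (hP : P ≠ 0) (hP' : P' ≠ 0) (hQ : Q ≠ 0) (hQ' : Q' ≠ 0)
    (h : C.t ^ a * aeval C.t P * aeval C.t⁻¹ Q = aeval C.t P' * aeval C.t⁻¹ Q') :
    a + P.natDegree - Q.natTrailingDegree = P'.natDegree - (Q'.natTrailingDegree : ℤ) := by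
  rw [aeval_inv, aeval_inv] at h
  have h1 : ∀ Q : K[X], (Q.reverse.natDegree : ℤ) = Q.natDegree - Q.natTrailingDegree := by
    intro Q
    rw [reverse_natDegree]; have := natTrailingDegree_le_natDegree Q; omega
  have hr : ∀ Q : K[X], Q ≠ 0 → Q.reverse ≠ 0 := fun Q h => by simpa using h
  have h2 := C.deg_zpow (P := P * Q.reverse) (P' := P' * Q'.reverse)
    (a := a - Q.natDegree + Q'.natDegree) (mul_ne_zero hP (hr _ hQ)) (by
      have e : C.t ^ (Q'.natDegree : ℤ) * C.t ^ (-(Q'.natDegree : ℤ)) = 1 := by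
        rw [← zpow_add₀ C.t0]; simp
      have h3 := congrArg (fun x => C.t ^ (Q'.natDegree : ℤ) * x) h
      rw [map_mul, map_mul, zpow_add₀ C.t0, sub_eq_add_neg, zpow_add₀ C.t0]
      calc _ = C.t ^ (Q'.natDegree : ℤ) * (C.t ^ a * (aeval C.t) P *
            (C.t ^ (-(Q.natDegree : ℤ)) * (aeval C.t) Q.reverse)) := by ring
        _ = _ := h3
        _ = (C.t ^ (Q'.natDegree : ℤ) * C.t ^ (-(Q'.natDegree : ℤ))) *
            (aeval C.t P' * aeval C.t Q'.reverse) := by ring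
        _ = _ := by rw [e, one_mul])
  rw [natDegree_mul hP (hr _ hQ), natDegree_mul hP' (hr _ hQ')] at h2
  have h3 := h1 Q
  have h4 := h1 Q'
  push_cast at h2
  omega

end Crv

lemma mnr_scale {n N k : ℕ} (hk : k ≤ n) (M : Fin n → Fin N → E) (u : Fin n → E) (v : Fin N → E)
    (S : Fin k → Fin N) : mnr hk (fun i j => u i * v j * M i j) S =
      (∏ i : Fin k, u (Fin.castLE hk i)) * (∏ j, v (S j)) * mnr hk M S := by
  unfold mnr
  rw [← det_scale]
  rfl

lemma mnr_fv {p : ℕ} [Fact p.Prime] [CharP E p] {q : ℕ} (hq : ∃ n, q = p ^ n) {n N k : ℕ}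
    (hk : k ≤ n) (M : Fin n → Fin N → E) (S : Fin k → Fin N) :
    mnr hk (fun i => fv q (M i)) S = mnr hk M S ^ q := by
  obtain ⟨a, rfl⟩ := hq
  have := RingHom.map_det (iterateFrobenius E p a) (Matrix.of fun i j => M (Fin.castLE hk i) (S j))
  rw [iterateFrobenius_def] at this
  unfold mnr
  rw [this]
  rfl

lemma mnr_change {n N k : ℕ} (hk : k ≤ n) (M M' : Fin n → Fin N → E)
    (h : ∀ i : Fin k, M (Fin.castLE hk i) ∈
      Submodule.span E (Set.range fun i : Fin k => M' (Fin.castLE hk i))) :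
    ∃ f, ∀ S : Fin k → Fin N, mnr hk M S = f * mnr hk M' S := by
  choose A hA using fun i => (Submodule.mem_span_range_iff_exists_fun E).1 (h i)
  refine ⟨Matrix.det (Matrix.of A), fun S => ?_⟩
  unfold mnr
  rw [← Matrix.det_mul]
  congr 1
  ext i j
  simp only [Matrix.of_apply, Matrix.mul_apply]
  rw [← hA i]
  simp

lemma mnr_ne {n N k : ℕ} (hk : k ≤ n) (M : Fin n → Fin N → E)
    (h : LinearIndependent E M) : ∃ S : Fin k → Fin N, mnr hk M S ≠ 0 := by
  have h1 : LinearIndependent E (fun i : Fin k => M (Fin.castLE hk i)) :=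
    h.comp _ (Fin.castLE_injective hk)
  have h2 : (Matrix.of fun (i : Fin k) (j : Fin N) => M (Fin.castLE hk i) j).rank = k := by
    have := LinearIndependent.rank_matrix (M := Matrix.of fun (i : Fin k) (j : Fin N) =>
      M (Fin.castLE hk i) j) h1
    simpa using this
  obtain ⟨S, hS⟩ : ∃ S : Fin k → Fin N, LinearIndependent E (fun j => fun i : Fin k =>
      M (Fin.castLE hk i) (S j)) := by
    rw [Matrix.rank_eq_finrank_span_cols] at h2
    obtain ⟨b, hb1, hb2, hb3⟩ := exists_linearIndependent E
      (Set.range (Matrix.of fun (i : Fin k) (j : Fin N) => M (Fin.castLE hk i) j).col)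
    have hfin : Finite b := (Set.finite_range _).subset hb1
    cases nonempty_fintype b
    have hcard : Fintype.card b = k := by
      have := finrank_span_eq_card hb3
      rw [Subtype.range_coe, hb2, h2] at this
      exact this.symm
    let ψ : Fin k ≃ b := (Fintype.equivFinOfCardEq hcard).symm
    choose S hS using fun x : b => hb1 x.2
    refine ⟨fun j => S (ψ j), ?_⟩
    have := hb3.comp ψ ψ.injective
    have e : (fun j => fun i : Fin k => M (Fin.castLE hk i) (S (ψ j))) = Subtype.val ∘ ψ :=
      funext fun j => hS (ψ j)
    rw [e]; exact this
  refine ⟨S, ?_⟩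
  have h3 : LinearIndependent E (Matrix.of fun (i j : Fin k) => M (Fin.castLE hk i) (S j)).col := hS
  have := Matrix.linearIndependent_cols_iff_isUnit.1 h3
  rw [Matrix.isUnit_iff_isUnit_det] at this
  exact this.ne_zero

end FT

namespace FT
open Polynomial IntermediateField
open scoped IntermediateField.algebraAdjoinAdjoin
set_option linter.unusedSectionVars false

variable {K E : Type*} [Field K] [Field E] [Algebra K E]
variable {r : ℕ}

lemma Crv.sig_chart (C : Crv K E) {k : ℕ} (hk : k ≤ r) (s0 : Fin r → Fin (r + 1) → E)
    (h0 : ∀ i j, s0 i j ∈ C.B) (hli : LinearIndependent E s0) :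
    ∃ D0 : K[X], D0 ≠ 0 ∧ ∀ q : ℕ, q ≠ 0 → ∀ (s' : Fin r → Fin (r + 1) → E) (y : Fin (r + 1) → E)
      (f : E), (∀ i j, s' i j ∈ C.B) → (∀ j, y j ∈ C.B) →
      (∀ S, mnr hk s' S = f * mnr hk s0 S ^ q) → hd s' y ≠ 0 →
      ∃ Dq H : K[X], Dq ≠ 0 ∧ C.nrm f * aeval C.t D0 ^ q = aeval C.t Dq ∧
        C.nrm (hd s' y) = aeval C.t H ∧ Dq ∣ H := by
  have hdet : ∀ {k : ℕ} (M : Matrix (Fin k) (Fin k) E), (∀ i j, M i j ∈ C.B) → M.det ∈ C.B := by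
    intro k M h
    rw [Matrix.det_apply]
    refine sum_mem fun σ _ => ?_
    rw [Units.smul_def]
    exact zsmul_mem (prod_mem fun i _ => h _ _) _
  obtain ⟨D0, hD0, H⟩ := C.chart (mnr hk s0) (fun S => hdet _ fun i j => h0 _ _)
    (mnr_ne hk s0 hli)
  refine ⟨D0, hD0, fun q hq s' y f hs' hy hf hne => ?_⟩
  refine H q hq (mnr hk s') f _ (fun S => hdet _ fun i j => hs' _ _) hf hne ?_
  rw [hd_apply]
  have := det_mem_minors C.B (Matrix.of (Fin.snoc (α := fun _ => Fin (r + 1) → E) s' y)) (by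
    intro i j
    refine Fin.lastCases ?_ (fun i => ?_) i
    · simpa using hy j
    · simpa using hs' i j) (hk.trans (Nat.le_succ r))
  refine Submodule.span_mono ?_ this
  rintro _ ⟨S, rfl⟩
  refine ⟨S, ?_⟩
  unfold mnr
  congr 1
  ext i j
  simp only [Matrix.of_apply]
  rw [show Fin.castLE (hk.trans (Nat.le_succ r)) i = (Fin.castLE hk i).castSucc from rfl,
    Fin.snoc_castSucc]

lemma zpow_prod {t : E} (ht : t ≠ 0) {ι : Type*} (s : Finset ι) (f : ι → ℤ) :
    ∏ i ∈ s, t ^ f i = t ^ ∑ i ∈ s, f i := by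
  classical
  induction s using Finset.induction_on with
  | empty => simp
  | insert a s ha ih => rw [Finset.prod_insert ha, Finset.sum_insert ha, zpow_add₀ ht, ih]

lemma hd_scale {t : E} (ht : t ≠ 0) (s : Fin r → Fin (r + 1) → E) (y : Fin (r + 1) → E)
    (m : Fin r → ℤ) (w : Fin (r + 1) → ℤ) :
    hd (fun i j => t ^ (-(m i - w j)) * s i j) (fun j => t ^ (w j) * y j) =
      t ^ (-(∑ i, m i - ∑ j, w j)) * hd s y := by
  rw [hd_apply, hd_apply]
  have hs := det_scale (fun i => t ^ (-(Fin.snoc (α := fun _ => ℤ) m 0 : Fin (r+1) → ℤ) i))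
      (fun j => t ^ (w j))
      (Matrix.of (Fin.snoc (α := fun _ => Fin (r + 1) → E) s y))
  rw [zpow_prod ht, zpow_prod ht, ← zpow_add₀ ht] at hs
  rw [show -(∑ i, m i - ∑ j, w j) = ∑ i, -(Fin.snoc (α := fun _ => ℤ) m 0 : Fin (r+1) → ℤ) i
    + ∑ j, w j by rw [Fin.sum_univ_castSucc]; simp; ring, ← hs]
  congr 1
  ext i j
  refine Fin.lastCases ?_ (fun i => ?_) i
  · simp
  · simp only [Matrix.of_apply, Fin.snoc_castSucc]
    rw [← zpow_add₀ ht]; congr 2; ring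

variable {C : Crv K E} {D : Dat C r} {p : ℕ} [Fact p.Prime] [CharP E p]

namespace Dat

set_option maxHeartbeats 1000000 in
lemma IsMin.sig_aux {q : ℕ} {m : Fin r → ℤ} {s : Fin r → (Fin (r + 1) → E)}
    (h : D.IsMin q m s) {k : ℕ} (hk : k ≤ r) :
    ∃ Γ : ℤ, ∀ (q' : ℕ) (m' : Fin r → ℤ) (s' : Fin r → (Fin (r + 1) → E)), (∃ n, q' = p ^ n) →
      (∃ n, q * q' = p ^ n) → D.IsMin (q * q') m' s' → Wk s' k = Wk (fun i => fv q' (s i)) k →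
      C.dl * (q' * ∑ i ∈ Fk r k, m i - ∑ i ∈ Fk r k, m' i) ≤ q' * Γ ∧
      q' * Γ ≤ C.dl * (q' * ∑ i ∈ Fk r k, m i - ∑ i ∈ Fk r k, m' i)
        + C.dl * (∑ i, m' i - (q * q' : ℕ) * ∑ j, D.e j) := by
  have ht := C.t0
  -- the matrices at infinity
  let si : (Fin r → (Fin (r + 1) → E)) → (Fin r → ℤ) → ℕ → (Fin r → (Fin (r + 1) → E)) :=
    fun s m q i j => C.t ^ (-(m i - q * D.e j)) * s i j
  have hsi : ∀ s m q, D.IsMin q m s → ∀ i j, si s m q i j ∈ C.swap.B :=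
    fun s m q h i j => C.swap.O_le_B ((h.mem i).1 j).2
  have hs0 : ∀ s m q, D.IsMin q m s → ∀ i j, s i j ∈ C.B :=
    fun s m q h i j => C.O_le_B ((h.mem i).1 j).1
  have hsi_mnr : ∀ (s : Fin r → (Fin (r + 1) → E)) m q S, mnr hk (si s m q) S =
      C.t ^ (-∑ i ∈ Fk r k, m i + q * ∑ l, D.e (S l)) * mnr hk s S := by
    intro s m q S
    rw [show si s m q = fun i j => C.t ^ (-m i) * C.t ^ (q * D.e j) * s i j by
      funext i j; simp only [si]; rw [← zpow_add₀ ht]; congr 2; ring]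
    rw [mnr_scale, zpow_prod ht, zpow_prod ht, ← zpow_add₀ ht, sum_Fk hk, Finset.mul_sum,
      Finset.sum_neg_distrib]
  have hli : LinearIndependent E (si s m q) := by
    rw [linearIndependent_iff'] 
    intro u g hg i hi
    have := linearIndependent_iff'.1 h.li u (fun i => g i * C.t ^ (- m i)) (by
      funext j
      have := congrFun hg j
      simp only [Finset.sum_apply, Pi.smul_apply, smul_eq_mul, Pi.zero_apply, si] at this ⊢
      have h2 := congrArg (fun x => C.t ^ (- (q * D.e j)) * x) this
      simp only [mul_zero, Finset.mul_sum] at h2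
      rw [← h2]
      refine Finset.sum_congr rfl fun i _ => ?_
      rw [show -(m i - q * D.e j) = - m i + q * D.e j by ring, zpow_add₀ ht]
      have : C.t ^ (- (q * D.e j)) * C.t ^ (q * D.e j) = 1 := by
        rw [← zpow_add₀ ht]; simp
      linear_combination (- g i * C.t ^ (- m i) * s i j) * this) i hi
    exact (mul_eq_zero.1 this).resolve_right (zpow_ne_zero _ ht)
  obtain ⟨D0, hD0, H0⟩ := C.sig_chart hk s (hs0 s m q h) h.li
  obtain ⟨D1, hD1, H1⟩ := C.swap.sig_chart hk (si s m q) (hsi s m q h) hli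
  refine ⟨D0.natDegree + D1.natTrailingDegree, fun q' m' s' hq' hqq h' hW => ?_⟩
  have hq0 : q' ≠ 0 := by
    obtain ⟨n, rfl⟩ := hq'; exact pow_ne_zero _ (Fact.out : p.Prime).ne_zero
  obtain ⟨f, hf⟩ := mnr_change (E := E) hk s' (fun i => fv q' (s i)) (by
    intro i
    rw [← Wk_eq_range hk (fun i => fv q' (s i)), ← hW]
    exact Submodule.subset_span ⟨_, mem_Fk.2 i.2, rfl⟩)
  simp_rw [mnr_fv hq'] at hf
  have hne := h'.hd_ne (fv (q * q') D.a) (D.ph_a hqq)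
  obtain ⟨Dq, H, hDq, e1, e2, e3⟩ := H0 q' hq0 s' (fv (q * q') D.a) f (hs0 _ _ _ h')
    (fun j => C.O_le_B (pow_mem (D.ha j) _)) hf hne
  set N := ∑ i, m' i - (q * q' : ℕ) * ∑ j, D.e j with hN
  set Δ := q' * ∑ i ∈ Fk r k, m i - ∑ i ∈ Fk r k, m' i with hΔ
  have hinf : hd (si s' m' (q * q')) (fv (q * q') D.b) = C.t ^ (-N) * hd s' (fv (q * q') D.a) := by
    have h1 := hd_scale ht s' (fun j => (C.t ^ (-D.e j) * D.b j) ^ (q * q')) m'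
      (fun j => ((q * q' : ℕ) : ℤ) * D.e j)
    have h2 : (fun j => C.t ^ (((q * q' : ℕ) : ℤ) * D.e j) * (C.t ^ (-D.e j) * D.b j) ^ (q * q'))
        = fv (q * q') D.b := by
      funext j
      rw [mul_pow, ← mul_assoc, ← zpow_natCast, ← zpow_mul, ← zpow_add₀ ht]
      rw [show ((q * q' : ℕ) : ℤ) * D.e j + -D.e j * ((q * q' : ℕ) : ℤ) = 0 by ring, zpow_zero,
        one_mul]
      rfl
    rw [h2] at h1
    rw [← Finset.mul_sum] at h1
    rw [hN]
    refine h1.trans ?_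
    congr 1
    rw [h'.hd_eq hqq _ (D.ph_b hqq) (fv (q * q') D.a)]
    have : D.ph (q * q') (fv (q * q') D.a) = 1 := D.ph_a hqq
    rw [this, one_mul]
  have hneI : hd (si s' m' (q * q')) (fv (q * q') D.b) ≠ 0 := by
    rw [hinf]; exact mul_ne_zero (zpow_ne_zero _ ht) hne
  obtain ⟨Dq', H', hDq', e1', e2', e3'⟩ := H1 q' hq0 (si s' m' (q * q')) (fv (q * q') D.b)
    (C.t ^ Δ * f) (hsi _ _ _ h')
    (fun j => C.swap.O_le_B (pow_mem (D.hb j) _)) (by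
      intro S
      rw [hsi_mnr, hsi_mnr, hf, mul_pow, ← zpow_natCast (C.t ^ _) q', ← zpow_mul]
      have : C.t ^ (-∑ i ∈ Fk r k, m' i + (q * q' : ℕ) * ∑ l, D.e (S l)) =
        C.t ^ Δ * C.t ^ ((-∑ i ∈ Fk r k, m i + q * ∑ l, D.e (S l)) * q') := by
        rw [← zpow_add₀ ht]; congr 1; rw [hΔ]; push_cast; ring
      rw [this]; ring) hneI
  rw [hinf] at e2'
  rw [Crv.nrm_swap] at e1' e2'
  change _ * aeval C.t⁻¹ D1 ^ q' = aeval C.t⁻¹ Dq' at e1'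
  change _ = aeval C.t⁻¹ H' at e2'
  have hpw : ∀ z : ℤ, C.nrm (C.t ^ z) = C.t ^ (C.dl * z) := by
    intro z
    rw [C.nrm_zpow, C.nrm_t, ← zpow_natCast, ← zpow_mul]
  rw [C.nrm_mul, hpw] at e1' e2'
  rw [e2] at e2'
  have hH0 : H ≠ 0 := by
    rintro rfl; rw [map_zero] at e2; exact C.nrm_ne hne e2
  have hd1 := C.deg_swap (P := H) (Q := H') (D := C.dl * N) hH0
    (by rw [← e2', mul_neg])
  have hd2 := C.deg_mixed (P := Dq) (P' := D0 ^ q') (Q := D1 ^ q') (Q' := Dq') (a := C.dl * Δ) hDq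
    (pow_ne_zero _ hD0) (pow_ne_zero _ hD1) hDq' (by
      rw [← e1', ← e1, map_pow, map_pow]; ring)
  rw [natDegree_pow] at hd2
  have htr : ∀ (P : K[X]), P ≠ 0 → ∀ n : ℕ, (P ^ n).natTrailingDegree = n * P.natTrailingDegree := by
    intro P hP n
    induction n with
    | zero => simp
    | succ n ih => rw [pow_succ, natTrailingDegree_mul (pow_ne_zero _ hP) hP, ih]; ring
  rw [htr _ hD1] at hd2
  have hH0' : H' ≠ 0 := by
    rintro rfl
    rw [map_zero] at e2'
    exact (mul_ne_zero (zpow_ne_zero _ ht) (e2 ▸ C.nrm_ne hne)) e2'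
  have hd3 := natDegree_le_of_dvd e3 hH0
  have hd4 : Dq'.natTrailingDegree ≤ H'.natTrailingDegree := by
    obtain ⟨w, rfl⟩ := e3'
    rw [natTrailingDegree_mul hDq' (right_ne_zero_of_mul hH0')]
    omega
  push_cast at hd2
  constructor
  · have : (0:ℤ) ≤ Dq.natDegree := by positivity
    have : (0:ℤ) ≤ Dq'.natTrailingDegree := by positivity
    linarith
  · have : (Dq.natDegree : ℤ) ≤ H.natDegree := by exact_mod_cast hd3
    have : (Dq'.natTrailingDegree : ℤ) ≤ H'.natTrailingDegree := by exact_mod_cast hd4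
    linarith

end Dat

/-- membership in `ℤ[1/p]` -/
def PI (p : ℕ) (x : ℝ) : Prop := ∃ (e : ℕ) (Γ : ℤ), x * p ^ e = Γ

lemma PI.add {p : ℕ} {x y : ℝ} (hx : PI p x) (hy : PI p y) : PI p (x + y) := by
  obtain ⟨e, a, h⟩ := hx
  obtain ⟨f, b, h'⟩ := hy
  refine ⟨e + f, a * p ^ f + b * p ^ e, ?_⟩
  push_cast
  rw [← h, ← h', pow_add]; ring

lemma PI.mul {p : ℕ} {x y : ℝ} (hx : PI p x) (hy : PI p y) : PI p (x * y) := by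
  obtain ⟨e, a, h⟩ := hx
  obtain ⟨f, b, h'⟩ := hy
  refine ⟨e + f, a * b, ?_⟩
  push_cast
  rw [← h, ← h', pow_add]; ring

lemma PI.int {p : ℕ} (a : ℤ) : PI p a := ⟨0, a, by simp⟩

lemma PI.nat {p : ℕ} (a : ℕ) : PI p a := ⟨0, a, by simp⟩

lemma PI.neg {p : ℕ} {x : ℝ} (hx : PI p x) : PI p (-x) := by
  obtain ⟨e, a, h⟩ := hx
  exact ⟨e, -a, by push_cast; rw [← h]; ring⟩

lemma PI.sub {p : ℕ} {x y : ℝ} (hx : PI p x) (hy : PI p y) : PI p (x - y) := by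
  rw [sub_eq_add_neg]; exact hx.add hy.neg

lemma PI.of_div {p : ℕ} (hp : p ≠ 0) {x : ℝ} (e : ℕ) (hx : PI p (x * p ^ e)) : PI p x := by
  obtain ⟨f, a, h⟩ := hx
  exact ⟨e + f, a, by rw [← h, pow_add]; ring⟩

lemma lower_eq_Fk (S : Finset (Fin r)) (h : ∀ i j, i ≤ j → j ∈ S → i ∈ S) : S = Fk r S.card := by
  ext j
  rw [mem_Fk]
  constructor
  · intro hj
    have : Finset.Iic j ⊆ S := fun i hi => h i j (Finset.mem_Iic.1 hi) hj
    have := Finset.card_le_card this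
    rw [Fin.card_Iic] at this
    omega
  · intro hj
    by_contra hc
    have : S ⊆ Finset.Iio j := fun i hi => by
      rw [Finset.mem_Iio]
      by_contra h2
      exact hc (h j i (not_lt.1 h2) hi)
    have := Finset.card_le_card this
    rw [Fin.card_Iio] at this
    omega

lemma le_of_lin {a b c : ℝ} {p : ℕ} (hp : 1 < p) (h : ∀ e : ℕ, a * p ^ e ≤ b * p ^ e + c) : a ≤ b := by
  by_contra hc
  push Not at hc
  have hp' : (1 : ℝ) < p := by exact_mod_cast hp
  obtain ⟨e, he⟩ := pow_unbounded_of_one_lt (c / (a - b)) hp'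
  have := h e
  rw [div_lt_iff₀ (by linarith)] at he
  nlinarith

namespace MinSys
variable (sys : MinSys p D)

lemma mono : Monotone sys.β := by
  intro i j hij
  apply le_of_lin (c := sys.C0) (Fact.out : p.Prime).one_lt
  intro e
  have h1 := sys.lo e i
  have h2 := sys.hi e j
  have h3 : (sys.m e i : ℝ) ≤ sys.m e j := by exact_mod_cast (sys.h e).mono hij
  linarith

lemma nonneg (i : Fin r) : 0 ≤ sys.β i := by
  apply le_of_lin (c := sys.C0) (Fact.out : p.Prime).one_lt
  intro e
  have h2 := sys.hi e i
  have h3 : (0 : ℝ) ≤ sys.m e i := by exact_mod_cast (sys.h e).nonneg i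
  linarith

/-- at a break, the subspaces are eventually Frobenius pullbacks -/
lemma exists_e0 {k : ℕ} (hbr : ∀ i j : Fin r, (i : ℕ) < k → (j : ℕ) = k → sys.β i < sys.β j) :
    ∃ e0, ∀ e ≥ e0, ∀ i j : Fin r, (i : ℕ) < k → (j : ℕ) = k →
      sys.β i * p ^ e + sys.C0 < sys.β j * p ^ e := by
  have hp' : (1 : ℝ) < p := by exact_mod_cast (Fact.out : p.Prime).one_lt
  have : ∀ i j : Fin r, ∃ e0 : ℕ, ∀ e ≥ e0, (i : ℕ) < k → (j : ℕ) = k →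
      sys.β i * p ^ e + sys.C0 < sys.β j * p ^ e := by
    intro i j
    by_cases h : (i : ℕ) < k ∧ (j : ℕ) = k
    · have h1 := hbr i j h.1 h.2
      obtain ⟨e0, he⟩ := pow_unbounded_of_one_lt (sys.C0 / (sys.β j - sys.β i)) hp'
      refine ⟨e0, fun e hee _ _ => ?_⟩
      have : (p : ℝ) ^ e0 ≤ p ^ e := pow_le_pow_right₀ hp'.le hee
      rw [div_lt_iff₀ (by linarith)] at he
      nlinarith
    · exact ⟨0, fun e _ h1 h2 => absurd ⟨h1, h2⟩ h⟩
  choose f hf using this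
  refine ⟨∑ i, ∑ j, f i j, fun e he i j => hf i j e (le_trans ?_ he)⟩
  exact (Finset.single_le_sum (f := fun j => f i j) (fun _ _ => Nat.zero_le _)
    (Finset.mem_univ j)).trans
    (Finset.single_le_sum (f := fun i => ∑ j, f i j) (fun _ _ => Nat.zero_le _) (Finset.mem_univ i))

lemma Wk_frob {k : ℕ} (hk : k ≤ r) {e0 : ℕ}
    (he0 : ∀ e ≥ e0, ∀ i j : Fin r, (i : ℕ) < k → (j : ℕ) = k →
      sys.β i * p ^ e + sys.C0 < sys.β j * p ^ e) (e : ℕ) :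
    Wk (sys.s (e0 + e)) k = Wk (fun i => fv (p ^ e) (sys.s e0 i)) k := by
  have h' := sys.h (e0 + e)
  rw [pow_add] at h'
  refine (sys.h e0).Wk_frob (p := p) ⟨e, rfl⟩ ⟨e0 + e, (pow_add _ _ _).symm⟩ h' hk ?_
  intro i j hi hj
  have h1 := he0 e0 le_rfl i j hi hj
  have h2 := sys.hi e0 i
  have h3 := sys.lo (e0 + e) j
  have : ((p ^ e : ℕ) * sys.m e0 i : ℝ) < sys.m (e0 + e) j := by
    refine lt_of_lt_of_le ?_ h3
    rw [pow_add]
    have hp' : (0 : ℝ) < p ^ e := by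
      have : (0 : ℝ) < p := by exact_mod_cast (Fact.out : p.Prime).pos
      positivity
    push_cast
    have h4 : (sys.m e0 i : ℝ) < sys.β j * p ^ e0 := by linarith
    nlinarith
  exact_mod_cast this

lemma sig {k : ℕ} (hk : k ≤ r)
    (hbr : ∀ i j : Fin r, (i : ℕ) < k → (j : ℕ) = k → sys.β i < sys.β j) :
    PI p (C.dl * ∑ i ∈ Fk r k, sys.β i) := by
  obtain ⟨e0, he0⟩ := sys.exists_e0 hbr
  obtain ⟨Γ, hΓ⟩ := (sys.h e0).sig_aux (p := p) hk
  refine ⟨e0, C.dl * ∑ i ∈ Fk r k, sys.m e0 i - Γ, ?_⟩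
  have hp1 := (Fact.out : p.Prime).one_lt
  have key : ∀ e : ℕ, (C.dl : ℤ) * ((p ^ e : ℕ) * ∑ i ∈ Fk r k, sys.m e0 i
      - ∑ i ∈ Fk r k, sys.m (e0 + e) i) ≤ (p ^ e : ℕ) * Γ ∧
      (p ^ e : ℕ) * Γ ≤ C.dl * ((p ^ e : ℕ) * ∑ i ∈ Fk r k, sys.m e0 i
      - ∑ i ∈ Fk r k, sys.m (e0 + e) i) + C.dl * (∑ i, sys.m (e0 + e) i
        - (p ^ e0 * p ^ e : ℕ) * ∑ j, D.e j) := by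
    intro e
    have h' := sys.h (e0 + e)
    rw [pow_add] at h'
    exact hΓ (p ^ e) _ _ ⟨e, rfl⟩ ⟨e0 + e, (pow_add _ _ _).symm⟩ h' (sys.Wk_frob hk he0 e)
  have hsl : ∀ e, (∑ i ∈ Fk r k, sys.β i) * p ^ e ≤ ((∑ i ∈ Fk r k, sys.m e i : ℤ) : ℝ) := by
    intro e; push_cast; rw [Finset.sum_mul]; exact Finset.sum_le_sum fun i _ => sys.lo e i
  have hsu : ∀ (S : Finset (Fin r)) e, ((∑ i ∈ S, sys.m e i : ℤ) : ℝ)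
      ≤ (∑ i ∈ S, sys.β i) * p ^ e + r * sys.C0 := by
    intro S e
    push_cast
    rw [Finset.sum_mul]
    calc _ ≤ ∑ i ∈ S, (sys.β i * p ^ e + sys.C0) := Finset.sum_le_sum fun i _ => sys.hi e i
      _ = ∑ i ∈ S, sys.β i * p ^ e + S.card * sys.C0 := by
        rw [Finset.sum_add_distrib]; simp
      _ ≤ _ := by
        have : (S.card : ℝ) ≤ r := by
          have := Finset.card_le_univ S; rw [Fintype.card_fin] at this; exact_mod_cast this
        have := mul_le_mul_of_nonneg_right this sys.C0_nn
        linarith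
  have hdl : (0 : ℝ) ≤ C.dl := by positivity
  push_cast
  set σ := ∑ i ∈ Fk r k, sys.β i
  have hM : ((∑ i ∈ Fk r k, sys.m e0 i : ℤ) : ℝ) = ∑ i ∈ Fk r k, (sys.m e0 i : ℝ) := by push_cast; rfl
  rw [← hM]
  set M0 : ℝ := ((∑ i ∈ Fk r k, sys.m e0 i : ℤ) : ℝ)
  apply le_antisymm
  · apply le_of_lin (c := C.dl * (r * sys.C0) + C.dl * (r * sys.C0)) hp1
    intro e
    have h2 : (((p ^ e : ℕ) * Γ : ℤ) : ℝ) ≤ _ := Int.cast_le.2 (key e).2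
    push_cast at h2
    have h3 := hsu (Fk r k) (e0 + e)
    have h4 := hsu Finset.univ (e0 + e)
    have h5 := hsl (e0 + e)
    rw [sys.sum] at h4
    push_cast at h3 h4 h5 hM
    rw [pow_add] at h3 h4 h5
    rw [← hM] at h2
    have h6 := mul_le_mul_of_nonneg_left h4 hdl
    have h5 := mul_le_mul_of_nonneg_left h5 hdl
    nlinarith
  · apply le_of_lin (c := C.dl * (r * sys.C0)) hp1
    intro e
    have h1 : _ ≤ (((p ^ e : ℕ) * Γ : ℤ) : ℝ) := Int.cast_le.2 (key e).1
    push_cast at h1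
    have h3 := hsu (Fk r k) (e0 + e)
    push_cast at h3 hM
    rw [pow_add] at h3
    rw [← hM] at h1
    have h3 := mul_le_mul_of_nonneg_left h3 hdl
    nlinarith

lemma beta_int (i : Fin r) : PI p (C.dl * r.factorial * sys.β i) := by
  classical
  let S := Finset.univ.filter (fun j => sys.β j < sys.β i)
  let S' := Finset.univ.filter (fun j => sys.β j ≤ sys.β i)
  have hS := lower_eq_Fk S (fun a b hab hb => by
    simp only [S, Finset.mem_filter, Finset.mem_univ, true_and] at hb ⊢
    exact lt_of_le_of_lt (sys.mono hab) hb)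
  have hS' := lower_eq_Fk S' (fun a b hab hb => by
    simp only [S', Finset.mem_filter, Finset.mem_univ, true_and] at hb ⊢
    exact (sys.mono hab).trans hb)
  have hc : S.card ≤ r := by simpa using Finset.card_le_univ S
  have hc' : S'.card ≤ r := by simpa using Finset.card_le_univ S'
  have h1 := sys.sig hc (by
    intro a b ha hb
    have h1 : a ∈ S := by rw [hS, mem_Fk]; exact ha
    have h2 : b ∉ S := by rw [hS, mem_Fk]; omega
    simp only [S, Finset.mem_filter, Finset.mem_univ, true_and] at h1 h2
    linarith)
  have h2 := sys.sig hc' (by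
    intro a b ha hb
    have h1 : a ∈ S' := by rw [hS', mem_Fk]; exact ha
    have h2 : b ∉ S' := by rw [hS', mem_Fk]; omega
    simp only [S', Finset.mem_filter, Finset.mem_univ, true_and] at h1 h2
    linarith)
  rw [← hS] at h1
  rw [← hS'] at h2
  have hsub : S ⊆ S' := by
    intro a ha
    simp only [S, S', Finset.mem_filter, Finset.mem_univ, true_and] at ha ⊢
    exact ha.le
  have hsd : ∑ j ∈ S' \ S, sys.β j = (S' \ S).card * sys.β i := by
    rw [Finset.sum_congr rfl (g := fun _ => sys.β i)]
    · simp
    · intro a ha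
      simp only [S, S', Finset.mem_sdiff, Finset.mem_filter, Finset.mem_univ, true_and] at ha
      linarith
  have h3 := h2.sub h1
  rw [← mul_sub, ← Finset.sum_sdiff_eq_sub hsub, hsd] at h3
  have hpos : 0 < (S' \ S).card := Finset.card_pos.2 ⟨i, by simp [S, S']⟩
  have hle : (S' \ S).card ≤ r := by simpa using Finset.card_le_univ (S' \ S)
  obtain ⟨w, hw⟩ := Nat.dvd_factorial hpos hle
  have h4 := h3.mul (PI.nat w)
  convert h4 using 1
  rw [hw]; push_cast; ring

end MinSys
end FT

namespace FT
open Polynomial IntermediateField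
open scoped IntermediateField.algebraAdjoinAdjoin
set_option linter.unusedSectionVars false

variable {K E : Type*} [Field K] [Field E] [Algebra K E]

lemma exists_nf {Γ : Type*} [LinearOrderedCommGroupWithZero Γ] (v : Valuation E Γ) {N : ℕ}
    (W : Submodule E (Fin N → E)) : ∃ M : Matrix (Fin N) (Fin N) E, (∀ i j, v (M i j) ≤ 1) ∧
      (∀ y, y - M.mulVec y ∈ W) ∧ ∀ w ∈ W, M.mulVec w = 0 := by
  classical
  suffices H : ∀ s : Finset (Fin N → E), ∃ M : Matrix (Fin N) (Fin N) E, (∀ i j, v (M i j) ≤ 1) ∧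
      (∀ y, y - M.mulVec y ∈ Submodule.span E (s : Set (Fin N → E))) ∧
      ∀ w ∈ Submodule.span E (s : Set (Fin N → E)), M.mulVec w = 0 by
    obtain ⟨s, hs⟩ := (inferInstance : IsNoetherian E (Fin N → E)).noetherian W
    rw [← hs]; exact H s
  intro s
  induction s using Finset.induction_on with
  | empty =>
    refine ⟨1, fun i j => ?_, fun y => by simp, fun w hw => by simpa using hw⟩
    rw [Matrix.one_apply]; split_ifs <;> simp
  | insert w s hw ih =>
    obtain ⟨M, h1, h2, h3⟩ := ih
    have hsub : Submodule.span E (s : Set (Fin N → E)) ≤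
        Submodule.span E ((insert w s : Finset _) : Set (Fin N → E)) :=
      Submodule.span_mono (by simp)
    have hw' : w ∈ Submodule.span E ((insert w s : Finset _) : Set (Fin N → E)) :=
      Submodule.subset_span (by simp)
    have hdec : ∀ x ∈ Submodule.span E ((insert w s : Finset _) : Set (Fin N → E)),
        ∃ a : E, ∃ z ∈ Submodule.span E (s : Set (Fin N → E)), x = a • w + z := by
      intro x hx
      rw [Finset.coe_insert, Submodule.mem_span_insert] at hx
      exact hx
    by_cases h0 : M.mulVec w = 0
    · refine ⟨M, h1, fun y => hsub (h2 y), fun x hx => ?_⟩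
      obtain ⟨a, z, hz, rfl⟩ := hdec x hx
      rw [Matrix.mulVec_add, Matrix.mulVec_smul, h0, h3 z hz]; simp
    · obtain ⟨l0, hl0⟩ := Function.ne_iff.1 h0
      obtain ⟨l, -, hl⟩ := Finset.exists_max_image Finset.univ (fun j => v (M.mulVec w j))
        ⟨l0, Finset.mem_univ _⟩
      have hle : ∀ j, v (M.mulVec w j) ≤ v (M.mulVec w l) := fun j => hl j (Finset.mem_univ _)
      have hne : M.mulVec w l ≠ 0 := by
        intro h
        have := hle l0
        rw [h, map_zero, le_zero_iff, map_eq_zero] at this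
        exact hl0 this
      set u : Fin N → E := fun j => M.mulVec w j / M.mulVec w l with hu
      have hu1 : ∀ j, v (u j) ≤ 1 := by
        intro j
        rw [hu]
        simp only [map_div₀]
        exact div_le_one_of_le₀ (hle j) (zero_le)
      have hMw : M.mulVec w = M.mulVec w l • u := by
        funext j; simp only [hu, Pi.smul_apply, smul_eq_mul]; field_simp
      have hmw : ∀ y, (M - Matrix.of fun i j => u i * M l j).mulVec y
          = M.mulVec y - M.mulVec y l • u := by
        intro y
        rw [Matrix.sub_mulVec]
        congr 1
        funext i
        simp only [Matrix.mulVec, dotProduct, Matrix.of_apply, Pi.smul_apply, smul_eq_mul,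
          Finset.sum_mul]
        exact Finset.sum_congr rfl fun j _ => by ring
      refine ⟨M - Matrix.of fun i j => u i * M l j, fun i j => ?_, fun y => ?_, fun x hx => ?_⟩
      · refine (v.map_sub _ _).trans (max_le (h1 _ _) ?_)
        simp only [Matrix.of_apply, map_mul]
        exact mul_le_one' (hu1 i) (h1 l j)
      · rw [hmw, ← sub_add]
        refine add_mem (hsub (h2 y)) (Submodule.smul_mem _ _ ?_)
        have : u = (M.mulVec w l)⁻¹ • M.mulVec w := by
          rw [hMw]; simp only [smul_smul, Pi.smul_apply, smul_eq_mul]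
          have : u l = 1 := by simp only [hu]; exact div_self hne
          rw [this, mul_one, inv_mul_cancel₀ hne, one_smul]
        rw [this]
        refine Submodule.smul_mem _ _ ?_
        have h4 := sub_mem hw' (hsub (h2 w))
        simpa using h4
      · rw [hmw]
        obtain ⟨a, z, hz, rfl⟩ := hdec x hx
        rw [Matrix.mulVec_add, Matrix.mulVec_smul, h3 z hz, add_zero]
        nth_rewrite 1 [hMw]
        simp [smul_smul]

/-- Frobenius pullback of a subspace -/
def fW {N : ℕ} (q : ℕ) (W : Submodule E (Fin N → E)) : Submodule E (Fin N → E) :=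
  Submodule.span E ((fun w => fv q w) '' (W : Set (Fin N → E)))

variable {p : ℕ} [Fact p.Prime] [CharP E p]

lemma mulVec_fv {q : ℕ} (hq : ∃ n, q = p ^ n) {N : ℕ} (M : Matrix (Fin N) (Fin N) E)
    (y : Fin N → E) : (Matrix.of fun i j => M i j ^ q).mulVec (fv q y) = fv q (M.mulVec y) := by
  funext i
  simp only [Matrix.mulVec, dotProduct, Matrix.of_apply, fv]
  rw [frob_sum hq]
  exact Finset.sum_congr rfl fun j _ => (mul_pow _ _ _).symm

lemma fv_add {q : ℕ} (hq : ∃ n, q = p ^ n) {N : ℕ} (x y : Fin N → E) :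
    fv q (x + y) = fv q x + fv q y := by
  obtain ⟨n, rfl⟩ := hq
  funext j
  exact add_pow_char_pow (R := E) (x j) (y j) p n

lemma fv_smul {q : ℕ} {N : ℕ} (a : E) (x : Fin N → E) : fv q (a • x) = a ^ q • fv q x := by
  funext j; simp [fv, mul_pow]

lemma fW_span {q : ℕ} (hq : ∃ n, q = p ^ n) {N : ℕ} (S : Set (Fin N → E)) :
    fW q (Submodule.span E S) = Submodule.span E ((fun w => fv q w) '' S) := by
  have hq0 : q ≠ 0 := by
    obtain ⟨n, rfl⟩ := hq; exact pow_ne_zero _ (Fact.out : p.Prime).ne_zero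
  apply le_antisymm
  · rw [fW, Submodule.span_le]
    rintro _ ⟨w, hw, rfl⟩
    refine Submodule.span_induction (p := fun w _ => fv q w ∈
      Submodule.span E ((fun w => fv q w) '' S)) ?_ ?_ ?_ ?_ hw
    · intro x hx; exact Submodule.subset_span ⟨x, hx, rfl⟩
    · have : fv q (0 : Fin N → E) = 0 := by funext j; simp [fv, hq0]
      rw [this]; exact zero_mem _
    · intro x y _ _ hx hy; rw [fv_add hq]; exact add_mem hx hy
    · intro a x _ hx; rw [fv_smul]; exact Submodule.smul_mem _ _ hx
  · exact Submodule.span_mono (Set.image_mono Submodule.subset_span)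

lemma nf_frob {q : ℕ} (hq : ∃ n, q = p ^ n) {Γ : Type*} [LinearOrderedCommGroupWithZero Γ]
    (v : Valuation E Γ) {N : ℕ} (W : Submodule E (Fin N → E)) (M : Matrix (Fin N) (Fin N) E)
    (h1 : ∀ i j, v (M i j) ≤ 1) (h2 : ∀ y, y - M.mulVec y ∈ W) (h3 : ∀ w ∈ W, M.mulVec w = 0) :
    (∀ i j, v ((Matrix.of fun i j => M i j ^ q) i j) ≤ 1) ∧
      (∀ y, y - (Matrix.of fun i j => M i j ^ q).mulVec y ∈ fW q W) ∧
      ∀ w ∈ fW q W, (Matrix.of fun i j => M i j ^ q).mulVec w = 0 := by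
  have hq0 : q ≠ 0 := by
    obtain ⟨n, rfl⟩ := hq; exact pow_ne_zero _ (Fact.out : p.Prime).ne_zero
  refine ⟨fun i j => ?_, fun y => ?_, fun w hw => ?_⟩
  · simp only [Matrix.of_apply, map_pow]
    exact pow_le_one' (h1 i j) q
  · have hb : y = ∑ j, y j • fv q (Pi.single j (1 : E)) := by
      funext i
      simp only [Finset.sum_apply, Pi.smul_apply, fv, smul_eq_mul]
      rw [Finset.sum_eq_single i]
      · simp
      · intro b _ hb; rw [Pi.single_eq_of_ne hb.symm]; simp [hq0]
      · simp
    rw [hb, Matrix.mulVec_sum, ← Finset.sum_sub_distrib]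
    refine sum_mem fun j _ => ?_
    rw [Matrix.mulVec_smul, ← smul_sub, mulVec_fv hq]
    refine Submodule.smul_mem _ _ ?_
    have := h2 (Pi.single j 1)
    have h5 : fv q (Pi.single j (1 : E)) - fv q (M.mulVec (Pi.single j 1))
      = fv q (Pi.single j 1 - M.mulVec (Pi.single j 1)) := by
      rw [sub_eq_iff_eq_add, ← fv_add hq, sub_add_cancel]
    rw [h5]
    exact Submodule.subset_span ⟨_, this, rfl⟩
  · refine Submodule.span_induction (p := fun w _ => (Matrix.of fun i j => M i j ^ q).mulVec w = 0)
      ?_ ?_ ?_ ?_ hw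
    · rintro _ ⟨w, hw, rfl⟩
      rw [mulVec_fv hq, h3 w hw]; funext j; simp [fv, hq0]
    · simp
    · intro x y _ _ hx hy; rw [Matrix.mulVec_add, hx, hy, add_zero]
    · intro a x _ hx; rw [Matrix.mulVec_smul, hx, smul_zero]


namespace Crv
variable (C : Crv K E)

/-- inclusion of the chart in its normalization -/
def OB : C.O →+* C.B where
  toFun x := ⟨x, C.O_le_B x.2⟩
  map_one' := rfl
  map_mul' _ _ := rfl
  map_zero' := rfl
  map_add' _ _ := rfl

lemma A_le_O {x : E} (hx : x ∈ C.A) : x ∈ C.O :=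
  (Algebra.adjoin_le (S := C.O) (by simpa using C.t_mem)) hx

lemma OB_int : C.OB.IsIntegral := by
  let ι : C.A →+* C.O :=
    { toFun := fun x => ⟨x, C.A_le_O x.2⟩
      map_one' := rfl
      map_mul' := fun _ _ => rfl
      map_zero' := rfl
      map_add' := fun _ _ => rfl }
  have h : (C.OB.comp ι).IsIntegral := by
    have : C.OB.comp ι = algebraMap C.A C.B := rfl
    rw [this]
    exact algebraMap_isIntegral_iff.2 inferInstance
  exact RingHom.IsIntegral.tower_top ι C.OB h

lemma conductor : ∃ z ∈ C.O, z ≠ 0 ∧ ∀ b ∈ C.B, z * b ∈ C.O := by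
  obtain ⟨s, hs⟩ := (inferInstance : Module.Finite C.A C.B).fg_top
  obtain ⟨z, hz, hz0, h⟩ := common_den C.frac (fun x : s => ((x : C.B) : E))
  refine ⟨z, hz, hz0, fun b hb => ?_⟩
  have : (⟨b, hb⟩ : C.B) ∈ Submodule.span C.A (s : Set C.B) := by rw [hs]; trivial
  refine Submodule.span_induction (p := fun (b : C.B) _ => z * (b : E) ∈ C.O) ?_ ?_ ?_ ?_ this
  · intro x hx; exact h ⟨x, hx⟩
  · simp
  · intro x y _ _ hx hy
    push_cast; rw [mul_add]; exact add_mem hx hy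
  · intro a x _ hx
    have := mul_mem (C.A_le_O a.2) hx
    convert this using 1
    rw [Algebra.smul_def]
    push_cast
    change z * ((a : E) * x) = _
    ring

/-- membership modulo a subspace -/
def Suc {N : ℕ} (W : Submodule E (Fin N → E)) (Y : Fin N → E) : Prop :=
  ∃ u : Fin N → E, (∀ j, u j ∈ C.O) ∧ Y - u ∈ W

variable {C}

lemma Suc.smul {N : ℕ} {W : Submodule E (Fin N → E)} {Y : Fin N → E} (h : C.Suc W Y) {x : E}
    (hx : x ∈ C.O) : C.Suc W (x • Y) := by
  obtain ⟨u, h1, h2⟩ := h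
  refine ⟨x • u, fun j => mul_mem hx (h1 j), ?_⟩
  rw [← smul_sub]; exact W.smul_mem _ h2

lemma Suc.add {N : ℕ} {W : Submodule E (Fin N → E)} {Y Y' : Fin N → E} (h : C.Suc W Y)
    (h' : C.Suc W Y') : C.Suc W (Y + Y') := by
  obtain ⟨u, h1, h2⟩ := h
  obtain ⟨u', h1', h2'⟩ := h'
  refine ⟨u + u', fun j => add_mem (h1 j) (h1' j), ?_⟩
  rw [add_sub_add_comm]; exact add_mem h2 h2'

variable (C)

open IsDedekindDomain in
set_option maxHeartbeats 1000000 in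
lemma core_prime {N : ℕ} (W : Submodule E (Fin N → E)) (y : Fin N → E) {ξ z : E} (hξ : ξ ∈ C.O)
    (hz0 : z ≠ 0) (hz : ∀ b ∈ C.B, z * b ∈ C.O) (hfail : ¬ C.Suc W (ξ • y)) :
    ∃ P : HeightOneSpectrum C.B, (∀ x (hx : x ∈ C.O), C.Suc W (x • y) →
      C.OB ⟨x, hx⟩ ∈ P.asIdeal) ∧
      ∀ M : Matrix (Fin N) (Fin N) E, (∀ y, y - M.mulVec y ∈ W) →
        ∃ j, 1 < P.valuation E (M.mulVec y j * ξ * z⁻¹) := by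
  let 𝔞 : Ideal C.O :=
    { carrier := {x | C.Suc W ((x : E) • ξ • y)}
      zero_mem' := ⟨0, fun j => by simp, by simp⟩
      add_mem' := by
        intro a b ha hb
        have := Suc.add ha hb
        rw [← add_smul] at this
        exact this
      smul_mem' := by
        intro a b hb
        have := Suc.smul hb a.2
        rw [smul_smul] at this
        exact this }
  have hane : 𝔞 ≠ ⊤ := by
    rw [Ne, Ideal.eq_top_iff_one]
    intro h
    have h : C.Suc W ((1 : E) • ξ • y) := h
    rw [one_smul] at h
    exact hfail h
  obtain ⟨𝔮, h𝔮, ha𝔮⟩ := Ideal.exists_le_maximal 𝔞 hane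
  let 𝔟 : Ideal C.B :=
    { carrier := {x | ∃ u : Fin N → E, (∀ j, u j ∈ C.B) ∧ (x : E) • (z⁻¹ * ξ) • y - u ∈ W}
      zero_mem' := ⟨0, fun j => zero_mem _, by simp⟩
      add_mem' := by
        rintro a b ⟨u, h1, h2⟩ ⟨u', h1', h2'⟩
        refine ⟨u + u', fun j => add_mem (h1 j) (h1' j), ?_⟩
        push_cast
        rw [add_smul, add_sub_add_comm]; exact add_mem h2 h2'
      smul_mem' := by
        rintro a b ⟨u, h1, h2⟩
        refine ⟨(a : E) • u, fun j => mul_mem a.2 (h1 j), ?_⟩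
        rw [smul_eq_mul]
        push_cast
        rw [mul_smul, ← smul_sub]; exact W.smul_mem _ h2 }
  let _ : Algebra C.O C.B := C.OB.toAlgebra
  have hOBint : Algebra.IsIntegral C.O C.B := ⟨C.OB_int⟩
  have hcomap : 𝔟.comap (algebraMap C.O C.B) ≤ 𝔮 := by
    refine le_trans ?_ ha𝔮
    rintro x ⟨u, h1, h2⟩
    refine ⟨z • u, fun j => hz _ (h1 j), ?_⟩
    have := W.smul_mem z h2
    rw [smul_sub, smul_comm z, smul_smul z, ← mul_assoc, mul_inv_cancel₀ hz0, one_mul] at this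
    exact this
  obtain ⟨P, hbP, hP, hPq⟩ := Ideal.exists_ideal_over_prime_of_isIntegral 𝔮 𝔟 hcomap
  have hmem : ∀ x (hx : x ∈ C.O), C.Suc W (x • y) → C.OB ⟨x, hx⟩ ∈ P := by
    intro x hx hS
    have : (⟨x, hx⟩ : C.O) ∈ 𝔮 := ha𝔮 (by
      have := hS.smul hξ
      rw [smul_comm] at this
      exact this)
    rw [← hPq] at this
    exact this
  have hP0 : P ≠ ⊥ := by
    obtain ⟨b, hb, hb0, hbx⟩ := common_den C.frac y
    have := hmem b hb ⟨b • y, fun j => hbx j, by simp⟩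
    rintro rfl
    rw [Ideal.mem_bot] at this
    exact hb0 (congrArg Subtype.val this)
  refine ⟨⟨P, hP, hP0⟩, hmem, fun M hM => ?_⟩
  by_contra hc
  push Not at hc
  choose n d hnd using fun j =>
    HeightOneSpectrum.exists_primeCompl_mul_eq_of_integer ⟨P, hP, hP0⟩ _ (hc j)
  have hprod : (∏ j, (d j : C.B)) ∉ P := by
    intro h
    obtain ⟨j, -, hj⟩ := (Ideal.IsPrime.prod_mem_iff (hp := hP)).1 h
    exact (d j).2 hj
  apply hprod
  apply hbP
  refine ⟨fun j => ((∏ j, (d j : C.B) : C.B) : E) * (M.mulVec y j * ξ * z⁻¹), fun j => ?_, ?_⟩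
  · rw [← Finset.mul_prod_erase _ _ (Finset.mem_univ j)]
    push_cast
    have h5 : (M.mulVec y j * ξ * z⁻¹) * ((d j : C.B) : E) = (n j : E) := hnd j
    have : ((d j : C.B) : E) * (∏ x ∈ Finset.univ.erase j, ((d x : C.B) : E)) *
        (M.mulVec y j * ξ * z⁻¹) = (n j : E) * (∏ x ∈ Finset.univ.erase j, ((d x : C.B) : E)) := by
      rw [← h5]; ring
    rw [this]
    exact mul_mem (n j).2 (prod_mem fun x _ => (d x : C.B).2)
  · have := W.smul_mem (((∏ j, (d j : C.B) : C.B) : E) * (z⁻¹ * ξ)) (hM y)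
    convert this using 1
    funext j
    simp only [Pi.sub_apply, Pi.smul_apply, smul_eq_mul]
    ring

end Crv
end FT

namespace FT
open Polynomial IntermediateField
open scoped IntermediateField.algebraAdjoinAdjoin
set_option linter.unusedSectionVars false

variable {K E : Type*} [Field K] [Field E] [Algebra K E]

namespace Crv
variable (C : Crv K E)

open IsDedekindDomain WithZero

set_option maxHeartbeats 1000000 in
lemma val_bound (P : HeightOneSpectrum C.B) {x : E} {d : ℤ} (hx : x ∈ C.L d) (hx0 : x ≠ 0) :
    ∃ a : ℕ, P.valuation E x = exp (-(a : ℤ)) ∧ (a : ℤ) ≤ C.dl * d := by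
  let b : C.B := ⟨x, C.O_le_B hx.1⟩
  have hb0 : b ≠ 0 := fun h => hx0 (congrArg Subtype.val h)
  refine ⟨multiplicity P.asIdeal (Ideal.span {b}), ?_, ?_⟩
  · have := P.valuation_of_algebraMap (K := E) b
    rw [P.intValuation_eq_exp_neg_multiplicity hb0] at this
    exact this
  · set a := multiplicity P.asIdeal (Ideal.span {b})
    have hdvd : P.asIdeal ^ a ∣ Ideal.span {b} := pow_multiplicity_dvd _ _
    have h1 := Ideal.relNorm_mono C.A (Ideal.le_of_dvd hdvd)
    rw [Ideal.relNorm_singleton, map_pow] at h1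
    obtain ⟨π, hπ⟩ := (inferInstance : (Ideal.relNorm C.A P.asIdeal).IsPrincipal)
    change _ = Ideal.span {π} at hπ
    rw [hπ, Ideal.span_singleton_pow, Ideal.span_singleton_le_span_singleton] at h1
    obtain ⟨w, hw⟩ := h1
    obtain ⟨Q, hQ0, hQ, hQd⟩ := C.nrm_L hx hx0
    obtain ⟨Pp, hPp⟩ := mem_adj.1 π.2
    obtain ⟨w', hw'⟩ := mem_adj.1 w.2
    have h2 : Q = Pp ^ a * w' := by
      apply C.aeval_inj
      rw [← hQ, C.nrm_intNorm b, hw]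
      simp [hPp, hw']
    have h3 : 1 ≤ Pp.natDegree := by
      by_contra hc
      have hc : Pp.natDegree = 0 := by omega
      rw [natDegree_eq_zero] at hc
      obtain ⟨c, rfl⟩ := hc
      have hc0 : c ≠ 0 := by
        rintro rfl
        have : π = 0 := Subtype.ext (by rw [← hPp]; simp)
        rw [this, Ideal.span_singleton_eq_bot.2 rfl, Ideal.relNorm_eq_bot_iff] at hπ
        exact P.ne_bot hπ
      have h4 : π ∈ Ideal.relNorm C.A P.asIdeal := by rw [hπ]; exact Ideal.mem_span_singleton_self _
      have h5 := Ideal.relNorm_le_comap C.A _ h4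
      rw [Ideal.mem_comap] at h5
      apply P.isPrime.ne_top
      rw [Ideal.eq_top_iff_one]
      have h6 : (algebraMap C.A C.B (algebraMap K C.A c⁻¹)) * algebraMap C.A C.B π = 1 := by
        rw [← map_mul]
        have : algebraMap K C.A c⁻¹ * π = 1 := by
          apply Subtype.ext
          change algebraMap K E c⁻¹ * (π : E) = 1
          rw [← hPp, aeval_C, ← map_mul, inv_mul_cancel₀ hc0, map_one]
        rw [this, map_one]
      rw [← h6]
      exact Ideal.mul_mem_left _ _ h5
    have h7 : a ≤ Q.natDegree := by
      rw [h2] at hQ0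
      rw [h2, natDegree_mul (left_ne_zero_of_mul hQ0) (right_ne_zero_of_mul hQ0), natDegree_pow]
      nlinarith
    omega

variable {p : ℕ} [Fact p.Prime] [CharP E p]

lemma val_prod (P : HeightOneSpectrum C.B) {n : ℕ} (ξ : Fin n → E) (v : Fin n → ℕ)
    (hv : ∀ i, P.valuation E (ξ i) = exp (-(v i : ℤ))) (α : Fin n → ℕ) :
    P.valuation E (∏ i, ξ i ^ α i) = exp (-(∑ i, (α i : ℤ) * v i)) := by
  rw [map_prod]
  simp only [map_pow, hv]
  simp only [← exp_nsmul]
  rw [← Finset.sum_neg_distrib]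
  generalize (Finset.univ : Finset (Fin n)) = s
  induction s using Finset.cons_induction with
  | empty => simp
  | cons a s ha ih => rw [Finset.prod_cons, Finset.sum_cons, exp_add, ih]; simp

set_option maxHeartbeats 2000000 in
lemma chart_thm (p : ℕ) [Fact p.Prime] [CharP E p] {n N : ℕ} (ξ : Fin n → E) (d : Fin n → ℕ)
    (hξ : ∀ i, ξ i ∈ C.L (d i))
    (hξ0 : ∀ i, ξ i ≠ 0) (l0 : Fin N → E) (W0 : Submodule E (Fin N → E)) :
    ∃ (𝒯 : Finset ((Fin n → ℕ) × ℤ)) (κ : ℤ), (∀ x ∈ 𝒯, ∀ i, x.1 i ≤ C.dl * d i) ∧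
      ∀ (e : ℕ) (α : Fin n → ℕ),
        ¬ C.Suc (fW (p ^ e) W0) ((∏ i, ξ i ^ α i) • fv (p ^ e) l0) →
        (∃ α' : Fin n → ℕ, C.Suc (fW (p ^ e) W0) ((∏ i, ξ i ^ α' i) • fv (p ^ e) l0)) →
        ∃ x ∈ 𝒯, ∑ i, (α i : ℤ) * x.1 i < p ^ e * x.2 + κ ∧
          ∀ α' : Fin n → ℕ, C.Suc (fW (p ^ e) W0) ((∏ i, ξ i ^ α' i) • fv (p ^ e) l0) →
            (p : ℤ) ^ e * x.2 ≤ ∑ i, (α' i : ℤ) * x.1 i ∧ 1 ≤ ∑ i, (α' i : ℤ) * x.1 i := by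
  classical
  obtain ⟨z, hz, hz0, hzB⟩ := C.conductor
  have hO : ∀ α : Fin n → ℕ, (∏ i, ξ i ^ α i) ∈ C.O := fun α =>
    prod_mem fun i _ => pow_mem (hξ i).1 _
  let b : Fin n → C.B := fun i => ⟨ξ i, C.O_le_B (hξ i).1⟩
  have hb0 : ∀ i, b i ≠ 0 := fun i h => hξ0 i (congrArg Subtype.val h)
  have hfin : {P : HeightOneSpectrum C.B | ∃ i, b i ∈ P.asIdeal}.Finite := by
    have : {P : HeightOneSpectrum C.B | ∃ i, b i ∈ P.asIdeal}
        = ⋃ i, {P : HeightOneSpectrum C.B | P.asIdeal ∣ Ideal.span {b i}} := by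
      ext P
      simp [Ideal.dvd_span_singleton]
    rw [this]
    refine Set.finite_iUnion fun i => Ideal.finite_factors ?_
    rw [Ne, Ideal.zero_eq_bot, Ideal.span_singleton_eq_bot]
    exact hb0 i
  choose v hv hvd using fun P : HeightOneSpectrum C.B => fun i => C.val_bound P (hξ i) (hξ0 i)
  have hzv : ∀ P : HeightOneSpectrum C.B, ∃ a : ℕ, P.valuation E z = exp (-(a : ℤ)) := by
    intro P
    have hb : (⟨z, C.O_le_B hz⟩ : C.B) ≠ 0 := fun h => hz0 (congrArg Subtype.val h)
    have := P.valuation_of_algebraMap (K := E) (⟨z, C.O_le_B hz⟩ : C.B)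
    rw [P.intValuation_eq_exp_neg_multiplicity hb] at this
    exact ⟨_, this⟩
  choose κ hκ using hzv
  choose M hM1 hM2 hM3 using fun P : HeightOneSpectrum C.B => exists_nf (P.valuation E) W0
  have hζ : ∀ P : HeightOneSpectrum C.B, ∃ ζ : ℤ, (∀ j, P.valuation E ((M P).mulVec l0 j) ≤ exp ζ) ∧
      ((M P).mulVec l0 ≠ 0 → ∃ j, P.valuation E ((M P).mulVec l0 j) = exp ζ) := by
    intro P
    by_cases h0 : (M P).mulVec l0 = 0
    · exact ⟨0, fun j => by rw [h0]; simp, fun h => absurd h0 h⟩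
    · obtain ⟨l1, hl1⟩ := Function.ne_iff.1 h0
      obtain ⟨l, -, hl⟩ := Finset.exists_max_image Finset.univ
        (fun j => P.valuation E ((M P).mulVec l0 j)) ⟨l1, Finset.mem_univ _⟩
      have hne : P.valuation E ((M P).mulVec l0 l) ≠ 0 := by
        intro h
        have := hl l1 (Finset.mem_univ _)
        rw [h, le_zero_iff, map_eq_zero] at this
        exact hl1 this
      refine ⟨log (P.valuation E ((M P).mulVec l0 l)), fun j => ?_, fun _ => ⟨l, ?_⟩⟩
      · rw [exp_log hne]; exact hl j (Finset.mem_univ _)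
      · rw [exp_log hne]
  choose ζ hζ1 hζ2 using hζ
  refine ⟨hfin.toFinset.image fun P => (v P, ζ P), ∑ P ∈ hfin.toFinset, (κ P : ℤ), ?_, ?_⟩
  · intro x hx i
    obtain ⟨P, -, rfl⟩ := Finset.mem_image.1 hx
    exact_mod_cast hvd P i
  intro e α hfail hsuc
  obtain ⟨P, hP1, hP2⟩ := C.core_prime (fW (p ^ e) W0) (fv (p ^ e) l0) (hO α) hz0 hzB hfail
  obtain ⟨f1, f2, f3⟩ := nf_frob (p := p) (q := p ^ e) ⟨e, rfl⟩ (P.valuation E) W0 (M P)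
    (hM1 P) (hM2 P) (hM3 P)
  have hPS : P ∈ hfin.toFinset := by
    rw [Set.Finite.mem_toFinset]
    obtain ⟨α', hα'⟩ := hsuc
    have := hP1 _ (hO α') hα'
    have h2 : C.OB ⟨_, hO α'⟩ = ∏ i, b i ^ α' i := by
      apply Subtype.ext
      change (∏ i, ξ i ^ α' i) = _
      push_cast
      rfl
    rw [h2] at this
    obtain ⟨i, -, hi⟩ := (Ideal.IsPrime.prod_mem_iff (hp := P.isPrime)).1 this
    exact ⟨i, P.isPrime.mem_of_pow_mem _ hi⟩
  obtain ⟨j, hj⟩ := hP2 _ f2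
  rw [mulVec_fv (p := p) ⟨e, rfl⟩] at hj
  have hne : (M P).mulVec l0 ≠ 0 := by
    intro h
    rw [h] at hj
    have hp0 : p ^ e ≠ 0 := pow_ne_zero _ (Fact.out : p.Prime).ne_zero
    simp only [fv, Pi.zero_apply, zero_pow hp0, zero_mul, map_zero] at hj
    exact absurd hj (by simp)
  refine ⟨(v P, ζ P), Finset.mem_image.2 ⟨P, hPS, rfl⟩, ?_, ?_⟩
  · simp only [fv, map_mul, map_pow, map_inv₀, C.val_prod P ξ (v P) (hv P), hκ] at hj
    have h3 : (1 : ℤᵐ⁰) < exp (ζ P) ^ (p ^ e) * exp (-(∑ i, (α i : ℤ) * v P i)) * (exp (-(κ P : ℤ)))⁻¹ := by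
      refine hj.trans_le ?_
      gcongr
      exact hζ1 P j
    rw [← exp_nsmul, ← exp_neg, ← exp_add, ← exp_add, ← exp_zero, exp_lt_exp] at h3
    have h4 : (κ P : ℤ) ≤ ∑ P ∈ hfin.toFinset, (κ P : ℤ) :=
      Finset.single_le_sum (f := fun P => (κ P : ℤ)) (fun _ _ => by positivity) hPS
    simp only [nsmul_eq_mul] at h3
    push_cast at h3
    simp only
    linarith
  · intro α' hα'
    constructor
    · obtain ⟨j, hj⟩ := hζ2 P hne
      obtain ⟨u, hu1, hu2⟩ := hα'
      have h5 := f3 _ hu2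
      rw [Matrix.mulVec_sub, sub_eq_zero, Matrix.mulVec_smul, mulVec_fv (p := p) ⟨e, rfl⟩] at h5
      have h6 := congrFun h5 j
      have h7 : P.valuation E ((Matrix.of fun i j => M P i j ^ (p ^ e)).mulVec u j) ≤ 1 := by
        simp only [Matrix.mulVec, dotProduct]
        refine Valuation.map_sum_le _ fun l _ => ?_
        rw [map_mul]
        refine mul_le_one' (f1 _ _) ?_
        exact P.valuation_le_one (K := E) ⟨u l, C.O_le_B (hu1 l)⟩
      rw [← h6] at h7
      simp only [Pi.smul_apply, smul_eq_mul, fv, map_mul, map_pow, hj,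
        C.val_prod P ξ (v P) (hv P)] at h7
      rw [← exp_nsmul, ← exp_add, ← exp_zero, exp_le_exp] at h7
      simp only [nsmul_eq_mul] at h7
      push_cast at h7
      simp only
      linarith
    · have h8 := hP1 _ (hO α') hα'
      have h9 := (P.valuation_lt_one_iff_mem (K := E) (C.OB ⟨_, hO α'⟩)).2 h8
      change P.valuation E (∏ i, ξ i ^ α' i) < 1 at h9
      rw [C.val_prod P ξ (v P) (hv P), ← exp_zero, exp_lt_exp] at h9
      simp only
      linarith

end Crv
end FT

namespace FT
open Polynomial IntermediateField
open scoped IntermediateField.algebraAdjoinAdjoin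
set_option linter.unusedSectionVars false

variable {K E : Type*} [Field K] [Field E] [Algebra K E]

/-- monomials -/
def mon {n : ℕ} (ξ : Fin n → E) (α : Fin n → ℕ) : E := ∏ i, ξ i ^ α i

/-- weighted degree -/
def nn {n : ℕ} (d : Fin n → ℕ) (α : Fin n → ℕ) : ℤ := ∑ i, (α i : ℤ) * d i

/-- length -/
def len {n : ℕ} (α : Fin n → ℕ) : ℕ := ∑ i, α i

lemma mon_add {n : ℕ} (ξ : Fin n → E) (α β : Fin n → ℕ) : mon ξ (α + β) = mon ξ α * mon ξ β := by
  simp [mon, pow_add, Finset.prod_mul_distrib]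

lemma nn_add {n : ℕ} (d : Fin n → ℕ) (α β : Fin n → ℕ) : nn d (α + β) = nn d α + nn d β := by
  simp [nn, add_mul, Finset.sum_add_distrib]

lemma len_add {n : ℕ} (α β : Fin n → ℕ) : len (α + β) = len α + len β := by
  simp [len, Finset.sum_add_distrib]

lemma mon_ne {n : ℕ} {ξ : Fin n → E} (h : ∀ i, ξ i ≠ 0) (α : Fin n → ℕ) : mon ξ α ≠ 0 :=
  Finset.prod_ne_zero_iff.2 fun i _ => pow_ne_zero _ (h i)

lemma mon_mem {C : Crv K E} {n : ℕ} {ξ : Fin n → E} {d : Fin n → ℕ} (hξ : ∀ i, ξ i ∈ C.L (d i))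
    (α : Fin n → ℕ) : mon ξ α ∈ C.L (nn d α) :=
  C.prod_mem_L _ (fun i => (α i : ℤ) * d i) _ fun i _ => C.pow_mem_L (hξ i) _

lemma nn_single {n : ℕ} (d : Fin n → ℕ) (i : Fin n) (a : ℕ) : nn d (Pi.single i a) = a * d i := by
  unfold nn
  rw [Finset.sum_eq_single i]
  · simp
  · intro b _ hb; simp [hb]
  · simp

lemma mon_single {n : ℕ} (ξ : Fin n → E) (i : Fin n) (a : ℕ) : mon ξ (Pi.single i a) = ξ i ^ a := by
  unfold mon
  rw [Finset.prod_eq_single i]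
  · simp
  · intro b _ hb; simp [hb]
  · simp

lemma len_single {n : ℕ} (i : Fin n) (a : ℕ) : len (Pi.single i a) = a := by
  simp [len]

variable {C : Crv K E} {r : ℕ} {n : ℕ}

/-- membership in the Frobenius power -/
def Dat.Mem (D : Dat C r) (ξ : Fin n → E) (d : Fin n → ℕ) (q : ℕ) (α : Fin n → ℕ) : Prop :=
  ∃ g ∈ D.G q (nn d α), D.ph q g = mon ξ α

/-- the refined notion -/
def Dat.Good (D : Dat C r) (ξ : Fin n → E) (d : Fin n → ℕ) (q : ℕ)
    (W : Submodule E (Fin (r + 1) → E)) (l : Fin (r + 1) → E) (α : Fin n → ℕ) : Prop :=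
  ∃ g ∈ D.G q (nn d α), mon ξ α • l - g ∈ W

namespace Dat
variable {D : Dat C r} {ξ : Fin n → E} {d : Fin n → ℕ} {q : ℕ}

lemma Mem.add (hξ : ∀ i, ξ i ∈ C.L (d i)) {α : Fin n → ℕ} (h : D.Mem ξ d q α) (γ : Fin n → ℕ) :
    D.Mem ξ d q (α + γ) := by
  obtain ⟨g, h1, h2⟩ := h
  refine ⟨mon ξ γ • g, ?_, ?_⟩
  · rw [nn_add, add_comm (nn d _)]
    exact D.smul_mem_G (mon_mem hξ γ) h1
  · rw [map_smul, h2, mon_add, smul_eq_mul, mul_comm]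

lemma Good.add (hξ : ∀ i, ξ i ∈ C.L (d i)) {α : Fin n → ℕ} {W : Submodule E (Fin (r + 1) → E)}
    {l : Fin (r + 1) → E} (h : D.Good ξ d q W l α) (γ : Fin n → ℕ) :
    D.Good ξ d q W l (α + γ) := by
  obtain ⟨g, h1, h2⟩ := h
  refine ⟨mon ξ γ • g, ?_, ?_⟩
  · rw [nn_add, add_comm (nn d _)]
    exact D.smul_mem_G (mon_mem hξ γ) h1
  · rw [mon_add, mul_comm, mul_smul, ← smul_sub]
    exact W.smul_mem _ h2

lemma Good.ph_eq {α : Fin n → ℕ} {W : Submodule E (Fin (r + 1) → E)} (hW : W ≤ D.kr q)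
    {l : Fin (r + 1) → E} (hl : D.ph q l = 1) {g : Fin (r + 1) → E}
    (h : mon ξ α • l - g ∈ W) : D.ph q g = mon ξ α := by
  have := D.mem_kr.1 (hW h)
  rw [map_sub, map_smul, hl, smul_eq_mul, mul_one, sub_eq_zero] at this
  exact this.symm

lemma Good.mem {α : Fin n → ℕ} {W : Submodule E (Fin (r + 1) → E)} (hW : W ≤ D.kr q)
    {l : Fin (r + 1) → E} (hl : D.ph q l = 1) (h : D.Good ξ d q W l α) : D.Mem ξ d q α := by
  obtain ⟨g, h1, h2⟩ := h
  exact ⟨g, h1, Good.ph_eq hW hl h2⟩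

variable {p : ℕ} [Fact p.Prime] [CharP E p] {m : Fin r → ℤ} {s : Fin r → (Fin (r + 1) → E)}

lemma Good.of (hξ : ∀ i, ξ i ∈ C.L (d i)) (hξ0 : ∀ i, ξ i ≠ 0) (h : D.IsMin q m s)
    (hq : ∃ n, q = p ^ n) {k : ℕ} (hk : k ≤ r) {l : Fin (r + 1) → E} (hl : D.ph q l = 1)
    {β β' γ γ' : Fin n → ℕ} (hb : β + γ = β' + γ') (hM : D.Mem ξ d q β)
    (hG : D.Good ξ d q (Wk s k) l β')
    (hn : ∀ i : Fin r, (i : ℕ) = k → nn d (β + γ) < m i) : D.Good ξ d q (Wk s k) l β := by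
  obtain ⟨g, h1, h2⟩ := hM
  obtain ⟨g', h1', h2'⟩ := hG
  refine ⟨g, h1, ?_⟩
  have h3 := Good.ph_eq (h.Wk_le k) hl h2'
  have h4 : mon ξ γ • g - mon ξ γ' • g' ∈ Wk s k := by
    apply h.mem_Wk hq hk hn
    · refine sub_mem ?_ ?_
      · rw [nn_add, add_comm (nn d _)]; exact D.smul_mem_G (mon_mem hξ γ) h1
      · rw [hb, nn_add, add_comm (nn d _)]; exact D.smul_mem_G (mon_mem hξ γ') h1'
    · rw [D.mem_kr, map_sub, map_smul, map_smul, h2, h3, smul_eq_mul, smul_eq_mul, mul_comm,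
        ← mon_add, hb, mon_add, mul_comm, sub_self]
  have h5 : mon ξ γ • (mon ξ β • l - g) ∈ Wk s k := by
    have h6 := sub_mem ((Wk s k).smul_mem (mon ξ γ') h2') h4
    convert h6 using 1
    rw [smul_sub, smul_sub, smul_smul, smul_smul, mul_comm, ← mon_add, hb, mon_add,
      mul_comm (mon ξ β')]
    abel
  have h7 := (Wk s k).smul_mem (mon ξ γ)⁻¹ h5
  rwa [smul_smul, inv_mul_cancel₀ (mon_ne hξ0 γ), one_smul] at h7

lemma Good.walk (hξ : ∀ i, ξ i ∈ C.L (d i)) (hξ0 : ∀ i, ξ i ≠ 0) (h : D.IsMin q m s)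
    (hq : ∃ n, q = p ^ n) {k : ℕ} (hk : k ≤ r) {l : Fin (r + 1) → E} (hl : D.ph q l = 1)
    {rr N0 : ℕ} (hrr : ∀ α, rr ≤ len α → D.Mem ξ d q α) (i0 : Fin n) (hi0 : ∀ i, d i0 ≤ d i)
    (hN0 : D.Good ξ d q (Wk s k) l (Pi.single i0 N0))
    (hN : ∀ i : Fin r, (i : ℕ) = k → (N0 : ℤ) * d i0 < m i)
    (α : Fin n → ℕ) (hα : rr ≤ len α)
    (hn : ∀ i : Fin r, (i : ℕ) = k → nn d α + d i0 < m i) : D.Good ξ d q (Wk s k) l α := by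
  have s1 : ∀ N, rr ≤ N → D.Good ξ d q (Wk s k) l (Pi.single i0 N) := by
    intro N hNr
    rcases le_total N0 N with hle | hle
    · have := hN0.add hξ (Pi.single i0 (N - N0))
      rwa [← Pi.single_add, Nat.add_sub_cancel' hle] at this
    · induction hle using Nat.decreasingInduction with
      | self => exact hN0
      | of_succ N hlt ih =>
        have ih := ih (by omega)
        refine Good.of hξ hξ0 h hq hk hl (β' := Pi.single i0 (N + 1)) (γ := Pi.single i0 1) (γ' := 0)
          ?_ (hrr _ (by rwa [len_single])) ih ?_
        · rw [← Pi.single_add, add_zero]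
        · intro i hi
          rw [← Pi.single_add, nn_single]
          refine lt_of_le_of_lt ?_ (hN i hi)
          gcongr
          omega
  generalize hM : len α - α i0 = M
  induction M using Nat.strong_induction_on generalizing α with
  | _ M ih =>
    by_cases hc : ∃ i, i ≠ i0 ∧ α i ≠ 0
    · obtain ⟨i, hi, hαi⟩ := hc
      let δ : Fin n → ℕ := fun j => if j = i then α i - 1 else α j
      have hδ : α = δ + Pi.single i 1 := by
        funext j
        by_cases hj : j = i
        · subst hj; simp [δ]; omega
        · simp [δ, hj]
      have hlen : len α = len δ + 1 := by
        conv_lhs => rw [hδ]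
        rw [len_add, len_single]
      have hnn : nn d α = nn d δ + d i := by
        conv_lhs => rw [hδ]
        rw [nn_add, nn_single]; simp
      have hα0 : α i0 = δ i0 := by simp [δ, hi.symm]
      have hle : α i0 ≤ len δ := by
        rw [hα0]; exact Finset.single_le_sum (f := δ) (fun _ _ => Nat.zero_le _) (Finset.mem_univ _)
      have hlen' : len (δ + Pi.single i0 1) = len δ + 1 := by rw [len_add, len_single]
      have hnn' : nn d (δ + Pi.single i0 1) = nn d δ + d i0 := by rw [nn_add, nn_single]; simp
      have hdd : (d i0 : ℤ) ≤ d i := by exact_mod_cast hi0 i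
      have hG := ih (len (δ + Pi.single i0 1) - (δ + Pi.single i0 1 : Fin n → ℕ) i0) (by
          rw [hlen', Pi.add_apply, Pi.single_eq_same, ← hα0]; omega) (δ + Pi.single i0 1)
        (by omega) (fun j hj => by have := hn j hj; omega) rfl
      refine Good.of hξ hξ0 h hq hk hl (β' := δ + Pi.single i0 1) (γ := Pi.single i0 1)
        (γ' := Pi.single i 1) ?_ (hrr _ hα) hG ?_
      · conv_lhs => rw [hδ]
        exact add_right_comm _ _ _
      · intro j hj
        rw [nn_add, nn_single]
        have := hn j hj
        push_cast; omega
    · push Not at hc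
      have : α = Pi.single i0 (len α) := by
        have h0 : len α = α i0 := by
          unfold len
          rw [Finset.sum_eq_single i0]
          · intro b _ hb; exact hc b hb
          · simp
        funext j
        by_cases hj : j = i0
        · subst hj; simp [h0]
        · simp [hj, hc j hj]
      rw [this]
      exact s1 _ hα

end Dat
end FT

namespace FT
open Polynomial IntermediateField
open scoped IntermediateField.algebraAdjoinAdjoin
set_option linter.unusedSectionVars false

variable {K E : Type*} [Field K] [Field E] [Algebra K E]

/-- diagonal maps -/
def dg {N : ℕ} (w : Fin N → E) : (Fin N → E) →ₗ[E] (Fin N → E) where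
  toFun x := fun j => w j * x j
  map_add' x y := by funext j; simp [mul_add]
  map_smul' a x := by funext j; simp; ring

lemma dg_apply {N : ℕ} (w x : Fin N → E) (j : Fin N) : dg w x j = w j * x j := rfl

lemma fW_dg {N : ℕ} (q : ℕ) (w : Fin N → E) (W : Submodule E (Fin N → E)) :
    fW q (W.map (dg w)) = (fW q W).map (dg (fv q w)) := by
  rw [fW, fW, Submodule.map_span]
  congr 1
  ext x
  simp only [Submodule.map_coe, Set.mem_image, exists_exists_and_eq_and]
  have : ∀ a : Fin N → E, fv q (dg w a) = dg (fv q w) (fv q a) := by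
    intro a; funext j; simp [dg_apply, fv, mul_pow]
  simp only [this]

variable {C : Crv K E} {r : ℕ} {n : ℕ}

/-- membership at infinity modulo a subspace -/
def Dat.SucI (D : Dat C r) (q : ℕ) (W : Submodule E (Fin (r + 1) → E)) (n : ℤ)
    (Y : Fin (r + 1) → E) : Prop :=
  ∃ u : Fin (r + 1) → E, (∀ j, C.t ^ (-(n - q * D.e j)) * u j ∈ C.Oi) ∧ Y - u ∈ W

lemma Dat.sucI_iff (D : Dat C r) (q : ℕ) (W : Submodule E (Fin (r + 1) → E)) (n : ℤ)
    (Y : Fin (r + 1) → E) : D.SucI q W n Y ↔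
      C.swap.Suc (W.map (dg fun j => C.t ^ (q * D.e j)))
        (C.t ^ (-n) • dg (fun j => C.t ^ (q * D.e j)) Y) := by
  have ht := C.t0
  constructor
  · rintro ⟨u, h1, h2⟩
    refine ⟨C.t ^ (-n) • dg (fun j => C.t ^ (q * D.e j)) u, fun j => ?_, ?_⟩
    · have := h1 j
      change _ ∈ C.Oi
      convert this using 1
      rw [Pi.smul_apply, dg_apply, smul_eq_mul, ← mul_assoc, ← zpow_add₀ ht]
      congr 2; ring
    · rw [← smul_sub, ← map_sub]
      exact Submodule.smul_mem _ _ (Submodule.mem_map_of_mem h2)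
  · rintro ⟨u, h1, h2⟩
    have hd : ∀ x : Fin (r + 1) → E, dg (fun j => C.t ^ (q * D.e j))
        (dg (fun j => C.t ^ (-(q * D.e j))) x) = x := by
      intro x; funext j
      rw [dg_apply, dg_apply, ← mul_assoc, ← zpow_add₀ ht, add_neg_cancel, zpow_zero, one_mul]
    have hd' : ∀ x : Fin (r + 1) → E, dg (fun j => C.t ^ (-(q * D.e j)))
        (dg (fun j => C.t ^ (q * D.e j)) x) = x := by
      intro x; funext j
      rw [dg_apply, dg_apply, ← mul_assoc, ← zpow_add₀ ht, neg_add_cancel, zpow_zero, one_mul]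
    refine ⟨C.t ^ n • dg (fun j => C.t ^ (-(q * D.e j))) u, fun j => ?_, ?_⟩
    · have : u j ∈ C.Oi := h1 j
      convert this using 1
      rw [Pi.smul_apply, dg_apply, smul_eq_mul, ← mul_assoc, ← mul_assoc, ← zpow_add₀ ht,
        ← zpow_add₀ ht]
      have : -(n - q * D.e j) + n + -(q * D.e j) = 0 := by ring
      rw [this, zpow_zero, one_mul]
    · obtain ⟨w, hw, hw2⟩ := h2
      have h3 := congrArg (fun x => C.t ^ n • dg (fun j => C.t ^ (-(q * D.e j))) x) hw2
      simp only [hd', map_sub, map_smul, smul_sub, smul_smul, ← zpow_add₀ ht] at h3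
      rw [add_neg_cancel, zpow_zero, one_smul] at h3
      rw [← h3]
      exact W.smul_mem _ hw

lemma chart_inf (p : ℕ) [Fact p.Prime] [CharP E p] (D : Dat C r) (q0 : ℕ) (ξ : Fin n → E)
    (d : Fin n → ℕ) (hξ : ∀ i, ξ i ∈ C.L (d i))
    (hξ0 : ∀ i, ξ i ≠ 0) (l0 : Fin (r + 1) → E) (W0 : Submodule E (Fin (r + 1) → E)) :
    ∃ (𝒯 : Finset ((Fin n → ℕ) × ℤ)) (κ : ℤ), (∀ x ∈ 𝒯, ∀ i, x.1 i ≤ C.dl * d i) ∧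
      ∀ (e : ℕ) (α : Fin n → ℕ),
        ¬ D.SucI (q0 * p ^ e) (fW (p ^ e) W0) (nn d α) (mon ξ α • fv (p ^ e) l0) →
        (∃ α' : Fin n → ℕ, D.SucI (q0 * p ^ e) (fW (p ^ e) W0) (nn d α') (mon ξ α' • fv (p ^ e) l0)) →
        ∃ x ∈ 𝒯, ∑ i, (α i : ℤ) * x.1 i < p ^ e * x.2 + κ ∧
          ∀ α' : Fin n → ℕ, D.SucI (q0 * p ^ e) (fW (p ^ e) W0) (nn d α') (mon ξ α' • fv (p ^ e) l0) →
            (p : ℤ) ^ e * x.2 ≤ ∑ i, (α' i : ℤ) * x.1 i ∧ 1 ≤ ∑ i, (α' i : ℤ) * x.1 i := by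
  have ht := C.t0
  have key : ∀ (e : ℕ) (α : Fin n → ℕ),
      D.SucI (q0 * p ^ e) (fW (p ^ e) W0) (nn d α) (mon ξ α • fv (p ^ e) l0) ↔
      C.swap.Suc (fW (p ^ e) (W0.map (dg fun j => C.t ^ (q0 * D.e j))))
        ((∏ i, (C.t ^ (-(d i : ℤ)) * ξ i) ^ α i) •
          fv (p ^ e) (fun j => C.t ^ (q0 * D.e j) * l0 j)) := by
    intro e α
    have h1 : (fun j => C.t ^ (((q0 * p ^ e : ℕ) : ℤ) * D.e j))
        = fv (p ^ e) (fun j => C.t ^ (q0 * D.e j)) := by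
      funext j
      rw [fv, ← zpow_natCast, ← zpow_mul]
      congr 1; push_cast; ring
    rw [D.sucI_iff, fW_dg, h1]
    have h2 : (∏ i, (C.t ^ (-(d i : ℤ)) * ξ i) ^ α i) = C.t ^ (-(nn d α)) * mon ξ α := by
      have h3 : ∏ i, (C.t ^ (-(d i : ℤ))) ^ α i = C.t ^ (-(nn d α)) := by
        unfold nn
        rw [← Finset.sum_neg_distrib]
        generalize (Finset.univ : Finset (Fin n)) = S
        induction S using Finset.cons_induction with
        | empty => simp
        | cons a S ha ih =>
          rw [Finset.prod_cons, Finset.sum_cons, zpow_add₀ ht, ih, ← zpow_natCast, ← zpow_mul]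
          congr 2; ring
      simp only [mul_pow, Finset.prod_mul_distrib, h3]
      rfl
    rw [h2]
    have h4 : C.t ^ (-(nn d α)) • (dg (fv (p ^ e) fun j => C.t ^ (q0 * D.e j)))
        (mon ξ α • fv (p ^ e) l0) = (C.t ^ (-(nn d α)) * mon ξ α) •
          fv (p ^ e) (fun j => C.t ^ (q0 * D.e j) * l0 j) := by
      funext j
      simp only [Pi.smul_apply, dg_apply, fv, smul_eq_mul, mul_pow]
      ring
    rw [h4]
  simp only [key]
  obtain ⟨𝒯, κ, h1, h2⟩ := C.swap.chart_thm p (fun i => C.t ^ (-(d i : ℤ)) * ξ i) d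
    (fun i => C.mem_L_swap.2 (hξ i)) (fun i => mul_ne_zero (zpow_ne_zero _ ht) (hξ0 i))
    (fun j => C.t ^ (q0 * D.e j) * l0 j) (W0.map (dg fun j => C.t ^ (q0 * D.e j)))
  rw [C.dl_swap] at h1
  exact ⟨𝒯, κ, h1, h2⟩

set_option maxHeartbeats 1000000 in
lemma walk_thm {p : ℕ} [Fact p.Prime] [CharP E p] {D : Dat C r} (sys : MinSys p D) (ξ : Fin n → E)
    (d : Fin n → ℕ) (hξ : ∀ i, ξ i ∈ C.L (d i)) (hξ0 : ∀ i, ξ i ≠ 0)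
    {c' : ℤ} (hc : ∀ n, C.dl * n - c' ≤ dm K C.L n) (hc0 : 0 ≤ c') {k : ℕ} (hk : k ≤ r)
    (i0 : Fin n) (hi0 : ∀ i, d i0 ≤ d i) (rr : ℕ → ℕ)
    (hrr : ∀ e α, rr e ≤ len α → D.Mem ξ d (p ^ e) α) {e0 : ℕ}
    (he0 : ∀ i j : Fin r, (i : ℕ) < k → (j : ℕ) = k →
      sys.β i * p ^ e0 + sys.C0 < sys.β j * p ^ e0)
    (he0' : ∀ j : Fin r, (j : ℕ) = k → (rr e0 : ℝ) * d i0 < sys.β j * p ^ e0)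
    (hWk : ∀ e, Wk (sys.s (e0 + e)) k = Wk (fun i => fv (p ^ e) (sys.s e0 i)) k) :
    ∃ (𝒯 : Finset ((Fin n → ℕ) × ℤ)) (κ : ℤ), (∀ x ∈ 𝒯, ∀ i, x.1 i ≤ C.dl * d i) ∧
      ∀ (e : ℕ) (α : Fin n → ℕ), ¬ D.Mem ξ d (p ^ (e0 + e)) α →
        (∀ i : Fin r, (i : ℕ) < k → sys.m (e0 + e) i + (C.dl * k + k * c') ≤ nn d α) →
        ∃ x ∈ 𝒯, ∑ i, (α i : ℤ) * x.1 i < p ^ e * x.2 + κ ∧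
          ∀ α' : Fin n → ℕ, rr (e0 + e) ≤ len α' →
            (∀ i : Fin r, (i : ℕ) = k → nn d α' + d i0 < sys.m (e0 + e) i) →
            (p : ℤ) ^ e * x.2 ≤ ∑ i, (α' i : ℤ) * x.1 i ∧ 1 ≤ ∑ i, (α' i : ℤ) * x.1 i := by
  have hp0 : (0 : ℝ) < p := by exact_mod_cast (Fact.out : p.Prime).pos
  obtain ⟨g0, hg0, hg0'⟩ := hrr e0 (Pi.single i0 (rr e0)) (by rw [len_single])
  rw [mon_single] at hg0'
  rw [nn_single] at hg0
  set l0 : Fin (r + 1) → E := (ξ i0 ^ rr e0)⁻¹ • g0 with hl0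
  have hx0 : ξ i0 ^ rr e0 ≠ 0 := pow_ne_zero _ (hξ0 i0)
  set W0 := Wk (sys.s e0) k with hW0
  have hW : ∀ e, Wk (sys.s (e0 + e)) k = fW (p ^ e) W0 := by
    intro e
    rw [hWk, hW0, Wk, Wk, fW_span (p := p) ⟨e, rfl⟩, Set.image_image]
  have hl : ∀ e, D.ph (p ^ (e0 + e)) (fv (p ^ e) l0) = 1 := by
    intro e
    have h1 : D.ph (p ^ e0) l0 = 1 := by
      rw [hl0, map_smul, hg0', smul_eq_mul, inv_mul_cancel₀ hx0]
    rw [D.ph_apply] at h1 ⊢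
    have h2 := congrArg (· ^ (p ^ e)) h1
    simp only [one_pow] at h2
    rw [frob_sum (p := p) ⟨e, rfl⟩] at h2
    rw [← h2]
    refine Finset.sum_congr rfl fun j _ => ?_
    rw [mul_pow, fv, pow_add, pow_mul]
  have hstart : ∀ e, D.Good ξ d (p ^ (e0 + e)) (Wk (sys.s (e0 + e)) k) (fv (p ^ e) l0)
      (Pi.single i0 (p ^ e * rr e0)) := by
    intro e
    refine ⟨fv (p ^ e) g0, fun j => ?_, ?_⟩
    · have := C.pow_mem_L (hg0 j) (p ^ e)
      rw [nn_single, fv]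
      convert this using 2
      push_cast
      rw [pow_add]; ring
    · have : mon ξ (Pi.single i0 (p ^ e * rr e0)) • fv (p ^ e) l0 = fv (p ^ e) g0 := by
        rw [mon_single, hl0, fv_smul, smul_smul, mul_comm (p ^ e), pow_mul, ← mul_pow,
          mul_inv_cancel₀ hx0, one_pow, one_smul]
      rw [this, sub_self]; exact zero_mem _
  have hwalk : ∀ (e : ℕ) (α' : Fin n → ℕ), rr (e0 + e) ≤ len α' →
      (∀ i : Fin r, (i : ℕ) = k → nn d α' + d i0 < sys.m (e0 + e) i) →
      D.Good ξ d (p ^ (e0 + e)) (Wk (sys.s (e0 + e)) k) (fv (p ^ e) l0) α' := by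
    intro e α' h1 h2
    refine Dat.Good.walk hξ hξ0 (sys.h (e0 + e)) ⟨e0 + e, rfl⟩ hk (hl e) (hrr (e0 + e)) i0 hi0
      (hstart e) ?_ α' h1 h2
    intro j hj
    have h3 := he0' j hj
    have h4 := sys.lo (e0 + e) j
    have : ((p ^ e * rr e0 : ℕ) : ℝ) * d i0 < sys.m (e0 + e) j := by
      refine lt_of_lt_of_le ?_ h4
      have h5 : (0 : ℝ) < p ^ e := by positivity
      push_cast
      rw [pow_add]
      nlinarith
    exact_mod_cast this
  obtain ⟨𝒯1, κ1, hT1, hch1⟩ := C.chart_thm p ξ d hξ hξ0 l0 W0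
  obtain ⟨𝒯2, κ2, hT2, hch2⟩ := chart_inf p D (p ^ e0) ξ d hξ hξ0 l0 W0
  have hS1 : ∀ e α', D.Good ξ d (p ^ (e0 + e)) (Wk (sys.s (e0 + e)) k) (fv (p ^ e) l0) α' →
      C.Suc (fW (p ^ e) W0) ((∏ i, ξ i ^ α' i) • fv (p ^ e) l0) := by
    rintro e α' ⟨g, h1, h2⟩
    rw [hW] at h2
    exact ⟨g, fun j => (h1 j).1, h2⟩
  have hS2 : ∀ e α', D.Good ξ d (p ^ (e0 + e)) (Wk (sys.s (e0 + e)) k) (fv (p ^ e) l0) α' →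
      D.SucI (p ^ e0 * p ^ e) (fW (p ^ e) W0) (nn d α') (mon ξ α' • fv (p ^ e) l0) := by
    rintro e α' ⟨g, h1, h2⟩
    rw [hW] at h2
    rw [pow_add] at h1
    exact ⟨g, fun j => (h1 j).2, h2⟩
  classical
  refine ⟨𝒯1 ∪ 𝒯2, max κ1 κ2, ?_, ?_⟩
  · intro x hx
    rcases Finset.mem_union.1 hx with h | h
    · exact hT1 x h
    · exact hT2 x h
  intro e α hα hn
  by_cases c1 : C.Suc (fW (p ^ e) W0) ((∏ i, ξ i ^ α i) • fv (p ^ e) l0)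
  · by_cases c2 : D.SucI (p ^ e0 * p ^ e) (fW (p ^ e) W0) (nn d α) (mon ξ α • fv (p ^ e) l0)
    · exfalso
      apply hα
      obtain ⟨u, hu, hu2⟩ := c1
      obtain ⟨u', hu', hu2'⟩ := c2
      rw [← hW] at hu2 hu2'
      rw [← pow_add] at hu'
      have hnn0 : 0 ≤ nn d α := Finset.sum_nonneg fun i _ => by positivity
      have hM : ∃ M : ℤ, 0 ≤ M ∧ (∀ i ∈ Fk r k, sys.m (e0 + e) i ≤ M) ∧
          M + (C.dl * k + k * c') ≤ nn d α := by
        rcases Nat.eq_zero_or_pos k with rfl | hk0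
        · exact ⟨0, le_rfl, fun i hi => by simp [mem_Fk] at hi, by simpa using hnn0⟩
        · have hlast : k - 1 < r := by omega
          refine ⟨sys.m (e0 + e) ⟨k - 1, hlast⟩, (sys.h (e0 + e)).nonneg _, fun i hi => ?_,
            hn _ (by simp; omega)⟩
          apply (sys.h (e0 + e)).mono
          rw [mem_Fk] at hi
          rw [Fin.le_def]; simp only; omega
      obtain ⟨M, hM0, hM1, hM2⟩ := hM
      obtain ⟨g, hg, hg2⟩ := (sys.h (e0 + e)).glue hc hc0 hk hM0 hM1 (nn d α) hM2 _ u u' hu hu2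
        hu' hu2'
      exact Dat.Good.mem ((sys.h (e0 + e)).Wk_le k) (hl e) ⟨g, hg, hg2⟩
    · obtain ⟨x, hx, h1, h2⟩ := hch2 e α c2 ⟨_, hS2 e _ (hstart e)⟩
      refine ⟨x, Finset.mem_union_right _ hx, h1.trans_le (by have := le_max_right κ1 κ2; linarith),
        fun α' h3 h4 => h2 α' (hS2 e _ (hwalk e α' h3 h4))⟩
  · obtain ⟨x, hx, h1, h2⟩ := hch1 e α c1 ⟨_, hS1 e _ (hstart e)⟩
    refine ⟨x, Finset.mem_union_left _ hx, h1.trans_le (by have := le_max_left κ1 κ2; linarith),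
      fun α' h3 h4 => h2 α' (hS1 e _ (hwalk e α' h3 h4))⟩

end FT

namespace FT
set_option linter.unusedSectionVars false

lemma lp_red {n : ℕ} (a u : Fin n → ℝ) (ha : ∀ i, 0 ≤ a i) (hu : ∃ i, u i < 0)
    (hs : ∀ i, a i = 0 → u i = 0) :
    ∃ τ : ℝ, 0 ≤ τ ∧ (∀ i, 0 ≤ a i + τ * u i) ∧
      (Finset.univ.filter fun i => a i + τ * u i ≠ 0).card < (Finset.univ.filter fun i => a i ≠ 0).card := by
  classical
  obtain ⟨i1, hi1⟩ := hu
  obtain ⟨j, hj, hmin⟩ := Finset.exists_min_image (Finset.univ.filter fun i => u i < 0)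
    (fun i => a i / (- u i)) ⟨i1, by simpa using hi1⟩
  simp only [Finset.mem_filter, Finset.mem_univ, true_and] at hj hmin
  have hj0 : a j ≠ 0 := fun h => hj.ne (hs j h)
  refine ⟨a j / (- u j), div_nonneg (ha j) (by linarith), fun i => ?_, ?_⟩
  · rcases lt_or_ge (u i) 0 with h | h
    · have := hmin i h
      rw [le_div_iff₀ (by linarith)] at this
      linarith
    · have : 0 ≤ a j / (- u j) := div_nonneg (ha j) (by linarith)
      have := ha i
      positivity
  · apply Finset.card_lt_card
    rw [Finset.ssubset_iff_of_subset]
    · refine ⟨j, by simpa using hj0, ?_⟩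
      simp only [Finset.mem_filter, Finset.mem_univ, true_and, not_not]
      field_simp [hj.ne]
      ring
    · intro i
      simp only [Finset.mem_filter, Finset.mem_univ, true_and]
      intro h h0
      exact h (by simp [h0, hs i h0])

/-- existence of a kernel vector -/
lemma lp_ker {n : ℕ} (d : Fin n → ℝ) (i j l : Fin n) (hij : i ≠ j) (hil : i ≠ l) (hjl : j ≠ l) :
    ∃ u : Fin n → ℝ, (∃ m, u m ≠ 0) ∧ ∑ m, u m = 0 ∧ ∑ m, u m * d m = 0 ∧
      ∀ m, m ≠ i → m ≠ j → m ≠ l → u m = 0 := by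
  classical
  by_cases h : d i = d j
  · refine ⟨fun m => (if m = i then (1:ℝ) else 0) - (if m = j then (1:ℝ) else 0), ⟨i, by simp [hij]⟩, by simp, ?_, ?_⟩
    · simp [sub_mul, Finset.sum_sub_distrib, Pi.single_apply, h]
    · intro m h1 h2 _
      simp [h1, h2]
  · refine ⟨fun m => (d l - d j) * (if m = i then (1:ℝ) else 0) + (d i - d l) * (if m = j then (1:ℝ) else 0) +
      (d j - d i) * (if m = l then (1:ℝ) else 0), ⟨l, ?_⟩, ?_, ?_, ?_⟩
    · simp [hil.symm, hjl.symm]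
      intro h'
      exact h (by linarith)
    · simp only [Finset.sum_add_distrib, ← Finset.mul_sum]
      simp
    · simp only [add_mul, Finset.sum_add_distrib, mul_assoc, ← Finset.mul_sum]
      simp [Pi.single_apply]
      ring
    · intro m h1 h2 h3
      simp [h1, h2, h3]

lemma lp_one {n : ℕ} (f : Fin n → ℝ) (i : Fin n) (h : ∀ m, m ≠ i → f m = 0) : ∑ m, f m = f i :=
  Finset.sum_eq_single i (fun m _ hm => h m hm) (by simp)

lemma lp_two {n : ℕ} (f : Fin n → ℝ) (i j : Fin n) (hij : i ≠ j)
    (h : ∀ m, m ≠ i → m ≠ j → f m = 0) : ∑ m, f m = f i + f j := by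
  classical
  rw [← Finset.sum_subset (Finset.subset_univ {i, j}), Finset.sum_pair hij]
  intro x _ hx
  simp at hx
  exact h x hx.1 hx.2

lemma lp {n : ℕ} (d v : Fin n → ℕ) (hd : ∀ i, 1 ≤ d i) (c Z B : ℝ) (hc : 0 < c)
    (U : ∀ a : Fin n → ℝ, (∀ i, 0 ≤ a i) → c ≤ ∑ i, a i → ∑ i, a i * d i ≤ B → Z ≤ ∑ i, a i * v i)
    (Lx : ∃ a : Fin n → ℝ, (∀ i, 0 ≤ a i) ∧ ∑ i, a i = c ∧ ∑ i, a i * d i ≤ B ∧ ∑ i, a i * v i ≤ Z)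
    (N : ∀ i, d i * c < B → 1 ≤ v i) (dd δ : ℕ) (hδ : 1 ≤ δ) (Dd : ∀ i, d i ≤ dd)
    (V : ∀ i, v i ≤ δ * d i) :
    ∃ x : ℕ, ∃ y w : ℤ, 0 < x ∧ x ≤ δ * dd * dd ∧ (x : ℝ) * c = y * Z + w * B := by
  classical
  obtain ⟨a, ha, hac, had, hav⟩ := Lx
  have bd : ∀ i, d i ≤ δ * dd * dd ∧ v i ≤ δ * dd * dd := by
    intro i
    have h1 := Dd i
    have h2 := V i
    have h3 := hd i
    constructor
    · nlinarith [Nat.mul_le_mul (Nat.mul_le_mul hδ (h3.trans h1)) h1]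
    · nlinarith [Nat.mul_le_mul (Nat.mul_le_mul (le_refl δ) (h3.trans h1)) h1]
  induction hm : (Finset.univ.filter fun i => a i ≠ 0).card using Nat.strong_induction_on
    generalizing a with
  | _ m ih =>
  have hZ : ∑ i, a i * v i = Z := le_antisymm hav (U a ha hac.ge had)
  by_cases h3 : 2 < m
  · obtain ⟨i, j, l, hi, hj, hl, hij, hil, hjl⟩ := Finset.two_lt_card_iff.1 (hm ▸ h3)
    simp only [Finset.mem_filter, Finset.mem_univ, true_and] at hi hj hl
    obtain ⟨u0, hu0, hus, hud, huz⟩ := lp_ker (fun i => (d i : ℝ)) i j l hij hil hjl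
    obtain ⟨u, hu0, hus, hud, huz, huv⟩ : ∃ u : Fin n → ℝ, (∃ m, u m ≠ 0) ∧ ∑ m, u m = 0 ∧
        ∑ m, u m * d m = 0 ∧ (∀ m, m ≠ i → m ≠ j → m ≠ l → u m = 0) ∧ ∑ m, u m * v m ≤ 0 := by
      rcases le_total (∑ m, u0 m * v m) 0 with h | h
      · exact ⟨u0, hu0, hus, hud, huz, h⟩
      · refine ⟨fun m => - u0 m, ?_, ?_, ?_, ?_, ?_⟩
        · simpa using hu0
        · simpa using hus
        · simpa using hud
        · simpa using huz
        · simpa using h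
    have hneg : ∃ i, u i < 0 := by
      by_contra hcon
      push Not at hcon
      obtain ⟨m, hm⟩ := hu0
      exact hm ((Finset.sum_eq_zero_iff_of_nonneg fun i _ => hcon i).1 hus m (Finset.mem_univ _))
    obtain ⟨τ, hτ, h1, h2⟩ := lp_red a u ha hneg (by
      intro m hm
      apply huz m <;> rintro rfl <;> contradiction)
    refine ih _ (hm ▸ h2) (fun i => a i + τ * u i) h1 ?_ ?_ ?_ rfl
    · simp [Finset.sum_add_distrib, ← Finset.mul_sum, hus, hac]
    · simp only [add_mul, Finset.sum_add_distrib, mul_assoc, ← Finset.mul_sum, hud]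
      simpa using had
    · simp only [add_mul, Finset.sum_add_distrib, mul_assoc, ← Finset.mul_sum]
      nlinarith
  · have hm' : m = 0 ∨ m = 1 ∨ m = 2 := by omega
    rcases hm' with h | h | h
    · rw [h, Finset.card_eq_zero, Finset.filter_eq_empty_iff] at hm
      have : ∑ i, a i = 0 := Finset.sum_eq_zero fun i hi => by simpa using hm hi
      linarith
    · rw [h, Finset.card_eq_one] at hm
      obtain ⟨i, hi⟩ := hm
      have hz : ∀ m, m ≠ i → a m = 0 := by
        intro m hm
        by_contra hcon
        have : m ∈ Finset.univ.filter fun i => a i ≠ 0 := by simpa using hcon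
        rw [hi] at this
        exact hm (by simpa using this)
      rw [lp_one _ i hz] at hac
      rw [lp_one _ i (fun m hm => by simp [hz m hm])] at had hZ
      rw [hac] at had hZ
      by_cases hv : v i = 0
      · have : c * d i = B := by
          apply le_antisymm had
          by_contra hcon
          have := N i (by linarith)
          omega
        exact ⟨d i, 0, 1, hd i, (bd i).1, by push_cast; linarith⟩
      · exact ⟨v i, 1, 0, by omega, (bd i).2, by push_cast; linarith⟩
    · rw [h, Finset.card_eq_two] at hm
      obtain ⟨i, j, hij, hs⟩ := hm
      have key : ∀ i j : Fin n, i ≠ j → (Finset.univ.filter fun i => a i ≠ 0) = {i, j} → d i ≤ d j →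
          ∃ x : ℕ, ∃ y w : ℤ, 0 < x ∧ x ≤ δ * dd * dd ∧ (x : ℝ) * c = y * Z + w * B := by
        clear hs hij i j
        intro i j hij hs hdij
        have hz : ∀ m, m ≠ i → m ≠ j → a m = 0 := by
          intro m hm hm'
          by_contra hcon
          have : m ∈ Finset.univ.filter fun i => a i ≠ 0 := by simpa using hcon
          rw [hs] at this
          simp at this
          tauto
        have hi : 0 < a i := by
          have : i ∈ Finset.univ.filter fun i => a i ≠ 0 := by simp [hs]
          exact lt_of_le_of_ne (ha i) (Ne.symm (by simpa using this))
        have hj : 0 < a j := by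
          have : j ∈ Finset.univ.filter fun i => a i ≠ 0 := by simp [hs]
          exact lt_of_le_of_ne (ha j) (Ne.symm (by simpa using this))
        rw [lp_two _ i j hij hz] at hac
        rw [lp_two _ i j hij (fun m hm hm' => by simp [hz m hm hm'])] at had hZ
        -- two-point test
        have U2 : ∀ x y : ℝ, 0 ≤ x → 0 ≤ y → c ≤ x + y → x * d i + y * d j ≤ B →
            Z ≤ x * v i + y * v j := by
          intro x y hx hy hxy hB
          have hzz : ∀ m, m ≠ i → m ≠ j → ((if m = i then x else 0) + (if m = j then y else 0) : ℝ) = 0 := by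
            intro m h1 h2
            simp [h1, h2]
          have := U (fun m => (if m = i then x else 0) + (if m = j then y else 0)) ?_ ?_ ?_
          · rw [lp_two _ i j hij (fun m h1 h2 => by simp [hzz m h1 h2])] at this
            simpa [hij, hij.symm] using this
          · intro m
            apply add_nonneg
            · split_ifs <;> simp [hx]
            · split_ifs <;> simp [hy]
          · rw [lp_two _ i j hij hzz]
            simpa [hij, hij.symm] using hxy
          · rw [lp_two _ i j hij (fun m h1 h2 => by simp [hzz m h1 h2])]
            simpa [hij, hij.symm] using hB
        have hdR : (d i : ℝ) ≤ d j := by exact_mod_cast hdij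
        -- moving toward i
        have hvij : (v j : ℝ) ≤ v i := by
          have := U2 (a i + a j) 0 (by linarith) le_rfl (by linarith) (by nlinarith)
          nlinarith
        by_cases hB : a i * d i + a j * d j = B
        · by_cases hdd : d i = d j
          · refine ⟨d i, 0, 1, hd i, (bd i).1, ?_⟩
            rw [← hdd] at hB
            push_cast
            rw [← hac]
            linarith
          · have hlt : d i < d j := by omega
            have hltR : (d i : ℝ) < d j := by exact_mod_cast hlt
            have hN : 1 ≤ v i := N i (by nlinarith)
            have hvN : v j ≤ v i := by exact_mod_cast hvij
            have hpos : v j * d i < v i * d j := by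
              calc v j * d i ≤ v i * d i := Nat.mul_le_mul_right _ hvN
                _ < v i * d j := Nat.mul_lt_mul_of_pos_left hlt (by omega)
            refine ⟨v i * d j - v j * d i, (d j : ℤ) - d i, (v i : ℤ) - v j, by omega, ?_, ?_⟩
            · refine (Nat.sub_le _ _).trans ?_
              calc v i * d j ≤ (δ * dd) * dd :=
                  Nat.mul_le_mul ((V i).trans (Nat.mul_le_mul_left _ (Dd i))) (Dd j)
                _ = _ := rfl
            · rw [Nat.cast_sub hpos.le]
              push_cast
              rw [← hac, ← hZ, ← hB]
              ring
        · have hBlt : a i * d i + a j * d j < B := lt_of_le_of_ne had hB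
          obtain ⟨ε, hε, hεi, hεB⟩ : ∃ ε : ℝ, 0 < ε ∧ ε ≤ a i ∧
              ε * (d j - d i) ≤ B - (a i * d i + a j * d j) := by
            have hpos : (0 : ℝ) < (d j - d i) + 1 := by linarith
            refine ⟨min (a i) ((B - (a i * d i + a j * d j)) / ((d j - d i) + 1)),
              lt_min hi (div_pos (by linarith) hpos), min_le_left _ _, ?_⟩
            have h1 := min_le_right (a i) ((B - (a i * d i + a j * d j)) / ((d j - d i : ℝ) + 1))
            rw [le_div_iff₀ hpos] at h1
            have h0 : 0 ≤ min (a i) ((B - (a i * d i + a j * d j)) / ((d j - d i : ℝ) + 1)) :=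
              (lt_min hi (div_pos (by linarith) hpos)).le
            nlinarith
          have h2 := U2 (a i - ε) (a j + ε) (by linarith) (by linarith) (by linarith) (by nlinarith)
          have hvv : (v i : ℝ) = v j := by
            apply le_antisymm _ hvij
            by_contra hcon
            push Not at hcon
            nlinarith
          have hdiB : d i * c < B := by rw [← hac]; nlinarith
          refine ⟨v i, 1, 0, N i hdiB, (bd i).2, ?_⟩
          push_cast
          rw [← hac, ← hZ, ← hvv]
          ring
      rcases le_total (d i) (d j) with h' | h'
      · exact key i j hij hs h'
      · exact key j i hij.symm (by rw [hs, Finset.pair_comm]) h'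
end FT

namespace FT
open Polynomial IntermediateField
open scoped IntermediateField.algebraAdjoinAdjoin
set_option linter.unusedSectionVars false

variable {K E : Type*} [Field K] [Field E] [Algebra K E]

lemma lp' {n : ℕ} (d v : Fin n → ℕ) (hd : ∀ i, 1 ≤ d i) (c Z B : ℝ) (hc : 0 < c)
    (i0 : Fin n) (hB : c * d i0 < B)
    (SU : ∀ a : Fin n → ℝ, (∀ i, 0 ≤ a i) → c < ∑ i, a i → ∑ i, a i * d i < B →
      Z ≤ ∑ i, a i * v i ∧ 0 < ∑ i, a i * v i)
    (Lx : ∃ a : Fin n → ℝ, (∀ i, 0 ≤ a i) ∧ ∑ i, a i = c ∧ ∑ i, a i * d i ≤ B ∧ ∑ i, a i * v i ≤ Z)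
    (dd δ : ℕ) (hδ : 1 ≤ δ) (Dd : ∀ i, d i ≤ dd)
    (V : ∀ i, v i ≤ δ * d i) :
    ∃ x : ℕ, ∃ y w : ℤ, 0 < x ∧ x ≤ δ * dd * dd ∧ (x : ℝ) * c = y * Z + w * B := by
  classical
  have hex : ∀ i, d i * c < B → ∃ b : ℝ, c < b ∧ b * d i < B := by
    intro i hi
    have h1 : (0 : ℝ) < d i := by exact_mod_cast hd i
    refine ⟨(c + B / d i) / 2, ?_, ?_⟩
    · have : c < B / d i := by rw [lt_div_iff₀ h1]; linarith
      linarith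
    · have : B / d i * d i = B := by field_simp
      nlinarith
  have sg : ∀ (i : Fin n) (b : ℝ) (f : Fin n → ℝ), ∑ m, (if m = i then b else 0) * f m = b * f i := by
    intro i b f
    simp
  refine lp d v hd c Z B hc ?_ Lx ?_ dd δ hδ Dd V
  · intro a ha hac had
    obtain ⟨b, hb1, hb2⟩ := hex i0 (by linarith)
    by_contra hcon
    push Not at hcon
    have key : ∀ τ : ℝ, 0 < τ → τ ≤ 1 → Z ≤ (1 - τ) * ∑ i, a i * v i + τ * (b * v i0) := by
      intro τ h1 h2
      have := (SU (fun m => (1 - τ) * a m + τ * (if m = i0 then b else 0)) ?_ ?_ ?_).1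
      · simp only [add_mul, Finset.sum_add_distrib, mul_assoc, ← Finset.mul_sum, sg] at this
        exact this
      · intro i
        have h3 := ha i
        have : 0 ≤ (if i = i0 then b else 0) := by split_ifs <;> linarith
        have h4 : 0 ≤ 1 - τ := by linarith
        positivity
      · simp only [Finset.sum_add_distrib, ← Finset.mul_sum]
        simp
        nlinarith
      · simp only [add_mul, Finset.sum_add_distrib, mul_assoc, ← Finset.mul_sum, sg]
        nlinarith
    set V1 := ∑ i, a i * v i
    have hw := key 1 one_pos le_rfl
    set w := b * v i0
    have hpos : 0 < w - V1 := by linarith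
    have := key ((Z - V1) / (2 * (w - V1))) (div_pos (by linarith) (by linarith)) (by
      rw [div_le_one (by linarith)]; linarith)
    have h3 : (Z - V1) / (2 * (w - V1)) * (w - V1) = (Z - V1) / 2 := by field_simp
    nlinarith
  · intro i hi
    obtain ⟨b, hb1, hb2⟩ := hex i hi
    have := (SU (fun m => if m = i then b else 0) ?_ ?_ ?_).2
    · rw [sg] at this
      by_contra hcon
      have h0 : v i = 0 := by omega
      simp [h0] at this
    · intro m
      split_ifs <;> linarith
    · simpa using hb1
    · rwa [sg]

lemma len_mono_drop {n : ℕ} (d : Fin n → ℕ) (hd : ∀ i, 1 ≤ d i) (bad : Finset ℤ) (α : Fin n → ℕ)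
    (h : bad.card ≤ len α) :
    ∃ α' γ : Fin n → ℕ, α = α' + γ ∧ len α ≤ len α' + bad.card ∧ nn d α' ∉ bad := by
  classical
  induction hb : bad.card generalizing bad α with
  | zero =>
    rw [Finset.card_eq_zero] at hb
    exact ⟨α, 0, by simp, by simp, by simp [hb]⟩
  | succ m ih =>
    by_cases hα : nn d α ∈ bad
    · have hex : ∃ i, α i ≠ 0 := by
        by_contra hcon
        push Not at hcon
        have : len α = 0 := by simp [len, hcon]
        omega
      obtain ⟨i, hi⟩ := hex
      obtain ⟨α1, h1⟩ : ∃ α1 : Fin n → ℕ, α = α1 + Pi.single i 1 := by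
        refine ⟨α - Pi.single i 1, ?_⟩
        funext j
        by_cases hj : j = i
        · subst hj; simp; omega
        · simp [hj]
      have hl : len α = len α1 + 1 := by rw [h1, len_add, len_single]
      have hn : nn d α = nn d α1 + d i := by rw [h1, nn_add, nn_single]; simp
      have hc := Finset.card_erase_of_mem hα
      obtain ⟨α', γ, e1, e2, e3⟩ := ih (bad.erase (nn d α)) α1 (by omega) (by omega)
      refine ⟨α', γ + Pi.single i 1, by rw [h1, e1, add_assoc], by omega, ?_⟩
      intro hmem
      apply e3
      rw [Finset.mem_erase]
      refine ⟨?_, hmem⟩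
      have h5 : 0 ≤ nn d γ := by unfold nn; positivity
      have h6 : nn d α1 = nn d α' + nn d γ := by rw [e1, nn_add]
      have := hd i
      omega
    · exact ⟨α, 0, by simp, by omega, hα⟩

lemma avoid {n r : ℕ} (d : Fin n → ℕ) (hd : ∀ i, 1 ≤ d i) (D' dm' : ℕ) (m : Fin r → ℤ)
    (hm : Monotone m) (α : Fin n → ℕ) (h : r * (D' + dm' + 1) ≤ len α) :
    ∃ α' γ : Fin n → ℕ, α = α' + γ ∧ len α ≤ len α' + r * (D' + dm' + 1) ∧
      ∃ k : Fin (r + 1), (∀ i : Fin r, (i : ℕ) < k → m i + D' ≤ nn d α') ∧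
        ∀ i : Fin r, (k : ℕ) ≤ i → nn d α' + dm' < m i := by
  classical
  let bad : Finset ℤ := Finset.univ.biUnion fun i : Fin r => Finset.Icc (m i - dm') (m i + D')
  have hb : bad.card ≤ r * (D' + dm' + 1) := by
    refine Finset.card_biUnion_le.trans ?_
    calc _ ≤ ∑ i : Fin r, (D' + dm' + 1) := by
            apply Finset.sum_le_sum
            intro i _
            rw [Int.card_Icc]
            omega
      _ = _ := by simp
  obtain ⟨α', γ, e1, e2, e3⟩ := len_mono_drop d hd bad α (hb.trans h)
  have hsep : ∀ i, nn d α' < m i - dm' ∨ m i + D' < nn d α' := by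
    intro i
    by_contra hcon
    push Not at hcon
    exact e3 (Finset.mem_biUnion.2 ⟨i, Finset.mem_univ _, Finset.mem_Icc.2 hcon⟩)
  let S : Finset (Fin r) := Finset.univ.filter fun i => m i + D' < nn d α'
  have hS : S = Fk r S.card := lower_eq_Fk S (by
    intro i j hij hj
    simp only [S, Finset.mem_filter, Finset.mem_univ, true_and] at hj ⊢
    have := hm hij
    omega)
  have hc : S.card ≤ r := by simpa using Finset.card_le_univ S
  refine ⟨α', γ, e1, by omega, ⟨S.card, by omega⟩, ?_, ?_⟩
  · intro i hi
    have : i ∈ S := by rw [hS, mem_Fk]; exact hi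
    simp only [S, Finset.mem_filter, Finset.mem_univ, true_and] at this
    omega
  · intro i hi
    have : i ∉ S := by rw [hS, mem_Fk]; simpa using hi
    simp only [S, Finset.mem_filter, Finset.mem_univ, true_and] at this
    have := hsep i
    omega
end FT

namespace FT
open Polynomial IntermediateField
open scoped IntermediateField.algebraAdjoinAdjoin
set_option linter.unusedSectionVars false

variable {K E : Type*} [Field K] [Field E] [Algebra K E]
variable {C : Crv K E} {r : ℕ} {n : ℕ}

/-- first extraction: a subsequence with constant position among the jumps -/
lemma extract1 {p : ℕ} [Fact p.Prime] [CharP E p] {D : Dat C r} (sys : MinSys p D) (ξ : Fin n → E)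
    (d : Fin n → ℕ) (hξ : ∀ i, ξ i ∈ C.L (d i)) (hd : ∀ i, 1 ≤ d i) (c : ℝ) (hc : 0 < c)
    (αs : ℕ → Fin n → ℕ) (hαs : ∀ᶠ e in atTop, ¬ D.Mem ξ d (p ^ e) (αs e))
    (hαl : Tendsto (fun e => (len (αs e) : ℝ) / (p : ℝ) ^ e) atTop (𝓝 c)) (D' dm' : ℕ) :
    ∃ (k : ℕ) (φ : ℕ → ℕ) (α : ℕ → Fin n → ℕ) (a : Fin n → ℝ), k ≤ r ∧ StrictMono φ ∧
      (∀ j, ¬ D.Mem ξ d (p ^ φ j) (α j) ∧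
        (∀ i : Fin r, (i : ℕ) < k → sys.m (φ j) i + D' ≤ nn d (α j)) ∧
        ∀ i : Fin r, k ≤ (i : ℕ) → nn d (α j) + dm' < sys.m (φ j) i) ∧
      (∀ i, 0 ≤ a i) ∧ ∑ i, a i = c ∧
      ∀ i, Tendsto (fun j => (α j i : ℝ) / (p : ℝ) ^ φ j) atTop (𝓝 (a i)) := by
  classical
  have hp1 : (1 : ℝ) < p := by exact_mod_cast (Fact.out : p.Prime).one_lt
  have hp0 : ∀ e : ℕ, (0 : ℝ) < (p : ℝ) ^ e := fun e => by positivity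
  have hpt : Tendsto (fun e : ℕ => (p : ℝ) ^ e) atTop atTop := tendsto_pow_atTop_atTop_of_one_lt hp1
  set W := r * (D' + dm' + 1) with hW
  have hlen : ∀ᶠ e in atTop, (W : ℝ) ≤ len (αs e) := by
    have h1 := hαl.pos_mul_atTop hc hpt
    filter_upwards [h1.eventually_ge_atTop (W : ℝ)] with e he
    rwa [div_mul_cancel₀ _ (hp0 e).ne'] at he
  have hev : ∀ᶠ e in atTop, ∃ k : Fin (r + 1), ∃ α' : Fin n → ℕ, ¬ D.Mem ξ d (p ^ e) α' ∧
      len α' ≤ len (αs e) ∧ len (αs e) ≤ len α' + W ∧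
      (∀ i : Fin r, (i : ℕ) < k → sys.m e i + D' ≤ nn d α') ∧
        ∀ i : Fin r, (k : ℕ) ≤ i → nn d α' + dm' < sys.m e i := by
    filter_upwards [hαs, hlen] with e h1 h2
    obtain ⟨α', γ, e1, e2, k, e3, e4⟩ := avoid d hd D' dm' (sys.m e) (sys.h e).mono (αs e)
      (by exact_mod_cast h2)
    refine ⟨k, α', fun h => h1 ?_, ?_, e2, e3, e4⟩
    · rw [e1]; exact h.add hξ γ
    · rw [e1, len_add]; omega
  obtain ⟨k, hk⟩ : ∃ k : Fin (r + 1), ∃ᶠ e in atTop, ∃ α' : Fin n → ℕ, ¬ D.Mem ξ d (p ^ e) α' ∧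
      len α' ≤ len (αs e) ∧ len (αs e) ≤ len α' + W ∧
      (∀ i : Fin r, (i : ℕ) < k → sys.m e i + D' ≤ nn d α') ∧
        ∀ i : Fin r, (k : ℕ) ≤ i → nn d α' + dm' < sys.m e i := by
    by_contra hcon
    have := (eventually_all.2 fun k => not_frequently.1 (not_exists.1 hcon k)).and hev
    obtain ⟨e, h1, k, h2⟩ := this.exists
    exact h1 k h2
  obtain ⟨φ, hφ, hP⟩ := extraction_of_frequently_atTop hk
  choose α hα using hP
  have hlim : Tendsto (fun j => (len (α j) : ℝ) / (p : ℝ) ^ φ j) atTop (𝓝 c) := by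
    have h1 := hαl.comp hφ.tendsto_atTop
    have h2 : Tendsto (fun j => (W : ℝ) / (p : ℝ) ^ φ j) atTop (𝓝 0) :=
      (hpt.comp hφ.tendsto_atTop).const_div_atTop _
    have h3 := h1.sub h2
    rw [sub_zero] at h3
    refine tendsto_of_tendsto_of_tendsto_of_le_of_le h3 h1 ?_ ?_
    · intro j
      have : (len (αs (φ j)) : ℝ) ≤ len (α j) + W := by exact_mod_cast (hα j).2.2.1
      simp only [Function.comp]
      rw [← sub_div]
      gcongr
      linarith
    · intro j
      simp only [Function.comp]
      gcongr
      exact (hα j).2.1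
  obtain ⟨M, hM⟩ := (hlim.bddAbove_range)
  obtain ⟨a, ha, ψ, hψ, hψa⟩ := (isCompact_Icc (a := (0 : Fin n → ℝ)) (b := fun _ => M)).tendsto_subseq
    (x := fun j => fun i => (α j i : ℝ) / (p : ℝ) ^ φ j) (by
      intro j
      constructor
      · intro i
        simp only [Pi.zero_apply]
        have := hp0 (φ j)
        positivity
      · intro i
        refine le_trans ?_ (hM ⟨j, rfl⟩)
        dsimp only
        gcongr
        exact Finset.single_le_sum (f := α j) (fun _ _ => Nat.zero_le _) (Finset.mem_univ i))
  rw [tendsto_pi_nhds] at hψa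
  refine ⟨k, φ ∘ ψ, α ∘ ψ, a, by omega, hφ.comp hψ, ?_, fun i => ha.1 i, ?_, hψa⟩
  · intro j
    exact ⟨(hα (ψ j)).1, (hα (ψ j)).2.2.2.1, (hα (ψ j)).2.2.2.2⟩
  · have h1 := tendsto_finsetSum Finset.univ (fun i _ => hψa i)
    refine tendsto_nhds_unique h1 ?_
    convert hlim.comp hψ.tendsto_atTop using 1
    funext j
    simp only [Function.comp, len]
    rw [← Finset.sum_div]
    push_cast
    rfl

set_option maxHeartbeats 1000000 in
/-- the rationality theorem on a curve -/
theorem crv_limit {p : ℕ} [Fact p.Prime] [CharP E p] (D : Dat C r) (ξ : Fin n → E)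
    (d : Fin n → ℕ) (hξ : ∀ i, ξ i ∈ C.L (d i)) (hξ0 : ∀ i, ξ i ≠ 0) (hd : ∀ i, 1 ≤ d i)
    (dd : ℕ) (hdd : ∀ i, d i ≤ dd) (c : ℝ) (hc : 0 < c) (rr : ℕ → ℕ)
    (hrr : ∀ e α, rr e ≤ len α → D.Mem ξ d (p ^ e) α)
    (hrl : Tendsto (fun e => (rr e : ℝ) / (p : ℝ) ^ e) atTop (𝓝 c))
    (αs : ℕ → Fin n → ℕ) (hαs : ∀ᶠ e in atTop, ¬ D.Mem ξ d (p ^ e) (αs e))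
    (hαl : Tendsto (fun e => (len (αs e) : ℝ) / (p : ℝ) ^ e) atTop (𝓝 c)) :
    ∃ b : ℕ, 0 < b ∧ b ≤ C.dl * r.factorial * (C.dl * dd * dd) ∧ PI p (b * c) := by
  classical
  have hp1 : (1 : ℝ) < p := by exact_mod_cast (Fact.out : p.Prime).one_lt
  have hpne : p ≠ 0 := (Fact.out : p.Prime).ne_zero
  have hp0 : ∀ e : ℕ, (0 : ℝ) < (p : ℝ) ^ e := fun e => by positivity
  have hpt : Tendsto (fun e : ℕ => (p : ℝ) ^ e) atTop atTop := tendsto_pow_atTop_atTop_of_one_lt hp1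
  obtain ⟨sys⟩ := exists_minSys p D
  obtain ⟨c', hc'0, hc'⟩ := C.L_lower
  have hdlp := C.dl_pos
  -- a minimal weight
  have hne : Nonempty (Fin n) := by
    by_contra hcon
    rw [not_nonempty_iff] at hcon
    have h1 : ∀ e, (len (αs e) : ℝ) / (p : ℝ) ^ e = 0 := by intro e; simp [len]
    simp only [h1] at hαl
    exact hc.ne (tendsto_nhds_unique tendsto_const_nhds hαl)
  obtain ⟨i0, -, hi0⟩ := Finset.exists_min_image (Finset.univ : Finset (Fin n)) d
    (Finset.univ_nonempty)
  replace hi0 : ∀ i, d i0 ≤ d i := fun i => hi0 i (Finset.mem_univ _)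
  set D' : ℕ := (C.dl * r + r * c').toNat + (⌈sys.C0⌉₊ + 1) with hD'
  obtain ⟨k, φ, α, a, hk, hφ, hα, ha0, hac, hat⟩ :=
    extract1 sys ξ d hξ hd c hc αs hαs hαl D' (d i0)
  have hφt := hφ.tendsto_atTop
  have hptφ := hpt.comp hφt
  have hat' : ∀ w : Fin n → ℕ, Tendsto (fun j => (∑ i, (α j i : ℝ) * w i) / (p : ℝ) ^ φ j) atTop
      (𝓝 (∑ i, a i * w i)) := by
    intro w
    have := tendsto_finsetSum Finset.univ (fun i _ => (hat i).mul_const (w i : ℝ))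
    convert this using 1
    funext j
    rw [Finset.sum_div]
    refine Finset.sum_congr rfl fun i _ => ?_
    ring
  have hnnR : ∀ β : Fin n → ℕ, (nn d β : ℝ) = ∑ i, (β i : ℝ) * d i := by
    intro β; simp [nn]
  -- break
  have hbr : ∀ i j : Fin r, (i : ℕ) < k → (j : ℕ) = k → sys.β i < sys.β j := by
    intro i j hi hj
    have h1 := (hα 0).2.1 i hi
    have h2 := (hα 0).2.2 j (by omega)
    have h3 := sys.lo (φ 0) i
    have h4 := sys.hi (φ 0) j
    have h5 : (sys.m (φ 0) i : ℝ) + D' + d i0 < sys.m (φ 0) j := by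
      have : sys.m (φ 0) i + D' + d i0 < sys.m (φ 0) j := by omega
      exact_mod_cast this
    have h6 : sys.C0 + 1 ≤ D' := by
      rw [hD']; push_cast
      have := Nat.le_ceil sys.C0
      have h7 : (0 : ℝ) ≤ ((C.dl * r + r * c').toNat : ℝ) := by positivity
      linarith
    have h8 : (0 : ℝ) ≤ d i0 := by positivity
    have h9 : sys.β i * p ^ φ 0 < sys.β j * p ^ φ 0 := by linarith
    exact lt_of_mul_lt_mul_right h9 (hp0 _).le
  obtain ⟨B, hBPI, hBk, hBa⟩ : ∃ B : ℝ, PI p (C.dl * r.factorial * B) ∧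
      (∀ i : Fin r, (i : ℕ) = k → B = sys.β i) ∧ ∑ i, a i * d i ≤ B := by
    by_cases hkr : k < r
    · refine ⟨sys.β ⟨k, hkr⟩, sys.beta_int _, ?_, ?_⟩
      · rintro ⟨i, hi⟩ h; simp only at h; subst h; rfl
      · have h1 : Tendsto (fun j => sys.β ⟨k, hkr⟩ + sys.C0 / (p : ℝ) ^ φ j) atTop
            (𝓝 (sys.β ⟨k, hkr⟩ + 0)) := tendsto_const_nhds.add (hptφ.const_div_atTop _)
        rw [add_zero] at h1
        refine le_of_tendsto_of_tendsto' (hat' d) h1 fun j => ?_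
        rw [div_le_iff₀ (hp0 _), add_mul, div_mul_cancel₀ _ (hp0 _).ne', ← hnnR]
        refine le_trans ?_ (sys.hi (φ j) ⟨k, hkr⟩)
        have := (hα j).2.2 ⟨k, hkr⟩ le_rfl
        have h2 : nn d (α j) ≤ sys.m (φ j) ⟨k, hkr⟩ := by omega
        exact_mod_cast h2
    · refine ⟨(⌈∑ i, a i * d i⌉ : ℤ), ?_, ?_, Int.le_ceil _⟩
      · exact ((PI.nat C.dl).mul (PI.nat _)).mul (PI.int _)
      · intro i hi; exact absurd i.2 (by omega)
  have hcB : c * d i0 ≤ B := by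
    refine le_trans ?_ hBa
    rw [← hac, Finset.sum_mul]
    refine Finset.sum_le_sum fun i _ => ?_
    have : (d i0 : ℝ) ≤ d i := by exact_mod_cast hi0 i
    exact mul_le_mul_of_nonneg_left this (ha0 i)
  rcases hcB.eq_or_lt with hEq | hlt
  · refine ⟨C.dl * r.factorial * d i0, ?_, ?_, ?_⟩
    · have := hd i0
      have := r.factorial_pos
      positivity
    · apply Nat.mul_le_mul_left
      have h1 := hd i0
      have h2 := hdd i0
      nlinarith [Nat.mul_le_mul (Nat.mul_le_mul hdlp (h1.trans h2)) h2]
    · convert hBPI using 1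
      rw [← hEq]; push_cast; ring
  -- main case
  obtain ⟨e1, he1⟩ := sys.exists_e0 hbr
  have hrd : Tendsto (fun e => (rr e : ℝ) / (p : ℝ) ^ e * d i0) atTop (𝓝 (c * d i0)) :=
    hrl.mul_const _
  obtain ⟨e2, he2⟩ := eventually_atTop.1 (hrd.eventually_lt_const hlt)
  set e0 := max e1 e2 with he0d
  have he0 : ∀ e ≥ e0, ∀ i j : Fin r, (i : ℕ) < k → (j : ℕ) = k →
      sys.β i * p ^ e + sys.C0 < sys.β j * p ^ e := fun e he => he1 e ((le_max_left _ _).trans he)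
  obtain ⟨𝒯, κ, hT, hw⟩ := walk_thm sys ξ d hξ hξ0 hc' hc'0 hk i0 hi0 rr hrr
    (he0 e0 le_rfl) (by
      intro j hj
      rw [← hBk j hj]
      have := he2 e0 (le_max_right _ _)
      rw [div_mul_eq_mul_div, div_lt_iff₀ (hp0 _)] at this
      exact this) (sys.Wk_frob hk he0)
  -- fix an element of 𝒯
  obtain ⟨x, hx, hxf⟩ : ∃ x ∈ 𝒯, ∃ᶠ j in atTop, e0 ≤ φ j ∧
      ∑ i, (α j i : ℤ) * x.1 i < p ^ (φ j - e0) * x.2 + κ ∧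
          ∀ α' : Fin n → ℕ, rr (φ j) ≤ len α' →
            (∀ i : Fin r, (i : ℕ) = k → nn d α' + d i0 < sys.m (φ j) i) →
            (p : ℤ) ^ (φ j - e0) * x.2 ≤ ∑ i, (α' i : ℤ) * x.1 i ∧ 1 ≤ ∑ i, (α' i : ℤ) * x.1 i := by
    by_contra hcon
    have h1 := (Finset.eventually_all 𝒯).2 fun x hx => not_frequently.1 fun h => hcon ⟨x, hx, h⟩
    obtain ⟨j, h1, h2⟩ := (h1.and (hφt.eventually_ge_atTop e0)).exists
    obtain ⟨x, hx, h3, h4⟩ := hw (φ j - e0) (α j) (by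
      rw [Nat.add_sub_cancel' h2]; exact (hα j).1) (by
      intro i hi
      rw [Nat.add_sub_cancel' h2]
      refine le_trans ?_ ((hα j).2.1 i hi)
      have h5 : (C.dl : ℤ) * k + k * c' ≤ C.dl * r + r * c' := by
        have : (k : ℤ) ≤ r := by exact_mod_cast hk
        have h6 : (0 : ℤ) ≤ C.dl := by positivity
        nlinarith
      have h6 : (C.dl : ℤ) * r + r * c' ≤ D' := by
        rw [hD']; push_cast
        have := Int.self_le_toNat ((C.dl : ℤ) * r + r * c')
        omega
      linarith)
    rw [Nat.add_sub_cancel' h2] at h4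
    exact h1 x hx ⟨h2, h3, h4⟩
  obtain ⟨v, ζ⟩ := x
  simp only at hxf
  set Z : ℝ := (ζ : ℝ) / (p : ℝ) ^ e0 with hZ
  have hZPI : PI p Z := ⟨e0, ζ, by rw [hZ, div_mul_cancel₀ _ (hp0 _).ne']⟩
  have hpZ : ∀ j, e0 ≤ φ j → ((p : ℤ) ^ (φ j - e0) * ζ : ℤ) = (p : ℝ) ^ φ j * Z := by
    intro j hj
    rw [hZ]
    have := hp0 e0
    push_cast
    rw [← Nat.add_sub_cancel' hj, pow_add]
    simp only [Nat.add_sub_cancel_left]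
    field_simp
  have Lx : ∑ i, a i * v i ≤ Z := by
    have h1 := (hat' v).sub (hptφ.const_div_atTop (κ : ℝ))
    rw [sub_zero] at h1
    refine le_of_tendsto_of_frequently h1 (hxf.mono fun j hj => ?_)
    have h2 : ((∑ i, (α j i : ℤ) * v i : ℤ) : ℝ) < ((p : ℤ) ^ (φ j - e0) * ζ : ℤ) + κ := by
      have := hj.2.1
      exact_mod_cast this
    rw [hpZ j hj.1] at h2
    push_cast at h2
    simp only [Function.comp]
    rw [← sub_div, div_le_iff₀ (hp0 _)]
    linarith
  have SU : ∀ b : Fin n → ℝ, (∀ i, 0 ≤ b i) → c < ∑ i, b i → ∑ i, b i * d i < B →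
      Z ≤ ∑ i, b i * v i ∧ 0 < ∑ i, b i * v i := by
    intro b hb hbc hbd
    have E1 : ∀ᶠ e in atTop, (rr e : ℝ) ≤ (∑ i, b i) * (p : ℝ) ^ e - n := by
      have h1 : Tendsto (fun e : ℕ => (rr e : ℝ) / (p : ℝ) ^ e + n / (p : ℝ) ^ e) atTop (𝓝 (c + 0)) :=
        hrl.add (hpt.const_div_atTop _)
      rw [add_zero] at h1
      filter_upwards [h1.eventually_lt_const hbc] with e he
      rw [← add_div, div_lt_iff₀ (hp0 _)] at he
      linarith
    have E2 : ∀ᶠ e in atTop, (∑ i, b i * d i) * (p : ℝ) ^ e + d i0 < B * (p : ℝ) ^ e := by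
      have h1 := (tendsto_const_nhds (x := ∑ i, b i * (d i : ℝ))).add
        (hpt.const_div_atTop (d i0 : ℝ))
      rw [add_zero] at h1
      filter_upwards [h1.eventually_lt_const hbd] with e he
      rw [← mul_lt_mul_iff_left₀ (hp0 e), add_mul, div_mul_cancel₀ _ (hp0 _).ne'] at he
      exact he
    obtain ⟨j, hj, h1, h2⟩ := (hxf.and_eventually
      ((hφt.eventually E1).and (hφt.eventually E2))).exists
    set β : Fin n → ℕ := fun i => ⌊b i * (p : ℝ) ^ φ j⌋₊ with hβ
    have hβle : ∀ i, (β i : ℝ) ≤ b i * (p : ℝ) ^ φ j := fun i =>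
      Nat.floor_le (mul_nonneg (hb i) (hp0 _).le)
    have hβge : ∀ i, b i * (p : ℝ) ^ φ j - 1 ≤ (β i : ℝ) := fun i => (Nat.sub_one_lt_floor _).le
    have hlenb : rr (φ j) ≤ len β := by
      have h3 : (∑ i, b i) * (p : ℝ) ^ φ j - n ≤ (len β : ℝ) := by
        have := Finset.sum_le_sum fun i (_ : i ∈ Finset.univ) => hβge i
        rw [Finset.sum_sub_distrib, ← Finset.sum_mul] at this
        simp only [Finset.sum_const, Finset.card_univ, Fintype.card_fin, nsmul_eq_mul, mul_one] at this
        simpa [len] using this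
      exact_mod_cast h1.trans h3
    have hwle : ∀ w : Fin n → ℕ, ∑ i, (β i : ℝ) * w i ≤ (∑ i, b i * w i) * (p : ℝ) ^ φ j := by
      intro w
      rw [Finset.sum_mul]
      refine Finset.sum_le_sum fun i _ => ?_
      have := mul_le_mul_of_nonneg_right (hβle i) (Nat.cast_nonneg (α := ℝ) (w i))
      linarith
    obtain ⟨h5, h6⟩ := hj.2.2 β hlenb (by
      intro i hi
      have h3 := sys.lo (φ j) i
      rw [← hBk i hi] at h3
      have h4 := hwle d
      rw [← hnnR] at h4
      have : (nn d β : ℝ) + d i0 < sys.m (φ j) i := by linarith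
      exact_mod_cast this)
    have h7 := hwle v
    have h5' : (((p : ℤ) ^ (φ j - e0) * ζ : ℤ) : ℝ) ≤ ((∑ i, (β i : ℤ) * v i : ℤ) : ℝ) :=
      Int.cast_le.2 h5
    have h6' : (1 : ℝ) ≤ ((∑ i, (β i : ℤ) * v i : ℤ) : ℝ) := by exact_mod_cast h6
    rw [hpZ j hj.1] at h5'
    push_cast at h5' h6'
    have hpp := hp0 (φ j)
    constructor
    · have : Z * (p : ℝ) ^ φ j ≤ (∑ i, b i * v i) * (p : ℝ) ^ φ j := by linarith
      exact le_of_mul_le_mul_right this hpp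
    · have : 0 < (∑ i, b i * v i) * (p : ℝ) ^ φ j := by linarith
      exact pos_of_mul_pos_left this hpp.le
  obtain ⟨X, y, w, hX0, hX1, hX⟩ := lp' d v hd c Z B hc i0 hlt SU ⟨a, ha0, hac, hBa, Lx⟩ dd C.dl hdlp
    hdd (hT _ hx)
  refine ⟨C.dl * r.factorial * X, ?_, Nat.mul_le_mul_left _ hX1, ?_⟩
  · have := r.factorial_pos
    positivity
  · have : ((C.dl * r.factorial * X : ℕ) : ℝ) * c =
        (C.dl : ℝ) * (r.factorial : ℝ) * (y * Z) + w * (C.dl * r.factorial * B) := by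
      push_cast
      rw [mul_assoc, hX]; ring
    rw [this]
    exact (((PI.nat _).mul (PI.nat _)).mul ((PI.int y).mul hZPI)).add ((PI.int w).mul hBPI)
end FT

namespace FT
open Polynomial IntermediateField
set_option linter.unusedSectionVars false

lemma dim_le_of_integral {A B : Type*} [CommRing A] [CommRing B] [Algebra A B]
    [Algebra.IsIntegral A B] : ringKrullDim B ≤ ringKrullDim A := by
  apply Order.krullDim_le_of_strictMono (PrimeSpectrum.comap (algebraMap A B))
  intro P Q h
  have h' : P.asIdeal < Q.asIdeal := h
  have := Ideal.IsIntegral.comap_lt_comap (R := A) h'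
  exact this

section gr
variable {K S : Type*} [Field K] [CommRing S] [IsDomain S] [Algebra K S]

lemma two_le_trdeg [Algebra.FiniteType K S] (h : ringKrullDim S = 2) :
    2 ≤ Algebra.trdeg K S := by
  obtain ⟨s, g, inj, int⟩ := exists_integral_inj_algHom_of_fg K S
  let _ : Algebra (MvPolynomial (Fin s) K) S := g.toRingHom.toAlgebra
  have : Algebra.IsIntegral (MvPolynomial (Fin s) K) S := ⟨int⟩
  have h1 := dim_le_of_integral (A := MvPolynomial (Fin s) K) (B := S)
  rw [h, MvPolynomial.ringKrullDim_of_isNoetherianRing, ringKrullDim_eq_zero_of_field] at h1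
  have h2 : 2 ≤ s := by
    rw [zero_add] at h1
    have h1' : 2 ≤ Nat.card (Fin s) := by exact_mod_cast h1
    simpa using h1'
  have h3 : AlgebraicIndependent K (fun i => g (MvPolynomial.X i)) := by
    rw [AlgebraicIndependent]
    have : MvPolynomial.aeval (fun i => g (MvPolynomial.X i)) = g := by
      ext i; simp
    rw [this]; exact inj
  have h4 := h3.lift_cardinalMk_le_trdeg
  simp at h4
  exact le_trans (by exact_mod_cast h2) h4

/-- Graded domain with homogeneous generators of positive degree. -/
structure Gr {K S : Type*} [Field K] [CommRing S] [Algebra K S]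
    (𝒮 : ℕ → Submodule K S) {n : ℕ} (x : Fin n → S) (d : Fin n → ℕ) : Prop where
  h0 : ∀ s ∈ 𝒮 0, ∃ a : K, s = algebraMap K S a
  hx : ∀ i, x i ∈ 𝒮 (d i)
  hx0 : ∀ i, x i ≠ 0
  hd : ∀ i, 1 ≤ d i
  gen : Algebra.adjoin K (Set.range x) = ⊤

variable {𝒮 : ℕ → Submodule K S} [GradedAlgebra 𝒮] {n : ℕ} {x : Fin n → S} {d : Fin n → ℕ}

lemma prod_mem_gr (hx : ∀ i, x i ∈ 𝒮 (d i)) (α : Fin n → ℕ) :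
    ∏ i, x i ^ α i ∈ 𝒮 (∑ i, α i * d i) := by
  apply SetLike.prod_mem_graded
  intro i _
  simpa using SetLike.pow_mem_graded (α i) (hx i)

namespace Gr

lemma ft (G : Gr 𝒮 x d) : Algebra.FiniteType K S := by
  classical
  exact ⟨⟨Finset.univ.image x, by simpa using G.gen⟩⟩

lemma noeth (G : Gr 𝒮 x d) : IsNoetherianRing S := by
  have := G.ft
  exact Algebra.FiniteType.isNoetherianRing K S

lemma mono_span (G : Gr 𝒮 x d) {m : ℕ} {s : S} (hs : s ∈ 𝒮 m) :
    s ∈ Submodule.span K {y | ∃ α : Fin n → ℕ, ∑ i, α i * d i = m ∧ y = ∏ i, x i ^ α i} := by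
  have h1 : s ∈ Algebra.adjoin K (Set.range x) := by rw [G.gen]; trivial
  rw [Algebra.adjoin_range_eq_range_aeval] at h1
  obtain ⟨P, hP⟩ := h1
  have h2 : s = ∑ α ∈ P.support, P.coeff α • ∏ i, x i ^ α i := by
    rw [← hP]
    conv_lhs => rw [P.as_sum]
    simp only [RingHom.coe_coe, AlgHom.toRingHom_eq_coe, map_sum]
    apply Finset.sum_congr rfl
    intro α _
    simp [MvPolynomial.aeval_monomial, Algebra.smul_def, Finsupp.prod_fintype]
  have h3 : s = ∑ α ∈ P.support, P.coeff α •
      ((DirectSum.decompose 𝒮 (∏ i, x i ^ α i) m : 𝒮 m) : S) := by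
    conv_lhs => rw [← DirectSum.decompose_of_mem_same 𝒮 hs, h2]
    rw [DirectSum.decompose_sum, DFinsupp.finsetSum_apply, Submodule.coe_sum]
    apply Finset.sum_congr rfl
    intro α _
    rw [DirectSum.decompose_smul]
    rfl
  rw [h3]
  apply Submodule.sum_mem
  intro α _
  apply Submodule.smul_mem
  by_cases h : ∑ i, α i * d i = m
  · apply Submodule.subset_span
    refine ⟨α, h, ?_⟩
    exact DirectSum.decompose_of_mem_same 𝒮 (h ▸ prod_mem_gr G.hx α)
  · rw [DirectSum.decompose_of_mem_ne 𝒮 (prod_mem_gr G.hx α) h]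
    exact Submodule.zero_mem _

lemma _root_.FT.hom_comb {ι : Type*} [Fintype ι] {f : ι → S} {e : ι → ℕ} (hf : ∀ j, f j ∈ 𝒮 (e j))
    {m : ℕ} {s : S} (hs : s ∈ 𝒮 m) (h : s ∈ Ideal.span (Set.range f)) :
    ∃ h : ι → S, (∀ j, (e j ≤ m ∧ h j ∈ 𝒮 (m - e j)) ∨ h j = 0) ∧ s = ∑ j, h j * f j := by
  rw [Ideal.mem_span_range_iff_exists_fun] at h
  obtain ⟨c, hc⟩ := h
  classical
  refine ⟨fun j => if e j ≤ m then ((DirectSum.decompose 𝒮 (c j) (m - e j) : 𝒮 (m - e j)) : S) else 0,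
    fun j => ?_, ?_⟩
  · by_cases h : e j ≤ m
    · left; simp [h]
    · right; simp [h]
  · conv_lhs => rw [← DirectSum.decompose_of_mem_same 𝒮 hs, ← hc]
    rw [DirectSum.decompose_sum, DFinsupp.finsetSum_apply, Submodule.coe_sum]
    apply Finset.sum_congr rfl
    intro j _
    dsimp only
    by_cases h : e j ≤ m
    · rw [DirectSum.coe_decompose_mul_of_right_mem_of_le 𝒮 (hf j) h, if_pos h]
    · rw [DirectSum.coe_decompose_mul_of_right_mem_of_not_le 𝒮 (hf j) h, if_neg h, zero_mul]

lemma comp_mem (G : Gr 𝒮 x d) {m : ℕ} (hm : 0 < m) {s : S} (hs : s ∈ 𝒮 m) : s ∈ Ideal.span (Set.range x) := by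
  have h := G.mono_span hs
  have : Submodule.span K {y | ∃ α : Fin n → ℕ, ∑ i, α i * d i = m ∧ y = ∏ i, x i ^ α i} ≤
      (Ideal.span (Set.range x)).restrictScalars K := by
    rw [Submodule.span_le]
    rintro _ ⟨α, hα, rfl⟩
    have : ∃ i, α i ≠ 0 := by
      by_contra hcon
      push Not at hcon
      simp [hcon] at hα
      omega
    obtain ⟨i, hi⟩ := this
    have hd : x i ∣ ∏ i, x i ^ α i :=
      (dvd_pow_self _ hi).trans (Finset.dvd_prod_of_mem (fun i => x i ^ α i) (Finset.mem_univ i))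
    exact Ideal.mem_of_dvd _ hd (Ideal.subset_span ⟨i, rfl⟩)
  exact this h

lemma decomp (G : Gr 𝒮 x d) (s : S) : ∃ a : K, s - algebraMap K S a ∈ Ideal.span (Set.range x) ∧
    algebraMap K S a = ((DirectSum.decompose 𝒮 s 0 : 𝒮 0) : S) := by
  classical
  obtain ⟨a, ha⟩ := G.h0 _ (DirectSum.decompose 𝒮 s 0).2
  refine ⟨a, ?_, ha.symm⟩
  rw [← ha]
  have h1 := DirectSum.sum_support_decompose 𝒮 s
  have h2 : s - ((DirectSum.decompose 𝒮 s 0 : 𝒮 0) : S) =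
      ∑ i ∈ (DirectSum.decompose 𝒮 s).support.erase 0, ((DirectSum.decompose 𝒮 s i : 𝒮 i) : S) := by
    rw [sub_eq_iff_eq_add]
    by_cases h : 0 ∈ (DirectSum.decompose 𝒮 s).support
    · rw [Finset.sum_erase_add _ _ h, h1]
    · rw [Finset.erase_eq_of_notMem h, h1]
      simp at h
      simp [h]
  rw [h2]
  apply Ideal.sum_mem
  intro i hi
  have := Finset.ne_of_mem_erase hi
  exact G.comp_mem (by omega) (DirectSum.decompose 𝒮 s i).2

lemma one_notMem (G : Gr 𝒮 x d) : (1 : S) ∉ Ideal.span (Set.range x) := by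
  intro h
  have h1 : Ideal.span (Set.range x) ≤ (HomogeneousIdeal.irrelevant 𝒮).toIdeal := by
    rw [Ideal.span_le]
    rintro _ ⟨i, rfl⟩
    have := G.hd i
    rw [SetLike.mem_coe, HomogeneousIdeal.mem_iff, HomogeneousIdeal.mem_irrelevant_iff]
    rw [GradedRing.proj_apply, DirectSum.decompose_of_mem_ne 𝒮 (G.hx i) (by omega)]
  have h2 := h1 h
  rw [HomogeneousIdeal.mem_iff, HomogeneousIdeal.mem_irrelevant_iff, GradedRing.proj_apply,
    DirectSum.decompose_of_mem_same 𝒮 SetLike.GradedOne.one_mem] at h2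
  exact one_ne_zero h2

lemma isMax (G : Gr 𝒮 x d) : (Ideal.span (Set.range x)).IsMaximal := by
  rw [Ideal.isMaximal_iff]
  refine ⟨G.one_notMem, ?_⟩
  intro J s hJ hs hsJ
  obtain ⟨a, ha, -⟩ := G.decomp s
  have hane : a ≠ 0 := by
    rintro rfl
    simp at ha
    exact hs ha
  have h1 : algebraMap K S a ∈ J := by
    have := J.sub_mem hsJ (hJ ha)
    simpa using this
  have := J.mul_mem_left (algebraMap K S a⁻¹) h1
  rwa [← map_mul, inv_mul_cancel₀ hane, map_one] at this

lemma le_mm (G : Gr 𝒮 x d) {J : Ideal S} (hJ : J.IsHomogeneous 𝒮) (hJ1 : J ≠ ⊤) :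
    J ≤ Ideal.span (Set.range x) := by
  intro s hs
  obtain ⟨a, ha, ha0⟩ := G.decomp s
  have h1 : algebraMap K S a ∈ J := by rw [ha0]; exact hJ 0 hs
  have hane : a = 0 := by
    by_contra hane
    apply hJ1
    rw [Ideal.eq_top_iff_one]
    have := J.mul_mem_left (algebraMap K S a⁻¹) h1
    rwa [← map_mul, inv_mul_cancel₀ hane, map_one] at this
  subst hane
  simpa using ha

lemma _root_.FT.minPrime_hom {J : Ideal S} (hJ : J.IsHomogeneous 𝒮) {P : Ideal S}
    (hP : P ∈ J.minimalPrimes) : P.IsHomogeneous 𝒮 := by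
  have hPp := hP.1.1
  have h1 := hPp.homogeneousCore (𝒜 := 𝒮)
  have h2 : J ≤ (P.homogeneousCore 𝒮).toIdeal := by
    rw [← hJ.toIdeal_homogeneousCore_eq_self]
    exact Ideal.homogeneousCore_mono 𝒮 hP.1.2
  have h3 := hP.2 ⟨h1, h2⟩ (Ideal.toIdeal_homogeneousCore_le 𝒮 P)
  have h4 := le_antisymm h3 (Ideal.toIdeal_homogeneousCore_le 𝒮 P)
  rw [h4]
  exact (P.homogeneousCore 𝒮).isHomogeneous

lemma exists_v (G : Gr 𝒮 x d) [Infinite K] (hdim : ringKrullDim S ≤ 2) {T : S} (hT : T ∈ 𝒮 1) (hT0 : T ≠ 0)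
    {g : ℕ} (hg : 0 < g) (hdg : ∀ i, d i ∣ g) :
    ∃ v ∈ 𝒮 g, Ideal.span (Set.range x) ≤ (Ideal.span {T, v}).radical := by
  have := G.noeth
  have hTh : (Ideal.span {T}).IsHomogeneous 𝒮 := Ideal.homogeneous_span _ _ (by
    rintro y rfl; exact ⟨1, hT⟩)
  by_cases hc : ∃ P ∈ (Ideal.span {T}).minimalPrimes, Ideal.span (Set.range x) ≤ P
  · obtain ⟨P, hP, hxP⟩ := hc
    refine ⟨0, Submodule.zero_mem _, ?_⟩
    have : Ideal.span {T, 0} = Ideal.span {T} := by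
      rw [Ideal.span_insert]; simp
    rw [this, ← Ideal.sInf_minimalPrimes]
    apply le_sInf
    intro Q hQ
    have h1 := G.le_mm (minPrime_hom hTh hQ) hQ.1.1.ne_top
    exact hP.2 hQ.1 (h1.trans hxP) |>.trans' hxP
  · push Not at hc
    have hfin := Ideal.finite_minimalPrimes_of_isNoetherianRing S (Ideal.span {T})
    -- choose v
    let φ : Ideal S → Submodule K (𝒮 g) := fun P => (P.restrictScalars K).comap (𝒮 g).subtype
    have hsub := Subspace.biUnion_ne_univ_of_top_notMem (s := hfin.toFinset.image φ) (by
      intro htop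
      simp only [Finset.mem_image, Set.Finite.mem_toFinset] at htop
      obtain ⟨P, hP, hPt⟩ := htop
      apply hc P hP
      rw [Ideal.span_le]
      rintro _ ⟨i, rfl⟩
      obtain ⟨k, hk⟩ := hdg i
      have h1 : x i ^ k ∈ 𝒮 g := by
        have := SetLike.pow_mem_graded k (G.hx i)
        rwa [hk, mul_comm]
      have h2 : (⟨_, h1⟩ : 𝒮 g) ∈ φ P := by rw [hPt]; trivial
      exact hP.1.1.mem_of_pow_mem k h2)
    obtain ⟨v, hv⟩ := (Set.ne_univ_iff_exists_notMem _).1 hsub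
    have hv' : ∀ P ∈ (Ideal.span {T}).minimalPrimes, (v : S) ∉ P := by
      intro P hP hvP
      apply hv
      simp only [Set.mem_iUnion]
      refine ⟨φ P, ?_, hvP⟩
      simp only [Finset.mem_image, Set.Finite.mem_toFinset]
      exact ⟨P, hP, rfl⟩
    refine ⟨v, v.2, ?_⟩
    have hTv : (Ideal.span {T, (v : S)}).IsHomogeneous 𝒮 := Ideal.homogeneous_span _ _ (by
      rintro y (rfl | rfl)
      · exact ⟨1, hT⟩
      · exact ⟨g, v.2⟩)
    rw [← Ideal.sInf_minimalPrimes]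
    apply le_sInf
    intro Q hQ
    have hQp := hQ.1.1
    have hQm := G.le_mm (minPrime_hom hTv hQ) hQp.ne_top
    by_contra hQn
    have hTQ : Ideal.span {T} ≤ Q := le_trans (Ideal.span_mono (by simp)) hQ.1.2
    obtain ⟨P, hP, hPQ⟩ := Ideal.exists_minimalPrimes_le hTQ
    have hPp := hP.1.1
    have hmp := G.isMax.isPrime
    have l1 : (⊥ : Ideal S) < P := by
      rw [bot_lt_iff_ne_bot]
      rintro rfl
      have := hP.1.2 (Ideal.mem_span_singleton_self T)
      exact hT0 (by simpa using this)
    have l2 : P < Q := lt_of_le_of_ne hPQ (by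
      rintro rfl
      exact hv' P hP (hQ.1.2 (Ideal.subset_span (by simp))))
    have l3 : Q < Ideal.span (Set.range x) := lt_of_le_not_ge hQm hQn
    let c0 : PrimeSpectrum S := ⟨⊥, Ideal.isPrime_bot⟩
    let c1 : PrimeSpectrum S := ⟨P, hPp⟩
    let c2 : PrimeSpectrum S := ⟨Q, hQp⟩
    let c3 : PrimeSpectrum S := ⟨_, hmp⟩
    let ch : LTSeries (PrimeSpectrum S) := LTSeries.mk 3 ![c0, c1, c2, c3] (by
      rw [Fin.strictMono_iff_lt_succ]
      intro i
      fin_cases i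
      · exact l1
      · exact l2
      · exact l3)
    have := Order.LTSeries.length_le_krullDim ch
    have h3 : ch.length = 3 := rfl
    rw [h3] at this
    have h4 := this.trans hdim
    norm_cast at h4

/-- the `TV` lemma -/
lemma exists_TV (G : Gr 𝒮 x d) [Infinite K] (hdim : ringKrullDim S ≤ 2) {T : S} (hT : T ∈ 𝒮 1) (hT0 : T ≠ 0)
    {g : ℕ} (hg : 0 < g) (hdg : ∀ i, d i ∣ g) :
    ∃ v ∈ 𝒮 g, ∃ m1 : ℕ, g < m1 ∧ ∀ m ≥ m1, ∀ s ∈ 𝒮 m, ∃ a ∈ 𝒮 (m - 1), ∃ b ∈ 𝒮 (m - g),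
      s = T * a + v * b := by
  obtain ⟨v, hv, hr⟩ := G.exists_v hdim hT hT0 hg hdg
  refine ⟨v, hv, ?_⟩
  have hN : ∃ N : ℕ, ∀ i, x i ^ N ∈ Ideal.span {T, v} := by
    have h1 : ∀ i, ∃ N : ℕ, x i ^ N ∈ Ideal.span {T, v} := fun i => hr (Ideal.subset_span ⟨i, rfl⟩)
    choose N hN using h1
    refine ⟨Finset.univ.sup N, fun i => Ideal.mem_of_dvd _ (pow_dvd_pow _ ?_) (hN i)⟩
    exact Finset.le_sup (Finset.mem_univ i)
  obtain ⟨N, hN⟩ := hN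
  refine ⟨∑ i, N * d i + g + 1, by omega, ?_⟩
  intro m hm s hs
  have h1 : s ∈ Ideal.span {T, v} := by
    have h := G.mono_span hs
    have : Submodule.span K {y | ∃ α : Fin n → ℕ, ∑ i, α i * d i = m ∧ y = ∏ i, x i ^ α i} ≤
        (Ideal.span {T, v}).restrictScalars K := by
      rw [Submodule.span_le]
      rintro _ ⟨α, hα, rfl⟩
      have : ∃ i, N ≤ α i := by
        by_contra hcon
        push Not at hcon
        have : ∑ i, α i * d i ≤ ∑ i, N * d i := Finset.sum_le_sum fun i _ =>
          Nat.mul_le_mul_right _ (hcon i).le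
        omega
      obtain ⟨i, hi⟩ := this
      have hd : x i ^ N ∣ ∏ i, x i ^ α i :=
        (pow_dvd_pow _ hi).trans (Finset.dvd_prod_of_mem (fun i => x i ^ α i) (Finset.mem_univ i))
      exact Ideal.mem_of_dvd _ hd (hN i)
    exact this h
  have h2 : s ∈ Ideal.span (Set.range ![T, v]) := by simpa [Set.pair_comm v T] using h1
  obtain ⟨h, hh, hs2⟩ := hom_comb (𝒮 := 𝒮) (f := ![T, v]) (e := ![1, g])
    (by intro j; fin_cases j <;> simp [hT, hv]) hs h2
  refine ⟨h 0, ?_, h 1, ?_, ?_⟩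
  · rcases hh 0 with ⟨-, h⟩ | h
    · simpa using h
    · rw [h]; exact Submodule.zero_mem _
  · rcases hh 1 with ⟨-, h⟩ | h
    · simpa using h
    · rw [h]; exact Submodule.zero_mem _
  · rw [hs2, Fin.sum_univ_two]; simp [mul_comm]

end Gr
end gr
end FT

namespace FT
open Polynomial IntermediateField
set_option linter.unusedSectionVars false

section gr
variable {K S : Type*} [Field K] [CommRing S] [IsDomain S] [Algebra K S]
variable {𝒮 : ℕ → Submodule K S} [GradedAlgebra 𝒮] {n : ℕ} {x : Fin n → S} {d : Fin n → ℕ}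

lemma Gr.fd (G : Gr 𝒮 x d) (m : ℕ) : (𝒮 m).FG := by
  have hfin : ({y | ∃ α : Fin n → ℕ, ∑ i, α i * d i = m ∧ y = ∏ i, x i ^ α i} : Set S).Finite := by
    have h1 : (Set.Iic (fun _ : Fin n => m)).Finite := Set.finite_Iic _
    refine (h1.image (fun α : Fin n → ℕ => ∏ i, x i ^ α i)).subset ?_
    rintro _ ⟨α, hα, rfl⟩
    refine ⟨α, ?_, rfl⟩
    intro i
    have h2 : α i * d i ≤ m := by
      rw [← hα]; exact Finset.single_le_sum (f := fun i => α i * d i) (fun _ _ => Nat.zero_le _) (Finset.mem_univ i)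
    exact le_trans (Nat.le_mul_of_pos_right _ (G.hd i)) h2
  refine ⟨hfin.toFinset, ?_⟩
  apply le_antisymm
  · rw [Submodule.span_le]
    intro y hy
    simp only [Set.Finite.coe_toFinset] at hy
    obtain ⟨α, hα, rfl⟩ := hy
    rw [← hα]; exact prod_mem_gr G.hx α
  · intro s hs
    simpa using G.mono_span hs

/-- the parameters `T, v` -/
structure Tv (𝒮 : ℕ → Submodule K S) (T v : S) (g m1 : ℕ) : Prop where
  hT : T ∈ 𝒮 1
  T0 : T ≠ 0
  hg : 0 < g
  hv : v ∈ 𝒮 g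
  hm : g < m1
  st : ∀ m ≥ m1, ∀ s ∈ 𝒮 m, ∃ a ∈ 𝒮 (m - 1), ∃ b ∈ 𝒮 (m - g), s = T * a + v * b

variable {T v : S} {g m1 : ℕ}
variable {F : Type*} [Field F] [Algebra S F] [IsFractionRing S F] [Algebra K F] [IsScalarTower K S F]

lemma Tv.integral (H : Tv 𝒮 T v g m1) (hfd : ∀ m, (𝒮 m).FG) {K1 : Type*} [Field K1] [Algebra K K1]
    [Algebra K1 F] [IsScalarTower K K1 F] (B : Subalgebra K1 F) (w : F)
    (hTB : algebraMap S F T * w ∈ B) (hvB : algebraMap S F v * w ^ g ∈ B)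
    (hw : w ≠ 0) {m : ℕ} {s : S} (hs : s ∈ 𝒮 m) :
    IsIntegral B (algebraMap S F s * w ^ m) := by
  classical
  choose b hb using hfd
  let Z : Finset F := (Finset.range m1).biUnion fun m => (b m).image fun s => algebraMap S F s * w ^ m
  let N : Submodule B F := Submodule.span B (Z : Set F)
  have key : ∀ m : ℕ, ∀ s ∈ 𝒮 m, algebraMap S F s * w ^ m ∈ N := by
    intro m
    induction m using Nat.strong_induction_on with
    | _ m ih =>
      intro s hs
      by_cases hm : m < m1
      · rw [← hb m] at hs
        induction hs using Submodule.span_induction with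
        | mem y hy =>
          apply Submodule.subset_span
          simp only [Z, Finset.coe_biUnion, Set.mem_iUnion, Finset.mem_coe, Finset.mem_image]
          exact ⟨m, by simpa using hm, y, hy, rfl⟩
        | zero => simp
        | add y z _ _ hy hz => rw [map_add, add_mul]; exact N.add_mem hy hz
        | smul a y _ hy =>
          have : algebraMap S F (a • y) * w ^ m =
              (algebraMap K1 B (algebraMap K K1 a)) • (algebraMap S F y * w ^ m) := by
            rw [Algebra.smul_def, map_mul, ← IsScalarTower.algebraMap_apply K S F, Algebra.smul_def, mul_assoc,
              ← IsScalarTower.algebraMap_apply K1 B F, ← IsScalarTower.algebraMap_apply K K1 F]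
          rw [this]
          exact N.smul_mem _ hy
      · have := H.hm
        have := H.hg
        obtain ⟨a, ha, c, hc, rfl⟩ := H.st m (by omega) s hs
        have h1 := N.smul_mem ⟨_, hTB⟩ (ih (m - 1) (by omega) a ha)
        have h2 := N.smul_mem ⟨_, hvB⟩ (ih (m - g) (by omega) c hc)
        have h3 := N.add_mem h1 h2
        convert h3 using 1
        rw [Subalgebra.smul_def, Subalgebra.smul_def]
        simp only [smul_eq_mul, map_add, map_mul]
        have e1 : w ^ m = w * w ^ (m - 1) := by rw [← pow_succ']; congr 1; omega
        have e2 : w ^ m = w ^ g * w ^ (m - g) := by rw [← pow_add]; congr 1; omega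
        rw [add_mul]
        congr 1
        · rw [e1]; ring
        · rw [e2]; ring
  have hmul : ∀ m : ℕ, ∀ s ∈ 𝒮 m, ∀ z ∈ N, (algebraMap S F s * w ^ m) * z ∈ N := by
    intro m s hs z hz
    induction hz using Submodule.span_induction with
    | mem y hy =>
      simp only [Z, Finset.coe_biUnion, Set.mem_iUnion, Finset.mem_coe, Finset.mem_image] at hy
      obtain ⟨k, hk, s', hs', rfl⟩ := hy
      have h1 : s' ∈ 𝒮 k := by rw [← hb k]; exact Submodule.subset_span hs'
      have h2 := key _ _ (SetLike.GradedMul.mul_mem hs h1)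
      convert h2 using 1
      rw [map_mul, pow_add]; ring
    | zero => simp
    | add y z _ _ hy hz => rw [mul_add]; exact N.add_mem hy hz
    | smul a y _ hy => rw [mul_smul_comm]; exact N.smul_mem _ hy
  apply isIntegral_of_smul_mem_submodule N ?_ ⟨Z, rfl⟩
  · intro z hz; exact hmul m s hs z hz
  · intro h0
    have h1 := key 1 T H.hT
    rw [h0, Submodule.mem_bot] at h1
    have hT0 : algebraMap S F T ≠ 0 := by
      simpa using H.T0
    simp [hT0, hw] at h1

/-- the parameter `u` -/
noncomputable def uu (F : Type*) [Field F] [Algebra S F] (T v : S) (g : ℕ) : F :=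
  (1 - algebraMap S F v) / algebraMap S F T ^ g

lemma Tv.T0F (H : Tv 𝒮 T v g m1) : algebraMap S F T ≠ 0 := by simpa using H.T0

lemma Tv.u_eq (H : Tv 𝒮 T v g m1) :
    uu F T v g * algebraMap S F T ^ g = 1 - algebraMap S F v := by
  rw [uu, div_mul_cancel₀]
  exact pow_ne_zero _ H.T0F

lemma Tv.one_eq (H : Tv 𝒮 T v g m1) :
    (1 : F) = algebraMap S F v + uu F T v g * algebraMap S F T ^ g := by
  rw [H.u_eq]; ring

/-- The base field. -/
noncomputable abbrev KK (K F : Type*) {S : Type*} [Field K] [CommRing S] [Field F] [Algebra S F] [Algebra K F] (T v : S) (g : ℕ) :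
  IntermediateField K F := K⟮uu F T v g⟯

/-- u as an element -/
noncomputable def uK (K F : Type*) {S : Type*} [Field K] [CommRing S] [Field F] [Algebra S F] [Algebra K F] (T v : S) (g : ℕ) : KK K F T v g :=
  ⟨uu F T v g, mem_adjoin_simple_self K _⟩

/-- homogeneous pieces in a window -/
noncomputable def VV (F : Type*) [Field F] [Algebra S F] [Algebra K F] (𝒮 : ℕ → Submodule K S) (T v : S) (g : ℕ) (n : ℤ) :
    Submodule (KK K F T v g) F :=
  Submodule.span _ {y | ∃ i : ℕ, (i : ℤ) ≤ n ∧ ∃ s ∈ 𝒮 i, algebraMap S F s = y}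

variable (F) in
lemma mem_VV {n : ℤ} {i : ℕ} (hi : (i : ℤ) ≤ n) {s : S} (hs : s ∈ 𝒮 i) :
    algebraMap S F s ∈ VV F 𝒮 T v g n := Submodule.subset_span ⟨i, hi, s, hs, rfl⟩

lemma VV_mono : Monotone (VV F 𝒮 T v g) := by
  intro a b hab
  apply Submodule.span_mono
  rintro y ⟨i, hi, h⟩
  exact ⟨i, hi.trans hab, h⟩

lemma VV_neg {n : ℤ} (hn : n < 0) : VV F 𝒮 T v g n = ⊥ := by
  rw [VV, Submodule.span_eq_bot]
  rintro y ⟨i, hi, -⟩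
  omega

lemma VV_mul {a b : ℤ} {y z : F} (hy : y ∈ VV F 𝒮 T v g a) (hz : z ∈ VV F 𝒮 T v g b) :
    y * z ∈ VV F 𝒮 T v g (a + b) := by
  induction hy using Submodule.span_induction with
  | zero => simp
  | add y y' _ _ h h' => rw [add_mul]; exact Submodule.add_mem _ h h'
  | smul c y _ h => rw [smul_mul_assoc]; exact Submodule.smul_mem _ _ h
  | mem y hy =>
    obtain ⟨i, hi, s, hs, rfl⟩ := hy
    induction hz using Submodule.span_induction with
    | zero => simp
    | add y y' _ _ h h' => rw [mul_add]; exact Submodule.add_mem _ h h'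
    | smul c y _ h => rw [mul_smul_comm]; exact Submodule.smul_mem _ _ h
    | mem z hz =>
      obtain ⟨j, hj, s', hs', rfl⟩ := hz
      rw [← map_mul]
      exact mem_VV F (i := i + j) (by push_cast; omega) (SetLike.GradedMul.mul_mem hs hs')

lemma VV_one : (1 : F) ∈ VV F 𝒮 T v g 0 := by
  rw [← map_one (algebraMap S F)]
  exact mem_VV F (i := 0) (by simp) SetLike.GradedOne.one_mem

lemma VV_T (H : Tv 𝒮 T v g m1) : algebraMap S F T ∈ VV F 𝒮 T v g 1 := mem_VV F (i := 1) (by simp) H.hT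

lemma VV_Tpow (H : Tv 𝒮 T v g m1) (k : ℕ) : algebraMap S F T ^ k ∈ VV F 𝒮 T v g k := by
  rw [← map_pow]
  exact mem_VV F (i := k) le_rfl (by simpa using SetLike.pow_mem_graded k H.hT)

lemma VV_win (H : Tv 𝒮 T v g m1) (n : ℤ) : VV F 𝒮 T v g n ≤ Submodule.span (KK K F T v g)
    {y | ∃ i : ℕ, (i : ℤ) ≤ n ∧ n < i + g ∧ ∃ s ∈ 𝒮 i, algebraMap S F s = y} := by
  rw [VV, Submodule.span_le]
  rintro y ⟨i, hi, s, hs, rfl⟩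
  obtain ⟨k, hk⟩ : ∃ k : ℕ, (n - i).toNat ≤ k := ⟨_, le_rfl⟩
  induction k using Nat.strong_induction_on generalizing i s with
  | _ k ih =>
    by_cases hc : n < i + g
    · exact Submodule.subset_span ⟨i, hi, hc, s, hs, rfl⟩
    · have hg := H.hg
      have e1 : algebraMap S F s = algebraMap S F (v * s) + uK K F T v g • algebraMap S F (T ^ g * s) := by
        have : uK K F T v g • algebraMap S F (T ^ g * s) = uu F T v g * algebraMap S F (T ^ g * s) := rfl
        rw [this, map_mul, map_mul, map_pow]
        have := H.one_eq (F := F)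
        linear_combination (algebraMap S F s) * this
      rw [e1]
      have hTg : T ^ g ∈ 𝒮 g := by simpa using SetLike.pow_mem_graded g H.hT
      apply Submodule.add_mem
      · exact ih (k - 1) (by omega) (g + i) (by push_cast; omega) _ (SetLike.GradedMul.mul_mem H.hv hs)
          (by push_cast; omega)
      · apply Submodule.smul_mem
        exact ih (k - 1) (by omega) (g + i) (by push_cast; omega) _ (SetLike.GradedMul.mul_mem hTg hs)
          (by push_cast; omega)

lemma VV_step (H : Tv 𝒮 T v g m1) {n : ℤ} (hn : (m1 : ℤ) ≤ n) {y : F} (hy : y ∈ VV F 𝒮 T v g n) :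
    ∃ a ∈ VV F 𝒮 T v g (n - 1), ∃ b ∈ VV F 𝒮 T v g (n - 1), y = a + algebraMap S F T * b := by
  induction hy using Submodule.span_induction with
  | zero => exact ⟨0, Submodule.zero_mem _, 0, Submodule.zero_mem _, by simp⟩
  | add y z _ _ h1 h2 =>
    obtain ⟨a, ha, b, hb, rfl⟩ := h1
    obtain ⟨a', ha', b', hb', rfl⟩ := h2
    exact ⟨a + a', Submodule.add_mem _ ha ha', b + b', Submodule.add_mem _ hb hb', by ring⟩
  | smul c y _ h =>
    obtain ⟨a, ha, b, hb, rfl⟩ := h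
    exact ⟨c • a, Submodule.smul_mem _ _ ha, c • b, Submodule.smul_mem _ _ hb, by
      rw [smul_add, mul_smul_comm]⟩
  | mem y hy =>
    obtain ⟨i, hi, s, hs, rfl⟩ := hy
    by_cases hin : (i : ℤ) ≤ n - 1
    · exact ⟨_, mem_VV F hin hs, 0, Submodule.zero_mem _, by simp⟩
    have hm := H.hm
    have hg := H.hg
    have hi1 : (i : ℤ) = n := by omega
    obtain ⟨a, ha, b, hb, rfl⟩ := H.st i (by omega) s hs
    have hb' : algebraMap S F b ∈ VV F 𝒮 T v g (n - g) := mem_VV F (by push_cast [Nat.cast_sub (show g ≤ i by omega)]; omega) hb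
    have hT' : algebraMap S F T ^ (g - 1) * algebraMap S F b ∈ VV F 𝒮 T v g (n - 1) :=
      VV_mono (by push_cast [Nat.cast_sub (show 1 ≤ g by omega)]; omega) (VV_mul (VV_Tpow H (g - 1)) hb')
    refine ⟨algebraMap S F b, VV_mono (by omega) hb', algebraMap S F a -
      uK K F T v g • (algebraMap S F T ^ (g - 1) * algebraMap S F b), Submodule.sub_mem _
        (mem_VV F (by push_cast [Nat.cast_sub (show 1 ≤ i by omega)]; omega) ha) (Submodule.smul_mem _ _ hT'), ?_⟩
    have : uK K F T v g • (algebraMap S F T ^ (g - 1) * algebraMap S F b) =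
      uu F T v g * (algebraMap S F T ^ (g - 1) * algebraMap S F b) := rfl
    rw [this]
    have h1 := H.one_eq (F := F)
    have e1 : algebraMap S F T ^ g = algebraMap S F T * algebraMap S F T ^ (g - 1) := by
      rw [← pow_succ']; congr 1; omega
    rw [e1] at h1
    rw [map_add, map_mul, map_mul]
    linear_combination (- algebraMap S F b) * h1

end gr
end FT

namespace FT
open Polynomial IntermediateField
set_option linter.unusedSectionVars false

section gr
variable {K S : Type*} [Field K] [CommRing S] [IsDomain S] [Algebra K S]
variable {𝒮 : ℕ → Submodule K S} [GradedAlgebra 𝒮] {n : ℕ} {x : Fin n → S} {d : Fin n → ℕ}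
variable {T v : S} {g m1 : ℕ}
variable {F : Type*} [Field F] [Algebra S F] [IsFractionRing S F] [Algebra K F] [IsScalarTower K S F]

lemma int_mul {K1 : Type*} [Field K1] [Algebra K1 F] (B : Subalgebra K1 F) {c y : F} (hc : c ∈ B)
    (h : IsIntegral B y) : IsIntegral B (c * y) :=
  (isIntegral_algebraMap (R := B) (A := F) (x := ⟨c, hc⟩)).mul h

/-- `O_∞` -/
noncomputable def Oinf (F : Type*) [Field F] [Algebra S F] [IsFractionRing S F] [Algebra K F]
    [IsScalarTower K S F] (𝒮 : ℕ → Submodule K S)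
    [GradedAlgebra 𝒮] (T v : S) (g : ℕ) : Subalgebra (KK K F T v g) F where
  carrier := {y | ∃ k : ℕ, y ∈ VV F 𝒮 T v g k}
  mul_mem' := by
    rintro a b ⟨k, hk⟩ ⟨l, hl⟩
    exact ⟨k + l, by push_cast; exact VV_mul hk hl⟩
  add_mem' := by
    rintro a b ⟨k, hk⟩ ⟨l, hl⟩
    exact ⟨k + l, Submodule.add_mem _ (VV_mono (by push_cast; omega) hk)
      (VV_mono (by push_cast; omega) hl)⟩
  algebraMap_mem' := by
    intro r
    refine ⟨0, ?_⟩
    rw [Algebra.algebraMap_eq_smul_one]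
    exact Submodule.smul_mem _ _ VV_one

/-- the filtration `L'` -/
noncomputable def LL (F : Type*) [Field F] [Algebra S F] [Algebra K F] (𝒮 : ℕ → Submodule K S)
    (T v : S) (g : ℕ) (n : ℤ) : Submodule (KK K F T v g) F where
  carrier := {y | algebraMap S F T ^ n * y ∈ VV F 𝒮 T v g n}
  add_mem' := by
    intro a b ha hb
    simp only [Set.mem_ofPred_eq, mul_add] at *
    exact Submodule.add_mem _ ha hb
  zero_mem' := by simp
  smul_mem' := by
    intro c y hy
    simp only [Set.mem_ofPred_eq, mul_smul_comm] at *
    exact Submodule.smul_mem _ _ hy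

lemma mem_LL {n : ℤ} {y : F} : y ∈ LL F 𝒮 T v g n ↔ algebraMap S F T ^ n * y ∈ VV F 𝒮 T v g n := Iff.rfl

lemma LL_mul (H : Tv 𝒮 T v g m1) {a b : ℤ} {y z : F} (hy : y ∈ LL F 𝒮 T v g a)
    (hz : z ∈ LL F 𝒮 T v g b) : y * z ∈ LL F 𝒮 T v g (a + b) := by
  rw [mem_LL] at *
  have := VV_mul hy hz
  convert this using 1
  rw [zpow_add₀ H.T0F]; ring

lemma LL_one : (1 : F) ∈ LL F 𝒮 T v g 0 := by
  rw [mem_LL]; simpa using VV_one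

lemma LL_one1 (H : Tv 𝒮 T v g m1) : (1 : F) ∈ LL F 𝒮 T v g 1 := by
  rw [mem_LL]; simpa using VV_T H

lemma LL_th (H : Tv 𝒮 T v g m1) : (algebraMap S F T)⁻¹ ∈ LL F 𝒮 T v g 1 := by
  rw [mem_LL, zpow_one, mul_inv_cancel₀ H.T0F]; exact VV_mono (by simp) VV_one

lemma LL_mono (H : Tv 𝒮 T v g m1) : Monotone (LL F 𝒮 T v g) := by
  apply monotone_int_of_le_succ
  intro n y hy
  simpa using LL_mul H hy (LL_one1 H)

lemma LL_thpow (H : Tv 𝒮 T v g m1) (k : ℕ) : (algebraMap S F T)⁻¹ ^ k ∈ LL F 𝒮 T v g k := by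
  rw [mem_LL, inv_pow, zpow_natCast, mul_inv_cancel₀ (pow_ne_zero _ H.T0F)]
  exact VV_mono (by simp) VV_one

/-- `O` -/
noncomputable def Ofin (H : Tv 𝒮 T v g m1) (F : Type*) [Field F] [Algebra S F] [IsFractionRing S F]
    [Algebra K F] [IsScalarTower K S F] : Subalgebra (KK K F T v g) F where
  carrier := {y | ∃ k : ℕ, y ∈ LL F 𝒮 T v g k}
  mul_mem' := by
    rintro a b ⟨k, hk⟩ ⟨l, hl⟩
    exact ⟨k + l, by push_cast; exact LL_mul H hk hl⟩
  add_mem' := by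
    rintro a b ⟨k, hk⟩ ⟨l, hl⟩
    exact ⟨k + l, Submodule.add_mem _ (LL_mono H (by push_cast; omega) hk)
      (LL_mono H (by push_cast; omega) hl)⟩
  algebraMap_mem' := by
    intro r
    refine ⟨0, ?_⟩
    rw [Algebra.algebraMap_eq_smul_one]
    exact Submodule.smul_mem _ _ LL_one

lemma mem_Oinf_of (s : S) : algebraMap S F s ∈ Oinf F 𝒮 T v g := by
  classical
  rw [← DirectSum.sum_support_decompose 𝒮 s, map_sum]
  apply Subalgebra.sum_mem
  intro i _
  exact ⟨i, mem_VV F le_rfl (DirectSum.decompose 𝒮 s i).2⟩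

lemma Oinf_int (H : Tv 𝒮 T v g m1) (hfd : ∀ m, (𝒮 m).FG) (y : F) (hy : y ∈ Oinf F 𝒮 T v g) :
    IsIntegral (Algebra.adjoin (KK K F T v g) {algebraMap S F T}) y := by
  obtain ⟨k, hk⟩ := hy
  set B := Algebra.adjoin (KK K F T v g) {algebraMap S F T} with hB
  have hT : algebraMap S F T ∈ B := Algebra.self_mem_adjoin_singleton _ _
  induction hk using Submodule.span_induction with
  | zero => exact isIntegral_zero
  | add y z _ _ h1 h2 => exact h1.add h2
  | smul c y _ h =>
    rw [Algebra.smul_def]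
    exact int_mul B (B.algebraMap_mem c) h
  | mem y hy =>
    obtain ⟨i, hi, s, hs, rfl⟩ := hy
    have := H.integral hfd B 1 (by simpa using hT) ?_ one_ne_zero hs
    · simpa using this
    · have e : algebraMap S F v = 1 - uK K F T v g • algebraMap S F T ^ g := by
        have : uK K F T v g • algebraMap S F T ^ g = uu F T v g * algebraMap S F T ^ g := rfl
        rw [this, H.u_eq]; ring
      rw [one_pow, mul_one, e]
      exact B.sub_mem B.one_mem (B.smul_mem (B.pow_mem hT _) _)

lemma Ofin_int (H : Tv 𝒮 T v g m1) (hfd : ∀ m, (𝒮 m).FG) (y : F) (hy : y ∈ Ofin H F) :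
    IsIntegral (Algebra.adjoin (KK K F T v g) {(algebraMap S F T)⁻¹}) y := by
  obtain ⟨k, hk⟩ := hy
  have hT0 := H.T0F (F := F)
  rw [mem_LL] at hk
  set B := Algebra.adjoin (KK K F T v g) {(algebraMap S F T)⁻¹} with hB
  have hT : (algebraMap S F T)⁻¹ ∈ B := Algebra.self_mem_adjoin_singleton _ _
  have key : ∀ z ∈ VV F 𝒮 T v g k, IsIntegral B ((algebraMap S F T)⁻¹ ^ k * z) := by
    intro z hz
    induction hz using Submodule.span_induction with
    | zero => simpa using isIntegral_zero
    | add y z _ _ h1 h2 => rw [mul_add]; exact h1.add h2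
    | smul c y _ h =>
      rw [Algebra.smul_def, mul_left_comm]
      exact int_mul B (B.algebraMap_mem c) h
    | mem y hy =>
      obtain ⟨i, hi, s, hs, rfl⟩ := hy
      have := H.integral hfd B (algebraMap S F T)⁻¹ ?_ ?_ (inv_ne_zero hT0) hs
      · have e1 : (algebraMap S F T)⁻¹ ^ k * algebraMap S F s =
          (algebraMap S F T)⁻¹ ^ (k - i) * (algebraMap S F s * (algebraMap S F T)⁻¹ ^ i) := by
          have : (algebraMap S F T)⁻¹ ^ k = (algebraMap S F T)⁻¹ ^ (k - i) * (algebraMap S F T)⁻¹ ^ i := by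
            rw [← pow_add]; congr 1; omega
          rw [this]; ring
        rw [e1]
        exact int_mul B (B.pow_mem hT (k - i)) this
      · rw [mul_inv_cancel₀ hT0]; exact B.one_mem
      · have e : algebraMap S F v * (algebraMap S F T)⁻¹ ^ g =
            (algebraMap S F T)⁻¹ ^ g - algebraMap (KK K F T v g) F (uK K F T v g) := by
          have : algebraMap (KK K F T v g) F (uK K F T v g) = uu F T v g := rfl
          rw [this, uu, div_eq_mul_inv, inv_pow]
          ring
        rw [e]
        exact B.sub_mem (B.pow_mem hT _) (B.algebraMap_mem _)
  have := key _ hk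
  rwa [zpow_natCast, ← mul_assoc, ← mul_pow, inv_mul_cancel₀ hT0, one_pow, one_mul] at this

end gr
end FT

namespace FT
open Polynomial IntermediateField
set_option linter.unusedSectionVars false

section gr
variable {K S : Type*} [Field K] [CommRing S] [IsDomain S] [Algebra K S]
variable {𝒮 : ℕ → Submodule K S} [GradedAlgebra 𝒮] {n : ℕ} {x : Fin n → S} {d : Fin n → ℕ}
variable {T v : S} {g m1 : ℕ}
variable {F : Type*} [Field F] [Algebra S F] [IsFractionRing S F] [Algebra K F] [IsScalarTower K S F]

lemma isAlg_frac {B : Type*} [CommRing B] [IsDomain B] [Algebra B F]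
    (h : ∀ s : S, IsAlgebraic B (algebraMap S F s)) : Algebra.IsAlgebraic B F := by
  refine ⟨fun y => ?_⟩
  obtain ⟨a, b, hb, rfl⟩ := IsFractionRing.div_surjective (A := S) y
  rw [div_eq_mul_inv]
  exact (h a).mul (h b).inv

lemma Tv.alg_indep (H : Tv 𝒮 T v g m1) (hfd : ∀ m, (𝒮 m).FG) (htr : 2 ≤ Algebra.trdeg K F) :
    AlgebraicIndependent K ![algebraMap S F T, algebraMap S F v] := by
  set B := Algebra.adjoin K (Set.range ![algebraMap S F T, algebraMap S F v]) with hB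
  have hTB : algebraMap S F T ∈ B := Algebra.subset_adjoin ⟨0, rfl⟩
  have hvB : algebraMap S F v ∈ B := Algebra.subset_adjoin ⟨1, rfl⟩
  have halg : Algebra.IsAlgebraic B F := by
    apply isAlg_frac (S := S)
    intro s
    classical
    rw [← DirectSum.sum_support_decompose 𝒮 s, map_sum]
    apply IsIntegral.isAlgebraic
    apply IsIntegral.sum
    intro i _
    have := H.integral hfd B 1 (by simpa using hTB) (by simpa using hvB) one_ne_zero
      (DirectSum.decompose 𝒮 s i).2
    simpa using this
  exact (Algebra.IsAlgebraic.isTranscendenceBasis_of_lift_le_trdeg_of_finite K _ (by simpa using htr)).1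

lemma Tv.trans (H : Tv 𝒮 T v g m1) (hfd : ∀ m, (𝒮 m).FG) (htr : 2 ≤ Algebra.trdeg K F) :
    Transcendental (KK K F T v g) (algebraMap S F T)⁻¹ := by
  intro hcon
  have hcon' : IsAlgebraic (KK K F T v g) (algebraMap S F T) := by
    have := hcon.inv; rwa [inv_inv] at this
  have h1 : Algebra.IsIntegral (KK K F T v g) (Algebra.adjoin (KK K F T v g) {algebraMap S F T}) := by
    rw [← le_integralClosure_iff_isIntegral]
    apply Algebra.adjoin_le
    rintro _ rfl
    exact hcon'.isIntegral
  have h2 : Algebra.IsAlgebraic (KK K F T v g) F := by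
    apply isAlg_frac (S := S)
    intro s
    have h3 := Oinf_int H hfd (algebraMap S F s) (mem_Oinf_of s)
    exact (isIntegral_trans (A := Algebra.adjoin (KK K F T v g) {algebraMap S F T}) _ h3).isAlgebraic
  have h4 : Algebra.IsAlgebraic (Algebra.adjoin K {uu F T v g}) F := by
    open scoped IntermediateField.algebraAdjoinAdjoin in
    exact (IsFractionRing.comap_isAlgebraic_iff (A := Algebra.adjoin K {uu F T v g})
      (K := K⟮uu F T v g⟯) (C := F)).2 h2
  have h5 := Algebra.IsAlgebraic.trdeg_le_cardinalMk K {uu F T v g}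
  have h6 := htr.trans h5
  rw [Cardinal.mk_singleton] at h6
  exact absurd h6 (by simp)

lemma mon_indep {a b : F} (h : AlgebraicIndependent K ![a, b]) :
    LinearIndependent K (fun ij : ℕ × ℕ => a ^ ij.1 * b ^ ij.2) := by
  have h1 := (MvPolynomial.basisMonomials (Fin 2) K).linearIndependent.map'
    (MvPolynomial.aeval ![a, b]).toLinearMap (LinearMap.ker_eq_bot.2 h)
  have h2 := h1.comp (fun ij : ℕ × ℕ => Finsupp.equivFunOnFinite.symm ![ij.1, ij.2]) (by
    rintro ⟨i, j⟩ ⟨i', j'⟩ hij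
    have := Finsupp.equivFunOnFinite.symm.injective hij
    have e0 := congrFun this 0
    have e1 := congrFun this 1
    simp at e0 e1
    simp [e0, e1])
  refine (congrArg (fun w => LinearIndependent K w) ?_).mpr h2
  funext ij
  simp [MvPolynomial.aeval_monomial, Finsupp.prod_fintype, Fin.prod_univ_two]

lemma arith_bound {k g Cb D : ℕ} (hg : 0 < g)
    (h : ∀ M : ℕ, k * (g * (M * (M + 1))) ≤ Cb * ((g * M + D + 1) * (g * M + D + 2))) : k ≤ g * Cb := by
  by_contra hk
  push Not at hk
  set E := D + 2 with hE
  set M := 2 * Cb * g * E + Cb * E ^ 2 + 1 with hM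
  have h1 := h M
  have h2 : (g * M + D + 1) * (g * M + D + 2) ≤ (g * M + E) ^ 2 := by
    rw [sq]; exact Nat.mul_le_mul (by omega) (by omega)
  have h3 : (g * Cb + 1) * (g * (M * M)) ≤ k * (g * (M * (M + 1))) := by
    apply Nat.mul_le_mul (by omega)
    apply Nat.mul_le_mul_left
    exact Nat.mul_le_mul_left _ (by omega)
  have h4 := h3.trans (h1.trans (Nat.mul_le_mul_left Cb h2))
  have h5 : g * (M * M) ≤ 2 * Cb * g * E * M + Cb * E ^ 2 := by nlinarith
  have h6 : M * M ≤ g * (M * M) := Nat.le_mul_of_pos_left _ hg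
  have h7 : M * M = 2 * Cb * g * E * M + Cb * E ^ 2 * M + M := by
    conv_lhs => enter [1]; rw [hM]
    ring
  have h8 : Cb * E ^ 2 ≤ Cb * E ^ 2 * M := Nat.le_mul_of_pos_right _ (by omega)
  omega

/-- sum of graded pieces up to `N` -/
noncomputable def upto (𝒮 : ℕ → Submodule K S) (N : ℕ) : Submodule K S :=
  LinearMap.range (∑ m : Fin (N + 1), (𝒮 m).subtype.comp (LinearMap.proj (R := K) (φ := fun m : Fin (N + 1) => 𝒮 m) m))

lemma mem_upto {N m : ℕ} (hm : m ≤ N) {s : S} (hs : s ∈ 𝒮 m) : s ∈ upto 𝒮 N := by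
  classical
  refine ⟨Pi.single (⟨m, by omega⟩ : Fin (N + 1)) (⟨s, hs⟩ : 𝒮 m), ?_⟩
  rw [LinearMap.sum_apply]
  rw [Finset.sum_eq_single (⟨m, by omega⟩ : Fin (N + 1))]
  · simp
  · intro b _ hb
    simp [Pi.single_eq_of_ne hb]
  · simp

lemma exists_upto (s : S) : ∃ N, ∀ M, N ≤ M → s ∈ upto 𝒮 M := by
  classical
  refine ⟨(DirectSum.decompose 𝒮 s).support.sup id, fun M hM => ?_⟩
  rw [← DirectSum.sum_support_decompose 𝒮 s]
  apply Submodule.sum_mem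
  intro i hi
  exact mem_upto ((Finset.le_sup (f := id) hi).trans hM) (DirectSum.decompose 𝒮 s i).2

lemma mul_upto {a N : ℕ} {y s : S} (hy : y ∈ 𝒮 a) (hs : s ∈ upto 𝒮 N) {M : ℕ} (h : a + N ≤ M) :
    y * s ∈ upto 𝒮 M := by
  obtain ⟨f, rfl⟩ := hs
  rw [LinearMap.sum_apply, Finset.mul_sum]
  apply Submodule.sum_mem
  intro m _
  exact mem_upto (m := a + m) (by omega) (SetLike.GradedMul.mul_mem hy (f m).2)

lemma finrank_upto (hfd : ∀ m, (𝒮 m).FG) {Cb : ℕ} (hCb : ∀ m, Module.finrank K (𝒮 m) ≤ Cb * (m + 1)) (N : ℕ) :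
    2 * Module.finrank K (upto 𝒮 N) ≤ Cb * ((N + 1) * (N + 2)) ∧ Module.Finite K (upto 𝒮 N) := by
  have : ∀ m, Module.Finite K (𝒮 m) := fun m => Module.Finite.iff_fg.2 (hfd m)
  constructor
  · have h1 := LinearMap.finrank_range_le (∑ m : Fin (N + 1), (𝒮 m).subtype.comp
      (LinearMap.proj (R := K) (φ := fun m : Fin (N + 1) => 𝒮 m) m))
    rw [Module.finrank_pi_fintype] at h1
    have h2 : ∑ m : Fin (N + 1), Module.finrank K (𝒮 m) ≤ ∑ m : Fin (N + 1), Cb * ((m : ℕ) + 1) :=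
      Finset.sum_le_sum fun m _ => hCb m
    have h3 : 2 * ∑ m : Fin (N + 1), Cb * ((m : ℕ) + 1) = Cb * ((N + 1) * (N + 2)) := by
      rw [Fin.sum_univ_eq_sum_range (fun m => Cb * (m + 1)), ← Finset.mul_sum]
      have : ∀ N : ℕ, 2 * ∑ m ∈ Finset.range (N + 1), (m + 1) = (N + 1) * (N + 2) := by
        intro N
        induction N with
        | zero => simp
        | succ N ih => rw [Finset.sum_range_succ, mul_add, ih]; ring
      rw [mul_left_comm, this]
    have h4 := h1.trans h2
    rw [← h3]
    exact Nat.mul_le_mul_left 2 h4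
  · rw [upto]; infer_instance

lemma Tv.indep_card (H : Tv 𝒮 T v g m1) (hfd : ∀ m, (𝒮 m).FG)
    (halg : AlgebraicIndependent K ![algebraMap S F T, algebraMap S F v]) {Cb : ℕ}
    (hCb : ∀ m, Module.finrank K (𝒮 m) ≤ Cb * (m + 1)) {E0 : Type*} [Field E0] [Algebra K E0]
    [Algebra E0 F] [IsScalarTower K E0 F] (T' v' : E0)
    (hTE : algebraMap E0 F T' = algebraMap S F T) (hvE : algebraMap E0 F v' = algebraMap S F v) {ι : Type*} [Fintype ι] (y : ι → F)
    (hy : LinearIndependent E0 y) : Fintype.card ι ≤ g * Cb := by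
  classical
  obtain ⟨b, hb⟩ := IsLocalization.exist_integer_multiples_of_finite (nonZeroDivisors S) y
  have hb0 : algebraMap S F b ≠ 0 := by simpa using nonZeroDivisors.ne_zero b.2
  choose s hs using hb
  have hs' : LinearIndependent E0 (fun i => algebraMap S F (s i)) := by
    rw [Fintype.linearIndependent_iff] at hy ⊢
    intro c hc
    apply hy c
    have : algebraMap S F b * ∑ i, c i • y i = 0 := by
      rw [← hc, Finset.mul_sum]
      apply Finset.sum_congr rfl
      intro i _
      have e1 : algebraMap S F (s i) = algebraMap S F b * y i := by
        rw [hs i, Algebra.smul_def]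
      rw [e1, mul_smul_comm]
    exact (mul_eq_zero.1 this).resolve_left hb0
  choose N hN using fun i => exists_upto (𝒮 := 𝒮) (s i)
  set D := Finset.univ.sup N with hD
  apply arith_bound (D := D) H.hg
  intro M
  -- index type
  let J := Σ j : Fin M, Fin (g * (M - j))
  have hJ : 2 * Fintype.card J = g * (M * (M + 1)) := by
    simp only [J, Fintype.card_sigma, Fintype.card_fin]
    rw [Fin.sum_univ_eq_sum_range (fun j => g * (M - j)), ← Finset.mul_sum, mul_left_comm]
    congr 1
    have h1 := Finset.sum_range_reflect (fun j => j + 1) M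
    have h2 : ∑ j ∈ Finset.range M, (M - j) = ∑ j ∈ Finset.range M, (j + 1) := by
      rw [← h1]
      apply Finset.sum_congr rfl
      intro j hj
      simp at hj
      omega
    rw [h2]
    clear_value D
    clear h1 h2
    induction M with
    | zero => simp
    | succ M ih => rw [Finset.sum_range_succ, mul_add, ih]; ring
  have hm := mon_indep halg
  have hm2 : LinearIndependent K (fun ji : J => T' ^ (ji.2 : ℕ) * v' ^ (ji.1 : ℕ)) := by
    apply LinearIndependent.of_comp (IsScalarTower.toAlgHom K E0 F).toLinearMap
    have e1 : (⇑(IsScalarTower.toAlgHom K E0 F).toLinearMap ∘ fun ji : J => T' ^ (ji.2 : ℕ) * v' ^ (ji.1 : ℕ))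
        = (fun ij : ℕ × ℕ => algebraMap S F T ^ ij.1 * algebraMap S F v ^ ij.2) ∘
          (fun ji : J => ((ji.2 : ℕ), (ji.1 : ℕ))) := by
      funext ji
      simp [hTE, hvE]
    rw [e1]
    exact hm.comp (fun ji : J => ((ji.2 : ℕ), (ji.1 : ℕ))) (by
      rintro ⟨j, i⟩ ⟨j', i'⟩ h
      simp only [Prod.mk.injEq] at h
      obtain ⟨h1, h2⟩ := h
      have : j = j' := Fin.ext h2
      subst this
      have : i = i' := Fin.ext h1
      subst this
      rfl)
  have h3 := linearIndependent_smul hm2 hs'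
  have h4 : LinearIndependent K (fun p : J × ι => T ^ (p.1.2 : ℕ) * v ^ (p.1.1 : ℕ) * s p.2) := by
    apply LinearIndependent.of_comp (IsScalarTower.toAlgHom K S F).toLinearMap
    refine (congrArg (fun w => LinearIndependent K w) ?_).mpr h3
    funext p
    simp [Algebra.smul_def, hTE, hvE]
  have hmem : ∀ p : J × ι, T ^ (p.1.2 : ℕ) * v ^ (p.1.1 : ℕ) * s p.2 ∈ upto 𝒮 (g * M + D) := by
    rintro ⟨⟨j, i⟩, l⟩
    have h5 := SetLike.GradedMul.mul_mem (SetLike.pow_mem_graded (i : ℕ) H.hT) (SetLike.pow_mem_graded (j : ℕ) H.hv)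
    apply mul_upto h5 (hN l D (Finset.le_sup (Finset.mem_univ l)))
    have h6 := i.2
    have h7 := j.2
    have h8 : g * (M - j) + j * g = g * M := by
      rw [mul_comm (j : ℕ) g, ← Nat.mul_add]; congr 1; omega
    simp only [smul_eq_mul, mul_one]
    omega
  have h5 : LinearIndependent K (fun p : J × ι => (⟨_, hmem p⟩ : upto 𝒮 (g * M + D))) := by
    apply LinearIndependent.of_comp (upto 𝒮 (g * M + D)).subtype
    exact h4
  obtain ⟨h6, h7⟩ := finrank_upto hfd hCb (g * M + D)
  have h8 := h5.fintype_card_le_finrank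
  rw [Fintype.card_prod] at h8
  calc Fintype.card ι * (g * (M * (M + 1))) = 2 * (Fintype.card J * Fintype.card ι) := by rw [← hJ]; ring
    _ ≤ _ := (Nat.mul_le_mul_left 2 h8).trans h6

end gr
end FT

namespace FT
open Polynomial IntermediateField
set_option linter.unusedSectionVars false

lemma sep_of_finrank_lt {L F : Type*} [Field L] [Field F] [Algebra L F] [FiniteDimensional L F] (p : ℕ)
    [CharP L p] (h : Module.finrank L F < p) : Algebra.IsSeparable L F := by
  refine ⟨fun x => ?_⟩
  have hi := Algebra.IsIntegral.isIntegral (R := L) x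
  have h1 := minpoly.irreducible hi
  have h2 := minpoly.natDegree_le (A := L) x
  have h3 := minpoly.natDegree_pos hi
  rw [IsSeparable, Polynomial.separable_iff_derivative_ne_zero h1]
  intro h0
  have h4 := congrArg (fun P => P.coeff ((minpoly L x).natDegree - 1)) h0
  simp only [Polynomial.coeff_derivative, Polynomial.coeff_zero] at h4
  have h5 : (minpoly L x).natDegree - 1 + 1 = (minpoly L x).natDegree := by omega
  rw [h5, Polynomial.coeff_natDegree, (minpoly.monic hi).leadingCoeff, one_mul] at h4
  have h6 : (((minpoly L x).natDegree : ℕ) : L) = 0 := by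
    rw [← h5]; push_cast; exact h4
  rw [CharP.cast_eq_zero_iff L p] at h6
  have := Nat.le_of_dvd h3 h6
  omega

section gr
variable {K S : Type*} [Field K] [CommRing S] [IsDomain S] [Algebra K S]
variable {𝒮 : ℕ → Submodule K S} [GradedAlgebra 𝒮] {n : ℕ} {x : Fin n → S} {d : Fin n → ℕ}
variable {T v : S} {g m1 : ℕ}
variable {F : Type*} [Field F] [Algebra S F] [IsFractionRing S F] [Algebra K F] [IsScalarTower K S F]

lemma Tv.rank_le (H : Tv 𝒮 T v g m1) (hfd : ∀ m, (𝒮 m).FG)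
    (htr : 2 ≤ Algebra.trdeg K F) {Cb : ℕ}
    (hCb : ∀ m, Module.finrank K (𝒮 m) ≤ Cb * (m + 1)) :
    Module.rank (KK K F T v g)⟮(algebraMap S F T)⁻¹⟯ F ≤ (g * Cb : ℕ) := by
  apply _root_.rank_le
  intro s hs
  set E0 := (KK K F T v g)⟮(algebraMap S F T)⁻¹⟯ with hE0
  have hT : algebraMap S F T ∈ E0 := by
    have := inv_mem (mem_adjoin_simple_self (KK K F T v g) (algebraMap S F T)⁻¹)
    rwa [inv_inv] at this
  have hu : uu F T v g ∈ E0 := by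
    have := E0.algebraMap_mem (uK K F T v g)
    exact this
  have hv : algebraMap S F v ∈ E0 := by
    have h1 : algebraMap S F v = 1 - uu F T v g * algebraMap S F T ^ g := by
      have := H.one_eq (F := F)
      rw [eq_sub_iff_add_eq]
      exact this.symm
    rw [h1]
    exact sub_mem (one_mem _) (mul_mem hu (pow_mem hT _))
  have hst : IsScalarTower K E0 F := IsScalarTower.of_algebraMap_eq (fun _ => rfl)
  have := H.indep_card hfd (H.alg_indep (F := F) hfd htr) hCb (E0 := E0) ⟨_, hT⟩ ⟨_, hv⟩ rfl rfl _ hs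
  simpa using this

/-- the curve attached to a two-dimensional graded domain -/
noncomputable def Tv.crv (H : Tv 𝒮 T v g m1) (hfd : ∀ m, (𝒮 m).FG)
    (htr : 2 ≤ Algebra.trdeg K F) {Cb : ℕ}
    (hCb : ∀ m, Module.finrank K (𝒮 m) ≤ Cb * (m + 1)) (p : ℕ) [CharP F p] (hp : g * Cb < p) :
    Crv (KK K F T v g) F where
  t := (algebraMap S F T)⁻¹
  O := Ofin H F
  Oi := Oinf F 𝒮 T v g
  tr := H.trans hfd htr
  t_mem := ⟨1, LL_th H⟩
  ti_mem := by rw [inv_inv]; exact mem_Oinf_of T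
  loc := by
    rintro y ⟨k, hk⟩
    refine ⟨k, k, ?_⟩
    rw [inv_inv]
    rw [mem_LL] at hk
    simpa using hk
  loci := by
    rintro y ⟨k, hk⟩
    refine ⟨k, k, ?_⟩
    rw [mem_LL, zpow_natCast, ← mul_assoc, ← mul_pow, mul_inv_cancel₀ H.T0F]
    simpa using hk
  int := Ofin_int H hfd
  inti := by rw [inv_inv]; exact Oinf_int H hfd
  frac := by
    intro y
    obtain ⟨a, b, hb, rfl⟩ := IsFractionRing.div_surjective (A := S) y
    have hb0 : algebraMap S F b ≠ 0 := by simpa using nonZeroDivisors.ne_zero hb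
    have key : ∀ s : S, ∃ n : ℕ, ∀ m ≥ n, ((algebraMap S F T)⁻¹) ^ m * algebraMap S F s ∈ Ofin H F := by
      intro s
      obtain ⟨k, hk⟩ := mem_Oinf_of (F := F) (𝒮 := 𝒮) (T := T) (v := v) (g := g) s
      refine ⟨k, fun m hm => ⟨m, ?_⟩⟩
      rw [mem_LL, zpow_natCast, ← mul_assoc, ← mul_pow, mul_inv_cancel₀ H.T0F]
      simpa using VV_mono (by omega) hk
    obtain ⟨n1, h1⟩ := key a
    obtain ⟨n2, h2⟩ := key b
    refine ⟨_, h1 (n1 + n2) (by omega), _, h2 (n1 + n2) (by omega), ?_, ?_⟩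
    · exact mul_ne_zero (pow_ne_zero _ (inv_ne_zero H.T0F)) hb0
    · field_simp
  fraci := by
    intro y
    obtain ⟨a, b, hb, rfl⟩ := IsFractionRing.div_surjective (A := S) y
    have hb0 : algebraMap S F b ≠ 0 := by simpa using nonZeroDivisors.ne_zero hb
    exact ⟨_, mem_Oinf_of a, _, mem_Oinf_of b, hb0, by field_simp⟩
  fin := by
    have h1 := H.rank_le (F := F) hfd htr hCb
    exact Module.rank_lt_aleph0_iff.1 (h1.trans_lt (Cardinal.natCast_lt_aleph0))
  sep := by
    have h1 := H.rank_le (F := F) hfd htr hCb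
    have h2 : FiniteDimensional (KK K F T v g)⟮(algebraMap S F T)⁻¹⟯ F :=
      Module.rank_lt_aleph0_iff.1 (h1.trans_lt (Cardinal.natCast_lt_aleph0))
    have h3 : CharP (KK K F T v g)⟮(algebraMap S F T)⁻¹⟯ p :=
      (algebraMap (KK K F T v g)⟮(algebraMap S F T)⁻¹⟯ F).charP (RingHom.injective (algebraMap (KK K F T v g)⟮(algebraMap S F T)⁻¹⟯ F)) p
    exact sep_of_finrank_lt p ((Module.finrank_le_of_rank_le h1).trans_lt hp)

lemma Tv.crv_dl (H : Tv 𝒮 T v g m1) (hfd : ∀ m, (𝒮 m).FG)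
    (htr : 2 ≤ Algebra.trdeg K F) {Cb : ℕ}
    (hCb : ∀ m, Module.finrank K (𝒮 m) ≤ Cb * (m + 1)) (p : ℕ) [CharP F p] (hp : g * Cb < p) :
    (H.crv (F := F) hfd htr hCb p hp).dl ≤ g * Cb :=
  Module.finrank_le_of_rank_le (H.rank_le (F := F) hfd htr hCb)

lemma Tv.LL_le (H : Tv 𝒮 T v g m1) (hfd : ∀ m, (𝒮 m).FG)
    (htr : 2 ≤ Algebra.trdeg K F) {Cb : ℕ}
    (hCb : ∀ m, Module.finrank K (𝒮 m) ≤ Cb * (m + 1)) (p : ℕ) [CharP F p] (hp : g * Cb < p) (n : ℤ) :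
    LL F 𝒮 T v g n ≤ (H.crv (F := F) hfd htr hCb p hp).L n := by
  intro y hy
  rw [Crv.mem_L]
  refine ⟨⟨n.toNat, LL_mono H (by omega) hy⟩, n.toNat, ?_⟩
  rw [mem_LL] at hy
  have : (H.crv (F := F) hfd htr hCb p hp).t ^ (-n) = algebraMap S F T ^ n := by
    change (algebraMap S F T)⁻¹ ^ (-n) = _
    rw [inv_zpow', neg_neg]
  rw [this]
  exact VV_mono (by omega) hy

end gr
end FT

namespace FT
open Polynomial IntermediateField
set_option linter.unusedSectionVars false

lemma ev_const (f : ℕ → ℤ) (B : ℤ) (hm : Monotone f) (hb : ∀ n, f n ≤ B) : ∃ n0, ∀ n ≥ n0, f (n + 1) = f n := by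
  by_contra hcon
  push Not at hcon
  have key : ∀ k : ℕ, ∃ n, f 0 + k ≤ f n := by
    intro k
    induction k with
    | zero => exact ⟨0, by simp⟩
    | succ k ih =>
      obtain ⟨n, hn⟩ := ih
      obtain ⟨m, hm1, hm2⟩ := hcon n
      refine ⟨m + 1, ?_⟩
      have h1 := hm hm1
      have h2 := hm (Nat.le_succ m)
      have h3 : f m < f (m + 1) := lt_of_le_of_ne h2 (Ne.symm hm2)
      push_cast; linarith
  obtain ⟨n, hn⟩ := key (B - f 0 + 1).toNat
  have := hb n
  omega

lemma Crv.L_gen {K E : Type*} [Field K] [Field E] [Algebra K E] (C : Crv K E) :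
    ∃ n0 : ℕ, ∀ n : ℕ, n0 ≤ n → ∀ y ∈ C.L (n + 1 : ℕ), ∃ a ∈ C.L n, ∃ b ∈ C.L n, y = a + C.t * b := by
  have hconv := fun n : ℤ => C.fmodL.dm_convex C.t0 n
  have hstep := fun n : ℤ => C.fmodL.dm_step n ⊤ (fun _ _ => trivial)
  obtain ⟨n0, h0⟩ := ev_const (fun n : ℕ => dm K C.L ((n : ℤ) + 1) - dm K C.L n) _
    (monotone_nat_of_le_succ (fun n => by
      have := (hconv n).1
      have e1 : (n : ℤ) + 1 + 1 = n + 2 := by ring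
      push_cast
      rw [e1]
      exact this))
    (fun n => by
      have := hstep n
      exact sub_le_iff_le_add'.2 this)
  refine ⟨n0 + 1, fun n hn y hy => ?_⟩
  obtain ⟨m, rfl⟩ : ∃ m, n = m + 1 := ⟨n - 1, by omega⟩
  have h1 := h0 m (by omega)
  have e1 : (m : ℤ) + 1 + 1 = m + 2 := by ring
  have h2 := (hconv m).2 (by
    have h1' := h1.symm
    push_cast at h1'
    rw [e1] at h1'
    exact h1')
  have h3 := h2 y (by
    have : ((m + 1 + 1 : ℕ) : ℤ) = m + 2 := by push_cast; ring
    rw [this] at hy; exact hy)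
  simpa using h3

section gr
variable {K S : Type*} [Field K] [CommRing S] [IsDomain S] [Algebra K S]
variable {𝒮 : ℕ → Submodule K S} [GradedAlgebra 𝒮] {n : ℕ} {x : Fin n → S} {d : Fin n → ℕ}
variable {T v : S} {g m1 : ℕ}
variable {F : Type*} [Field F] [Algebra S F] [IsFractionRing S F] [Algebra K F] [IsScalarTower K S F]

lemma LL_step (H : Tv 𝒮 T v g m1) {n : ℤ} (hn : (m1 : ℤ) ≤ n) {y : F} (hy : y ∈ LL F 𝒮 T v g n) :
    ∃ a ∈ LL F 𝒮 T v g (n - 1), ∃ b ∈ LL F 𝒮 T v g (n - 1), y = a + (algebraMap S F T)⁻¹ * b := by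
  obtain ⟨a, ha, b, hb, hab⟩ := VV_step H hn (mem_LL.1 hy)
  have hT := H.T0F (F := F)
  refine ⟨algebraMap S F T ^ (1 - n) * b, ?_, algebraMap S F T ^ (1 - n) * a, ?_, ?_⟩
  · rw [mem_LL, ← mul_assoc, ← zpow_add₀ hT]; simpa using hb
  · rw [mem_LL, ← mul_assoc, ← zpow_add₀ hT]; simpa using ha
  · have h1 : y = algebraMap S F T ^ (-n) * (algebraMap S F T ^ n * y) := by
      rw [← mul_assoc, ← zpow_add₀ hT]; simp
    rw [h1, hab, sub_eq_add_neg, zpow_add₀ hT, zpow_one]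
    field_simp
    ring

lemma LL_ind (H : Tv 𝒮 T v g m1) (j : ℕ) : ∀ Q : AddSubgroup F,
    (∀ i ≤ j, ∀ w ∈ LL F 𝒮 T v g m1, (algebraMap S F T)⁻¹ ^ i * w ∈ Q) →
    ∀ z ∈ LL F 𝒮 T v g (m1 + j : ℕ), z ∈ Q := by
  induction j with
  | zero => intro Q hQ z hz; simpa using hQ 0 le_rfl z (by simpa using hz)
  | succ j ih =>
    intro Q hQ z hz
    obtain ⟨a, ha, b, hb, rfl⟩ := LL_step H (n := (m1 + (j + 1) : ℕ)) (by push_cast; omega) hz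
    have e1 : ((m1 + (j + 1) : ℕ) : ℤ) - 1 = (m1 + j : ℕ) := by push_cast; ring
    rw [e1] at ha hb
    refine Q.add_mem (ih Q (fun i hi w hw => hQ i (by omega) w hw) a ha) ?_
    refine ih (Q.comap (AddMonoidHom.mulLeft (algebraMap S F T)⁻¹)) (fun i hi w hw => ?_) b hb
    have := hQ (i + 1) (by omega) w hw
    simp only [AddSubgroup.mem_comap, AddMonoidHom.coe_mulLeft]
    rwa [pow_succ', mul_assoc] at this

lemma LL_cond (H : Tv 𝒮 T v g m1) {n : ℤ} {y : F} {a b : ℕ}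
    (h1 : algebraMap S F T ^ n * y ∈ VV F 𝒮 T v g (n + a)) (h2 : y ∈ LL F 𝒮 T v g (n + b)) (m : ℕ)
    (hm : m1 + a + b ≤ m) {z : F} (hz : z ∈ LL F 𝒮 T v g m) : y * z ∈ LL F 𝒮 T v g (n + m) := by
  obtain ⟨j, rfl⟩ : ∃ j, m = m1 + j := ⟨m - m1, by omega⟩
  have hT := H.T0F (F := F)
  refine LL_ind H j ((LL F 𝒮 T v g (n + (m1 + j : ℕ))).toAddSubgroup.comap (AddMonoidHom.mulLeft y)) ?_ z hz
  intro i hi w hw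
  change y * ((algebraMap S F T)⁻¹ ^ i * w) ∈ LL F 𝒮 T v g (n + (m1 + j : ℕ))
  rcases Nat.lt_or_ge i a with hia | hia
  · have := LL_mul H h2 (LL_mul H (LL_thpow H i) hw)
    refine LL_mono H ?_ this
    push_cast; omega
  · rw [mem_LL] at hw ⊢
    have h3 := VV_mul (VV_mul h1 (VV_Tpow (F := F) H (j - i))) hw
    have e1 : algebraMap S F T ^ n * y * algebraMap S F T ^ (j - i) * (algebraMap S F T ^ (m1 : ℤ) * w)
        = algebraMap S F T ^ (n + (m1 + j : ℕ)) * (y * ((algebraMap S F T)⁻¹ ^ i * w)) := by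
      rw [zpow_add₀ hT, inv_pow, zpow_natCast, zpow_natCast]
      obtain ⟨l, rfl⟩ : ∃ l, j = i + l := ⟨j - i, by omega⟩
      rw [Nat.add_sub_cancel_left, pow_add, pow_add]
      field_simp
    rw [e1] at h3
    refine VV_mono ?_ h3
    push_cast; omega

lemma Tv.conductor (H : Tv 𝒮 T v g m1) (hfd : ∀ m, (𝒮 m).FG)
    (htr : 2 ≤ Algebra.trdeg K F) {Cb : ℕ}
    (hCb : ∀ m, Module.finrank K (𝒮 m) ≤ Cb * (m + 1)) (p : ℕ) [CharP F p] (hp : g * Cb < p) :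
    ∃ m0 : ℕ, ∀ m : ℕ, m0 ≤ m → ∀ n : ℤ, ∀ y ∈ (H.crv (F := F) hfd htr hCb p hp).L n,
      ∀ z ∈ LL F 𝒮 T v g m, y * z ∈ LL F 𝒮 T v g (n + m) := by
  set C := H.crv (F := F) hfd htr hCb p hp with hC
  have h1 : ∀ n : ℤ, ∀ y ∈ C.L n, ∃ m0 : ℕ, ∀ m : ℕ, m0 ≤ m → ∀ z ∈ LL F 𝒮 T v g m,
      y * z ∈ LL F 𝒮 T v g (n + m) := by
    intro n y hy
    rw [Crv.mem_L] at hy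
    obtain ⟨⟨k, hk⟩, l, hl⟩ := hy
    have : C.t ^ (-n) = algebraMap S F T ^ n := by
      change (algebraMap S F T)⁻¹ ^ (-n) = _
      rw [inv_zpow', neg_neg]
    rw [this] at hl
    refine ⟨m1 + (l - n).toNat + (k - n).toNat, fun m hm z hz => ?_⟩
    exact LL_cond H (VV_mono (by omega) hl) (LL_mono H (by omega) hk) m hm hz
  have h2 : ∀ n : ℤ, ∃ m0 : ℕ, ∀ m : ℕ, m0 ≤ m → ∀ y ∈ C.L n, ∀ z ∈ LL F 𝒮 T v g m,
      y * z ∈ LL F 𝒮 T v g (n + m) := by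
    intro n
    have hfgL : (C.L n).FG := Module.Finite.iff_fg.1 inferInstance
    obtain ⟨s, hs⟩ := hfgL
    have hsL : ∀ y ∈ s, y ∈ C.L n := fun y hy => hs ▸ Submodule.subset_span hy
    have h3 : ∀ y : F, ∃ m0 : ℕ, y ∈ s → ∀ m : ℕ, m0 ≤ m → ∀ z ∈ LL F 𝒮 T v g m,
        y * z ∈ LL F 𝒮 T v g (n + m) := by
      intro y
      by_cases hy : y ∈ s
      · obtain ⟨m0, h⟩ := h1 n y (hsL y hy)
        exact ⟨m0, fun _ => h⟩
      · exact ⟨0, fun h => absurd h hy⟩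
    choose M hM using h3
    refine ⟨s.sup M, fun m hm y hy z hz => ?_⟩
    rw [← hs] at hy
    induction hy using Submodule.span_induction with
    | mem y hy => exact hM y hy m ((Finset.le_sup hy).trans hm) z hz
    | zero => simp
    | add a b _ _ ha hb => rw [add_mul]; exact Submodule.add_mem _ ha hb
    | smul c a _ ha => rw [smul_mul_assoc]; exact Submodule.smul_mem _ _ ha
  choose M hM using h2
  obtain ⟨n0, hn0⟩ := C.L_gen
  refine ⟨(Finset.range (n0 + 1)).sup (fun i : ℕ => M i), fun m hm n y hy z hz => ?_⟩
  rcases lt_or_ge n 0 with hn | hn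
  · rw [C.L_neg hn] at hy
    rw [(Submodule.mem_bot _).1 hy]; simp
  · obtain ⟨j, rfl⟩ := Int.eq_ofNat_of_zero_le hn
    clear hn
    induction j generalizing y with
    | zero => exact hM _ m ((Finset.le_sup (f := fun i : ℕ => M i) (by simp)).trans hm) y hy z hz
    | succ j ih =>
      rcases Nat.lt_or_ge n0 (j + 1) with hj | hj
      · obtain ⟨a, ha, b, hb, rfl⟩ := hn0 j (by omega) y hy
        have h5 := ih a ha
        have h6 := LL_mul H (LL_th H) (ih b hb)
        rw [add_mul]
        refine Submodule.add_mem _ (LL_mono H (by push_cast; omega) h5) ?_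
        rw [mul_assoc]
        refine LL_mono H ?_ h6
        push_cast; omega
      · exact hM _ m ((Finset.le_sup (f := fun i : ℕ => M i) (by simp; omega)).trans hm) y hy z hz

end gr
end FT

namespace FT
open Polynomial IntermediateField
set_option linter.unusedSectionVars false

section gr
variable {K S : Type*} [Field K] [CommRing S] [IsDomain S] [Algebra K S]
variable {𝒮 : ℕ → Submodule K S} [GradedAlgebra 𝒮] {n : ℕ} {x : Fin n → S} {d : Fin n → ℕ}
variable {T v : S} {g m1 : ℕ}
variable {F : Type*} [Field F] [Algebra S F] [IsFractionRing S F] [Algebra K F] [IsScalarTower K S F]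

/-- elements with components in the window `(N-g, N]` -/
def win (𝒮 : ℕ → Submodule K S) (g : ℕ) (N : ℤ) : Submodule K S :=
  Submodule.span K {s | ∃ i : ℕ, (i : ℤ) ≤ N ∧ N < i + g ∧ s ∈ 𝒮 i}

/-- elements of high degree -/
def high (𝒮 : ℕ → Submodule K S) (N : ℤ) : Ideal S :=
  Ideal.span {s | ∃ i : ℕ, N < i ∧ s ∈ 𝒮 i}

lemma high_win {N : ℤ} {w : S} (h1 : w ∈ high 𝒮 N) (h2 : w ∈ win 𝒮 g N) : w = 0 := by
  classical
  have e1 : ∀ i : ℕ, (i : ℤ) ≤ N → (DirectSum.decompose 𝒮 w i : S) = 0 := by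
    intro i hi
    have : ∀ a, GradedRing.proj 𝒮 i (a * w) = 0 := by
      clear h2
      induction h1 using Submodule.span_induction with
      | mem s hs =>
        obtain ⟨j, hj, hs⟩ := hs
        intro a
        exact DirectSum.coe_decompose_mul_of_right_mem_of_not_le 𝒮 hs (by omega)
      | zero => simp
      | add a b _ _ ha hb => intro c; rw [mul_add, map_add, ha, hb, add_zero]
      | smul a b _ hb => intro c; rw [smul_eq_mul, ← mul_assoc]; exact hb _
    simpa using this 1
  have e2 : ∀ i : ℕ, N < (i : ℤ) → (DirectSum.decompose 𝒮 w i : S) = 0 := by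
    intro i hi
    have : GradedAlgebra.proj 𝒮 i w = 0 := by
      clear h1 e1
      induction h2 using Submodule.span_induction with
      | mem s hs =>
        obtain ⟨j, hj, _, hs⟩ := hs
        exact DirectSum.decompose_of_mem_ne 𝒮 hs (by omega)
      | zero => simp
      | add a b _ _ ha hb => rw [map_add, ha, hb, add_zero]
      | smul a b _ hb => rw [map_smul, hb, smul_zero]
    simpa using this
  rw [← DirectSum.sum_support_decompose 𝒮 w]
  apply Finset.sum_eq_zero
  intro i _
  rcases le_or_gt (i : ℤ) N with h | h
  · exact e1 i h
  · exact e2 i h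

lemma win_mul {N : ℤ} {w y : S} (hw : w ∈ win 𝒮 g N) {j : ℕ} (hj : g ≤ j) (hy : y ∈ 𝒮 j) : y * w ∈ high 𝒮 N := by
  induction hw using Submodule.span_induction with
  | mem s hs =>
    obtain ⟨i, hi, h2, hs⟩ := hs
    exact Ideal.subset_span ⟨j + i, by push_cast; omega, SetLike.GradedMul.mul_mem hy hs⟩
  | zero => simp
  | add a b _ _ ha hb => rw [mul_add]; exact Ideal.add_mem _ ha hb
  | smul a b _ hb =>
    rw [mul_smul_comm, Algebra.smul_def]; exact Ideal.mul_mem_left _ _ hb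

lemma Tv.lemU (H : Tv 𝒮 T v g m1) {N : ℤ} (M : ℕ) : ∀ z : ℕ → S, (∀ m, z m ∈ win 𝒮 g N) →
    ∑ m ∈ Finset.range M, uu F T v g ^ m * algebraMap S F (z m) = 0 → ∀ m < M, z m = 0 := by
  induction M with
  | zero => intro z _ _ m hm; omega
  | succ M ih =>
    intro z hz h0
    have hTg : T ^ g ∈ 𝒮 g := by simpa using SetLike.pow_mem_graded g H.hT
    have h1 : ∑ m ∈ Finset.range (M + 1), (1 - v) ^ m * (T ^ (g * (M - m)) * z m) = 0 := by
      apply IsFractionRing.injective S F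
      rw [map_zero, ← mul_zero (algebraMap S F T ^ (g * M)), ← h0, map_sum, Finset.mul_sum]
      apply Finset.sum_congr rfl
      intro m hm
      have hm' : m ≤ M := by simp at hm; omega
      rw [map_mul, map_mul, map_pow, map_pow, map_sub, map_one, ← H.u_eq, mul_pow, ← pow_mul,
        show g * M = g * m + g * (M - m) by rw [← mul_add]; congr 1; omega, pow_add]
      ring
    rw [Finset.sum_range_succ] at h1
    have hlow : ∑ m ∈ Finset.range M, (1 - v) ^ m * (T ^ (g * (M - m)) * z m) ∈ high 𝒮 N := by
      apply Ideal.sum_mem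
      intro m hm
      have hm' : m < M := by simpa using hm
      apply Ideal.mul_mem_left
      have e : g * (M - m) = g * (M - m - 1) + g := by
        rw [← Nat.mul_succ]; congr 1; omega
      rw [e, pow_add, mul_assoc]
      apply Ideal.mul_mem_left
      exact win_mul (hz m) le_rfl hTg
    have htop : z M ∈ high 𝒮 N := by
      obtain ⟨P, hP⟩ : v ∣ (1 - v) ^ M - 1 := by
        have := sub_dvd_pow_sub_pow (1 - v) 1 M
        rw [one_pow] at this
        exact (by simp : v ∣ 1 - v - 1).trans this
      have e : z M = (1 - v) ^ M * z M - P * (v * z M) := by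
        linear_combination (-z M) * hP
      rw [Nat.sub_self, mul_zero, pow_zero, one_mul] at h1
      have e2 : (1 - v) ^ M * z M = -∑ m ∈ Finset.range M, (1 - v) ^ m * (T ^ (g * (M - m)) * z m) := by
        linear_combination h1
      rw [e, e2]
      exact Ideal.sub_mem _ (neg_mem hlow) (Ideal.mul_mem_left _ _ (win_mul (hz M) le_rfl H.hv))
    have hzM := high_win htop (hz M)
    intro m hm
    rcases Nat.lt_succ_iff_lt_or_eq.1 hm with h | rfl
    · refine ih z hz ?_ m h
      rw [Finset.sum_range_succ, hzM] at h0
      simpa using h0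
    · exact hzM

lemma Tv.lemW (H : Tv 𝒮 T v g m1) {N : ℤ} {W : Submodule K S} (hW : W ≤ win 𝒮 g N) {z : S}
    (hz : z ∈ win 𝒮 g N)
    (h : algebraMap S F z ∈ Submodule.span (KK K F T v g) (algebraMap S F '' (W : Set S))) : z ∈ W := by
  classical
  set u := uu F T v g with hu
  let Φ : (ℕ →₀ W) →ₗ[K] F := Finsupp.lsum K (fun m =>
    (LinearMap.mulLeft K (u ^ m)).comp ((IsScalarTower.toAlgHom K S F).toLinearMap.comp W.subtype))
  have hΦ : ∀ c, Φ c = c.sum (fun m w => u ^ m * algebraMap S F w) := by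
    intro c; rfl
  have hmem1 : ∀ m : ℕ, ∀ w ∈ W, u ^ m * algebraMap S F w ∈ LinearMap.range Φ := by
    intro m w hw
    refine ⟨Finsupp.single m ⟨w, hw⟩, ?_⟩
    rw [hΦ, Finsupp.sum_single_index]
    simp
  have hmemk : ∀ k : ℕ, ∀ y ∈ LinearMap.range Φ, u ^ k * y ∈ LinearMap.range Φ := by
    rintro k _ ⟨c, rfl⟩
    rw [hΦ, Finsupp.sum, Finset.mul_sum]
    apply Submodule.sum_mem
    intro m _
    rw [← mul_assoc, ← pow_add]
    exact hmem1 _ _ (c m).2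
  have hmemP : ∀ P : K[X], ∀ y ∈ LinearMap.range Φ, aeval u P * y ∈ LinearMap.range Φ := by
    intro P y hy
    rw [aeval_eq_sum_range, Finset.sum_mul]
    apply Submodule.sum_mem
    intro m _
    rw [smul_mul_assoc]
    exact Submodule.smul_mem _ _ (hmemk m y hy)
  have key : ∀ y ∈ Submodule.span (KK K F T v g) (algebraMap S F '' (W : Set S)),
      ∃ b : K[X], b ≠ 0 ∧ aeval u b * y ∈ LinearMap.range Φ := by
    intro y hy
    induction hy using Submodule.span_induction with
    | mem y hy =>
      obtain ⟨w, hw, rfl⟩ := hy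
      exact ⟨1, one_ne_zero, by simpa using hmem1 0 w hw⟩
    | zero => exact ⟨1, one_ne_zero, by simp⟩
    | add a b _ _ ha hb =>
      obtain ⟨P, hP, h1⟩ := ha
      obtain ⟨Q, hQ, h2⟩ := hb
      refine ⟨P * Q, mul_ne_zero hP hQ, ?_⟩
      have : aeval u (P * Q) * (a + b) = aeval u Q * (aeval u P * a) + aeval u P * (aeval u Q * b) := by
        rw [map_mul]; ring
      rw [this]
      exact Submodule.add_mem _ (hmemP _ _ h1) (hmemP _ _ h2)
    | smul c a _ ha =>
      obtain ⟨P, hP, h1⟩ := ha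
      obtain ⟨r, s, hrs⟩ := (IntermediateField.mem_adjoin_simple_iff K _).1 c.2
      rw [← hu] at hrs
      have e0 : c • a = (c : F) * a := rfl
      by_cases hs : aeval u s = 0
      · refine ⟨1, one_ne_zero, ?_⟩
        rw [e0, hrs, hs]; simp
      · refine ⟨P * s, mul_ne_zero hP (by rintro rfl; simp at hs), ?_⟩
        have : aeval u (P * s) * (c • a) = aeval u r * (aeval u P * a) := by
          rw [e0, hrs, map_mul]
          field_simp
        rw [this]
        exact hmemP _ _ h1
  obtain ⟨b, hb, c, hc⟩ := key _ h
  rw [hΦ] at hc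
  set M := max (b.natDegree + 1) (c.support.sup id + 1) with hM
  have hc2 : c.sum (fun m w => u ^ m * algebraMap S F w) = ∑ m ∈ Finset.range M, u ^ m * algebraMap S F (c m) := by
    apply Finsupp.sum_of_support_subset
    · intro m hm
      have := Finset.le_sup (f := id) hm
      simp only [id] at this
      simp only [Finset.mem_range]
      omega
    · simp
  have hb2 : aeval u b = ∑ m ∈ Finset.range M, b.coeff m • u ^ m :=
    aeval_eq_sum_range' (by omega) _
  have h0 : ∑ m ∈ Finset.range M, u ^ m * algebraMap S F (b.coeff m • z - (c m : S)) = 0 := by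
    have : ∀ m, u ^ m * algebraMap S F (b.coeff m • z - (c m : S)) =
        (b.coeff m • u ^ m) * algebraMap S F z - u ^ m * algebraMap S F (c m) := by
      intro m
      have e7 : algebraMap S F (b.coeff m • z) = b.coeff m • algebraMap S F z :=
        map_smul (IsScalarTower.toAlgHom K S F) _ _
      rw [map_sub, e7, mul_sub, mul_smul_comm, smul_mul_assoc]
    simp only [this]
    rw [Finset.sum_sub_distrib, ← Finset.sum_mul, ← hb2, ← hc2, hc, sub_self]
  have h3 := H.lemU (F := F) M (fun m => b.coeff m • z - (c m : S))
    (fun m => Submodule.sub_mem _ (Submodule.smul_mem _ _ hz) (hW (c m).2)) h0 b.natDegree (by omega)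
  have h4 : b.leadingCoeff • z ∈ W := by
    have : b.leadingCoeff • z = c b.natDegree := sub_eq_zero.1 h3
    rw [this]; exact (c _).2
  have h5 : b.leadingCoeff ≠ 0 := by simpa using hb
  have := W.smul_mem (b.leadingCoeff)⁻¹ h4
  rwa [smul_smul, inv_mul_cancel₀ h5, one_smul] at this

end gr
end FT

namespace FT
open Polynomial IntermediateField
set_option linter.unusedSectionVars false

section gr
variable {K S : Type*} [Field K] [CommRing S] [IsDomain S] [Algebra K S]
variable {𝒮 : ℕ → Submodule K S} [GradedAlgebra 𝒮] {n : ℕ} {x : Fin n → S} {d : Fin n → ℕ}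
variable {T v : S} {g m1 : ℕ}
variable {F : Type*} [Field F] [Algebra S F] [IsFractionRing S F] [Algebra K F] [IsScalarTower K S F]
variable {C : Crv (KK K F T v g) F} {r : ℕ} {D : Dat C r} {f : Fin (r + 1) → S} {ed : Fin (r + 1) → ℕ}

/-- Frobenius power on generators -/
def Jq (f : Fin (r + 1) → S) (q : ℕ) : Ideal S := Ideal.span (Set.range fun j => f j ^ q)

lemma mon_xi (H : Tv 𝒮 T v g m1) (α : Fin n → ℕ) :
    algebraMap S F T ^ (nn d α) * mon (fun i => algebraMap S F (x i) * (algebraMap S F T)⁻¹ ^ d i) α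
      = algebraMap S F (∏ i, x i ^ α i) := by
  have hT := H.T0F (F := F)
  have e1 : nn d α = ((∑ i, d i * α i : ℕ) : ℤ) := by
    simp [nn, mul_comm]
  rw [e1, zpow_natCast, mon, map_prod, ← Finset.prod_pow_eq_pow_sum, ← Finset.prod_mul_distrib]
  apply Finset.prod_congr rfl
  intro i _
  rw [map_pow, mul_pow, ← pow_mul, inv_pow]
  field_simp

lemma xi_mem_LL (H : Tv 𝒮 T v g m1) {i : ℕ} {s : S} (hs : s ∈ 𝒮 i) :
    algebraMap S F s * (algebraMap S F T)⁻¹ ^ i ∈ LL F 𝒮 T v g i := by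
  have hT := H.T0F (F := F)
  rw [mem_LL, zpow_natCast, mul_comm, mul_assoc, ← mul_pow, inv_mul_cancel₀ hT, one_pow, mul_one]
  exact mem_VV F le_rfl hs

lemma mem_of_Jq (H : Tv 𝒮 T v g m1) (hx : ∀ i, x i ∈ 𝒮 (d i)) (hf : ∀ j, f j ∈ 𝒮 (ed j))
    (hLL : ∀ n, LL F 𝒮 T v g n ≤ C.L n)
    (hDφ : ∀ j, D.φ j = algebraMap S F (f j) * (algebraMap S F T)⁻¹ ^ ed j) (hDe : ∀ j, D.e j = ed j)
    (q : ℕ) (α : Fin n → ℕ) (h : ∏ i, x i ^ α i ∈ Jq f q) :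
    D.Mem (fun i => algebraMap S F (x i) * (algebraMap S F T)⁻¹ ^ d i) d q α := by
  have hT := H.T0F (F := F)
  have e1 : nn d α = ((∑ i, α i * d i : ℕ) : ℤ) := by simp [nn]
  set N := ∑ i, α i * d i with hN
  have hs : ∏ i, x i ^ α i ∈ 𝒮 N := prod_mem_gr hx α
  obtain ⟨w, hw, hsw⟩ := hom_comb (e := fun j => q * ed j) (f := fun j => f j ^ q)
    (fun j => by simpa using SetLike.pow_mem_graded q (hf j)) hs h
  refine ⟨fun j => algebraMap S F T ^ (-((N : ℤ) - q * ed j)) * algebraMap S F (w j), ?_, ?_⟩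
  · rw [Dat.mem_G]
    intro j
    rw [e1, hDe]
    apply hLL
    rcases hw j with ⟨h1, h2⟩ | h0
    · rw [mem_LL, ← mul_assoc, ← zpow_add₀ hT]
      simp only [add_neg_cancel, zpow_zero, one_mul]
      refine mem_VV F ?_ h2
      push_cast [h1]; exact le_rfl
    · rw [h0]; simp
  · rw [Dat.ph_apply]
    have e2 := mon_xi (F := F) (x := x) (d := d) H α
    have hTn : algebraMap S F T ^ (nn d α) ≠ 0 := zpow_ne_zero _ hT
    apply mul_left_cancel₀ hTn
    rw [e2, hsw, map_sum, Finset.mul_sum]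
    apply Finset.sum_congr rfl
    intro j _
    rw [hDφ, e1, map_mul, map_pow, mul_pow, ← pow_mul, neg_sub, zpow_sub₀ hT, inv_pow]
    have : algebraMap S F T ^ ((q : ℤ) * ed j) = algebraMap S F T ^ (ed j * q) := by
      rw [← zpow_natCast]; congr 1; push_cast; ring
    rw [this]
    field_simp

lemma Jq_of_mem (H : Tv 𝒮 T v g m1) (hx : ∀ i, x i ∈ 𝒮 (d i)) (hf : ∀ j, f j ∈ 𝒮 (ed j))
    (q : ℕ) (α : Fin n → ℕ) (w : Fin (r + 1) → F)
    (hw : ∀ j, w j ∈ LL F 𝒮 T v g (nn d α - q * ed j))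
    (h : ∑ j, w j * (algebraMap S F (f j) * (algebraMap S F T)⁻¹ ^ ed j) ^ q =
      mon (fun i => algebraMap S F (x i) * (algebraMap S F T)⁻¹ ^ d i) α) :
    ∏ i, x i ^ α i ∈ Jq f q := by
  have hT := H.T0F (F := F)
  have e1 : nn d α = ((∑ i, α i * d i : ℕ) : ℤ) := by simp [nn]
  set N := ∑ i, α i * d i with hN
  have hs : ∏ i, x i ^ α i ∈ 𝒮 N := prod_mem_gr hx α
  have e2 := mon_xi (F := F) (x := x) (d := d) H α
  let W : Submodule K S := (Jq f q).restrictScalars K ⊓ win 𝒮 g N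
  have hsW : ∏ i, x i ^ α i ∈ W := by
    apply H.lemW (F := F) (N := N) inf_le_right
    · exact Submodule.subset_span ⟨N, le_rfl, by have := H.hg; omega, hs⟩
    · rw [← e2, ← h, Finset.mul_sum]
      apply Submodule.sum_mem
      intro j _
      have h3 := VV_win H _ (mem_LL.1 (hw j))
      have h4 : algebraMap S F T ^ (nn d α) * (w j * (algebraMap S F (f j) * (algebraMap S F T)⁻¹ ^ ed j) ^ q)
          = algebraMap S F T ^ (nn d α - q * ed j) * w j * algebraMap S F (f j ^ q) := by
        rw [zpow_sub₀ hT, map_pow, mul_pow, ← pow_mul, inv_pow]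
        have : algebraMap S F T ^ ((q : ℤ) * ed j) = algebraMap S F T ^ (ed j * q) := by
          rw [← zpow_natCast]; congr 1; push_cast; ring
        rw [this]
        field_simp
      rw [h4]
      generalize algebraMap S F T ^ (nn d α - q * ed j) * w j = y at h3
      induction h3 using Submodule.span_induction with
      | mem y hy =>
        obtain ⟨i, hi, hi2, s, hs, rfl⟩ := hy
        rw [← map_mul]
        refine Submodule.subset_span ⟨s * f j ^ q, ⟨?_, ?_⟩, rfl⟩
        · exact Ideal.mul_mem_left _ _ (Ideal.subset_span ⟨j, rfl⟩)
        · refine Submodule.subset_span ⟨i + q * ed j, ?_, ?_, ?_⟩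
          · push_cast; omega
          · push_cast; omega
          · exact SetLike.GradedMul.mul_mem hs (by simpa using SetLike.pow_mem_graded q (hf j))
      | zero => simp
      | add a b _ _ ha hb => rw [add_mul]; exact Submodule.add_mem _ ha hb
      | smul c a _ ha => rw [smul_mul_assoc]; exact Submodule.smul_mem _ _ ha
  exact hsW.1

lemma mon_mem_LL (H : Tv 𝒮 T v g m1) (hx : ∀ i, x i ∈ 𝒮 (d i)) (γ : Fin n → ℕ) :
    mon (fun i => algebraMap S F (x i) * (algebraMap S F T)⁻¹ ^ d i) γ ∈ LL F 𝒮 T v g (nn d γ) := by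
  rw [mem_LL, mon_xi H]
  exact mem_VV F (i := ∑ i, γ i * d i) (by simp [nn]) (prod_mem_gr hx γ)

lemma Jq_of_Mem (H : Tv 𝒮 T v g m1) (hx : ∀ i, x i ∈ 𝒮 (d i)) (hf : ∀ j, f j ∈ 𝒮 (ed j))
    (hDφ : ∀ j, D.φ j = algebraMap S F (f j) * (algebraMap S F T)⁻¹ ^ ed j) (hDe : ∀ j, D.e j = ed j)
    {m0 : ℕ} (hcond : ∀ m : ℕ, m0 ≤ m → ∀ n : ℤ, ∀ y ∈ C.L n,
      ∀ z ∈ LL F 𝒮 T v g m, y * z ∈ LL F 𝒮 T v g (n + m))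
    (hd : ∀ i, 1 ≤ d i)
    (q : ℕ) (α γ : Fin n → ℕ) (hγ : m0 ≤ len γ)
    (h : D.Mem (fun i => algebraMap S F (x i) * (algebraMap S F T)⁻¹ ^ d i) d q α) :
    ∏ i, x i ^ (α + γ) i ∈ Jq f q := by
  obtain ⟨w, hw, hwe⟩ := h
  rw [Dat.ph_apply] at hwe
  rw [Dat.mem_G] at hw
  obtain ⟨k, hk⟩ : ∃ k : ℕ, nn d γ = k := ⟨∑ i, γ i * d i, by simp [nn]⟩
  have hk2 : m0 ≤ k := by
    have : (len γ : ℤ) ≤ nn d γ := by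
      rw [len, nn]; push_cast
      apply Finset.sum_le_sum
      intro i _
      have := hd i
      nlinarith [(by exact_mod_cast this : (1 : ℤ) ≤ d i), (Nat.cast_nonneg (γ i) : (0 : ℤ) ≤ γ i)]
    omega
  have hm := mon_mem_LL (F := F) H hx γ
  refine Jq_of_mem (F := F) H hx hf q (α + γ)
    (fun j => w j * mon (fun i => algebraMap S F (x i) * (algebraMap S F T)⁻¹ ^ d i) γ) ?_ ?_
  · intro j
    have h1 := hw j
    rw [hDe] at h1
    have h2 := hcond k hk2 _ _ h1 _ (hk ▸ hm)
    rw [nn_add, hk]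
    convert h2 using 2
    ring
  · rw [mon_add, ← hwe, Finset.sum_mul]
    apply Finset.sum_congr rfl
    intro j _
    rw [hDφ]; ring

end gr
end FT

namespace FT
open Polynomial IntermediateField
set_option linter.unusedSectionVars false

section gr
variable {K S : Type*} [Field K] [CommRing S] [IsDomain S] [Algebra K S]
variable {𝒮 : ℕ → Submodule K S} [GradedAlgebra 𝒮] {n : ℕ} {x : Fin n → S} {d : Fin n → ℕ}
variable {T v : S} {g m1 : ℕ}
variable {r : ℕ} {f : Fin (r + 1) → S} {ed : Fin (r + 1) → ℕ}

lemma pow_mem_of_fin (hf : ∀ j, f j ∈ 𝒮 (ed j))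
    (hfin : Module.Finite K (S ⧸ Ideal.span (Set.range f))) {e : ℕ} (he : 0 < e) {s : S}
    (hs : s ∈ 𝒮 e) : ∃ N, s ^ N ∈ Ideal.span (Set.range f) := by
  classical
  set J := Ideal.span (Set.range f) with hJ
  have hJh : J.IsHomogeneous 𝒮 := by
    apply Ideal.homogeneous_span
    rintro _ ⟨j, rfl⟩
    exact ⟨_, hf j⟩
  have h1 : ¬ LinearIndependent K (fun i : ℕ => Ideal.Quotient.mk J (s ^ i)) :=
    Module.Finite.not_linearIndependent_of_infinite _
  rw [not_linearIndependent_iff] at h1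
  obtain ⟨t, c, h2, i0, hi0, hc⟩ := h1
  refine ⟨i0, ?_⟩
  have h3 : ∑ i ∈ t, c i • s ^ i ∈ J := by
    rw [← Ideal.Quotient.eq_zero_iff_mem, map_sum, ← h2]
    apply Finset.sum_congr rfl
    intro i _
    rw [Algebra.smul_def, Algebra.smul_def, map_mul]
    rfl
  have hm : ∀ i, c i • s ^ i ∈ 𝒮 (i * e) := fun i =>
    Submodule.smul_mem _ _ (by simpa using SetLike.pow_mem_graded i hs)
  have h4 := hJh (i0 * e) h3
  rw [DirectSum.decompose_sum, DirectSum.sum_apply, AddSubmonoidClass.coe_finsetSum,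
    Finset.sum_eq_single i0] at h4
  · rw [DirectSum.decompose_of_mem_same _ (hm i0)] at h4
    have := Submodule.smul_of_tower_mem J (c i0)⁻¹ h4
    rwa [smul_smul, inv_mul_cancel₀ hc, one_smul] at this
  · intro i _ hi
    apply DirectSum.decompose_of_mem_ne _ (hm i)
    intro h
    exact hi (Nat.eq_of_mul_eq_mul_right he h)
  · intro h; exact absurd hi0 h

variable {F : Type*} [Field F] [Algebra S F] [IsFractionRing S F] [Algebra K F] [IsScalarTower K S F]

lemma exists_dat (H : Tv 𝒮 T v g m1) (hf : ∀ j, f j ∈ 𝒮 (ed j))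
    (hfin : Module.Finite K (S ⧸ Ideal.span (Set.range f))) (hfd : ∀ m, (𝒮 m).FG)
    (htr : 2 ≤ Algebra.trdeg K F) {Cb : ℕ}
    (hCb : ∀ m, Module.finrank K (𝒮 m) ≤ Cb * (m + 1)) (p : ℕ) [CharP F p] (hp : g * Cb < p) :
    ∃ D : Dat (H.crv (F := F) hfd htr hCb p hp) r,
      (∀ j, D.φ j = algebraMap S F (f j) * (algebraMap S F T)⁻¹ ^ ed j) ∧ (∀ j, D.e j = ed j) := by
  have hT := H.T0F (F := F)
  obtain ⟨N, hN⟩ := pow_mem_of_fin hf hfin one_pos H.hT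
  obtain ⟨N', hN'⟩ := pow_mem_of_fin hf hfin H.hg H.hv
  have hTN : T ^ N ∈ 𝒮 N := by simpa using SetLike.pow_mem_graded N H.hT
  obtain ⟨w, hw, hws⟩ := hom_comb hf hTN hN
  obtain ⟨w', hws'⟩ := (Ideal.mem_span_range_iff_exists_fun).1 hN'
  have hcop : ∃ a ∈ Oinf F 𝒮 T v g, ∃ b ∈ Oinf F 𝒮 T v g,
      a * algebraMap S F T ^ N + b * algebraMap S F v ^ N' = 1 := by
    have h1 : IsCoprime (⟨algebraMap S F T, mem_Oinf_of T⟩ : Oinf F 𝒮 T v g) ⟨algebraMap S F v, mem_Oinf_of v⟩ := by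
      refine ⟨algebraMap (KK K F T v g) _ (uK K F T v g) * ⟨algebraMap S F T, mem_Oinf_of T⟩ ^ (g - 1), 1, ?_⟩
      apply Subtype.ext
      have := H.one_eq (F := F)
      obtain ⟨g', rfl⟩ : ∃ g', g = g' + 1 := ⟨g - 1, by have := H.hg; omega⟩
      change uu F T v (g' + 1) * algebraMap S F T ^ (g' + 1 - 1) * algebraMap S F T + 1 * algebraMap S F v = 1
      rw [Nat.add_sub_cancel]
      linear_combination -this
    obtain ⟨a, b, hab⟩ := (h1.pow (m := N) (n := N'))
    exact ⟨a, a.2, b, b.2, congrArg Subtype.val hab⟩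
  obtain ⟨a, ha, b, hb, hab⟩ := hcop
  refine ⟨⟨fun j => algebraMap S F (f j) * (algebraMap S F T)⁻¹ ^ ed j, fun j => ed j, fun j => by simp, ?_,
    fun j => algebraMap S F T ^ (-((N : ℤ) - ed j)) * algebraMap S F (w j), ?_, ?_,
    fun j => a * algebraMap S F (w j) + b * algebraMap S F (w' j), ?_, ?_⟩, fun _ => rfl, fun _ => rfl⟩
  · intro j
    exact H.LL_le (F := F) hfd htr hCb p hp _ (xi_mem_LL H (hf j))
  · intro j
    rcases hw j with ⟨h1, h2⟩ | h0
    · refine ⟨N - ed j, ?_⟩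
      rw [mem_LL, ← mul_assoc, ← zpow_add₀ hT]
      push_cast [h1]
      simp only [add_neg_cancel, zpow_zero, one_mul]
      refine mem_VV F ?_ h2
      push_cast [h1]; exact le_rfl
    · simp only [h0, map_zero, mul_zero]; exact Subalgebra.zero_mem _
  · have : algebraMap S F T ^ N ≠ 0 := pow_ne_zero _ hT
    apply mul_left_cancel₀ this
    have e5 : algebraMap S F T ^ N = ∑ j, algebraMap S F (w j * f j) := by
      rw [← map_pow, hws, map_sum]
    rw [mul_one, Finset.mul_sum]
    conv_rhs => rw [e5]
    apply Finset.sum_congr rfl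
    intro j _
    rw [neg_sub, zpow_sub₀ hT, zpow_natCast, zpow_natCast, map_mul, inv_pow]
    field_simp
  · intro j
    exact Subalgebra.add_mem _ (Subalgebra.mul_mem _ ha (mem_Oinf_of _)) (Subalgebra.mul_mem _ hb (mem_Oinf_of _))
  · rw [← hab, ← map_pow, ← map_pow, hws, ← hws', map_sum, map_sum, Finset.mul_sum, Finset.mul_sum, ← Finset.sum_add_distrib]
    apply Finset.sum_congr rfl
    intro j _
    have : (H.crv (F := F) hfd htr hCb p hp).t ^ (-(ed j : ℤ)) = algebraMap S F T ^ ed j := by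
      change (algebraMap S F T)⁻¹ ^ (-(ed j : ℤ)) = _
      rw [zpow_neg, inv_zpow, inv_inv, zpow_natCast]
    rw [this, map_mul, map_mul, inv_pow]
    field_simp

end gr
end FT

namespace FT
open Polynomial IntermediateField
set_option linter.unusedSectionVars false

section gr
variable {K S : Type*} [Field K] [CommRing S] [IsDomain S] [Algebra K S]
variable {𝒮 : ℕ → Submodule K S} [GradedAlgebra 𝒮] {n : ℕ} {x : Fin n → S} {d : Fin n → ℕ}
variable {T v : S} {g m1 : ℕ}
variable {r : ℕ} {f : Fin (r + 1) → S} {ed : Fin (r + 1) → ℕ}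

lemma frobPow_eq {p : ℕ} [Fact p.Prime] [CharP S p] (e : ℕ) :
    (Ideal.span (Set.range f)).frobPow (p ^ e) = Jq f (p ^ e) := by
  apply le_antisymm
  · rw [Ideal.frobPow, Ideal.span_le]
    rintro _ ⟨s, hs, rfl⟩
    obtain ⟨w, rfl⟩ := (Ideal.mem_span_range_iff_exists_fun).1 hs
    have := sum_pow_char_pow (R := S) p e Finset.univ (fun i => w i * f i)
    simp only [SetLike.mem_coe]
    rw [this]
    refine Ideal.sum_mem _ fun j _ => ?_
    rw [mul_pow]
    exact Ideal.mul_mem_left _ _ (Ideal.subset_span ⟨j, rfl⟩)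
  · rw [Jq, Ideal.span_le]
    rintro _ ⟨j, rfl⟩
    exact Ideal.subset_span ⟨f j, Ideal.subset_span ⟨j, rfl⟩, rfl⟩

lemma irr_eq (G : Gr 𝒮 x d) : irrelevantIdeal 𝒮 = Ideal.span (Set.range x) := by
  apply le_antisymm
  · rw [irrelevantIdeal, Ideal.span_le]
    intro s hs
    simp only [Set.mem_iUnion, Set.mem_Ioi] at hs
    obtain ⟨m, hm, hs⟩ := hs
    exact G.comp_mem hm hs
  · rw [Ideal.span_le]
    rintro _ ⟨i, rfl⟩
    apply Ideal.subset_span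
    simp only [Set.mem_iUnion, Set.mem_Ioi]
    exact ⟨d i, G.hd i, G.hx i⟩

lemma pow_span_le (N : ℕ) : Ideal.span (Set.range x) ^ N ≤
    Ideal.span {s | ∃ α : Fin n → ℕ, len α = N ∧ s = ∏ i, x i ^ α i} := by
  classical
  induction N with
  | zero =>
    rw [pow_zero, Ideal.one_eq_top]
    refine (Ideal.eq_top_iff_one _ |>.2 (Ideal.subset_span (show (1 : S) ∈ {s | ∃ α : Fin n → ℕ, len α = 0 ∧ s = ∏ i, x i ^ α i} from ⟨0, by simp [len], by simp⟩))).ge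
  | succ N ih =>
    rw [pow_succ]
    refine (Ideal.mul_mono_left ih).trans ?_
    rw [Ideal.span_mul_span', Ideal.span_le]
    rintro _ ⟨_, ⟨α, hα, rfl⟩, _, ⟨i, rfl⟩, rfl⟩
    refine Ideal.subset_span ⟨α + Pi.single i 1, ?_, ?_⟩
    · rw [len_add, len_single, hα]
    · simp only [Pi.add_apply, pow_add, Finset.prod_mul_distrib]
      congr 1
      rw [Finset.prod_eq_single i]
      · simp
      · intro j _ hj; simp [hj]
      · simp

lemma prod_mem_pow (α : Fin n → ℕ) : ∏ i, x i ^ α i ∈ Ideal.span (Set.range x) ^ len α := by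
  rw [len, ← Finset.prod_pow_eq_pow_sum]
  exact Ideal.prod_mem_prod fun i _ => Ideal.pow_mem_pow (Ideal.subset_span (Set.mem_range_self i)) _

lemma exists_sub_len (α : Fin n → ℕ) (m : ℕ) (h : m ≤ len α) : ∃ β γ : Fin n → ℕ, α = β + γ ∧ len γ = m := by
  classical
  induction m with
  | zero => exact ⟨α, 0, by simp, by simp [len]⟩
  | succ m ih =>
    obtain ⟨β, γ, h1, h2⟩ := ih (by omega)
    have h3 : 0 < len β := by
      have : len α = len β + len γ := by rw [h1, len_add]
      omega
    obtain ⟨i, -, hi⟩ : ∃ i ∈ Finset.univ, 0 < β i := by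
      by_contra hcon
      push Not at hcon
      have : len β = 0 := Finset.sum_eq_zero fun i hi => by have := hcon i hi; omega
      omega
    refine ⟨β - Pi.single i 1, γ + Pi.single i 1, ?_, ?_⟩
    · rw [h1]; funext j
      by_cases hj : j = i
      · subst hj; simp; omega
      · simp [hj]
    · rw [len_add, len_single, h2]

lemma Gr.nu_ne (G : Gr 𝒮 x d) (hf : ∀ j, f j ∈ 𝒮 (ed j))
    (hfin : Module.Finite K (S ⧸ Ideal.span (Set.range f))) (q : ℕ) :
    ∃ r, Ideal.span (Set.range x) ^ (r + 1) ≤ Jq f q := by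
  have h1 : Ideal.span (Set.range x) ≤ (Jq f q).radical := by
    rw [Ideal.span_le]
    rintro _ ⟨i, rfl⟩
    obtain ⟨N, hN⟩ := pow_mem_of_fin hf hfin (G.hd i) (G.hx i)
    have h2 : Ideal.span (Set.range f) ≤ (Jq f q).radical := by
      rw [Ideal.span_le]
      rintro _ ⟨j, rfl⟩
      exact ⟨q, Ideal.subset_span ⟨j, rfl⟩⟩
    obtain ⟨M, hM⟩ := h2 hN
    exact ⟨N * M, by rwa [pow_mul]⟩
  obtain ⟨k, hk⟩ := Ideal.exists_pow_le_of_le_radical_of_fg h1 (Submodule.fg_span (Set.finite_range x))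
  exact ⟨k, (Ideal.pow_le_pow_right (Nat.le_succ k)).trans hk⟩

set_option maxHeartbeats 1000000 in
theorem thmG [Infinite K] {p : ℕ} [Fact p.Prime] [CharP K p] (hdim : ringKrullDim S = 2)
    (G : Gr 𝒮 x d) (hT : T ∈ 𝒮 1) (hT0 : T ≠ 0) (hg : 0 < g) (hdg : ∀ i, d i ∣ g) {Cb : ℕ}
    (hCb : ∀ m, Module.finrank K (𝒮 m) ≤ Cb * (m + 1)) (hp : g * Cb < p)
    (hf : ∀ j, f j ∈ 𝒮 (ed j)) (hfin : Module.Finite K (S ⧸ Ideal.span (Set.range f)))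
    {c : ℝ} (hc : Tendsto (fun e : ℕ => (nuF (irrelevantIdeal 𝒮) (Ideal.span (Set.range f)) (p ^ e) : ℝ)
      / (p : ℝ) ^ e) atTop (𝓝 c)) :
    c = 0 ∨ ∃ b : ℕ, 0 < b ∧ b ≤ (g * Cb) * r.factorial * ((g * Cb) * g * g) ∧ PI p (b * c) := by
  classical
  let F := FractionRing S
  have : CharP S p := charP_of_injective_algebraMap (algebraMap K S).injective p
  have : CharP F p := charP_of_injective_algebraMap (algebraMap K F).injective p
  obtain ⟨v, hv, m1, hm1, hst⟩ := G.exists_TV hdim.le hT hT0 hg hdg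
  have H : Tv 𝒮 T v g m1 := ⟨hT, hT0, hg, hv, hm1, hst⟩
  have hfd := G.fd
  have htr : 2 ≤ Algebra.trdeg K F := by
    have := G.ft
    refine (two_le_trdeg (K := K) hdim).trans ?_
    exact _root_.trdeg_le_of_injective (IsScalarTower.toAlgHom K S F) (IsFractionRing.injective S F)
  obtain ⟨C, D, hDφ, hDe, ⟨m0, hcond⟩, hLL, hdl⟩ : ∃ (C : Crv (KK K F T v g) F) (D : Dat C r),
      (∀ j, D.φ j = algebraMap S F (f j) * (algebraMap S F T)⁻¹ ^ ed j) ∧ (∀ j, D.e j = ed j) ∧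
      (∃ m0 : ℕ, ∀ m : ℕ, m0 ≤ m → ∀ n : ℤ, ∀ y ∈ C.L n,
      ∀ z ∈ LL F 𝒮 T v g m, y * z ∈ LL F 𝒮 T v g (n + m)) ∧ (∀ n, LL F 𝒮 T v g n ≤ C.L n) ∧
      C.dl ≤ g * Cb := by
    obtain ⟨D, hDφ, hDe⟩ := exists_dat (F := F) H hf hfin hfd htr hCb p hp
    exact ⟨_, D, hDφ, hDe, H.conductor (F := F) hfd htr hCb p hp, H.LL_le (F := F) hfd htr hCb p hp,
      H.crv_dl (F := F) hfd htr hCb p hp⟩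
  have hFT := H.T0F (F := F)
  have hp0 : ∀ e : ℕ, (0 : ℝ) < (p : ℝ) ^ e := fun e => by
    have := (Fact.out : p.Prime).pos
    positivity
  have hp1 : (1 : ℝ) < p := by exact_mod_cast (Fact.out : p.Prime).one_lt
  have hpt : Tendsto (fun e : ℕ => (p : ℝ) ^ e) atTop atTop := tendsto_pow_atTop_atTop_of_one_lt hp1
  have hinv : ∀ a : ℝ, Tendsto (fun e : ℕ => a / (p : ℝ) ^ e) atTop (𝓝 0) := fun a =>
    hpt.const_div_atTop a
  set ν : ℕ → ℕ := fun e => nuF (irrelevantIdeal 𝒮) (Ideal.span (Set.range f)) (p ^ e) with hν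
  have hc0 : 0 ≤ c := ge_of_tendsto' hc fun e => by positivity
  rcases hc0.eq_or_lt with h0 | hcpos
  · left; exact h0.symm
  right
  have hset : ∀ e, {r : ℕ | irrelevantIdeal 𝒮 ^ (r + 1) ≤ (Ideal.span (Set.range f)).frobPow (p ^ e)}
      = {r : ℕ | Ideal.span (Set.range x) ^ (r + 1) ≤ Jq f (p ^ e)} := by
    intro e; rw [irr_eq G, frobPow_eq]
  have hνmem : ∀ e, Ideal.span (Set.range x) ^ (ν e + 1) ≤ Jq f (p ^ e) := by
    intro e
    have : ν e ∈ {r : ℕ | Ideal.span (Set.range x) ^ (r + 1) ≤ Jq f (p ^ e)} := by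
      rw [hν]; simp only [nuF]; rw [hset]
      exact Nat.sInf_mem (G.nu_ne hf hfin (p ^ e))
    exact this
  have hνnot : ∀ e, ∀ m, m < ν e → ¬ Ideal.span (Set.range x) ^ (m + 1) ≤ Jq f (p ^ e) := by
    intro e m hm
    rw [hν] at hm; simp only [nuF] at hm; rw [hset] at hm
    exact Nat.notMem_of_lt_sInf hm
  have hex : ∀ e, ∃ α : Fin n → ℕ, m0 + 1 ≤ ν e → (len α + m0 = ν e ∧ 
      ¬ D.Mem (fun i => algebraMap S F (x i) * (algebraMap S F T)⁻¹ ^ d i) d (p ^ e) α) := by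
    intro e
    by_cases hm : m0 + 1 ≤ ν e
    · have h1 := hνnot e (ν e - 1) (by omega)
      rw [Nat.sub_add_cancel (by omega)] at h1
      obtain ⟨α, hα, hα2⟩ : ∃ α : Fin n → ℕ, len α = ν e ∧ ∏ i, x i ^ α i ∉ Jq f (p ^ e) := by
        by_contra hcon
        push Not at hcon
        apply h1
        refine (pow_span_le _).trans ?_
        rw [Ideal.span_le]
        rintro _ ⟨α, hα, rfl⟩
        exact hcon α hα
      obtain ⟨β, γ, h2, h3⟩ := exists_sub_len α m0 (by omega)
      refine ⟨β, fun _ => ⟨?_, fun hmem => hα2 ?_⟩⟩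
      · rw [← hα, h2, len_add, h3]
      · rw [h2]
        exact Jq_of_Mem (F := F) H G.hx hf hDφ hDe hcond G.hd _ β γ h3.ge hmem
    · exact ⟨0, fun h => absurd h hm⟩
  choose αs hαs using hex
  have hev : ∀ᶠ e in atTop, m0 + 1 ≤ ν e := by
    have h1 := (hinv (m0 + 1)).eventually (gt_mem_nhds (show (0:ℝ) < c / 2 by positivity))
    have h2 := hc.eventually (lt_mem_nhds (show c / 2 < c by linarith))
    filter_upwards [h1, h2] with e h1 h2
    have h3 := h1.trans h2
    rw [div_lt_div_iff_of_pos_right (hp0 e)] at h3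
    exact_mod_cast h3.le
  obtain ⟨b, hb, hbb, hPI⟩ := crv_limit (p := p) D
    (fun i => algebraMap S F (x i) * (algebraMap S F T)⁻¹ ^ d i) d
    (fun i => hLL _ (xi_mem_LL H (G.hx i)))
    (fun i => mul_ne_zero (by simpa using G.hx0 i) (pow_ne_zero _ (inv_ne_zero hFT))) G.hd g
    (fun i => Nat.le_of_dvd hg (hdg i)) c hcpos (fun e => ν e + 1)
    (fun e α hα => mem_of_Jq H G.hx hf hLL hDφ hDe _ _
      (hνmem e (Ideal.pow_le_pow_right hα (prod_mem_pow α))))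
    (by
      have := hc.add (hinv 1)
      rw [add_zero] at this
      refine this.congr fun e => ?_
      push_cast; ring)
    αs (hev.mono fun e he => (hαs e he).2)
    (by
      have := hc.sub (hinv m0)
      rw [sub_zero] at this
      refine this.congr' (hev.mono fun e he => ?_)
      have h1 := (hαs e he).1
      have h2 : ((len (αs e) : ℝ)) + m0 = ν e := by exact_mod_cast h1
      rw [← sub_div]
      congr 1
      linarith)
  refine ⟨b, hb, hbb.trans ?_, hPI⟩
  gcongr

end gr
end FT

namespace FT
set_option linter.unusedSectionVars false

section spread
variable {A RA Ω k : Type*} [CommRing A] [CommRing RA] [Algebra A RA] [Field Ω] [Algebra A Ω]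
  [Field k] [Algebra A k]

lemma redGrading_eq (𝒜A : ℕ → Submodule A RA) :
    redGrading A RA Ω 𝒜A = fun n => (𝒜A n).baseChange Ω := by
  funext n
  rw [Submodule.baseChange_eq_span]
  rfl

lemma red_graded (𝒜A : ℕ → Submodule A RA) [GradedAlgebra 𝒜A] :
    Nonempty (GradedAlgebra (redGrading A RA Ω 𝒜A)) := by
  rw [redGrading_eq]
  exact ⟨inferInstance⟩

lemma li_spread [Module.Flat A RA] (hk : Function.Injective (algebraMap A k)) {m : ℕ} (y : Fin m → RA)
    (h : LinearIndependent Ω (fun i => (1 : Ω) ⊗ₜ[A] y i)) :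
    LinearIndependent k (fun i => (1 : k) ⊗ₜ[A] y i) := by
  classical
  rw [Fintype.linearIndependent_iff]
  intro κ hκ
  have h1 : ∑ i, κ i ⊗ₜ[A] y i = (0 : k ⊗[A] RA) := by
    rw [← hκ]
    apply Finset.sum_congr rfl
    intro i _
    rw [TensorProduct.smul_tmul', smul_eq_mul, mul_one]
  obtain ⟨l, a, z, hz, ha⟩ := TensorProduct.vanishesTrivially_of_sum_tmul_eq_zero_of_rTensor_injective
    A (Module.Flat.rTensor_preserves_injective_linearMap _ (Submodule.injective_subtype _)) h1
  let b : Matrix (Fin m) (Fin l) Ω := fun i j => algebraMap A Ω (a i j)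
  have hrows : LinearIndependent Ω b.row := by
    rw [Fintype.linearIndependent_iff] at h ⊢
    intro w hw
    apply h
    have h2 : ∀ i, (1 : Ω) ⊗ₜ[A] y i = ∑ j, b i j • ((1 : Ω) ⊗ₜ[A] z j) := by
      intro i
      rw [hz i, TensorProduct.tmul_sum]
      apply Finset.sum_congr rfl
      intro j _
      rw [TensorProduct.tmul_smul, ← algebraMap_smul Ω]
    simp only [h2, Finset.smul_sum, smul_smul]
    rw [Finset.sum_comm]
    apply Finset.sum_eq_zero
    intro j _
    rw [← Finset.sum_smul]
    have h3 := congrFun hw j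
    simp only [Finset.sum_apply, Pi.smul_apply, smul_eq_mul, Matrix.row, Pi.zero_apply] at h3
    rw [h3, zero_smul]
  have hrk := hrows.rank_matrix
  rw [Fintype.card_fin, Matrix.rank_eq_finrank_span_cols] at hrk
  obtain ⟨f, hf, -, hfl⟩ := Submodule.exists_fun_fin_finrank_span_eq Ω (Set.range b.col)
  choose σ hσ using hf
  let τ : Fin m → Fin l := fun i => σ (Fin.cast hrk.symm i)
  let M : Matrix (Fin m) (Fin m) A := fun i j => a i (τ j)
  have hcol : LinearIndependent Ω (M.map (algebraMap A Ω)).col := by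
    have h5 := hfl.comp (Fin.cast hrk.symm) (Fin.cast_injective _)
    have e6 : (M.map (algebraMap A Ω)).col = f ∘ Fin.cast hrk.symm := funext fun j => hσ _
    rw [e6]
    exact h5
  have hdet : (M.map (algebraMap A Ω)).det ≠ 0 := by
    rw [Matrix.linearIndependent_cols_iff_isUnit, Matrix.isUnit_iff_isUnit_det] at hcol
    exact hcol.ne_zero
  have hdet2 : (M.map (algebraMap A k)).det ≠ 0 := by
    intro h0
    apply hdet
    have e1 := RingHom.map_det (algebraMap A k) M
    have e2 := RingHom.map_det (algebraMap A Ω) M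
    simp only [RingHom.mapMatrix_apply] at e1 e2
    rw [← e2]
    rw [h0, map_eq_zero_iff _ hk] at e1
    rw [e1, map_zero]
  have hv : Matrix.vecMul κ (M.map (algebraMap A k)) = 0 := by
    funext j
    rw [Matrix.vecMul, dotProduct, Pi.zero_apply, ← ha (τ j)]
    apply Finset.sum_congr rfl
    intro i _
    rw [Algebra.smul_def, mul_comm]; rfl
  have := Matrix.eq_zero_of_vecMul_eq_zero hdet2 hv
  intro i; rw [this]; rfl

lemma finrank_red_le [Module.Flat A RA] (hk : Function.Injective (algebraMap A k))
    (𝒜A : ℕ → Submodule A RA) (n : ℕ) [Module.Finite k (redGrading A RA k 𝒜A n)] :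
    Module.finrank Ω (redGrading A RA Ω 𝒜A n) ≤ Module.finrank k (redGrading A RA k 𝒜A n) := by
  change Module.finrank Ω (Submodule.span Ω (⇑(Algebra.TensorProduct.includeRight : RA →ₐ[A] Ω ⊗[A] RA) '' (𝒜A n : Set RA))) ≤ _
  by_cases hfi : Module.Finite Ω (Submodule.span Ω (⇑(Algebra.TensorProduct.includeRight : RA →ₐ[A] Ω ⊗[A] RA) '' (𝒜A n : Set RA)))
  swap
  · rw [Module.finrank_of_not_finite hfi]; exact Nat.zero_le _
  obtain ⟨f, hf, -, hfl⟩ := Submodule.exists_fun_fin_finrank_span_eq Ω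
    (⇑(Algebra.TensorProduct.includeRight : RA →ₐ[A] Ω ⊗[A] RA) '' (𝒜A n : Set RA))
  choose y hy hyf using hf
  have h1 : LinearIndependent Ω (fun i => (1 : Ω) ⊗ₜ[A] y i) := by
    have e6 : (fun i => (1 : Ω) ⊗ₜ[A] y i) = f := funext fun i => hyf i
    rw [e6]
    exact hfl
  have h2 := li_spread hk y h1
  have h3 : ∀ i, (1 : k) ⊗ₜ[A] y i ∈ redGrading A RA k 𝒜A n := fun i =>
    Submodule.subset_span ⟨y i, hy i, rfl⟩
  have h4 : LinearIndependent k (fun i => (⟨_, h3 i⟩ : redGrading A RA k 𝒜A n)) :=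
    LinearIndependent.of_comp (Submodule.subtype _) h2
  simpa using h4.fintype_card_le_finrank

lemma red_zero [Module.Flat A RA] [Nontrivial (Ω ⊗[A] RA)] (hk : Function.Injective (algebraMap A k))
    (𝒜A : ℕ → Submodule A RA)
    (h0 : ∀ s ∈ redGrading A RA k 𝒜A 0, ∃ a : k, s = algebraMap k _ a) :
    ∀ s ∈ redGrading A RA Ω 𝒜A 0, ∃ a : Ω, s = algebraMap Ω _ a := by
  suffices hle : redGrading A RA Ω 𝒜A 0 ≤ Submodule.span Ω {(1 : Ω ⊗[A] RA)} by
    intro s hs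
    obtain ⟨a, rfl⟩ := Submodule.mem_span_singleton.1 (hle hs)
    exact ⟨a, by rw [Algebra.smul_def, mul_one]⟩
  rw [redGrading, Submodule.span_le]
  rintro _ ⟨y, hy, rfl⟩
  by_contra hcon
  have h1 : LinearIndependent Ω (fun i : Fin 2 => (1 : Ω) ⊗ₜ[A] (![1, y] i : RA)) := by
    have e6 : (fun i : Fin 2 => (1 : Ω) ⊗ₜ[A] (![1, y] i : RA)) = ![1, (1 : Ω) ⊗ₜ[A] y] := by
      funext i; fin_cases i <;> rfl
    rw [e6, LinearIndependent.pair_iff' one_ne_zero]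
    intro a ha
    apply hcon
    rw [SetLike.mem_coe, Submodule.mem_span_singleton]
    exact ⟨a, ha⟩
  have h2 := li_spread hk _ h1
  have e7 : (fun i : Fin 2 => (1 : k) ⊗ₜ[A] (![1, y] i : RA)) = ![1, (1 : k) ⊗ₜ[A] y] := by
    funext i; fin_cases i <;> rfl
  rw [e7] at h2
  have hne : (1 : k ⊗[A] RA) ≠ 0 := by simpa using h2.ne_zero 0
  rw [LinearIndependent.pair_iff' hne] at h2
  obtain ⟨a, ha⟩ := h0 _ (Submodule.subset_span ⟨y, hy, rfl⟩)
  apply h2 a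
  rw [Algebra.smul_def, mul_one, ← ha]
  rfl

/-- kernel of the reduction map -/
lemma ker_red [Module.Flat A RA] (y : RA) (h : (1 : Ω) ⊗ₜ[A] y = 0) :
    y ∈ Ideal.map (algebraMap A RA) (RingHom.ker (algebraMap A Ω)) := by
  classical
  have h1 : ∑ i : Fin 1, (fun _ => (1 : Ω)) i ⊗ₜ[A] (fun _ => y) i = (0 : Ω ⊗[A] RA) := by simpa using h
  obtain ⟨l, a, z, hz, ha⟩ := TensorProduct.vanishesTrivially_of_sum_tmul_eq_zero_of_rTensor_injective
    A (Module.Flat.rTensor_preserves_injective_linearMap _ (Submodule.injective_subtype _)) h1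
  rw [show y = _ from hz 0]
  refine Ideal.sum_mem _ fun j _ => ?_
  rw [Algebra.smul_def]
  apply Ideal.mul_mem_right
  apply Ideal.mem_map_of_mem
  rw [RingHom.mem_ker]
  simpa [Algebra.smul_def] using ha j

lemma inj_red [Module.Flat A RA] (hk : Function.Injective (algebraMap A k)) (y : RA)
    (h : (1 : k) ⊗ₜ[A] y = 0) : y = 0 := by
  have := ker_red (Ω := k) y h
  rw [(RingHom.injective_iff_ker_eq_bot _).1 hk, Ideal.map_bot] at this
  simpa using this

lemma red_one_ne [Module.Flat A RA] [IsNoetherianRing RA] (hk : Function.Injective (algebraMap A k))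
    [IsDomain (k ⊗[A] RA)] [Nontrivial (Ω ⊗[A] RA)]
    (𝒜A : ℕ → Submodule A RA) [GradedAlgebra 𝒜A]
    (h : redGrading A RA k 𝒜A 1 ≠ ⊥) : ∃ T ∈ redGrading A RA Ω 𝒜A 1, T ≠ 0 := by
  classical
  by_contra hcon
  push Not at hcon
  set s := RingHom.ker (algebraMap A Ω)
  set P := Ideal.map (algebraMap A RA) s with hP
  set N : Ideal RA := Ideal.span (𝒜A 1 : Set RA) with hN
  have hcomp : ∀ z ∈ P, ∀ r : RA, (DirectSum.decompose 𝒜A (r * z) 1 : RA) ∈ P • N := by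
    intro z hz
    rw [hP, Ideal.map] at hz
    induction hz using Submodule.span_induction with
    | mem z hz =>
      intro r
      obtain ⟨a, ha, rfl⟩ := hz
      have e1 : r * algebraMap A RA a = a • r := by rw [Algebra.smul_def, mul_comm]
      rw [e1, DirectSum.decompose_smul]
      have e2 : (((a • DirectSum.decompose 𝒜A r) 1 : 𝒜A 1) : RA)
          = algebraMap A RA a • (DirectSum.decompose 𝒜A r 1 : RA) := by
        rw [algebraMap_smul]; rfl
      rw [e2]
      exact Submodule.smul_mem_smul (Ideal.mem_map_of_mem _ ha) (Ideal.subset_span (Subtype.coe_prop _))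
    | zero => simp
    | add x y _ _ hx hy => intro r; rw [mul_add, DirectSum.decompose_add]; exact add_mem (hx r) (hy r)
    | smul r x hx ih => intro r'; rw [show r' * r • x = (r' * r) * x by rw [smul_eq_mul, mul_assoc]]; exact ih _
  have hle : N ≤ P • N := by
    rw [hN, Ideal.span_le, ← hN]
    intro y hy
    have h1 := hcon _ (Submodule.subset_span ⟨y, hy, rfl⟩)
    have h2 := hcomp y (ker_red y h1) 1
    rw [one_mul, DirectSum.decompose_of_mem_same _ hy] at h2
    exact h2
  obtain ⟨r, hr1, hr⟩ := Submodule.exists_sub_one_mem_and_smul_eq_zero_of_fg_of_le_smul P N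
    (IsNoetherian.noetherian N) hle
  have hr0 : r = 0 := by
    apply inj_red (k := k) hk
    obtain ⟨y, hy, hy0⟩ : ∃ y ∈ 𝒜A 1, (1 : k) ⊗ₜ[A] y ≠ 0 := by
      by_contra hc2
      push Not at hc2
      apply h
      rw [redGrading, Submodule.span_eq_bot]
      rintro _ ⟨y, hy, rfl⟩
      exact hc2 y hy
    have h2 : ((1 : k) ⊗ₜ[A] r) * ((1 : k) ⊗ₜ[A] y) = 0 := by
      rw [Algebra.TensorProduct.tmul_mul_tmul]
      have := hr y (Ideal.subset_span hy)
      rw [smul_eq_mul] at this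
      rw [this, TensorProduct.tmul_zero]
    exact (mul_eq_zero.1 h2).resolve_right hy0
  have hPker : P ≤ RingHom.ker (Algebra.TensorProduct.includeRight : RA →ₐ[A] Ω ⊗[A] RA) := by
    rw [hP, Ideal.map_le_iff_le_comap]
    intro a ha
    rw [Ideal.mem_comap, RingHom.mem_ker, AlgHom.commutes, IsScalarTower.algebraMap_apply A Ω (Ω ⊗[A] RA),
      (RingHom.mem_ker).1 ha, map_zero]
  have h1 := hPker hr1
  rw [hr0, RingHom.mem_ker, zero_sub, map_neg, map_one, neg_eq_zero] at h1
  exact one_ne_zero h1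

end spread
end FT

namespace FT
set_option linter.unusedSectionVars false

section gr
variable {K S : Type*} [Field K] [CommRing S] [IsDomain S] [Algebra K S]
variable {𝒮 : ℕ → Submodule K S} [GradedAlgebra 𝒮] {n : ℕ} {x : Fin n → S} {d : Fin n → ℕ}
variable {T v : S} {g m1 : ℕ}

lemma std_gr (h0 : 𝒮 0 = Submodule.span K {1}) (hstd : ∀ n, 𝒮 (n + 1) = 𝒮 1 * 𝒮 n)
    (hfg : FiniteDimensional K (𝒮 1)) :
    Gr 𝒮 (fun i => (Module.finBasis K (𝒮 1) i : S)) (fun _ => 1) where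
  h0 := by
    intro s hs
    rw [h0, Submodule.mem_span_singleton] at hs
    obtain ⟨a, rfl⟩ := hs
    exact ⟨a, by rw [Algebra.smul_def, mul_one]⟩
  hx i := Subtype.coe_prop _
  hx0 i := by
    have := (Module.finBasis K (𝒮 1)).ne_zero i
    simpa using this
  hd _ := le_rfl
  gen := by
    classical
    set B := Algebra.adjoin K (Set.range (fun i => (Module.finBasis K (𝒮 1) i : S))) with hB
    have h1 : 𝒮 1 ≤ Subalgebra.toSubmodule B := by
      intro s hs
      have h2 := (Module.finBasis K (𝒮 1)).sum_repr ⟨s, hs⟩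
      have h3 := congrArg Subtype.val h2
      simp only at h3
      rw [← h3]
      rw [Submodule.coe_sum]
      apply Submodule.sum_mem
      intro i _
      exact Submodule.smul_mem _ _ (Algebra.subset_adjoin ⟨i, rfl⟩)
    have h2 : ∀ n, 𝒮 n ≤ Subalgebra.toSubmodule B := by
      intro n
      induction n with
      | zero =>
        rw [h0, Submodule.span_le, Set.singleton_subset_iff]
        exact B.one_mem
      | succ n ih =>
        rw [hstd, Submodule.mul_le]
        intro a ha b hb
        exact B.mul_mem (h1 ha) (ih hb)
    rw [eq_top_iff]
    intro s _
    rw [← DirectSum.sum_support_decompose 𝒮 s]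
    exact B.sum_mem fun i _ => h2 i (Subtype.coe_prop _)

lemma std_one_ne (h0 : 𝒮 0 = Submodule.span K {1}) (hstd : ∀ n, 𝒮 (n + 1) = 𝒮 1 * 𝒮 n)
    (hdim : ringKrullDim S = 2) : 𝒮 1 ≠ ⊥ := by
  classical
  intro h1
  have hz : ∀ n, 𝒮 (n + 1) = ⊥ := fun n => by rw [hstd, h1, Submodule.bot_mul]
  have hs : Function.Surjective (algebraMap K S) := by
    intro s
    have h2 : s ∈ 𝒮 0 := by
      rw [← DirectSum.sum_support_decompose 𝒮 s]
      apply Submodule.sum_mem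
      intro i _
      cases i with
      | zero => exact Subtype.coe_prop _
      | succ i =>
        have := (DirectSum.decompose 𝒮 s (i + 1)).2
        have h5 := (hz i).le this
        rw [Submodule.mem_bot] at h5
        rw [h5]; exact zero_mem _
    rw [h0, Submodule.mem_span_singleton] at h2
    obtain ⟨a, rfl⟩ := h2
    exact ⟨a, by rw [Algebra.smul_def, mul_one]⟩
  have h3 := ringKrullDim_le_of_surjective _ hs
  rw [hdim, ringKrullDim_eq_zero_of_field] at h3
  exact absurd h3 (by decide)

lemma hilb (H : Tv 𝒮 T v 1 m1) (hfd : ∀ m, (𝒮 m).FG) :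
    ∃ Cb, ∀ m, Module.finrank K (𝒮 m) ≤ Cb * (m + 1) := by
  classical
  have hfin : ∀ m, Module.Finite K (𝒮 m) := fun m => Module.Finite.iff_fg.2 (hfd m)
  have key : ∀ k, ∀ s ∈ 𝒮 (m1 + k), ∃ w : ℕ → S, (∀ i, w i ∈ 𝒮 m1) ∧
      s = ∑ i ∈ Finset.range (k + 1), T ^ i * v ^ (k - i) * w i := by
    intro k
    induction k with
    | zero => intro s hs; exact ⟨fun _ => s, fun _ => hs, by simp⟩
    | succ k ih =>
      intro s hs
      obtain ⟨a, ha, b, hb, rfl⟩ := H.st (m1 + (k + 1)) (by omega) s hs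
      obtain ⟨w, hw, rfl⟩ := ih a ha
      obtain ⟨z, hz, rfl⟩ := ih b hb
      refine ⟨fun i => (if i = 0 then 0 else w (i - 1)) + (if i ≤ k then z i else 0), ?_, ?_⟩
      · intro i
        apply Submodule.add_mem
        · split_ifs
          · exact zero_mem _
          · exact hw _
        · split_ifs
          · exact hz _
          · exact zero_mem _
      · simp only [mul_add]
        rw [Finset.sum_add_distrib, Finset.sum_range_succ' _ (k + 1), Finset.sum_range_succ _ (k + 1)]
        simp only [Nat.add_eq_zero_iff, one_ne_zero, and_false, if_false, if_true, mul_zero, add_zero,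
          Nat.add_sub_cancel, Nat.add_sub_add_right, Nat.not_succ_le_self]
        rw [Finset.mul_sum, Finset.mul_sum]
        congr 1
        · apply Finset.sum_congr rfl
          intro i _
          ring
        · apply Finset.sum_congr rfl
          intro i hi
          rw [Finset.mem_range] at hi
          rw [if_pos (by omega), show k + 1 - i = (k - i) + 1 by omega]
          ring
  have hb : ∀ k, Module.finrank K (𝒮 (m1 + k)) ≤ (k + 1) * Module.finrank K (𝒮 m1) := by
    intro k
    let Φ : (Fin (k + 1) → 𝒮 m1) →ₗ[K] S :=
      ∑ i : Fin (k + 1), (LinearMap.mulLeft K (T ^ (i : ℕ) * v ^ (k - i))) ∘ₗ (𝒮 m1).subtype ∘ₗ LinearMap.proj i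
    have h1 : 𝒮 (m1 + k) ≤ LinearMap.range Φ := by
      intro s hs
      obtain ⟨w, hw, rfl⟩ := key k s hs
      refine ⟨fun i => ⟨w i, hw i⟩, ?_⟩
      rw [Finset.sum_range]
      simp [Φ, mul_assoc]
    refine (Submodule.finrank_mono h1).trans ((LinearMap.finrank_range_le Φ).trans ?_)
    rw [Module.finrank_pi_fintype]
    simp
  refine ⟨∑ i ∈ Finset.range (m1 + 1), Module.finrank K (𝒮 i), fun m => ?_⟩
  rcases le_total m1 m with hm | hm
  · obtain ⟨k, rfl⟩ := Nat.exists_eq_add_of_le hm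
    refine (hb k).trans ?_
    rw [mul_comm]
    apply Nat.mul_le_mul _ (by omega)
    exact Finset.single_le_sum (f := fun i => Module.finrank K (𝒮 i)) (fun _ _ => Nat.zero_le _) (by simp)
  · refine le_trans ?_ (Nat.le_mul_of_pos_right _ (Nat.succ_pos m))
    exact Finset.single_le_sum (f := fun i => Module.finrank K (𝒮 i)) (fun _ _ => Nat.zero_le _) (by simp; omega)

lemma std_hilb [Infinite K] (h0 : 𝒮 0 = Submodule.span K {1}) (hstd : ∀ n, 𝒮 (n + 1) = 𝒮 1 * 𝒮 n)
    (hfg : FiniteDimensional K (𝒮 1)) (hdim : ringKrullDim S = 2) :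
    (∀ m, Module.Finite K (𝒮 m)) ∧ ∃ Cb, ∀ m, Module.finrank K (𝒮 m) ≤ Cb * (m + 1) := by
  have G := std_gr h0 hstd hfg
  obtain ⟨T, hT, hT0⟩ := (Submodule.ne_bot_iff _).1 (std_one_ne h0 hstd hdim)
  obtain ⟨v, hv, m1, hm1, hst⟩ := G.exists_TV hdim.le hT hT0 (g := 1) one_pos (fun _ => dvd_rfl)
  exact ⟨fun m => Module.Finite.iff_fg.2 (G.fd m), hilb (T := T) (v := v) (m1 := m1) ⟨hT, hT0, one_pos, hv, hm1, hst⟩ G.fd⟩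

end gr
end FT

namespace FT
set_option linter.unusedSectionVars false

section gens
variable {A RA : Type*} [CommRing A] [CommRing RA] [Algebra A RA]
  (𝒜A : ℕ → Submodule A RA) [GradedAlgebra 𝒜A]

lemma exists_hom_gens (hft : Algebra.FiniteType A RA) :
    ∃ Y : Finset RA, (∀ y ∈ Y, ∃ i, y ∈ 𝒜A i) ∧ Algebra.adjoin A (Y : Set RA) = ⊤ := by
  classical
  obtain ⟨t, ht⟩ := hft.out
  refine ⟨t.biUnion fun s => (DirectSum.decompose 𝒜A s).support.image fun i => (DirectSum.decompose 𝒜A s i : RA), ?_, ?_⟩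
  · intro y hy
    simp only [Finset.mem_biUnion, Finset.mem_image] at hy
    obtain ⟨s, -, i, -, rfl⟩ := hy
    exact ⟨i, Subtype.coe_prop _⟩
  · rw [eq_top_iff, ← ht, Algebra.adjoin_le_iff]
    intro s hs
    rw [SetLike.mem_coe, ← DirectSum.sum_support_decompose 𝒜A s]
    apply Subalgebra.sum_mem
    intro i hi
    apply Algebra.subset_adjoin
    simp only [Finset.coe_biUnion, Finset.coe_image, Set.mem_iUnion]
    exact ⟨s, hs, i, hi, rfl⟩

lemma exists_hom_igens [IsNoetherianRing RA] (IA : Ideal RA) (hIA : Ideal.IsHomogeneous 𝒜A IA) :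
    ∃ (r : ℕ) (f : Fin (r + 1) → RA) (ed : Fin (r + 1) → ℕ), (∀ j, f j ∈ 𝒜A (ed j)) ∧
      IA = Ideal.span (Set.range f) := by
  classical
  obtain ⟨t, ht⟩ := IsNoetherian.noetherian IA
  let Y : Finset RA := insert 0 (t.biUnion fun s => (DirectSum.decompose 𝒜A s).support.image fun i => (DirectSum.decompose 𝒜A s i : RA))
  have hY : ∀ y ∈ Y, (∃ i, y ∈ 𝒜A i) ∧ y ∈ IA := by
    intro y hy
    simp only [Y, Finset.mem_insert, Finset.mem_biUnion, Finset.mem_image] at hy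
    rcases hy with rfl | ⟨s, hs, i, -, rfl⟩
    · exact ⟨⟨0, zero_mem _⟩, zero_mem _⟩
    · exact ⟨⟨i, Subtype.coe_prop _⟩, hIA i (ht ▸ Submodule.subset_span hs)⟩
  obtain ⟨m, f, -, hf⟩ := Y.finite_toSet.fin_param
  obtain ⟨r, rfl⟩ : ∃ r, m = r + 1 := by
    cases m with
    | zero =>
      have : (0 : RA) ∈ Set.range f := hf ▸ (by simp [Y])
      obtain ⟨i, -⟩ := this
      exact i.elim0
    | succ r => exact ⟨r, rfl⟩
  have hfm : ∀ j, f j ∈ Y := fun j => by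
    have : f j ∈ Set.range f := ⟨j, rfl⟩
    rw [hf] at this; exact this
  choose ed hed using fun j => (hY _ (hfm j)).1
  refine ⟨r, f, ed, hed, le_antisymm ?_ ?_⟩
  · rw [← ht, Submodule.span_le]
    intro s hs
    rw [SetLike.mem_coe, ← DirectSum.sum_support_decompose 𝒜A s]
    refine Ideal.sum_mem _ fun i hi => ?_
    apply Ideal.subset_span
    rw [hf]
    simp only [Y, Finset.coe_insert, Finset.coe_biUnion, Finset.coe_image, Set.mem_insert_iff, Set.mem_iUnion]
    exact Or.inr ⟨s, hs, i, hi, rfl⟩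
  · rw [Ideal.span_le]
    rintro _ ⟨j, rfl⟩
    exact (hY _ (hfm j)).2

variable {𝒜A}
variable {Ω : Type*} [Field Ω] [Algebra A Ω]

lemma exists_red_gr [IsDomain (Ω ⊗[A] RA)] [GradedAlgebra (redGrading A RA Ω 𝒜A)] {Y : Finset RA} {dy : RA → ℕ}
    (hY : ∀ y ∈ Y, y ∈ 𝒜A (dy y)) (hgen : Algebra.adjoin A (Y : Set RA) = ⊤)
    (h0 : ∀ s ∈ redGrading A RA Ω 𝒜A 0, ∃ a : Ω, s = algebraMap Ω _ a) :
    ∃ (n : ℕ) (x : Fin n → Ω ⊗[A] RA) (d : Fin n → ℕ), Gr (redGrading A RA Ω 𝒜A) x d ∧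
      ∀ i, d i ∣ ∏ y ∈ Y, max 1 (dy y) := by
  classical
  let Z : Finset RA := Y.filter fun y => (1 : Ω) ⊗ₜ[A] y ≠ 0 ∧ 1 ≤ dy y
  obtain ⟨n, z, -, hz⟩ := Z.finite_toSet.fin_param
  have hzm : ∀ i, z i ∈ Z := fun j => by
    have : z j ∈ Set.range z := ⟨j, rfl⟩
    rw [hz] at this; exact this
  have hzY : ∀ i, z i ∈ Y ∧ (1 : Ω) ⊗ₜ[A] z i ≠ 0 ∧ 1 ≤ dy (z i) := fun i => by
    simpa [Z] using hzm i
  refine ⟨n, fun i => (1 : Ω) ⊗ₜ[A] z i, fun i => dy (z i), ⟨h0, ?_, fun i => (hzY i).2.1, fun i => (hzY i).2.2, ?_⟩, ?_⟩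
  · intro i
    exact Submodule.subset_span ⟨z i, hY _ (hzY i).1, rfl⟩
  · set B := Algebra.adjoin Ω (Set.range fun i => (1 : Ω) ⊗ₜ[A] z i)
    have h1 : ∀ y ∈ Y, (1 : Ω) ⊗ₜ[A] y ∈ B := by
      intro y hy
      by_cases hy0 : (1 : Ω) ⊗ₜ[A] y = 0
      · rw [hy0]; exact zero_mem _
      by_cases hy1 : 1 ≤ dy y
      · have : y ∈ Set.range z := by rw [hz]; simp only [Z, Finset.mem_coe, Finset.mem_filter]; exact ⟨hy, hy0, hy1⟩
        obtain ⟨i, rfl⟩ := this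
        exact Algebra.subset_adjoin ⟨i, rfl⟩
      · have h2 := hY y hy
        rw [show dy y = 0 by omega] at h2
        obtain ⟨a, ha⟩ := h0 ((1 : Ω) ⊗ₜ[A] y) (Submodule.subset_span ⟨y, h2, rfl⟩)
        rw [ha]; exact B.algebraMap_mem a
    have h2 : ∀ y : RA, (1 : Ω) ⊗ₜ[A] y ∈ B := by
      intro y
      have hy : y ∈ Algebra.adjoin A (Y : Set RA) := by rw [hgen]; trivial
      have h3 : Algebra.adjoin A (Y : Set RA) ≤ (B.restrictScalars A).comap
          (Algebra.TensorProduct.includeRight : RA →ₐ[A] Ω ⊗[A] RA) := by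
        rw [Algebra.adjoin_le_iff]
        intro y hy
        exact h1 y hy
      exact h3 hy
    rw [eq_top_iff]
    intro s _
    induction s using TensorProduct.induction_on with
    | zero => exact zero_mem _
    | tmul a y =>
      have : a ⊗ₜ[A] y = a • ((1 : Ω) ⊗ₜ[A] y) := by rw [TensorProduct.smul_tmul', smul_eq_mul, mul_one]
      rw [this]; exact B.smul_mem (h2 y) a
    | add a b ha hb => exact add_mem (ha trivial) (hb trivial)
  · intro i
    have h1 := Finset.dvd_prod_of_mem (fun y => max 1 (dy y)) (hzY i).1
    simp only [max_eq_right (hzY i).2.2] at h1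
    exact h1

end gens
end FT

namespace FT
set_option linter.unusedSectionVars false

lemma int_gap (y : ℝ) : ∃ δ : ℝ, 0 < δ ∧ ∀ z : ℤ, |(z : ℝ) - y| < δ → (z : ℝ) = y := by
  by_cases h : ((⌊y⌋ : ℤ) : ℝ) = y
  · refine ⟨1, one_pos, fun z hz => ?_⟩
    rw [← h] at hz ⊢
    have h1 : |z - ⌊y⌋| < 1 := by exact_mod_cast hz
    rw [Int.abs_lt_one_iff] at h1
    rw [sub_eq_zero.1 h1]
  · have h1 : ((⌊y⌋ : ℤ) : ℝ) < y := lt_of_le_of_ne (Int.floor_le y) h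
    have h2 := Int.lt_floor_add_one y
    refine ⟨min (y - ⌊y⌋) (⌊y⌋ + 1 - y), lt_min (by linarith) (by linarith), fun z hz => ?_⟩
    exfalso
    rw [lt_min_iff, abs_lt, abs_lt] at hz
    have h3 : ((⌊y⌋ : ℤ) : ℝ) < z := by linarith [hz.1.1]
    have h4 : (z : ℝ) < ((⌊y⌋ + 1 : ℤ) : ℝ) := by push_cast; linarith [hz.2.2]
    have h5 : ⌊y⌋ < z := by exact_mod_cast h3
    have h6 : z < ⌊y⌋ + 1 := by exact_mod_cast h4
    omega

lemma final_arith (L : ℝ) (M : ℕ) (hM : 0 < M) : ∃ ε : ℝ, 0 < ε ∧ ∀ p : ℕ, p.Prime → M < p →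
    ∀ c : ℝ, 0 ≤ c → PI p (M * c) → |c - L| < ε → c ≠ L →
      (∃ a₁ b₁ : ℕ, 0 < a₁ ∧ 0 < b₁ ∧ Nat.gcd a₁ p = 1 ∧ c = (a₁ : ℝ) / ((p : ℝ) * (b₁ : ℝ))) ∧
      (∀ q : ℚ, (q : ℝ) = c → p ∣ q.den) := by
  obtain ⟨δ, hδ, hgap⟩ := int_gap (M * L)
  have hM' : (0 : ℝ) < M := by exact_mod_cast hM
  refine ⟨δ / M, by positivity, fun p hp hMp c hc0 hPI hcl hne => ?_⟩
  obtain ⟨e, Γ, hΓ⟩ := hPI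
  have hp0 : (0 : ℝ) < p := by exact_mod_cast hp.pos
  let q : ℚ := (Γ : ℚ) / ((M * p ^ e : ℕ) : ℤ)
  have hq : (q : ℝ) = c := by
    simp only [q]
    push_cast
    rw [div_eq_iff (by positivity), ← hΓ]; ring
  have hdvd : q.den ∣ M * p ^ e := by
    have := Rat.den_dvd Γ ((M * p ^ e : ℕ) : ℤ)
    have hqe : Rat.divInt Γ ((M * p ^ e : ℕ) : ℤ) = q := Rat.divInt_eq_div _ _
    rw [hqe] at this
    exact Int.natCast_dvd_natCast.1 this
  have hpd : p ∣ q.den := by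
    by_contra hnd
    have hcop : Nat.Coprime q.den (p ^ e) := (Nat.Coprime.pow_left e ((Nat.Prime.coprime_iff_not_dvd hp).2 hnd)).symm
    obtain ⟨t, ht⟩ := hcop.dvd_of_dvd_mul_right hdvd
    apply hne
    have hMc : (M : ℝ) * c = ((t * q.num : ℤ) : ℝ) := by
      rw [← hq, ht]
      have h1 : (q : ℝ) * q.den = q.num := by exact_mod_cast Rat.mul_den_eq_num q
      push_cast
      rw [← h1]; ring
    have h2 := hgap (t * q.num) (by
      rw [← hMc, ← mul_sub, abs_mul, abs_of_pos hM']
      rw [lt_div_iff₀ hM'] at hcl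
      linarith)
    rw [← hMc] at h2
    exact mul_left_cancel₀ hM'.ne' h2
  refine ⟨?_, fun q' hq' => ?_⟩
  · obtain ⟨b, hb⟩ := hpd
    have hb0 : 0 < b := by
      rcases Nat.eq_zero_or_pos b with h | h
      · rw [h, mul_zero] at hb; exact absurd hb q.den_ne_zero
      · exact h
    have hq0 : 0 ≤ q := by
      have : (0 : ℝ) ≤ (q : ℝ) := by rw [hq]; exact hc0
      exact_mod_cast this
    have hn0 : 0 ≤ q.num := Rat.num_nonneg.2 hq0
    have hcop := q.reduced
    refine ⟨q.num.natAbs, b, ?_, hb0, ?_, ?_⟩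
    · rcases Nat.eq_zero_or_pos q.num.natAbs with h | h
      · rw [h, Nat.coprime_zero_left, hb] at hcop
        exact absurd (Nat.eq_one_of_mul_eq_one_right hcop) hp.ne_one
      · exact h
    · exact Nat.Coprime.coprime_dvd_right ⟨b, hb⟩ hcop
    · rw [← hq]
      have h1 : (q : ℝ) = q.num / q.den := by exact_mod_cast (Rat.num_div_den q).symm
      have h2 : ((q.num.natAbs : ℕ) : ℝ) = (q.num : ℝ) := by
        rw [← Int.cast_natCast, Int.natAbs_of_nonneg hn0]
      rw [h2, h1]
      have h3 : (q.den : ℝ) = p * b := by exact_mod_cast hb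
      rw [h3]
  · have : q' = q := by
      have : (q' : ℝ) = (q : ℝ) := by rw [hq, hq']
      exact_mod_cast this
    rw [this]; exact hpd

/-- one fibre -/
lemma fibre {A RA Ω : Type*} [CommRing A] [CommRing RA] [Algebra A RA] [Field Ω] [Algebra A Ω] [IsAlgClosed Ω]
    {𝒜A : ℕ → Submodule A RA} [GradedAlgebra 𝒜A] (hps : (ringChar Ω).Prime)
    (hdom : IsDomain (Ω ⊗[A] RA)) (hdim : ringKrullDim (Ω ⊗[A] RA) = 2)
    {IA : Ideal RA} (hcol : FiniteDimensional Ω ((Ω ⊗[A] RA) ⧸ redIdeal A RA Ω IA))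
    {r : ℕ} {f : Fin (r + 1) → RA} {ed : Fin (r + 1) → ℕ} (hf : ∀ j, f j ∈ 𝒜A (ed j))
    (hIA : IA = Ideal.span (Set.range f)) {Y : Finset RA} {dy : RA → ℕ}
    (hY : ∀ y ∈ Y, y ∈ 𝒜A (dy y)) (hgen : Algebra.adjoin A (Y : Set RA) = ⊤)
    (h0 : ∀ s ∈ redGrading A RA Ω 𝒜A 0, ∃ a : Ω, s = algebraMap Ω _ a)
    (h1 : ∃ T ∈ redGrading A RA Ω 𝒜A 1, T ≠ 0) {Cb g : ℕ}
    (hCb : ∀ m, Module.finrank Ω (redGrading A RA Ω 𝒜A m) ≤ Cb * (m + 1))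
    (hg : g = ∏ y ∈ Y, max 1 (dy y)) (hp : g * Cb < ringChar Ω) {c : ℝ}
    (hc : Tendsto (fun n : ℕ =>
        (nuF (irrelevantIdeal (redGrading A RA Ω 𝒜A)) (redIdeal A RA Ω IA)
            ((ringChar Ω) ^ n) : ℝ) / (ringChar Ω : ℝ) ^ n) atTop (𝓝 c)) :
    0 ≤ c ∧ PI (ringChar Ω) (((g * Cb) * r.factorial * ((g * Cb) * g * g)).factorial * c) := by
  refine ⟨ge_of_tendsto' hc fun e => by positivity, ?_⟩
  obtain ⟨inst⟩ := red_graded (Ω := Ω) 𝒜A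
  obtain ⟨n, x, d, G, hd⟩ := exists_red_gr hY hgen h0
  obtain ⟨T, hT, hT0⟩ := h1
  have : Fact (ringChar Ω).Prime := ⟨hps⟩
  have hred : redIdeal A RA Ω IA = Ideal.span (Set.range fun j => (1 : Ω) ⊗ₜ[A] f j) := by
    rw [redIdeal, hIA, Ideal.map_span, ← Set.range_comp]
    rfl
  rw [hred] at hc hcol
  have hgp : 0 < g := by
    rw [hg]; exact Finset.prod_pos fun y _ => by positivity
  rcases thmG (p := ringChar Ω) hdim G hT hT0 hgp (fun i => hg ▸ hd i) hCb hp
    (f := fun j => (1 : Ω) ⊗ₜ[A] f j) (ed := ed)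
    (fun j => Submodule.subset_span ⟨f j, hf j, rfl⟩) hcol hc with h | ⟨b, hb, hbb, e, Γ, hΓ⟩
  · exact ⟨0, 0, by rw [h]; simp⟩
  · obtain ⟨t, ht⟩ := Nat.dvd_factorial hb hbb
    refine ⟨e, t * Γ, ?_⟩
    rw [ht]; push_cast; rw [← hΓ]; ring

end FT

/-- **Theorem (Statement 6).** Let `(R, I)` be a standard graded pair over an algebraically
closed field `k` of characteristic `0`, with `R` a two-dimensional domain, with a suitable
spread `(A, R_A, I_A)` and reductions `(R_s, I_s, 𝔪_s)` mod `p_s`, and let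
`c^I_∞(𝔪) = lim_{p_s → ∞} c^{I_s}(𝔪_s)`.  Then there is `N` such that for every closed
point `s` with `p_s > N`: if `c^{I_s}(𝔪_s) ≠ c^I_∞(𝔪)` then
`c^{I_s}(𝔪_s) = a₁/(p_s·b₁)` for positive integers `a₁, b₁` with `gcd(a₁, p_s) = 1`;
in particular `p_s` divides the denominator of `c^{I_s}(𝔪_s)` in lowest terms. -/
theorem fThreshold_reduction_denominator
    (k : Type*) [Field k] [CharZero k] [IsAlgClosed k]
    (R : Type*) [CommRing R] [IsDomain R] [Algebra k R]
    (𝒜 : ℕ → Submodule k R) [GradedAlgebra 𝒜]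
    (h0 : 𝒜 0 = Submodule.span k {1})
    (hstd : ∀ n, 𝒜 (n + 1) = 𝒜 1 * 𝒜 n)
    (hfg : FiniteDimensional k (𝒜 1))
    (hdim : ringKrullDim R = 2)
    (I : Ideal R) (hIhom : Ideal.IsHomogeneous 𝒜 I)
    (hcolen : FiniteDimensional k (R ⧸ I))
    -- the spread `(A, R_A, I_A)`:
    (A : Subalgebra ℤ k) (hA : A.FG)
    (RA : Type*) [CommRing RA] [Algebra A RA]
    (hflat : Module.Flat A RA) (hft : Algebra.FiniteType A RA)
    (𝒜A : ℕ → Submodule A RA) [GradedAlgebra 𝒜A]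
    (IA : Ideal RA) (hIA : Ideal.IsHomogeneous 𝒜A IA)
    -- base change to `k` recovers `(R, 𝒜, I)`:
    (e : (k ⊗[A] RA) ≃ₐ[k] R)
    (hIe : I = Ideal.map ((e : k ⊗[A] RA →+* R).comp
        (Algebra.TensorProduct.includeRight : RA →ₐ[A] k ⊗[A] RA).toRingHom) IA)
    (h𝒜e : ∀ n, 𝒜 n = Submodule.span k
        (⇑((e : k ⊗[A] RA →+* R).comp
            (Algebra.TensorProduct.includeRight : RA →ₐ[A] k ⊗[A] RA).toRingHom) ''
          (𝒜A n : Set RA)))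
    -- reductions mod `p_s`:
    (hfin : ∀ s : MaximalSpectrum A, Finite (A ⧸ s.asIdeal))
    (Ω : MaximalSpectrum A → Type*) [∀ s, Field (Ω s)] [∀ s, Algebra A (Ω s)]
    [∀ s, IsAlgClosed (Ω s)]
    (hker : ∀ s, RingHom.ker (algebraMap A (Ω s)) = s.asIdeal)
    (hps : ∀ s, (ringChar (Ω s)).Prime)
    (hdomS : ∀ s, IsDomain (Ω s ⊗[A] RA))
    (hdimS : ∀ s, ringKrullDim (Ω s ⊗[A] RA) = 2)
    (hcolenS : ∀ s, FiniteDimensional (Ω s) ((Ω s ⊗[A] RA) ⧸ redIdeal ↥A RA (Ω s) IA))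
    -- `c s` is the `F`-threshold `c^{I_s}(𝔪_s)` of the reduction mod `p_s`:
    (c : MaximalSpectrum A → ℝ)
    (hc : ∀ s, Tendsto (fun n : ℕ =>
        (nuF (irrelevantIdeal (redGrading ↥A RA (Ω s) 𝒜A)) (redIdeal ↥A RA (Ω s) IA)
            ((ringChar (Ω s)) ^ n) : ℝ) / (ringChar (Ω s) : ℝ) ^ n)
      atTop (𝓝 (c s)))
    -- `L = c^I_∞(𝔪)` is the limit of the `c s` as `p_s → ∞`:
    (L : ℝ)
    (hL : ∀ ε : ℝ, 0 < ε → ∃ N : ℕ,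
      ∀ s : MaximalSpectrum A, N < ringChar (Ω s) → |c s - L| < ε) :
    ∃ N : ℕ, ∀ s : MaximalSpectrum A, N < ringChar (Ω s) → c s ≠ L →
      (∃ a₁ b₁ : ℕ, 0 < a₁ ∧ 0 < b₁ ∧ Nat.gcd a₁ (ringChar (Ω s)) = 1 ∧
        c s = (a₁ : ℝ) / ((ringChar (Ω s) : ℝ) * (b₁ : ℝ))) ∧
      (∀ q : ℚ, (q : ℝ) = c s → ringChar (Ω s) ∣ q.den) := by
  classical
  have hAk : Function.Injective (algebraMap A k) := Subtype.val_injective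
  have hAN : IsNoetherianRing A := by
    have : Algebra.FiniteType ℤ A := (Subalgebra.fg_iff_finiteType _).1 hA
    exact Algebra.FiniteType.isNoetherianRing ℤ A
  have hRN : IsNoetherianRing RA := Algebra.FiniteType.isNoetherianRing A RA
  have hdomk : IsDomain (k ⊗[A] RA) := e.toMulEquiv.isDomain R
  obtain ⟨Y, hY, hgen⟩ := FT.exists_hom_gens 𝒜A hft
  obtain ⟨r, f, ed, hf, hIf⟩ := FT.exists_hom_igens 𝒜A IA hIA
  let dy : RA → ℕ := fun y => if h : ∃ i, y ∈ 𝒜A i then h.choose else 0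
  have hdy : ∀ y ∈ Y, y ∈ 𝒜A (dy y) := by
    intro y hy
    have h := hY y hy
    simp only [dy, dif_pos h]
    exact h.choose_spec
  have hmap : ∀ n, 𝒜 n = (redGrading A RA k 𝒜A n).map (e : (k ⊗[A] RA) ≃ₗ[k] R).toLinearMap := by
    intro n
    rw [h𝒜e n, redGrading, Submodule.map_span, ← Set.image_comp]
    rfl
  obtain ⟨hfinA, Cb, hCb⟩ := FT.std_hilb h0 hstd hfg hdim
  have hmem : ∀ n s, s ∈ redGrading A RA k 𝒜A n → e s ∈ 𝒜 n := by
    intro n s hs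
    rw [hmap]; exact ⟨s, hs, rfl⟩
  let E : ∀ n, redGrading A RA k 𝒜A n ≃ₗ[k] 𝒜 n := fun n =>
    ((e : (k ⊗[A] RA) ≃ₗ[k] R).submoduleMap (redGrading A RA k 𝒜A n)).trans
      (LinearEquiv.ofEq _ _ (hmap n).symm)
  have hfink : ∀ n, Module.Finite k (redGrading A RA k 𝒜A n) := fun n => Module.Finite.equiv (E n).symm
  have hrank : ∀ s n, Module.finrank (Ω s) (redGrading A RA (Ω s) 𝒜A n) ≤ Cb * (n + 1) := by
    intro s n
    refine (FT.finrank_red_le hAk 𝒜A n).trans ?_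
    rw [(E n).finrank_eq]
    exact hCb n
  have hk0 : ∀ s ∈ redGrading A RA k 𝒜A 0, ∃ a : k, s = algebraMap k _ a := by
    intro s hs
    have h1 := hmem 0 s hs
    rw [h0, Submodule.mem_span_singleton] at h1
    obtain ⟨a, ha⟩ := h1
    refine ⟨a, e.injective ?_⟩
    rw [← ha, AlgEquiv.commutes, Algebra.smul_def, mul_one]
  have hk1 : redGrading A RA k 𝒜A 1 ≠ ⊥ := by
    intro h
    apply FT.std_one_ne h0 hstd hdim
    rw [hmap, h, Submodule.map_bot]
  set g := ∏ y ∈ Y, max 1 (dy y) with hg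
  set M := ((g * Cb) * r.factorial * ((g * Cb) * g * g)).factorial with hM
  obtain ⟨ε, hε, hfa⟩ := FT.final_arith L M (Nat.factorial_pos _)
  obtain ⟨N, hN⟩ := hL ε hε
  refine ⟨max N (max M (g * Cb)), fun s hs hne => ?_⟩
  simp only [max_lt_iff] at hs
  obtain ⟨hs1, hs2, hs3⟩ := hs
  have hd := hdomS s
  obtain ⟨hc0, hPI⟩ := FT.fibre (hps s) (hdomS s) (hdimS s) (hcolenS s) hf hIf hdy hgen
    (FT.red_zero hAk 𝒜A hk0) (FT.red_one_ne hAk 𝒜A hk1) (hrank s) hg hs3 (hc s)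
  exact hfa _ (hps s) hs2 (c s) hc0 hPI (hN s hs1) hne
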